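/- Persistence of spatial analyticity (main theorem): Let a₁, a₂ ≠ 0 and suppose the coefficients c₁₁, c₁₂, c₂₁, c₂₂ ∈ ℝ satisfy one of: (i) a₂/a₁ < 0 or a₂/a₁ > 4 with arbitrary coefficients; (ii) a₂/a₁ = 1 and c₂₁ = c₂₂; (iii) 0 < a₂/a₁ ≤ 4 with a₂ ≠ a₁ and c₁₂ = c₂₁ = c₂₂ = 0; and suppose there exists η > 0 with c₁₂ + η(c₂₂ − 2c₂₁) = 0. Let σ₀ > 0 and s ∈ ℝ, and let (u, v) be a pair of real-valued smooth functions on ℝ × ℝ solving pointwise the system u_t + a₁ u_{xxx} = c₁₁ u u_x + c₁₂ v v_x, v_t + a₂ v_{xxx} = c₂₁ u_x v + c₂₂ u v_x, such that u(t,·), v(t,·) are Schwartz for each t ∈ ℝ and ‖u(0)‖_{G^{σ₀,s}}, ‖v(0)‖_{G^{σ₀,s}} are finite. Then for every ε > 0 there exists a constant c > 0, depending on ε, σ₀ and the norms ‖u(0)‖_{G^{σ₀,s}}, ‖v(0)‖_{G^{σ₀,s}}, such that for every t ∈ ℝ the norms ‖u(t)‖_{G^{σ(t),s}} and ‖v(t)‖_{G^{σ(t),s}}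 are finite, where σ(t) = c (1+|t|)^{−4/3−ε}. In particular the radius of spatial analyticity of (u(t), v(t)) is bounded below by c |t|^{−4/3−ε} as |t| → ∞. -/

import Mathlib

open MeasureTheory Set Filter
open scoped ENNReal

/-- One-dimensional (spatial) Fourier transform `f̂(ξ) = ∫ e^{-i x ξ} f(x) dx`. -/
noncomputable def FT1 (g : ℝ → ℂ) (ξ : ℝ) : ℂ :=
  ∫ x : ℝ, Complex.exp (-Complex.I * (x * ξ)) * g x

/-- Gevrey norm `‖g‖_{G^{σ,s}}`, valued in `ℝ≥0∞` (so that infinite norms are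
meaningful). -/
noncomputable def gevreyNorm (σ s : ℝ) (g : ℝ → ℂ) : ℝ≥0∞ :=
  (∫⁻ ξ : ℝ, ENNReal.ofReal
      (Real.exp (2 * σ * |ξ|) * (1 + |ξ|) ^ (2 * s) * ‖FT1 g ξ‖ ^ 2)) ^ (1/2 : ℝ)

namespace PAn
set_option linter.unusedVariables false

/-- Japanese bracket. -/
noncomputable def jap (x : ℝ) : ℝ := Real.sqrt (1 + x ^ 2)

lemma jap_sq (x : ℝ) : jap x ^ 2 = 1 + x ^ 2 := Real.sq_sqrt (by positivity)

lemma jap_pos (x : ℝ) : 0 < jap x := Real.sqrt_pos.2 (by positivity)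

lemma one_le_jap (x : ℝ) : 1 ≤ jap x := by
  have := jap_sq x; have := jap_pos x; nlinarith [sq_nonneg x]

lemma abs_le_jap (x : ℝ) : |x| ≤ jap x := by
  apply Real.abs_le_sqrt; linarith

lemma jap_le (x : ℝ) : jap x ≤ 1 + |x| := by
  have := jap_sq x; have := jap_pos x; have := abs_nonneg x; have := sq_abs x
  nlinarith

lemma jap_neg (x : ℝ) : jap (-x) = jap x := by simp [jap]

lemma jap_abs (x : ℝ) : jap |x| = jap x := by simp [jap]

lemma jap_mono {x y : ℝ} (h : |x| ≤ |y|) : jap x ≤ jap y := by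
  apply Real.sqrt_le_sqrt; have := sq_le_sq.2 h; linarith

lemma jap_add (x y : ℝ) : jap (x + y) ≤ jap x + jap y := by
  have h1 := jap_sq x; have h2 := jap_sq y; have h3 := jap_sq (x + y)
  have h4 := jap_pos x; have h5 := jap_pos y; have h6 := jap_pos (x + y)
  have h7 : x * y ≤ jap x * jap y := by
    calc x * y ≤ |x * y| := le_abs_self _
      _ = |x| * |y| := abs_mul _ _
      _ ≤ _ := mul_le_mul (abs_le_jap x) (abs_le_jap y) (abs_nonneg _) h4.le
  nlinarith

lemma continuous_jap : Continuous jap := by unfold jap; fun_prop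

/-- truncated exponential -/
noncomputable def th (p : ℕ) (δ x : ℝ) : ℝ := (1 + x / (1 + δ * x) / p) ^ p

/-- the weight -/
noncomputable def mw (p : ℕ) (δ x : ℝ) : ℝ := jap x ^ 4 * th p δ (jap x)

lemma yd_mono {δ s t : ℝ} (hδ : 0 < δ) (hs : 0 ≤ s) (hst : s ≤ t) :
    s / (1 + δ * s) ≤ t / (1 + δ * t) := by
  have ht : 0 ≤ t := hs.trans hst
  rw [div_le_div_iff₀ (by positivity) (by positivity)]
  nlinarith

lemma yd_lip {δ s t : ℝ} (hδ : 0 < δ) (hs : 0 ≤ s) (hst : s ≤ t) :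
    t / (1 + δ * t) - s / (1 + δ * s) ≤ t - s := by
  have ht : 0 ≤ t := hs.trans hst
  have : t / (1 + δ * t) - s / (1 + δ * s) = (t - s) / ((1 + δ * t) * (1 + δ * s)) := by
    field_simp; ring
  rw [this]
  apply div_le_self (by linarith)
  have h1 : 0 ≤ δ * t := by positivity
  have h2 : 0 ≤ δ * s := by positivity
  nlinarith

lemma yd_add {δ s t : ℝ} (hδ : 0 < δ) (hs : 0 ≤ s) (ht : 0 ≤ t) :
    (s + t) / (1 + δ * (s + t)) ≤ s / (1 + δ * s) + t / (1 + δ * t) := by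
  have h1 : s / (1 + δ * (s + t)) ≤ s / (1 + δ * s) := by
    apply div_le_div_of_nonneg_left hs (by positivity); nlinarith
  have h2 : t / (1 + δ * (s + t)) ≤ t / (1 + δ * t) := by
    apply div_le_div_of_nonneg_left ht (by positivity); nlinarith
  rw [add_div]; linarith

lemma yd_nonneg {δ s : ℝ} (hδ : 0 < δ) (hs : 0 ≤ s) : 0 ≤ s / (1 + δ * s) := by positivity

lemma th_one_le {p : ℕ} {δ s : ℝ} (hδ : 0 < δ) (hs : 0 ≤ s) : 1 ≤ th p δ s := by
  unfold th; apply one_le_pow₀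
  have : 0 ≤ s / (1 + δ * s) / p := by positivity
  linarith

lemma th_mono {p : ℕ} {δ s t : ℝ} (hδ : 0 < δ) (hs : 0 ≤ s) (hst : s ≤ t) :
    th p δ s ≤ th p δ t := by
  unfold th
  have := yd_mono hδ hs hst
  have := yd_nonneg hδ hs
  gcongr

lemma th_add {p : ℕ} {δ s t : ℝ} (hδ : 0 < δ) (hs : 0 ≤ s) (ht : 0 ≤ t) :
    th p δ (s + t) ≤ th p δ s * th p δ t := by
  unfold th
  rw [← mul_pow]
  have h0 := yd_add hδ hs ht
  have h1 := yd_nonneg hδ hs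
  have h2 := yd_nonneg hδ ht
  have h3 := yd_nonneg hδ (add_nonneg hs ht)
  have h4 : (s + t) / (1 + δ * (s + t)) / p ≤ s / (1 + δ * s) / p + t / (1 + δ * t) / p := by
    rw [← add_div]; gcongr
  have h5 : 0 ≤ (s / (1 + δ * s) / p) * (t / (1 + δ * t) / p) := by positivity
  apply pow_le_pow_left₀
  · positivity
  · nlinarith

lemma th_le_exp {p : ℕ} {δ s : ℝ} (hδ : 0 < δ) (hs : 0 ≤ s) : th p δ s ≤ Real.exp s := by
  unfold th
  have h1 := yd_nonneg hδ hs
  have h2 : s / (1 + δ * s) ≤ s := div_le_self hs (by nlinarith [mul_nonneg hδ.le hs])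
  rcases Nat.eq_zero_or_pos p with rfl | hp
  · simp [hs]
  · calc (1 + s / (1 + δ * s) / p) ^ p ≤ (Real.exp (s / (1 + δ * s) / p)) ^ p := by
          apply pow_le_pow_left₀ (by positivity)
          have := Real.add_one_le_exp (s / (1 + δ * s) / p); linarith
      _ = Real.exp (s / (1 + δ * s)) := by
          rw [← Real.exp_nat_mul]; congr 1; field_simp
      _ ≤ _ := Real.exp_le_exp.2 h2

/-- `G(s) = s^8 θ(s)^2` increments -/
lemma G_lip {p : ℕ} (hp : 1 ≤ p) {δ s t : ℝ} (hδ : 0 < δ) (hs : 1 ≤ s) (hst : s ≤ t) :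
    (t ^ 4 * th p δ t) ^ 2 - (s ^ 4 * th p δ s) ^ 2 ≤ 10 * (t - s) * (t ^ 4 * th p δ t) ^ 2 := by
  have ht : 1 ≤ t := hs.trans hst
  have hp' : (1:ℝ) ≤ p := by exact_mod_cast hp
  by_cases hd : 1 ≤ 10 * (t - s)
  · nlinarith [sq_nonneg (s ^ 4 * th p δ s), sq_nonneg (t ^ 4 * th p δ t)]
  push Not at hd
  have e1 : t * (1 - (t - s)) ≤ s := by nlinarith
  have e2 : (1 + t / (1 + δ * t) / p) * (1 - (t - s) / p) ≤ 1 + s / (1 + δ * s) / p := by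
    have h1 := yd_lip hδ (by linarith) hst
    have h2 := yd_nonneg hδ (by linarith : 0 ≤ t)
    have h3 : t / (1 + δ * t) / p - s / (1 + δ * s) / p ≤ (t - s) / p := by
      rw [← sub_div]; gcongr
    have h4 : 0 ≤ (t / (1 + δ * t) / p) * ((t - s) / p) := by
      have : 0 ≤ t - s := by linarith
      positivity
    nlinarith
  have b1 : 1 - 8 * (t - s) ≤ (1 - (t - s)) ^ 8 := by
    have := one_add_mul_le_pow (a := -(t - s)) (by linarith) 8
    norm_num at this ⊢; linarith
  have q0 : (t - s) / p ≤ 1 / 10 := by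
    rw [div_le_iff₀ (by linarith)]; nlinarith
  have b2 : 1 - 2 * (t - s) ≤ (1 - (t - s) / p) ^ (2 * p) := by
    have := one_add_mul_le_pow (a := -((t - s) / p)) (by linarith) (2 * p)
    have h : ((2 * p : ℕ) : ℝ) * -((t - s) / p) = - (2 * (t - s)) := by
      push_cast; field_simp
    rw [h] at this
    have h' : (1 + -((t - s) / p)) = 1 - (t - s) / p := by ring
    rw [h'] at this; linarith
  have hy := yd_nonneg hδ (by linarith : 0 ≤ t)
  have key : (t ^ 4 * th p δ t) ^ 2 * (1 - 10 * (t - s)) ≤ (s ^ 4 * th p δ s) ^ 2 := by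
    calc (t ^ 4 * th p δ t) ^ 2 * (1 - 10 * (t - s))
        ≤ (t ^ 4 * th p δ t) ^ 2 * ((1 - (t - s)) ^ 8 * (1 - (t - s) / p) ^ (2 * p)) := by
          apply mul_le_mul_of_nonneg_left _ (sq_nonneg _)
          calc 1 - 10 * (t - s) ≤ (1 - 8 * (t - s)) * (1 - 2 * (t - s)) := by nlinarith [sq_nonneg (t-s)]
            _ ≤ _ := mul_le_mul b1 b2 (by linarith) (le_trans (by linarith) b1)
      _ = (t * (1 - (t - s))) ^ 8 * ((1 + t / (1 + δ * t) / p) * (1 - (t - s) / p)) ^ (2 * p) := by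
          unfold th; rw [mul_pow, mul_pow, mul_pow, pow_mul' _ 2 p, pow_mul' _ 2 p]
          generalize (1 + t / (1 + δ * t) / p) = A
          generalize (1 - (t - s) / p) = B
          ring
      _ ≤ s ^ 8 * (1 + s / (1 + δ * s) / p) ^ (2 * p) := by
          have : 0 ≤ 1 - (t - s) / p := by linarith
          have : 0 ≤ 1 - (t - s) := by linarith
          gcongr
      _ = _ := by
          unfold th
          generalize (1 + s / (1 + δ * s) / p) = A
          rw [pow_mul']; ring
  nlinarith

/-- Abstract properties of an admissible weight, with uniform constant 64. -/
structure GoodW (m : ℝ → ℝ) : Prop where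
  cont : Continuous m
  one_le : ∀ x, 1 ≤ m x
  even : ∀ x, m (-x) = m x
  mono : ∀ x y, |x| ≤ |y| → m x ≤ m y
  sub : ∀ x y, |x| ≤ |y| → m (x + y) * (1 + |x|) ^ 4 ≤ 64 * (m x * m y)
  lip : ∀ x y N, |x| ≤ N → |y| ≤ N →
    |m x ^ 2 - m y ^ 2| ≤ 64 * abs (|x| - |y|) * (N / (1 + N)) * m N ^ 2
  crude : ∃ C, ∀ x, m x ≤ C * (1 + |x|) ^ 4

lemma GoodW.pos {m : ℝ → ℝ} (h : GoodW m) (x : ℝ) : 0 < m x := lt_of_lt_of_le one_pos (h.one_le x)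

lemma one_add_abs_le (x : ℝ) : (1 + |x|) ^ 2 ≤ 2 * jap x ^ 2 := by
  rw [jap_sq]; nlinarith [sq_abs x, sq_nonneg (|x| - 1)]

lemma one_add_abs_pow_le (x : ℝ) : (1 + |x|) ^ 4 ≤ 4 * jap x ^ 4 := by
  have := one_add_abs_le x
  calc (1 + |x|) ^ 4 = ((1 + |x|) ^ 2) ^ 2 := by ring
    _ ≤ (2 * jap x ^ 2) ^ 2 := by gcongr
    _ = _ := by ring

lemma jap_lip (x y N : ℝ) (hx : |x| ≤ N) (hy : |y| ≤ N) :
    |jap x - jap y| ≤ abs (|x| - |y|) * (2 * (N / (1 + N))) := by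
  have hN : 0 ≤ N := (abs_nonneg x).trans hx
  have aux : ∀ z : ℝ, |z| ≤ N → |z| ≤ jap z * (2 * (N / (1 + N))) := by
    intro z hz
    have h1 : |z| * (1 + N) ≤ N * (1 + |z|) := by nlinarith
    have h2 : 1 + |z| ≤ 2 * jap z := by linarith [one_le_jap z, abs_le_jap z]
    have h3 : |z| * (1 + N) ≤ N * (2 * jap z) := h1.trans (by gcongr)
    have : jap z * (2 * (N / (1 + N))) = N * (2 * jap z) / (1 + N) := by ring
    rw [this, le_div_iff₀ (by linarith)]; exact h3
  have h4 : (jap x - jap y) * (jap x + jap y) = (|x| - |y|) * (|x| + |y|) := by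
    have := jap_sq x; have := jap_sq y; have := sq_abs x; have := sq_abs y; nlinarith
  have hs : 0 < jap x + jap y := by linarith [jap_pos x, jap_pos y]
  have h5 : |jap x - jap y| * (jap x + jap y) = abs (|x| - |y|) * (|x| + |y|) := by
    rw [← abs_of_pos hs, ← abs_mul, h4, abs_mul, abs_of_nonneg (by positivity : 0 ≤ |x| + |y|)]
  have h6 : abs (|x| - |y|) * (|x| + |y|) ≤ (abs (|x| - |y|) * (2 * (N / (1 + N)))) * (jap x + jap y) := by
    have := add_le_add (aux x hx) (aux y hy)
    calc _ ≤ abs (|x| - |y|) * (jap x * (2 * (N / (1 + N))) + jap y * (2 * (N / (1 + N)))) := by gcongr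
      _ = _ := by ring
  rw [← h5] at h6
  exact le_of_mul_le_mul_right h6 hs

theorem goodW_mw {p : ℕ} (hp : 1 ≤ p) {δ : ℝ} (hδ : 0 < δ) : GoodW (mw p δ) where
  cont := by
    unfold mw th
    have h1 := continuous_jap
    have h2 : ∀ x, 1 + δ * jap x ≠ 0 := fun x => by
      have := mul_pos hδ (jap_pos x); linarith
    fun_prop (disch := assumption)
  one_le x := by
    unfold mw
    have h1 := one_le_jap x
    have h2 := th_one_le (p := p) hδ (jap_pos x).le
    have h3 : 1 ≤ jap x ^ 4 := one_le_pow₀ h1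
    nlinarith
  even x := by simp [mw, jap_neg]
  mono x y h := by
    unfold mw
    have h1 := jap_mono h
    have h2 := th_mono (p := p) hδ (jap_pos x).le h1
    have h3 := th_one_le (p := p) hδ (jap_pos x).le
    have h4 := jap_pos x
    gcongr
  sub x y h := by
    unfold mw
    have h1 := jap_mono h
    have h2 := th_mono (p := p) hδ (jap_pos _).le (jap_add x y)
    have h3 := th_add (p := p) hδ (jap_pos x).le (jap_pos y).le
    have h4 := one_add_abs_pow_le x
    have h5 : jap (x + y) ≤ 2 * jap y := by linarith [jap_add x y]
    have p0 := jap_pos (x + y)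
    have p1 := th_one_le (p := p) hδ (jap_pos (x + y)).le
    have p2 := th_one_le (p := p) hδ (jap_pos x).le
    have p3 := th_one_le (p := p) hδ (jap_pos y).le
    have px := jap_pos x
    have py := jap_pos y
    calc jap (x + y) ^ 4 * th p δ (jap (x + y)) * (1 + |x|) ^ 4
        ≤ (2 * jap y) ^ 4 * (th p δ (jap x) * th p δ (jap y)) * (4 * jap x ^ 4) := by
          have := h2.trans h3
          gcongr
      _ = _ := by ring
  lip x y N hx hy := by
    have hN : 0 ≤ N := (abs_nonneg x).trans hx
    have aux : ∀ a b : ℝ, |a| ≤ N → |b| ≤ N → jap b ≤ jap a →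
        |mw p δ a ^ 2 - mw p δ b ^ 2| ≤ 64 * abs (|a| - |b|) * (N / (1 + N)) * mw p δ N ^ 2 := by
      intro a b ha hb hab
      have h1 := G_lip hp hδ (one_le_jap b) hab
      have h2 := jap_lip a b N ha hb
      have haN : jap a ≤ jap N := jap_mono (by rwa [abs_of_nonneg hN])
      have q1 := th_mono (p := p) hδ (jap_pos _).le hab
      have q2 := th_mono (p := p) hδ (jap_pos _).le haN
      have q3 := th_one_le (p := p) hδ (jap_pos b).le
      have q4 := jap_pos b
      have q5 := jap_pos a
      have q6 := th_one_le (p := p) hδ (jap_pos a).le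
      have m1 : (jap b ^ 4 * th p δ (jap b)) ^ 2 ≤ (jap a ^ 4 * th p δ (jap a)) ^ 2 := by gcongr
      have m2 : (jap a ^ 4 * th p δ (jap a)) ^ 2 ≤ (jap N ^ 4 * th p δ (jap N)) ^ 2 := by gcongr
      unfold mw
      rw [abs_of_nonneg (by linarith)]
      have h3 : jap a - jap b ≤ abs (|a| - |b|) * (2 * (N / (1 + N))) := (le_abs_self _).trans h2
      calc _ ≤ 10 * (jap a - jap b) * (jap a ^ 4 * th p δ (jap a)) ^ 2 := h1
        _ ≤ 10 * (abs (|a| - |b|) * (2 * (N / (1 + N)))) * (jap N ^ 4 * th p δ (jap N)) ^ 2 := by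
            have : 0 ≤ N / (1 + N) := by positivity
            have : 0 ≤ jap a - jap b := by linarith
            gcongr
        _ = 20 * (abs (|a| - |b|) * (N / (1 + N)) * (jap N ^ 4 * th p δ (jap N)) ^ 2) := by ring
        _ ≤ 64 * (abs (|a| - |b|) * (N / (1 + N)) * (jap N ^ 4 * th p δ (jap N)) ^ 2) := by
            have : 0 ≤ N / (1 + N) := by positivity
            gcongr; norm_num
        _ = _ := by ring
    rcases le_total (jap y) (jap x) with h | h
    · exact aux x y hx hy h
    · have := aux y x hy hx h
      rw [abs_sub_comm, abs_sub_comm |x|]; exact this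
  crude := by
    refine ⟨(1 + 1 / δ) ^ p, fun x => ?_⟩
    unfold mw
    have hp' : (1:ℝ) ≤ p := by exact_mod_cast hp
    have h1 : jap x / (1 + δ * jap x) ≤ 1 / δ := by
      have := jap_pos x
      rw [div_le_div_iff₀ (by positivity) hδ]; nlinarith
    have h2 : th p δ (jap x) ≤ (1 + 1 / δ) ^ p := by
      unfold th
      have h0 := yd_nonneg hδ (jap_pos x).le
      have : jap x / (1 + δ * jap x) / p ≤ 1 / δ := (div_le_self h0 hp').trans h1
      gcongr
    have h3 := jap_le x
    have h4 := jap_pos x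
    have h5 := th_one_le (p := p) hδ (jap_pos x).le
    rw [mul_comm]
    gcongr

end PAn

namespace PAn
set_option linter.unusedVariables false

lemma symA_aux {m : ℝ → ℝ} (hm : GoodW m) {x y z : ℝ} (hs : x + y + z = 0) (hxy : 0 ≤ x * y)
    {N : ℝ} (hx : |x| ≤ N) (hy : |y| ≤ N) (hz : |z| ≤ N)
    (hN : N = |x| ∨ N = |y| ∨ N = |z|) :
    |x * m x ^ 2 + y * m y ^ 2 + z * m z ^ 2| * (1 + N) ≤ 128 * (|x| * |y| * |z|) * m N ^ 2 := by
  have hzz : z = -(x + y) := by linarith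
  have hz' : |z| = |x| + |y| := by
    rw [hzz, abs_neg, abs_add_eq_add_abs_iff]
    rcases mul_nonneg_iff.1 hxy with h | h
    · exact Or.inl h
    · exact Or.inr h
  have hNz : N = |z| := by
    rcases hN with h | h | h
    · have := abs_nonneg x; have := abs_nonneg y; linarith
    · have := abs_nonneg x; have := abs_nonneg y; linarith
    · exact h
  have hN0 : 0 ≤ N := (abs_nonneg x).trans hx
  have e : x * m x ^ 2 + y * m y ^ 2 + z * m z ^ 2
      = x * (m x ^ 2 - m z ^ 2) + y * (m y ^ 2 - m z ^ 2) := by rw [hzz]; ring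
  have l1 := hm.lip x z N hx hz
  have l2 := hm.lip y z N hy hz
  have k1 : abs (|x| - |z|) = |y| := by rw [hz']; simp
  have k2 : abs (|y| - |z|) = |x| := by rw [hz']; simp
  rw [k1] at l1; rw [k2] at l2
  have : |x * m x ^ 2 + y * m y ^ 2 + z * m z ^ 2| ≤
      |x| * (64 * |y| * (N / (1 + N)) * m N ^ 2) + |y| * (64 * |x| * (N / (1 + N)) * m N ^ 2) := by
    rw [e]
    refine (abs_add_le _ _).trans ?_
    rw [abs_mul, abs_mul]
    gcongr
  calc _ ≤ (|x| * (64 * |y| * (N / (1 + N)) * m N ^ 2) +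
        |y| * (64 * |x| * (N / (1 + N)) * m N ^ 2)) * (1 + N) := by gcongr
    _ = 128 * (|x| * |y| * N) * m N ^ 2 := by field_simp; ring
    _ = _ := by rw [← hNz]

lemma symA {m : ℝ → ℝ} (hm : GoodW m) {x y z : ℝ} (hs : x + y + z = 0)
    {N : ℝ} (hx : |x| ≤ N) (hy : |y| ≤ N) (hz : |z| ≤ N)
    (hN : N = |x| ∨ N = |y| ∨ N = |z|) :
    |x * m x ^ 2 + y * m y ^ 2 + z * m z ^ 2| * (1 + N) ≤ 128 * (|x| * |y| * |z|) * m N ^ 2 := by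
  by_cases h1 : 0 ≤ x * y
  · exact symA_aux hm hs h1 hx hy hz hN
  by_cases h2 : 0 ≤ y * z
  · have := symA_aux hm (x := y) (y := z) (z := x) (by linarith) h2 hy hz hx (by tauto)
    convert this using 2
    · congr 1; ring_nf
    · ring
  by_cases h3 : 0 ≤ z * x
  · have := symA_aux hm (x := z) (y := x) (z := y) (by linarith) h3 hz hx hy (by tauto)
    convert this using 2
    · congr 1; ring_nf
    · ring
  · exfalso
    have : (x + y + z) * y = 0 := by rw [hs]; ring
    push Not at h1 h2 h3
    have h4 : 0 < (x * y) * (y * z) := mul_pos_of_neg_of_neg h1 h2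
    have h5 : 0 ≤ y ^ 2 := sq_nonneg y
    nlinarith

/-- Symbol of the mixed cubic form. -/
lemma symB {m : ℝ → ℝ} (hm : GoodW m) {x y z : ℝ} (hs : x + y + z = 0) (A B : ℝ)
    {N : ℝ} (hx : |x| ≤ N) (hy : |y| ≤ N) (hz : |z| ≤ N) :
    |A * (x * (m y ^ 2 + m z ^ 2 - 2 * m x ^ 2)) + B * (z * m y ^ 2 + y * m z ^ 2 + x * m x ^ 2)|
      * (1 + N) ≤ 128 * (|A| + |B|) * (|x| * N ^ 2) * m N ^ 2 := by
  have hzz : z = -(x + y) := by linarith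
  have hN0 : 0 ≤ N := (abs_nonneg x).trans hx
  have n1 : abs (|y| - |x|) ≤ N := by rw [abs_le]; constructor <;> linarith [abs_nonneg x, abs_nonneg y]
  have n2 : abs (|z| - |x|) ≤ N := by rw [abs_le]; constructor <;> linarith [abs_nonneg x, abs_nonneg z]
  have n3 : abs (|y| - |z|) ≤ |x| := by
    have h := abs_abs_sub_abs_le_abs_sub y (-z)
    rw [abs_neg] at h
    have : y - -z = -x := by linarith
    rwa [this, abs_neg] at h
  set L := 64 * (N / (1 + N)) * m N ^ 2 with hL
  have hL0 : 0 ≤ L := by positivity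
  have l1 : |m y ^ 2 - m x ^ 2| ≤ N * L := by
    refine (hm.lip y x N hy hx).trans ?_
    calc _ = abs (|y| - |x|) * L := by rw [hL]; ring
      _ ≤ _ := by gcongr
  have l2 : |m z ^ 2 - m x ^ 2| ≤ N * L := by
    refine (hm.lip z x N hz hx).trans ?_
    calc _ = abs (|z| - |x|) * L := by rw [hL]; ring
      _ ≤ _ := by gcongr
  have l3 : |m y ^ 2 - m z ^ 2| ≤ |x| * L := by
    refine (hm.lip y z N hy hz).trans ?_
    calc _ = abs (|y| - |z|) * L := by rw [hL]; ring
      _ ≤ _ := by gcongr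
  have e1 : |x * (m y ^ 2 + m z ^ 2 - 2 * m x ^ 2)| ≤ 2 * (|x| * (N * L)) := by
    rw [abs_mul]
    have : m y ^ 2 + m z ^ 2 - 2 * m x ^ 2 = (m y ^ 2 - m x ^ 2) + (m z ^ 2 - m x ^ 2) := by ring
    rw [this]
    have := (abs_add_le (m y ^ 2 - m x ^ 2) (m z ^ 2 - m x ^ 2)).trans (add_le_add l1 l2)
    calc _ ≤ |x| * (N * L + N * L) := by gcongr
      _ = _ := by ring
  have e2 : |z * m y ^ 2 + y * m z ^ 2 + x * m x ^ 2| ≤ 2 * (|x| * (N * L)) := by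
    have : z * m y ^ 2 + y * m z ^ 2 + x * m x ^ 2 =
      - (x * (m y ^ 2 - m x ^ 2)) - y * (m y ^ 2 - m z ^ 2) := by rw [hzz]; ring
    rw [this]
    refine (abs_sub _ _).trans ?_
    rw [abs_neg, abs_mul, abs_mul]
    calc _ ≤ |x| * (N * L) + N * (|x| * L) := by gcongr
      _ = _ := by ring
  have e3 : |A * (x * (m y ^ 2 + m z ^ 2 - 2 * m x ^ 2)) +
      B * (z * m y ^ 2 + y * m z ^ 2 + x * m x ^ 2)| ≤ (|A| + |B|) * (2 * (|x| * (N * L))) := by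
    refine (abs_add_le _ _).trans ?_
    rw [abs_mul A, abs_mul B, add_mul]
    gcongr
  calc _ ≤ (|A| + |B|) * (2 * (|x| * (N * L))) * (1 + N) := by gcongr
    _ = _ := by rw [hL]; field_simp; ring

lemma Qdef {a₁ a₂ : ℝ} (ha₁ : a₁ ≠ 0) (h : a₂ / a₁ < 0 ∨ 4 < a₂ / a₁) :
    ∃ c : ℝ, 0 < c ∧ ∀ y z : ℝ,
      c * (y ^ 2 + z ^ 2) ≤ |a₁ * (y + z) ^ 2 - a₂ * (y ^ 2 - y * z + z ^ 2)| := by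
  set r := a₂ / a₁ with hr
  have ha₂ : a₂ = r * a₁ := by rw [hr]; field_simp
  have hpos : 0 < |a₁| := abs_pos.2 ha₁
  have e : ∀ y z : ℝ, |a₁ * (y + z) ^ 2 - a₂ * (y ^ 2 - y * z + z ^ 2)|
      = |a₁| * |(y + z) ^ 2 - r * (y ^ 2 - y * z + z ^ 2)| := by
    intro y z; rw [← abs_mul, ha₂]; congr 1; ring
  rcases h with h | h
  · refine ⟨|a₁| * (-r / 2), by apply mul_pos hpos; linarith, fun y z => ?_⟩
    rw [e, mul_assoc]
    gcongr
    refine le_trans ?_ (le_abs_self _)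
    have : (0:ℝ) ≤ -r := by linarith
    nlinarith [mul_nonneg this (sq_nonneg (y - z)), sq_nonneg (y + z)]
  · refine ⟨|a₁| * ((r - 4) / 2), by apply mul_pos hpos; linarith, fun y z => ?_⟩
    rw [e, mul_assoc]
    gcongr
    refine le_trans ?_ (neg_le_abs _)
    have : (0:ℝ) ≤ r - 4 := by linarith
    nlinarith [mul_nonneg this (sq_nonneg (y - z)), sq_nonneg (y - z)]

/-- Abstract quadratic dispersive system data: phases, coefficients, energy coefficients. -/
structure Sys where
  α : Fin 2 → ℝ
  b : Fin 2 → Fin 2 → Fin 2 → ℝ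
  e : Fin 2 → ℝ

/-- cubic energy symbol -/
noncomputable def Sys.M3 (S : Sys) (m : ℝ → ℝ) (j k l : Fin 2) (x y z : ℝ) : ℝ :=
  2 * (S.e j * m x ^ 2 * (S.b j k l * y + S.b j l k * z)
    + S.e k * m y ^ 2 * (S.b k l j * z + S.b k j l * x)
    + S.e l * m z ^ 2 * (S.b l j k * x + S.b l k j * y))

noncomputable def Sys.Ph (S : Sys) (j k l : Fin 2) (x y z : ℝ) : ℝ :=
  S.α j * x ^ 3 + S.α k * y ^ 3 + S.α l * z ^ 3

noncomputable def Sys.q (S : Sys) (m : ℝ → ℝ) (j k l : Fin 2) (x y z : ℝ) : ℝ :=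
  S.M3 m j k l x y z / (3 * S.Ph j k l x y z)

structure Sys.Adm (S : Sys) (C : ℝ) : Prop where
  C_pos : 0 < C
  α_ne : ∀ j, S.α j ≠ 0
  e_pos : ∀ j, 0 < S.e j
  par : ∀ j k l, S.b j k l ≠ 0 → j + k + l = 0
  qpar : ∀ m j k l x y z, S.q m j k l x y z ≠ 0 → j + k + l = 0
  eq : ∀ m, GoodW m → ∀ j k l x y z, x + y + z = 0 →
    S.M3 m j k l x y z = 3 * S.Ph j k l x y z * S.q m j k l x y z
  bd : ∀ m, GoodW m → ∀ j k l x y z, x + y + z = 0 → ∀ N, |x| ≤ N → |y| ≤ N → |z| ≤ N →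
    (N = |x| ∨ N = |y| ∨ N = |z|) → |S.q m j k l x y z| * (1 + N) ≤ C * m N ^ 2

lemma Sys.q_cyc (S : Sys) (m : ℝ → ℝ) (j k l : Fin 2) (x y z : ℝ) :
    S.q m j k l x y z = S.q m k l j y z x := by
  have h1 : S.M3 m j k l x y z = S.M3 m k l j y z x := by unfold M3; ring
  have h2 : S.Ph j k l x y z = S.Ph k l j y z x := by unfold Ph; ring
  unfold q; rw [h1, h2]

/-- The KdV-KdV system. -/
noncomputable def kdv (a₁ a₂ c₁₁ c₁₂ c₂₁ c₂₂ η : ℝ) : Sys where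
  α := ![a₁, a₂]
  b := ![![![c₁₁ / 2, 0], ![0, c₁₂ / 2]], ![![0, c₂₁ / 2], ![c₂₂ / 2, 0]]]
  e := ![1, η]

/-- a division lemma -/
lemma div_bd {M P D w N C c : ℝ} (hP : c * D ≤ |P|) (hc : 0 < c) (hD : 0 ≤ D)
    (hw : 0 ≤ w) (hN : 0 ≤ N) (hC : 0 ≤ C)
    (hM : |M| * (1 + N) ≤ C * D * w) :
    (M = 3 * P * (M / (3 * P))) ∧ |M / (3 * P)| * (1 + N) ≤ (C / c) * w := by
  by_cases hD0 : D = 0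
  · have : M = 0 := by
      rw [hD0] at hM
      have : |M| ≤ 0 := by nlinarith [abs_nonneg M]
      simpa using this
    subst this; constructor
    · simp
    · simp; positivity
  · have hDp : 0 < D := lt_of_le_of_ne hD (Ne.symm hD0)
    have hPp : 0 < |P| := lt_of_lt_of_le (by positivity) hP
    have hP0 : P ≠ 0 := abs_pos.1 hPp
    constructor
    · field_simp
    · rw [abs_div, abs_mul, div_mul_eq_mul_div, div_le_iff₀ (by positivity)]
      refine hM.trans ?_
      have : C / c * w * (|3| * |P|) = (C / c * w) * 3 * |P| := by norm_num; ring
      rw [this]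
      have h1 : C * D * w = (C / c * w) * (c * D) := by field_simp
      rw [h1]
      have : 0 ≤ C / c * w := by positivity
      nlinarith

theorem kdv_adm (a₁ a₂ c₁₁ c₁₂ c₂₁ c₂₂ : ℝ) (ha₁ : a₁ ≠ 0) (ha₂ : a₂ ≠ 0)
    (hcoef : (a₂ / a₁ < 0 ∨ 4 < a₂ / a₁) ∨
      (a₂ / a₁ = 1 ∧ c₂₁ = c₂₂) ∨
      (0 < a₂ / a₁ ∧ a₂ / a₁ ≤ 4 ∧ a₂ ≠ a₁ ∧ c₁₂ = 0 ∧ c₂₁ = 0 ∧ c₂₂ = 0))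
    (η : ℝ) (hη : 0 < η) (hcancel : c₁₂ + η * (c₂₂ - 2 * c₂₁) = 0) :
    ∃ C, (kdv a₁ a₂ c₁₁ c₁₂ c₂₁ c₂₂ η).Adm C := by
  set S := kdv a₁ a₂ c₁₁ c₁₂ c₂₁ c₂₂ η with hS
  have hc12 : c₁₂ = - η * (c₂₂ - 2 * c₂₁) := by linarith
  -- fff
  have hA : ∃ C, 0 ≤ C ∧ ∀ m, GoodW m → ∀ x y z, x + y + z = 0 → ∀ N, |x| ≤ N → |y| ≤ N → |z| ≤ N →
    (N = |x| ∨ N = |y| ∨ N = |z|) → (S.M3 m 0 0 0 x y z = 3 * S.Ph 0 0 0 x y z * S.q m 0 0 0 x y z) ∧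
      |S.q m 0 0 0 x y z| * (1 + N) ≤ C * m N ^ 2 := by
    refine ⟨(128 * |c₁₁|) / (3 * |a₁|), by positivity, fun m hm x y z hs N hx hy hz hN => ?_⟩
    unfold Sys.q
    apply div_bd (D := |x| * |y| * |z|)
    · have : S.Ph 0 0 0 x y z = 3 * a₁ * (x * y * z) := by
        have hzz : z = -(x + y) := by linarith
        simp [Sys.Ph, hS, kdv]; rw [hzz]; ring
      rw [this, abs_mul, abs_mul, abs_mul, abs_mul]; norm_num
    · positivity
    · positivity
    · positivity
    · exact (abs_nonneg x).trans hx
    · positivity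
    · have : S.M3 m 0 0 0 x y z = - c₁₁ * (x * m x ^ 2 + y * m y ^ 2 + z * m z ^ 2) := by
        have hzz : z = -(x + y) := by linarith
        simp [Sys.M3, hS, kdv]; rw [hzz]; ring
      rw [this, abs_mul, abs_neg, mul_assoc]
      have := symA hm hs hx hy hz hN
      calc _ ≤ |c₁₁| * (128 * (|x| * |y| * |z|) * m N ^ 2) := by gcongr
        _ = _ := by ring
  have hMB : ∀ (m : ℝ → ℝ) x y z, x + y + z = 0 → S.M3 m 0 1 1 x y z =
      (η * c₂₁) * (x * (m y ^ 2 + m z ^ 2 - 2 * m x ^ 2)) +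
        (η * c₂₂) * (z * m y ^ 2 + y * m z ^ 2 + x * m x ^ 2) := by
    intro m x y z hs
    have hzz : z = -(x + y) := by linarith
    simp [Sys.M3, hS, kdv]; rw [hzz, hc12]; ring
  have hB : ∃ C, 0 ≤ C ∧ ∀ m, GoodW m → ∀ x y z, x + y + z = 0 → ∀ N, |x| ≤ N → |y| ≤ N → |z| ≤ N →
    (N = |x| ∨ N = |y| ∨ N = |z|) → (S.M3 m 0 1 1 x y z = 3 * S.Ph 0 1 1 x y z * S.q m 0 1 1 x y z) ∧
      |S.q m 0 1 1 x y z| * (1 + N) ≤ C * m N ^ 2 := by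
    rcases hcoef with h | ⟨h, h'⟩ | ⟨-, -, -, h1, h2, h3⟩
    · obtain ⟨c, hc, hQ⟩ := Qdef ha₁ h
      refine ⟨(128 * (|η * c₂₁| + |η * c₂₂|)) / (c / 2), by positivity, fun m hm x y z hs N hx hy hz hN => ?_⟩
      have hN0 : 0 ≤ N := (abs_nonneg x).trans hx
      unfold Sys.q
      apply div_bd (D := |x| * N ^ 2)
      · have : S.Ph 0 1 1 x y z = x * (a₁ * (y + z) ^ 2 - a₂ * (y ^ 2 - y * z + z ^ 2)) := by
          have hzz : x = -(y + z) := by linarith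
          simp [Sys.Ph, hS, kdv]; rw [hzz]; ring
        rw [this, abs_mul]
        have h1 := hQ y z
        have h2 : N ^ 2 ≤ 2 * (y ^ 2 + z ^ 2) := by
          rcases hN with h | h | h
          · rw [h, sq_abs]
            have hzz : x = -(y + z) := by linarith
            rw [hzz]; nlinarith [sq_nonneg (y - z)]
          · rw [h, sq_abs]; nlinarith [sq_nonneg y, sq_nonneg z]
          · rw [h, sq_abs]; nlinarith [sq_nonneg y, sq_nonneg z]
        calc c / 2 * (|x| * N ^ 2) = |x| * (c / 2 * N ^ 2) := by ring
          _ ≤ |x| * (c / 2 * (2 * (y ^ 2 + z ^ 2))) := by gcongr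
          _ = |x| * (c * (y ^ 2 + z ^ 2)) := by ring
          _ ≤ _ := by gcongr
      · positivity
      · positivity
      · positivity
      · exact hN0
      · positivity
      · rw [hMB m x y z hs]
        exact symB hm hs _ _ hx hy hz
    · have h12 : a₂ = a₁ := by rw [div_eq_iff ha₁] at h; linarith
      refine ⟨(128 * |η * c₂₁|) / (3 * |a₁|), by positivity, fun m hm x y z hs N hx hy hz hN => ?_⟩
      unfold Sys.q
      apply div_bd (D := |x| * |y| * |z|)
      · have : S.Ph 0 1 1 x y z = 3 * a₁ * (x * y * z) := by
          have hzz : z = -(x + y) := by linarith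
          simp [Sys.Ph, hS, kdv, h12]; rw [hzz]; ring
        rw [this, abs_mul, abs_mul, abs_mul, abs_mul]; norm_num
      · positivity
      · positivity
      · positivity
      · exact (abs_nonneg x).trans hx
      · positivity
      · have : S.M3 m 0 1 1 x y z = - (η * c₂₁) * (x * m x ^ 2 + y * m y ^ 2 + z * m z ^ 2) := by
          rw [hMB m x y z hs, ← h']
          have hzz : z = -(x + y) := by linarith
          rw [hzz]; ring
        rw [this, abs_mul, abs_neg, mul_assoc]
        have := symA hm hs hx hy hz hN
        calc _ ≤ |η * c₂₁| * (128 * (|x| * |y| * |z|) * m N ^ 2) := by gcongr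
          _ = _ := by ring
    · refine ⟨0, le_rfl, fun m hm x y z hs N hx hy hz hN => ?_⟩
      have : S.M3 m 0 1 1 x y z = 0 := by rw [hMB m x y z hs, h2, h3]; ring
      simp [Sys.q, this]
  obtain ⟨CA, hCA, hA⟩ := hA
  obtain ⟨CB, hCB, hB⟩ := hB
  have hbad : ∀ m j k l x y z, j + k + l ≠ 0 → S.M3 m j k l x y z = 0 := by
    intro m j k l x y z h
    fin_cases j <;> fin_cases k <;> fin_cases l <;> simp [Sys.M3, hS, kdv] at h ⊢
  have hqbad : ∀ m j k l x y z, j + k + l ≠ 0 → S.q m j k l x y z = 0 := by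
    intro m j k l x y z h; unfold Sys.q; rw [hbad m j k l x y z h]; simp
  have hall : ∀ m, GoodW m → ∀ j k l x y z, x + y + z = 0 → ∀ N, |x| ≤ N → |y| ≤ N → |z| ≤ N →
    (N = |x| ∨ N = |y| ∨ N = |z|) → (S.M3 m j k l x y z = 3 * S.Ph j k l x y z * S.q m j k l x y z) ∧
      |S.q m j k l x y z| * (1 + N) ≤ (CA + CB + 1) * m N ^ 2 := by
    intro m hm j k l x y z hs N hx hy hz hN
    have hw : 0 ≤ m N ^ 2 := by positivity
    have cyc1 : ∀ j k l x y z, S.M3 m j k l x y z = S.M3 m k l j y z x := by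
      intros; unfold Sys.M3; ring
    have cyc2 : ∀ j k l x y z, S.Ph j k l x y z = S.Ph k l j y z x := by
      intros; unfold Sys.Ph; ring
    have r0 := hA m hm x y z hs N hx hy hz hN
    have r1 := hB m hm x y z hs N hx hy hz hN
    have r2 := hB m hm y z x (by linarith) N hy hz hx (by tauto)
    have r3 := hB m hm z x y (by linarith) N hz hx hy (by tauto)
    by_cases hb : j + k + l = 0
    · fin_cases j <;> fin_cases k <;> fin_cases l <;>
        simp only [Fin.zero_eta, Fin.mk_one] at hb ⊢
      · exact ⟨r0.1, r0.2.trans (by nlinarith)⟩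
      · simp at hb
      · simp at hb
      · exact ⟨r1.1, r1.2.trans (by nlinarith)⟩
      · simp at hb
      · rw [cyc1 1 0 1, cyc2 1 0 1, S.q_cyc m 1 0 1]
        exact ⟨r2.1, r2.2.trans (by nlinarith)⟩
      · rw [← cyc1 0 1 1, ← cyc2 0 1 1, ← S.q_cyc m 0 1 1]
        exact ⟨r3.1, r3.2.trans (by nlinarith)⟩
      · exact absurd hb (by decide)
    · rw [hbad m j k l x y z hb, hqbad m j k l x y z hb]
      simp; positivity
  refine ⟨CA + CB + 1, by positivity, ?_, ?_, ?_, ?_, ?_, ?_⟩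
  · intro j; fin_cases j <;> simpa [hS, kdv]
  · intro j; fin_cases j <;> simp [hS, kdv, hη]
  · intro j k l; fin_cases j <;> fin_cases k <;> fin_cases l <;> simp [hS, kdv]
  · intro m j k l x y z h
    by_contra hb
    exact h (hqbad m j k l x y z hb)
  · intro m hm j k l x y z hs
    refine (hall m hm j k l x y z hs (max |x| (max |y| |z|)) (by simp) (by simp) (by simp) ?_).1
    rcases max_choice |x| (max |y| |z|) with h | h
    · exact Or.inl h
    · rcases max_choice |y| |z| with h' | h'
      · exact Or.inr (Or.inl (h.trans h'))
      · exact Or.inr (Or.inr (h.trans h'))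
  · intro m hm j k l x y z hs N hx hy hz hN
    exact (hall m hm j k l x y z hs N hx hy hz hN).2

end PAn

namespace PAn
set_option linter.unusedVariables false

lemma wamgm {κ A θ : ℝ} (hκ : 0 ≤ κ) (hA : 0 ≤ A) (h0 : 0 ≤ θ) (h1 : θ ≤ 1) :
    κ ^ (1 - θ) * A ^ θ ≤ κ + A := by
  have := Real.geom_mean_le_arith_mean2_weighted (sub_nonneg.2 h1) h0 hκ hA (by ring)
  refine this.trans ?_
  nlinarith

/-- lower bounds of `|x² - c|` -/
lemma sq_sub_lower (x c : ℝ) :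
    |x| * abs (|x| - Real.sqrt (max c 0)) ≤ |x ^ 2 - c| ∧
    (abs (|x| - Real.sqrt (max c 0))) ^ 2 ≤ |x ^ 2 - c| := by
  set x0 := Real.sqrt (max c 0) with hx0
  have h0 : 0 ≤ x0 := Real.sqrt_nonneg _
  have hsq : x0 ^ 2 = max c 0 := Real.sq_sqrt (le_max_right _ _)
  have hx := abs_nonneg x
  rcases le_total 0 c with hc | hc
  · rw [max_eq_left hc] at hsq
    have e : |x ^ 2 - c| = (|x| + x0) * abs (|x| - x0) := by
      have : x ^ 2 - c = (|x| + x0) * (|x| - x0) := by rw [← hsq, ← sq_abs x]; ring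
      rw [this, abs_mul, abs_of_nonneg (by positivity)]
    have hu : abs (|x| - x0) ≤ |x| + x0 := by rw [abs_le]; constructor <;> linarith
    have h1 := abs_nonneg (|x| - x0)
    constructor
    · rw [e]; gcongr; linarith
    · rw [e, sq]; gcongr
  · rw [max_eq_right hc] at hsq
    have : x0 = 0 := by simpa using hsq
    rw [this, sub_zero, abs_abs]
    have h2 : |x| ^ 2 ≤ |x ^ 2 - c| := by
      rw [sq_abs]; refine le_trans ?_ (le_abs_self _); linarith
    exact ⟨by rw [← sq]; exact h2, h2⟩

lemma Nform {k ρ X κ g c' β U : ℝ} (hk : 0 ≤ k) (hρ : 0 < ρ) (hρ1 : ρ ≤ 1) (hX : 0 < X)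
    (hκ : 0 < κ) (hc : 0 < c') (hβ0 : 0 ≤ β) (hβ1 : β ≤ 1) (hU : 0 ≤ U)
    (h : k * (1 + ρ * X) ^ 3 * (κ ^ g * (c' * X ^ β * U)) ≤ 2 * X) :
    k * (1 + X) ^ 2 * U ≤ 2 / (c' * ρ ^ 3) * κ ^ (-g) := by
  have hXb : X ≤ (1 + X) * X ^ β := by
    rcases le_total 1 X with h1 | h1
    · have : 1 ≤ X ^ β := Real.one_le_rpow h1 hβ0
      nlinarith
    · have : X ≤ X ^ β := by
        calc X = X ^ (1:ℝ) := (Real.rpow_one X).symm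
          _ ≤ X ^ β := Real.rpow_le_rpow_of_exponent_ge hX h1 hβ1
      nlinarith
  have hXp : 0 < X ^ β := Real.rpow_pos_of_pos hX _
  have hκp : 0 < κ ^ g := Real.rpow_pos_of_pos hκ _
  have h3 : ρ * (1 + X) ≤ 1 + ρ * X := by nlinarith
  have h4 : k * (ρ * (1 + X)) ^ 3 * (κ ^ g * (c' * X ^ β * U)) ≤ 2 * ((1 + X) * X ^ β) := by
    calc _ ≤ k * (1 + ρ * X) ^ 3 * (κ ^ g * (c' * X ^ β * U)) := by gcongr
      _ ≤ 2 * X := h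
      _ ≤ _ := by linarith
  have h5 : (k * (1 + X) ^ 2 * U) * (c' * ρ ^ 3 * κ ^ g) ≤ 2 := by
    have hp : 0 < (1 + X) * X ^ β := by positivity
    refine le_of_mul_le_mul_right ?_ hp
    calc _ = k * (ρ * (1 + X)) ^ 3 * (κ ^ g * (c' * X ^ β * U)) := by ring
      _ ≤ _ := h4
  rw [Real.rpow_neg hκ.le]
  have : 2 / (c' * ρ ^ 3) * (κ ^ g)⁻¹ = 2 / (c' * ρ ^ 3 * κ ^ g) := by field_simp
  rw [this, le_div_iff₀ (by positivity)]
  exact h5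

/-- The near-resonant bound in one variable. -/
lemma near_bound {a γ ρ : ℝ} (ha : a ≠ 0) (hγ : 0 < γ) (hγ4 : γ < 1 / 4) (hρ : 0 < ρ) (hρ1 : ρ ≤ 1) :
    ∃ C, 0 < C ∧ ∀ k κ X p x c : ℝ, 0 ≤ k → 0 < κ → 0 < X → Real.sqrt κ < |p| → |x| ≤ X →
      k * (1 + ρ * X) ^ 3 * (κ + |p| * (3 * |a| * |x ^ 2 - c|)) ≤ 2 * X →
      (ρ * X ≤ |p| ∨ ρ * X ≤ |x|) →
      k * (1 + |x|) ^ 2 * (abs (|x| - Real.sqrt (max c 0))) ^ (1 - 2 * γ) ≤ C * κ ^ (-(1 / 2 + γ)) := by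
  have hapos : 0 < |a| := abs_pos.2 ha
  obtain ⟨d, hd⟩ : ∃ d, d = 3 * |a| * ρ := ⟨_, rfl⟩
  have hdp : 0 < d := by rw [hd]; positivity
  set C1 := 2 / (d ^ (1 / 2 - γ) * ρ ^ 3) with hC1
  set C2 := 2 / (d ^ (1 - 2 * γ) * ρ ^ 3) with hC2
  have hC1p : 0 < C1 := by positivity
  have hC2p : 0 < C2 := by positivity
  refine ⟨C1 + C2, by positivity, ?_⟩
  intro k κ X p x c hk hκ hX hp hx hb hor
  set u := abs (|x| - Real.sqrt (max c 0)) with hu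
  have hu0 : 0 ≤ u := abs_nonneg _
  obtain ⟨hl1, hl2⟩ := sq_sub_lower x c
  rw [← hu] at hl1 hl2
  have hκ0 : 0 < κ ^ (-(1 / 2 + γ)) := Real.rpow_pos_of_pos hκ _
  have hU : 0 ≤ u ^ (1 - 2 * γ) := by positivity
  have fin : ∀ C', C' ≤ C1 + C2 → k * (1 + X) ^ 2 * u ^ (1 - 2 * γ) ≤ C' * κ ^ (-(1 / 2 + γ)) →
      k * (1 + |x|) ^ 2 * u ^ (1 - 2 * γ) ≤ (C1 + C2) * κ ^ (-(1 / 2 + γ)) := by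
    intro C' h1 h2
    calc _ ≤ k * (1 + X) ^ 2 * u ^ (1 - 2 * γ) := by gcongr
      _ ≤ C' * κ ^ (-(1 / 2 + γ)) := h2
      _ ≤ _ := by gcongr
  rcases hor with hor | hor
  · apply fin C1 (by linarith)
    apply Nform hk hρ hρ1 hX hκ (by positivity) (β := 1 / 2 - γ) (by linarith) (by linarith) hU
    refine le_trans ?_ hb
    gcongr
    have hA : d * X * u ^ 2 ≤ |p| * (3 * |a| * |x ^ 2 - c|) := by
      calc d * X * u ^ 2 = (ρ * X) * (3 * |a| * u ^ 2) := by rw [hd]; ring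
        _ ≤ _ := by gcongr
    have := wamgm hκ.le (by positivity : 0 ≤ d * X * u ^ 2) (θ := 1 / 2 - γ) (by linarith) (by linarith)
    calc _ = κ ^ (1 - (1 / 2 - γ)) * (d * X * u ^ 2) ^ (1 / 2 - γ) := by
          have e1 : (d * X * u ^ 2) ^ (1 / 2 - γ) = d ^ (1 / 2 - γ) * X ^ (1 / 2 - γ) * u ^ (1 - 2 * γ) := by
            rw [Real.mul_rpow (by positivity) (by positivity), Real.mul_rpow hdp.le hX.le,
              ← Real.rpow_natCast u 2, ← Real.rpow_mul hu0]
            congr 2; push_cast; ring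
          rw [e1]
          congr 2
          ring
      _ ≤ κ + d * X * u ^ 2 := this
      _ ≤ _ := by linarith
  · apply fin C2 (by linarith)
    apply Nform hk hρ hρ1 hX hκ (by positivity) (β := 1 - 2 * γ) (by linarith) (by linarith) hU
    refine le_trans ?_ hb
    gcongr
    have hA : Real.sqrt κ * (d * X * u) ≤ |p| * (3 * |a| * |x ^ 2 - c|) := by
      calc Real.sqrt κ * (d * X * u) = Real.sqrt κ * (3 * |a| * ((ρ * X) * u)) := by rw [hd]; ring
        _ ≤ |p| * (3 * |a| * (|x| * u)) := by gcongr
        _ ≤ _ := by gcongr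
    have := wamgm hκ.le (by positivity : 0 ≤ Real.sqrt κ * (d * X * u)) (θ := 1 - 2 * γ) (by linarith) (by linarith)
    calc _ = κ ^ (1 - (1 - 2 * γ)) * (Real.sqrt κ * (d * X * u)) ^ (1 - 2 * γ) := by
          have e1 : (Real.sqrt κ * (d * X * u)) ^ (1 - 2 * γ) = κ ^ (1 / 2 * (1 - 2 * γ)) *
              (d ^ (1 - 2 * γ) * X ^ (1 - 2 * γ) * u ^ (1 - 2 * γ)) := by
            rw [Real.mul_rpow (by positivity) (by positivity), Real.mul_rpow (by positivity) hu0,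
              Real.mul_rpow hdp.le hX.le, Real.sqrt_eq_rpow, ← Real.rpow_mul hκ.le]
          rw [e1, ← mul_assoc (κ ^ (1 - (1 - 2 * γ))), ← Real.rpow_add hκ, mul_assoc]
          congr 2
          ring
      _ ≤ κ + Real.sqrt κ * (d * X * u) := this
      _ ≤ _ := by linarith

/-- elementary lower bound in the region where two frequencies in different pairs are small -/
lemma B2_lower {a b ρ : ℝ} (ha : a ≠ 0) (hρ : 0 < ρ) (hρ1 : ρ ≤ 1) :
    ∃ ρ', 0 < ρ' ∧ ρ' ≤ ρ / 64 ∧ ∃ c, 0 < c ∧ ∀ x1 x2 x3 x4 X : ℝ, x1 + x2 + x3 + x4 = 0 →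
      X = |x1| + |x2| + |x3| + |x4| → ρ * X / 8 < |x1 + x2| → |x1| ≤ ρ' * X → |x3| ≤ ρ' * X →
      c * (X * |x1 + x3|) ≤
        |a * (x1 ^ 2 - x1 * x2 + x2 ^ 2) - b * (x3 ^ 2 - x3 * x4 + x4 ^ 2)| := by
  by_cases hab : a = b
  · subst hab
    have hap : 0 < |a| := abs_pos.2 ha
    refine ⟨ρ / 64, by positivity, le_rfl, 3 * |a| * (ρ / 32), by positivity, ?_⟩
    intro x1 x2 x3 x4 X hs hX hp h1 h3
    have e : a * (x1 ^ 2 - x1 * x2 + x2 ^ 2) - a * (x3 ^ 2 - x3 * x4 + x4 ^ 2)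
        = 3 * a * ((x1 + x3) * (x1 + x4)) := by
      have : x2 = -(x1 + x3 + x4) := by linarith
      rw [this]; ring
    rw [e, abs_mul, abs_mul, abs_mul]
    have h4 : ρ / 32 * X ≤ |x1 + x4| := by
      have t1 : |x1 + x2| ≤ |x3| + |x4| := by
        have : x1 + x2 = -(x3 + x4) := by linarith
        rw [this, abs_neg]; exact abs_add_le _ _
      have t2 : |x4| ≤ |x1 + x4| + |x1| := by
        have := abs_sub (x1 + x4) x1; simpa using this
      have : 0 ≤ ρ * X := by
        have : 0 ≤ X := by rw [hX]; positivity
        positivity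
      linarith
    calc 3 * |a| * (ρ / 32) * (X * |x1 + x3|) = 3 * |a| * (|x1 + x3| * (ρ / 32 * X)) := by ring
      _ ≤ 3 * |a| * (|x1 + x3| * |x1 + x4|) := by gcongr
      _ = _ := by norm_num
  · have hd : 0 < |a - b| := abs_pos.2 (sub_ne_zero.2 hab)
    set A := |a| + |b| with hA
    have hap : 0 < |a| := abs_pos.2 ha
    have hAp : 0 < A := by positivity
    set ρ' := min (ρ / 64) (|a - b| * ρ / (192 * A)) with hρ'
    refine ⟨ρ', lt_min (by positivity) (by positivity), min_le_left _ _, |a - b| / 2 * (ρ / 8) ^ 2,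
      by positivity, ?_⟩
    intro x1 x2 x3 x4 X hs hX hp h1 h3
    have hX0 : 0 ≤ X := by rw [hX]; positivity
    set p := x1 + x2 with hpdef
    have hρA : ρ' * (192 * A) ≤ |a - b| * ρ := by
      have := min_le_right (ρ / 64) (|a - b| * ρ / (192 * A))
      rw [← hρ', le_div_iff₀ (by positivity)] at this; exact this
    have hρ64 : ρ' ≤ ρ / 64 := min_le_left _ _
    have e : a * (x1 ^ 2 - x1 * x2 + x2 ^ 2) - b * (x3 ^ 2 - x3 * x4 + x4 ^ 2)
        = (a - b) * p ^ 2 - (3 * (a * (x1 * (p - x1))) + 3 * (b * (x3 * (p + x3)))) := by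
      have h4 : x4 = -(x1 + x2) - x3 := by linarith
      rw [h4, hpdef]; ring
    have hp0 := abs_nonneg p
    have s1 : |x1| ≤ |p| := by nlinarith
    have s3 : |x3| ≤ |p| := by nlinarith
    have t1 : |a * (x1 * (p - x1))| ≤ |a| * ((ρ' * X) * (2 * |p|)) := by
      rw [abs_mul, abs_mul]
      have := abs_sub p x1
      gcongr; linarith
    have t2 : |b * (x3 * (p + x3))| ≤ |b| * ((ρ' * X) * (2 * |p|)) := by
      rw [abs_mul, abs_mul]
      have := abs_add_le p x3
      gcongr; linarith
    have t3 : |3 * (a * (x1 * (p - x1))) + 3 * (b * (x3 * (p + x3)))| ≤ 6 * A * (ρ' * X) * |p| := by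
      refine (abs_add_le _ _).trans ?_
      rw [abs_mul 3 (a * (x1 * (p - x1))), abs_mul 3 (b * (x3 * (p + x3))), abs_of_pos (by norm_num : (0:ℝ) < 3)]
      calc _ ≤ 3 * (|a| * ((ρ' * X) * (2 * |p|))) + 3 * (|b| * ((ρ' * X) * (2 * |p|))) := by gcongr
        _ = _ := by rw [hA]; ring
    have t4 : 6 * A * (ρ' * X) * |p| ≤ |a - b| / 2 * |p| ^ 2 := by
      have : 6 * A * (ρ' * X) ≤ |a - b| / 2 * |p| := by
        have h5 : ρ' * (192 * A) * X ≤ |a - b| * ρ * X := by gcongr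
        have h6 : |a - b| * (ρ * X / 8) ≤ |a - b| * |p| := by gcongr
        nlinarith
      calc _ ≤ |a - b| / 2 * |p| * |p| := by gcongr
        _ = _ := by ring
    have t5 : |a - b| / 2 * |p| ^ 2 ≤ |(a - b) * p ^ 2 - (3 * (a * (x1 * (p - x1))) + 3 * (b * (x3 * (p + x3))))| := by
      have := abs_sub_abs_le_abs_sub ((a - b) * p ^ 2) (3 * (a * (x1 * (p - x1))) + 3 * (b * (x3 * (p + x3))))
      have e2 : |(a - b) * p ^ 2| = |a - b| * |p| ^ 2 := by rw [abs_mul, abs_pow]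
      rw [e2] at this
      linarith
    rw [e]
    refine le_trans ?_ t5
    have h13 : |x1 + x3| ≤ X := by
      have := abs_add_le x1 x3; have := abs_nonneg x2; have := abs_nonneg x4; linarith
    calc |a - b| / 2 * (ρ / 8) ^ 2 * (X * |x1 + x3|) ≤ |a - b| / 2 * (ρ / 8) ^ 2 * (X * X) := by gcongr
      _ = |a - b| / 2 * (ρ * X / 8) ^ 2 := by ring
      _ ≤ _ := by gcongr

/-- kernel bound in region B2 -/
lemma B2_kernel {c ρ : ℝ} (hc : 0 < c) (hρ : 0 < ρ) :
    ∃ C, 0 < C ∧ ∀ k κ X p r z P : ℝ, 0 ≤ k → 0 < κ → 0 < X → ρ * X ≤ |p| → 0 ≤ r → 0 ≤ z →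
      c * (X * z) ≤ P →
      k * (1 + r) ^ 3 * (κ + |p| * P) ≤ 2 * X → k * (1 + r) ^ 2 * z ^ (1 / 2 : ℝ) ≤ C * κ ^ (-(1 / 2 : ℝ)) := by
  refine ⟨2 / (c * ρ) ^ (1 / 2 : ℝ), by positivity, ?_⟩
  intro k κ X p r z P hk hκ hX hp hr hz hP h
  have h1 : (c * ρ) * X ^ 2 * z ≤ |p| * P := by
    calc _ = (ρ * X) * (c * (X * z)) := by ring
      _ ≤ _ := by gcongr
  have h2 := wamgm hκ.le (by positivity : 0 ≤ (c * ρ) * X ^ 2 * z) (θ := 1 / 2) (by norm_num) (by norm_num)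
  have e : ((c * ρ) * X ^ 2 * z) ^ (1 / 2 : ℝ) = (c * ρ) ^ (1 / 2 : ℝ) * X * z ^ (1 / 2 : ℝ) := by
    rw [Real.mul_rpow (by positivity) hz, Real.mul_rpow (by positivity) (by positivity),
      ← Real.sqrt_eq_rpow (X ^ 2), Real.sqrt_sq hX.le]
  rw [e] at h2
  have h3 : k * (1 + r) ^ 2 * (κ ^ (1 - 1 / 2 : ℝ) * ((c * ρ) ^ (1 / 2 : ℝ) * X * z ^ (1 / 2 : ℝ))) ≤ 2 * X := by
    refine le_trans ?_ h
    gcongr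
    · linarith
    · norm_num
    · linarith
  have hκ' : (1 - 1 / 2 : ℝ) = 1 / 2 := by norm_num
  rw [hκ'] at h3
  rw [Real.rpow_neg hκ.le]
  have hκp : 0 < κ ^ (1 / 2 : ℝ) := by positivity
  have hcp : 0 < (c * ρ) ^ (1 / 2 : ℝ) := by positivity
  have : 2 / (c * ρ) ^ (1 / 2 : ℝ) * (κ ^ (1 / 2 : ℝ))⁻¹ = 2 / ((c * ρ) ^ (1 / 2 : ℝ) * κ ^ (1 / 2 : ℝ)) := by
    field_simp
  rw [this, le_div_iff₀ (by positivity)]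
  refine le_of_mul_le_mul_right ?_ hX
  calc _ = k * (1 + r) ^ 2 * (κ ^ (1 / 2 : ℝ) * ((c * ρ) ^ (1 / 2 : ℝ) * X * z ^ (1 / 2 : ℝ))) := by ring
    _ ≤ _ := h3

end PAn

namespace PAn
set_option linter.unusedVariables false

/-- singular kernel in one variable -/
noncomputable def Wk (θ z c : ℝ) : ℝ≥0∞ :=
  ENNReal.ofReal (((1 + |z|) ^ 2)⁻¹) * (ENNReal.ofReal |z - c|) ^ (-θ)

lemma Wk_of_le {k θ z c D : ℝ} (hk : 0 ≤ k) (hθ : 0 < θ) (hD : 0 < D)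
    (h : k * (1 + |z|) ^ 2 * |z - c| ^ θ ≤ D) : ENNReal.ofReal k ≤ ENNReal.ofReal D * Wk θ z c := by
  have hz : 0 < (1 + |z|) ^ 2 := by positivity
  rcases (abs_nonneg (z - c)).eq_or_lt with h0 | h0
  · have : Wk θ z c = ⊤ := by
      unfold Wk
      rw [← h0, ENNReal.ofReal_zero, ENNReal.zero_rpow_of_neg (by linarith), ENNReal.mul_top]
      rw [Ne, ENNReal.ofReal_eq_zero, not_le]; positivity
    rw [this, ENNReal.mul_top]
    · exact le_top
    · rw [Ne, ENNReal.ofReal_eq_zero, not_le]; exact hD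
  · have e : Wk θ z c = ENNReal.ofReal (((1 + |z|) ^ 2)⁻¹ * |z - c| ^ (-θ)) := by
      unfold Wk
      rw [ENNReal.ofReal_rpow_of_pos h0, ENNReal.ofReal_mul (by positivity)]
    rw [e, ← ENNReal.ofReal_mul hD.le]
    apply ENNReal.ofReal_le_ofReal
    have hp : 0 < |z - c| ^ θ := Real.rpow_pos_of_pos h0 _
    rw [Real.rpow_neg h0.le, ← mul_inv, ← div_eq_mul_inv, le_div_iff₀ (by positivity)]
    linarith

/-- at least three of the four frequencies are at least `r` -/
def Tri (r x1 x2 x3 x4 : ℝ) : Prop :=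
  (r ≤ |x1| ∧ r ≤ |x2| ∧ r ≤ |x3|) ∨ (r ≤ |x1| ∧ r ≤ |x2| ∧ r ≤ |x4|) ∨
  (r ≤ |x1| ∧ r ≤ |x3| ∧ r ≤ |x4|) ∨ (r ≤ |x2| ∧ r ≤ |x3| ∧ r ≤ |x4|)

/-- the reduced resonance function -/
noncomputable def Rf (a b x1 x2 x3 x4 : ℝ) : ℝ :=
  a * (x1 ^ 2 - x1 * x2 + x2 ^ 2) - b * (x3 ^ 2 - x3 * x4 + x4 ^ 2)

noncomputable def y0f (a b x1 x2 : ℝ) : ℝ :=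
  Real.sqrt (max ((a * ((x1 + x2) ^ 2 / 4 + 3 * ((x1 - x2) / 2) ^ 2) - b * ((x1 + x2) ^ 2 / 4)) / (3 * b)) 0)

noncomputable def KB (a b γ x1 x2 x3 : ℝ) : ℝ≥0∞ :=
  Wk (1 - 2 * γ) (x3 + (x1 + x2) / 2) (y0f a b x1 x2) +
  Wk (1 - 2 * γ) (x3 + (x1 + x2) / 2) (-y0f a b x1 x2) +
  Wk (1 / 2) x3 (-x1) + Wk (1 / 2) x3 (-x2) +
  Wk (1 / 2) (-(x1 + x2) - x3) (-x1) + Wk (1 / 2) (-(x1 + x2) - x3) (-x2)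

/-- region A -/
def RA (ρ c1 κ a b x1 x2 x3 x4 : ℝ) : Prop :=
  |x1 + x2| ≤ Real.sqrt κ ∨
    (|x1 + x2| ≤ ρ * (|x1| + |x2| + |x3| + |x4|) / 8 ∧
      c1 * (|x1| + |x2| + |x3| + |x4|) ^ 2 ≤ |Rf a b x1 x2 x3 x4|)

lemma lowN {a b x y p X ρ μ A : ℝ} (hX : 0 < X) (hρ : 0 < ρ) (hρ1 : ρ ≤ 1) (hμ : 0 < μ)
    (ha : μ ≤ |a|) (hb : |b| ≤ A) (hA : A * ρ ^ 2 = μ) (hp : |p| ≤ ρ * X / 8)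
    (hx : X / 4 ≤ |x|) (hy : |y| < ρ * X / 8) :
    μ / 16 * X ^ 2 ≤ |a * (p ^ 2 / 4 + 3 * x ^ 2) - b * (p ^ 2 / 4 + 3 * y ^ 2)| := by
  have h1 : |a * (p ^ 2 / 4 + 3 * x ^ 2)| - |b * (p ^ 2 / 4 + 3 * y ^ 2)| ≤ _ := abs_sub_abs_le_abs_sub _ _
  refine le_trans ?_ h1
  rw [abs_mul, abs_mul, abs_of_nonneg (by positivity : 0 ≤ p ^ 2 / 4 + 3 * x ^ 2),
    abs_of_nonneg (by positivity : 0 ≤ p ^ 2 / 4 + 3 * y ^ 2)]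
  have hp2 : p ^ 2 ≤ (ρ * X / 8) ^ 2 := by rw [← sq_abs p]; gcongr
  have hy2 : y ^ 2 ≤ (ρ * X / 8) ^ 2 := by rw [← sq_abs y]; gcongr
  have hx2 : (X / 4) ^ 2 ≤ x ^ 2 := by rw [← sq_abs x]; gcongr
  have e1 : μ * (3 * (X / 4) ^ 2) ≤ |a| * (p ^ 2 / 4 + 3 * x ^ 2) := by
    gcongr; nlinarith [sq_nonneg p]
  have hA0 : 0 ≤ A := (abs_nonneg b).trans hb
  have e2 : |b| * (p ^ 2 / 4 + 3 * y ^ 2) ≤ A * ((ρ * X / 8) ^ 2 / 4 + 3 * (ρ * X / 8) ^ 2) := by gcongr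
  have e3 : A * ((ρ * X / 8) ^ 2 / 4 + 3 * (ρ * X / 8) ^ 2) = 13 / 256 * μ * X ^ 2 := by
    rw [← hA]; ring
  nlinarith [mul_pos hμ (pow_pos hX 2)]

lemma Rf_xy (a b x1 x2 x3 x4 : ℝ) (hs : x1 + x2 + x3 + x4 = 0) :
    Rf a b x1 x2 x3 x4 = a * ((x1 + x2) ^ 2 / 4 + 3 * ((x1 - x2) / 2) ^ 2) -
      b * ((x1 + x2) ^ 2 / 4 + 3 * (x3 + (x1 + x2) / 2) ^ 2) := by
  have : x4 = -(x1 + x2 + x3) := by linarith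
  rw [this]; unfold Rf; ring

lemma max_abs_half (x1 x2 M : ℝ) (h1 : |x1 + x2| ≤ M) (h2 : |x1 - x2| ≤ M) : |x1| + |x2| ≤ M := by
  rcases abs_cases x1 with h | h <;> rcases abs_cases x2 with h' | h' <;>
    rcases abs_le.1 h1 with ⟨_, _⟩ <;> rcases abs_le.1 h2 with ⟨_, _⟩ <;> linarith

/-- all frequencies comparable in the nearly resonant region -/
lemma allN {a b x1 x2 x3 x4 X ρ μ A : ℝ} (hs : x1 + x2 + x3 + x4 = 0)
    (hXd : X = |x1| + |x2| + |x3| + |x4|) (hX : 0 < X) (hρ : 0 < ρ) (hρ1 : ρ ≤ 1) (hμ : 0 < μ)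
    (ha : μ ≤ |a|) (ha' : |a| ≤ A) (hb : μ ≤ |b|) (hb' : |b| ≤ A) (hA : A * ρ ^ 2 = μ)
    (hp : |x1 + x2| ≤ ρ * X / 8) (hR : |Rf a b x1 x2 x3 x4| < μ / 16 * X ^ 2) :
    ρ * X / 8 ≤ |(x1 - x2) / 2| ∧ ρ * X / 8 ≤ |x3 + (x1 + x2) / 2| := by
  rw [Rf_xy _ _ _ _ _ _ hs] at hR
  set p := x1 + x2 with hpd
  set x := (x1 - x2) / 2 with hx
  set y := x3 + p / 2 with hy
  have hpX : |p| ≤ X / 8 := by nlinarith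
  have e1 : x1 - x2 = 2 * x := by rw [hx]; ring
  have e2 : x3 - x4 = 2 * y := by rw [hy, hpd]; linarith
  have e3 : |x3 + x4| = |p| := by rw [show x3 + x4 = -p by rw [hpd]; linarith, abs_neg]
  have m1 := max_abs_half x1 x2 (max |p| (2 * |x|)) (le_max_left _ _)
    (by rw [e1, abs_mul, abs_two]; exact le_max_right _ _)
  have m2 := max_abs_half x3 x4 (max |p| (2 * |y|)) (by rw [e3]; exact le_max_left _ _)
    (by rw [e2, abs_mul, abs_two]; exact le_max_right _ _)
  have hor : X / 4 ≤ |x| ∨ X / 4 ≤ |y| := by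
    by_contra hh
    push Not at hh
    have q1 : max |p| (2 * |x|) < X / 2 := max_lt (by linarith) (by linarith)
    have q2 : max |p| (2 * |y|) < X / 2 := max_lt (by linarith) (by linarith)
    linarith
  have hle : ρ * X / 8 ≤ X / 4 := by nlinarith
  rcases hor with h | h
  · refine ⟨hle.trans h, ?_⟩
    by_contra hh
    push Not at hh
    exact absurd hR (not_lt.2 (lowN hX hρ hρ1 hμ ha hb' hA hp h hh))
  · refine ⟨?_, hle.trans h⟩
    by_contra hh
    push Not at hh
    have := lowN hX hρ hρ1 hμ hb ha' hA hp h hh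
    rw [abs_sub_comm] at this
    exact absurd hR (not_lt.2 this)

lemma KB_near {a b γ k x1 x2 x3 D : ℝ} (hγ4 : γ < 1 / 4) (hk : 0 ≤ k) (hD : 0 < D)
    (h : k * (1 + |x3 + (x1 + x2) / 2|) ^ 2 *
      (abs (|x3 + (x1 + x2) / 2| - y0f a b x1 x2)) ^ (1 - 2 * γ) ≤ D) :
    ENNReal.ofReal k ≤ ENNReal.ofReal D * KB a b γ x1 x2 x3 := by
  set y := x3 + (x1 + x2) / 2
  set y0 := y0f a b x1 x2
  have : ENNReal.ofReal k ≤ ENNReal.ofReal D * Wk (1 - 2 * γ) y y0 ∨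
      ENNReal.ofReal k ≤ ENNReal.ofReal D * Wk (1 - 2 * γ) y (-y0) := by
    rcases le_total 0 y with hy | hy
    · left; apply Wk_of_le hk (by linarith) hD; rwa [abs_of_nonneg hy] at h ⊢
    · right; apply Wk_of_le hk (by linarith) hD
      rw [abs_of_nonpos hy] at h ⊢
      rwa [show y - -y0 = -(-y - y0) by ring, abs_neg]
  rcases this with h | h
  · refine h.trans ?_
    unfold KB
    gcongr
    simp only [add_assoc]; exact le_self_add
  · refine h.trans ?_
    unfold KB
    gcongr
    simp only [add_assoc]; exact le_add_left le_self_add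

lemma Wk_le_KB (a b γ x1 x2 x3 : ℝ) :
    Wk (1 / 2) x3 (-x1) ≤ KB a b γ x1 x2 x3 ∧ Wk (1 / 2) x3 (-x2) ≤ KB a b γ x1 x2 x3 ∧
    Wk (1 / 2) (-(x1 + x2) - x3) (-x1) ≤ KB a b γ x1 x2 x3 ∧
    Wk (1 / 2) (-(x1 + x2) - x3) (-x2) ≤ KB a b γ x1 x2 x3 := by
  unfold KB
  refine ⟨?_, ?_, ?_, ?_⟩ <;> simp only [add_assoc]
  · exact le_add_left (le_add_left le_self_add)
  · exact le_add_left (le_add_left (le_add_left le_self_add))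
  · exact le_add_left (le_add_left (le_add_left (le_add_left le_self_add)))
  · exact le_add_left (le_add_left (le_add_left (le_add_left le_add_self)))

end PAn

namespace PAn
set_option linter.unusedVariables false

/-- pointwise bound outside region A -/
lemma pointB {a b γ : ℝ} (ha : a ≠ 0) (hb : b ≠ 0) (hγ : 0 < γ) (hγ4 : γ < 1 / 4) {ρ μ A : ℝ}
    (hρ : 0 < ρ) (hρ1 : ρ ≤ 1) (hμ : 0 < μ)
    (hma : μ ≤ |a|) (hma' : |a| ≤ A) (hmb : μ ≤ |b|) (hmb' : |b| ≤ A) (hA : A * ρ ^ 2 = μ) :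
    ∃ C, 0 < C ∧ ∀ k κ x1 x2 x3 x4 : ℝ, 0 ≤ k → 0 < κ → κ ≤ 1 → x1 + x2 + x3 + x4 = 0 →
      (∀ r, 0 ≤ r → Tri r x1 x2 x3 x4 →
        k * (1 + r) ^ 3 * (κ + |x1 + x2| * |Rf a b x1 x2 x3 x4|) ≤ 2 * (|x1| + |x2| + |x3| + |x4|)) →
      ¬ RA ρ (μ / 16) κ a b x1 x2 x3 x4 →
      ENNReal.ofReal k ≤ ENNReal.ofReal (C * κ ^ (-(1 / 2 + γ))) * KB a b γ x1 x2 x3 := by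
  obtain ⟨ρ', hρ', hρ'le, c, hc, hlow⟩ := B2_lower (b := b) ha hρ hρ1
  have hρ'1 : ρ' ≤ 1 := by linarith
  obtain ⟨C1, hC1, hnear⟩ := near_bound hb hγ hγ4 hρ' hρ'1
  obtain ⟨C2, hC2, hker⟩ := B2_kernel hc (by positivity : 0 < ρ / 8)
  refine ⟨C1 + C2, by positivity, ?_⟩
  intro k κ x1 x2 x3 x4 hk hκ hκ1 hs hT hRA
  obtain ⟨X, hX⟩ : ∃ X, X = |x1| + |x2| + |x3| + |x4| := ⟨_, rfl⟩
  unfold RA at hRA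
  rw [← hX] at hRA hT
  push Not at hRA
  obtain ⟨hp, hRA⟩ := hRA
  have hκp : 0 < κ ^ (-(1 / 2 + γ)) := Real.rpow_pos_of_pos hκ _
  have n1 := abs_nonneg x1
  have n2 := abs_nonneg x2
  have n3 := abs_nonneg x3
  have n4 := abs_nonneg x4
  have hp12 := abs_add_le x1 x2
  have hp34 : |x1 + x2| ≤ |x3| + |x4| := by
    rw [show x1 + x2 = -(x3 + x4) by linarith, abs_neg]; exact abs_add_le _ _
  have hp0 : 0 < |x1 + x2| := lt_of_le_of_lt (Real.sqrt_nonneg _) hp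
  have hXp : 0 < X := by linarith
  have hρX : 0 < ρ * X := by positivity
  have hρ'X : ρ' * X ≤ ρ * X / 64 := by nlinarith
  -- the near-resonant conclusion
  have near : Tri (ρ' * X) x1 x2 x3 x4 → (ρ' * X ≤ |x1 + x2| ∨ ρ' * X ≤ |x3 + (x1 + x2) / 2|) →
      ENNReal.ofReal k ≤ ENNReal.ofReal ((C1 + C2) * κ ^ (-(1 / 2 + γ))) * KB a b γ x1 x2 x3 := by
    intro htri hor
    have h1 := hT (ρ' * X) (by positivity) htri
    apply KB_near hγ4 hk (by positivity)
    have hy : |x3 + (x1 + x2) / 2| ≤ X := by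
      have e : x3 + (x1 + x2) / 2 = (x3 - x4) / 2 := by linarith
      rw [e, abs_div, abs_two]
      have := abs_sub x3 x4
      linarith
    have eR : |Rf a b x1 x2 x3 x4| = 3 * |b| * |(x3 + (x1 + x2) / 2) ^ 2 -
        (a * ((x1 + x2) ^ 2 / 4 + 3 * ((x1 - x2) / 2) ^ 2) - b * ((x1 + x2) ^ 2 / 4)) / (3 * b)| := by
      rw [← abs_of_pos (by norm_num : (0:ℝ) < 3), ← abs_mul, ← abs_mul, Rf_xy _ _ _ _ _ _ hs,
        ← abs_neg, abs_of_pos (by norm_num : (0:ℝ) < 3)]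
      congr 1
      field_simp
      ring
    rw [eR] at h1
    refine (hnear k κ X (x1 + x2) (x3 + (x1 + x2) / 2) _ hk hκ hXp hp hy h1 hor).trans ?_
    gcongr
    linarith
  by_cases hsm : |x1 + x2| ≤ ρ * X / 8
  · have hR := hRA hsm
    obtain ⟨hx, hy⟩ := allN hs hX hXp hρ hρ1 hμ hma hma' hmb hmb' hA hsm hR
    have t1 : ρ' * X ≤ |x1| := by
      have := abs_sub ((x1 + x2) / 2) x1
      have e : (x1 + x2) / 2 - x1 = -((x1 - x2) / 2) := by ring
      rw [e, abs_neg, abs_div (x1 + x2), abs_two] at this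
      linarith
    have t2 : ρ' * X ≤ |x2| := by
      have := abs_sub ((x1 + x2) / 2) x2
      have e : (x1 + x2) / 2 - x2 = ((x1 - x2) / 2) := by ring
      rw [e, abs_div (x1 + x2), abs_two] at this
      linarith
    have t3 : ρ' * X ≤ |x3| := by
      have := abs_add_le x3 ((x1 + x2) / 2)
      rw [abs_div (x1 + x2), abs_two] at this
      linarith
    exact near (Or.inl ⟨t1, t2, t3⟩) (Or.inr (by linarith))
  · push Not at hsm
    by_cases htri : Tri (ρ' * X) x1 x2 x3 x4
    · exact near htri (Or.inl (by linarith))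
    · -- region B2
      have hRfs : ∀ y1 y2 y3 y4 : ℝ, (y1 = x1 ∧ y2 = x2 ∨ y1 = x2 ∧ y2 = x1) →
          (y3 = x3 ∧ y4 = x4 ∨ y3 = x4 ∧ y4 = x3) → |y1| ≤ ρ' * X → |y3| ≤ ρ' * X →
          k * (1 + |y3|) ^ 2 * |y3 - -y1| ^ (1 / 2 : ℝ) ≤ (C1 + C2) * κ ^ (-(1 / 2 + γ)) := by
        intro y1 y2 y3 y4 h12 h34 h1 h3
        have es : y1 + y2 = x1 + x2 := by rcases h12 with ⟨h, h'⟩ | ⟨h, h'⟩ <;> rw [h, h']; ring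
        have es2 : y3 + y4 = x3 + x4 := by rcases h34 with ⟨h, h'⟩ | ⟨h, h'⟩ <;> rw [h, h']; ring
        have eR : Rf a b x1 x2 x3 x4 =
            a * (y1 ^ 2 - y1 * y2 + y2 ^ 2) - b * (y3 ^ 2 - y3 * y4 + y4 ^ 2) := by
          unfold Rf
          rcases h12 with ⟨h, h'⟩ | ⟨h, h'⟩ <;> rcases h34 with ⟨g, g'⟩ | ⟨g, g'⟩ <;>
            rw [h, h', g, g'] <;> ring
        have eX : X = |y1| + |y2| + |y3| + |y4| := by
          rw [hX]
          rcases h12 with ⟨h, h'⟩ | ⟨h, h'⟩ <;> rcases h34 with ⟨g, g'⟩ | ⟨g, g'⟩ <;>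
            rw [h, h', g, g'] <;> ring
        have hl := hlow y1 y2 y3 y4 X (by linarith) eX (by rw [es]; exact hsm) h1 h3
        rw [← eR] at hl
        have b2 : |y3| ≤ |y2| := by
          have := abs_add_le y1 y2
          rw [es] at this
          linarith
        have b4 : |y3| ≤ |y4| := by
          have := abs_add_le y3 y4
          rw [es2, show x3 + x4 = -(x1 + x2) by linarith, abs_neg] at this
          linarith
        have htr : Tri |y3| x1 x2 x3 x4 := by
          unfold Tri
          rcases h12 with ⟨h, h'⟩ | ⟨h, h'⟩ <;> rcases h34 with ⟨g, g'⟩ | ⟨g, g'⟩ <;>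
            rw [h'] at b2 <;> rw [g'] at b4 <;> rw [g] at b2 b4 ⊢ <;> simp [b2, b4]
        have hh := hT |y3| (abs_nonneg _) htr
        have := hker k κ X (x1 + x2) |y3| |y1 + y3| _ hk hκ hXp (by linarith) (abs_nonneg _) (abs_nonneg _) hl hh
        rw [show y3 - -y1 = y1 + y3 by ring]
        refine this.trans ?_
        have hκκ : κ ^ (-(1 / 2 : ℝ)) ≤ κ ^ (-(1 / 2 + γ)) :=
          Real.rpow_le_rpow_of_exponent_ge hκ hκ1 (by linarith)
        calc C2 * κ ^ (-(1 / 2 : ℝ)) ≤ C2 * κ ^ (-(1 / 2 + γ)) := by gcongr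
          _ ≤ _ := by gcongr; linarith
      have hDp : 0 < (C1 + C2) * κ ^ (-(1 / 2 + γ)) := by positivity
      have e4 : x4 = -(x1 + x2) - x3 := by linarith
      have hi : |x1| ≤ ρ' * X ∨ |x2| ≤ ρ' * X := by
        by_contra hh
        push Not at hh
        apply htri
        unfold Tri
        by_cases h3 : ρ' * X ≤ |x3|
        · exact Or.inl ⟨hh.1.le, hh.2.le, h3⟩
        · push Not at h3
          exact Or.inr (Or.inl ⟨hh.1.le, hh.2.le, by linarith⟩)
      have hj : |x3| ≤ ρ' * X ∨ |x4| ≤ ρ' * X := by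
        by_contra hh
        push Not at hh
        apply htri
        unfold Tri
        by_cases h3 : ρ' * X ≤ |x1|
        · exact Or.inr (Or.inr (Or.inl ⟨h3, hh.1.le, hh.2.le⟩))
        · push Not at h3
          exact Or.inr (Or.inr (Or.inr ⟨by linarith, hh.1.le, hh.2.le⟩))
      obtain ⟨w1, w2, w3, w4⟩ := Wk_le_KB a b γ x1 x2 x3
      rcases hi with hi | hi <;> rcases hj with hj | hj
      · refine (Wk_of_le hk (by norm_num) hDp (hRfs x1 x2 x3 x4 (by simp) (by simp) hi hj)).trans ?_
        gcongr
      · have := Wk_of_le hk (by norm_num) hDp (hRfs x1 x2 x4 x3 (by simp) (by simp) hi hj)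
        rw [e4] at this
        refine this.trans ?_
        gcongr
      · refine (Wk_of_le hk (by norm_num) hDp (hRfs x2 x1 x3 x4 (by simp) (by simp) hi hj)).trans ?_
        gcongr
      · have := Wk_of_le hk (by norm_num) hDp (hRfs x2 x1 x4 x3 (by simp) (by simp) hi hj)
        rw [e4] at this
        refine this.trans ?_
        gcongr

/-- kernel in region A -/
noncomputable def KA (C κ p Y : ℝ) : ℝ≥0∞ :=
  indicator {p : ℝ | |p| ≤ Real.sqrt κ} (fun _ => ENNReal.ofReal κ⁻¹) p +
  indicator {p : ℝ | |p| ≤ Y} (fun _ => ENNReal.ofReal (C * (Real.sqrt κ)⁻¹ * Y⁻¹)) p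

lemma pointA {a b ρ c1 : ℝ} (hc1 : 0 < c1) (hρ : 0 < ρ) (hρ1 : ρ ≤ 1) :
    ∃ C, 0 < C ∧ ∀ k κ x1 x2 x3 x4 : ℝ, 0 ≤ k → 0 < κ → x1 + x2 + x3 + x4 = 0 → κ * k ≤ 1 →
      (k * (κ + |x1 + x2| * |Rf a b x1 x2 x3 x4|) ≤ 2 * (|x1| + |x2| + |x3| + |x4|)) →
      RA ρ c1 κ a b x1 x2 x3 x4 →
      ENNReal.ofReal k ≤ KA C κ (x1 + x2) (|x1| + |x3|) ∧
      ENNReal.ofReal k ≤ KA C κ (x1 + x2) (|x2| + |x4|) := by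
  refine ⟨8 / c1, by positivity, ?_⟩
  intro k κ x1 x2 x3 x4 hk hκ hs hkk hT hRA
  by_cases hp : |x1 + x2| ≤ Real.sqrt κ
  · have : ENNReal.ofReal k ≤ ENNReal.ofReal κ⁻¹ := by
      apply ENNReal.ofReal_le_ofReal
      rw [← one_div, le_div_iff₀ hκ]; linarith
    constructor
    all_goals
      unfold KA
      rw [indicator_of_mem (by exact hp)]
      exact this.trans le_self_add
  · rcases hRA with h | ⟨h1, h2⟩
    · exact absurd h hp
    push Not at hp
    obtain ⟨X, hX⟩ : ∃ X, X = |x1| + |x2| + |x3| + |x4| := ⟨_, rfl⟩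
    rw [← hX] at h1 h2 hT
    have n1 := abs_nonneg x1
    have n2 := abs_nonneg x2
    have n3 := abs_nonneg x3
    have n4 := abs_nonneg x4
    have hX0 : 0 ≤ X := by linarith
    have hp0 : 0 < |x1 + x2| := lt_of_le_of_lt (Real.sqrt_nonneg _) hp
    have hpX : |x1 + x2| ≤ X / 8 := by nlinarith
    have hXp : 0 < X := by linarith
    have hsk : 0 < Real.sqrt κ := Real.sqrt_pos.2 hκ
    have hk2 : k * (Real.sqrt κ * (c1 * X)) ≤ 2 := by
      refine le_of_mul_le_mul_right ?_ hXp
      calc k * (Real.sqrt κ * (c1 * X)) * X = k * (Real.sqrt κ * (c1 * X ^ 2)) := by ring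
        _ ≤ k * (|x1 + x2| * |Rf a b x1 x2 x3 x4|) := by gcongr
        _ ≤ k * (κ + |x1 + x2| * |Rf a b x1 x2 x3 x4|) := by gcongr; linarith
        _ ≤ 2 * X := hT
    have key : ∀ Y, X ≤ 8 / 3 * Y → Y ≤ X → ENNReal.ofReal k ≤ KA (8 / c1) κ (x1 + x2) Y := by
      intro Y hY hYX
      have hYp : 0 < Y := by linarith
      unfold KA
      rw [indicator_of_mem (s := {p : ℝ | |p| ≤ Y}) (by show |x1 + x2| ≤ Y; linarith)]
      refine le_trans ?_ le_add_self
      apply ENNReal.ofReal_le_ofReal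
      have : 8 / c1 * (Real.sqrt κ)⁻¹ * Y⁻¹ = 8 / (Real.sqrt κ * (c1 * Y)) := by field_simp
      rw [this, le_div_iff₀ (by positivity)]
      have : k * (Real.sqrt κ * (c1 * Y)) ≤ k * (Real.sqrt κ * (c1 * X)) := by gcongr
      linarith
    have q : |x1| ≤ |x1 + x2| + |x2| := by have := abs_sub (x1 + x2) x2; simpa using this
    have q' : |x2| ≤ |x1 + x2| + |x1| := by have := abs_sub (x1 + x2) x1; simpa using this
    have e34 : |x3 + x4| = |x1 + x2| := by
      rw [show x3 + x4 = -(x1 + x2) by linarith, abs_neg]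
    have q3 : |x3| ≤ |x1 + x2| + |x4| := by have := abs_sub (x3 + x4) x4; rw [e34] at this; simpa using this
    have q4 : |x4| ≤ |x1 + x2| + |x3| := by have := abs_sub (x3 + x4) x3; rw [e34] at this; simpa using this
    exact ⟨key _ (by linarith) (by linarith), key _ (by linarith) (by linarith)⟩

end PAn

namespace PAn
set_option linter.unusedVariables false

/-! one-dimensional integrals -/

lemma measurable_Wk (θ c : ℝ) : Measurable (fun z => Wk θ z c) := by
  unfold Wk
  have : Measurable fun z : ℝ => ENNReal.ofReal |z - c| := by fun_prop
  exact (by fun_prop : Measurable fun z : ℝ => ENNReal.ofReal (((1 + |z|) ^ 2)⁻¹)).mul (this.pow_const _)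

lemma lint_jap : ∃ C : ℝ, 0 < C ∧ ∫⁻ z : ℝ, ENNReal.ofReal (((1 + |z|) ^ 2)⁻¹) ≤ ENNReal.ofReal C := by
  have h : Integrable (fun z : ℝ => (1 + ‖z‖) ^ (-(2:ℝ))) := by
    apply integrable_one_add_norm; simp
  have e : ∀ z : ℝ, ((1 + |z|) ^ 2)⁻¹ = (1 + ‖z‖) ^ (-(2:ℝ)) := by
    intro z
    rw [Real.rpow_neg (by positivity), Real.norm_eq_abs]; norm_cast
  simp_rw [e]
  rw [← ofReal_integral_eq_lintegral_ofReal h (Eventually.of_forall fun z => by positivity)]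
  refine ⟨|∫ z : ℝ, (1 + ‖z‖) ^ (-(2:ℝ))| + 1, by positivity, ENNReal.ofReal_le_ofReal ?_⟩
  linarith [le_abs_self (∫ z : ℝ, (1 + ‖z‖) ^ (-(2:ℝ)))]

lemma lint_sing {θ : ℝ} (hθ : 0 < θ) (hθ1 : θ < 1) : ∃ C : ℝ, 0 < C ∧
    ∫⁻ z in Icc (-1:ℝ) 1, (ENNReal.ofReal |z|) ^ (-θ) ≤ ENNReal.ofReal C := by
  have hI : IntervalIntegrable (fun x : ℝ => x ^ (-θ)) volume 0 1 :=
    intervalIntegral.intervalIntegrable_rpow' (by linarith)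
  rw [intervalIntegrable_iff_integrableOn_Ioc_of_le (by norm_num)] at hI
  have h1 : ∫⁻ z in Ioc (0:ℝ) 1, (ENNReal.ofReal |z|) ^ (-θ) ≠ ⊤ := by
    have : ∫⁻ z in Ioc (0:ℝ) 1, (ENNReal.ofReal |z|) ^ (-θ) = ∫⁻ z in Ioc (0:ℝ) 1, ENNReal.ofReal (z ^ (-θ)) := by
      apply setLIntegral_congr_fun measurableSet_Ioc
      intro z hz
      simp only
      rw [abs_of_pos hz.1, ENNReal.ofReal_rpow_of_pos hz.1]
    rw [this]
    have := hI.2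
    rw [hasFiniteIntegral_iff_ofReal] at this
    · exact this.ne
    · filter_upwards [ae_restrict_mem measurableSet_Ioc] with z hz
      exact Real.rpow_nonneg hz.1.le _
  have h2 : ∫⁻ z in Ico (-1:ℝ) 0, (ENNReal.ofReal |z|) ^ (-θ) ≠ ⊤ := by
    have : ∫⁻ z in Ico (-1:ℝ) 0, (ENNReal.ofReal |z|) ^ (-θ) = ∫⁻ z in Ioc (0:ℝ) 1, (ENNReal.ofReal |z|) ^ (-θ) := by
      rw [← lintegral_indicator measurableSet_Ico, ← lintegral_indicator measurableSet_Ioc,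
        ← lintegral_neg_eq_self]
      congr 1
      ext z
      by_cases hz : z ∈ Ioc (0:ℝ) 1
      · rw [indicator_of_mem hz, indicator_of_mem, abs_neg]
        exact ⟨by linarith [hz.2], by linarith [hz.1]⟩
      · rw [indicator_of_notMem hz, indicator_of_notMem]
        rintro ⟨h, h'⟩
        exact hz ⟨by linarith, by linarith⟩
    rw [this]; exact h1
  have h3 : ∫⁻ z in Icc (-1:ℝ) 1, (ENNReal.ofReal |z|) ^ (-θ) ≤
      (∫⁻ z in Ico (-1:ℝ) 0, (ENNReal.ofReal |z|) ^ (-θ)) + ∫⁻ z in Ioc (0:ℝ) 1, (ENNReal.ofReal |z|) ^ (-θ) := by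
    have hsub : Icc (-1:ℝ) 1 ⊆ (Ico (-1:ℝ) 0 ∪ Ioc (0:ℝ) 1) ∪ {0} := by
      intro z hz
      rcases lt_trichotomy z 0 with h | h | h
      · exact Or.inl (Or.inl ⟨hz.1, h⟩)
      · exact Or.inr h
      · exact Or.inl (Or.inr ⟨h, hz.2⟩)
    calc _ ≤ _ := lintegral_mono_set hsub
      _ ≤ _ := lintegral_union_le _ _ _
      _ ≤ _ := add_le_add (lintegral_union_le _ _ _) le_rfl
      _ = _ := by simp
  have h4 := lt_of_le_of_lt h3 (ENNReal.add_lt_top.2 ⟨h2.lt_top, h1.lt_top⟩)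
  refine ⟨(∫⁻ z in Icc (-1:ℝ) 1, (ENNReal.ofReal |z|) ^ (-θ)).toReal + 1, by positivity, ?_⟩
  refine le_trans ?_ (ENNReal.ofReal_le_ofReal (le_add_of_nonneg_right zero_le_one))
  rw [ENNReal.ofReal_toReal h4.ne]

lemma lint_Wk {θ : ℝ} (hθ : 0 < θ) (hθ1 : θ < 1) : ∃ C : ℝ, 0 < C ∧
    ∀ c, ∫⁻ z, Wk θ z c ≤ ENNReal.ofReal C := by
  obtain ⟨C1, hC1, h1⟩ := lint_jap
  obtain ⟨C2, hC2, h2⟩ := lint_sing hθ hθ1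
  refine ⟨C1 + C2, by positivity, fun c => ?_⟩
  have hpt : ∀ z, Wk θ z c ≤ ENNReal.ofReal (((1 + |z|) ^ 2)⁻¹) +
      indicator (Icc (-1:ℝ) 1) (fun w => (ENNReal.ofReal |w|) ^ (-θ)) (z - c) := by
    intro z
    unfold Wk
    by_cases hz : z - c ∈ Icc (-1:ℝ) 1
    · rw [indicator_of_mem hz]
      refine le_trans ?_ le_add_self
      calc _ ≤ 1 * (ENNReal.ofReal |z - c|) ^ (-θ) := by
            gcongr
            rw [ENNReal.ofReal_le_one]
            apply inv_le_one_of_one_le₀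
            apply one_le_pow₀; linarith [abs_nonneg z]
        _ = _ := one_mul _
    · rw [indicator_of_notMem hz, add_zero]
      have : 1 ≤ ENNReal.ofReal |z - c| := by
        rw [ENNReal.one_le_ofReal]
        by_contra hh
        push Not at hh
        exact hz ⟨(abs_lt.1 hh).1.le, (abs_lt.1 hh).2.le⟩
      calc _ ≤ ENNReal.ofReal (((1 + |z|) ^ 2)⁻¹) * 1 := by
            gcongr
            rw [ENNReal.rpow_neg]
            exact ENNReal.inv_le_one.2 (ENNReal.one_le_rpow this hθ)
        _ = _ := mul_one _
  calc _ ≤ _ := lintegral_mono hpt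
    _ = (∫⁻ z : ℝ, ENNReal.ofReal (((1 + |z|) ^ 2)⁻¹)) +
        ∫⁻ z : ℝ, indicator (Icc (-1:ℝ) 1) (fun w => (ENNReal.ofReal |w|) ^ (-θ)) (z - c) := by
        apply lintegral_add_left; fun_prop
    _ = (∫⁻ z : ℝ, ENNReal.ofReal (((1 + |z|) ^ 2)⁻¹)) +
        ∫⁻ z : ℝ, indicator (Icc (-1:ℝ) 1) (fun w => (ENNReal.ofReal |w|) ^ (-θ)) z := by
        congr 1
        exact lintegral_sub_right_eq_self (fun z => indicator (Icc (-1:ℝ) 1) (fun w => (ENNReal.ofReal |w|) ^ (-θ)) z) c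
    _ ≤ _ := by
        rw [lintegral_indicator measurableSet_Icc, ENNReal.ofReal_add hC1.le hC2.le]
        exact add_le_add h1 h2

lemma lint_KB {a b γ : ℝ} (hγ : 0 < γ) (hγ4 : γ < 1 / 4) : ∃ C : ℝ, 0 < C ∧
    ∀ x1 x2, ∫⁻ x3, KB a b γ x1 x2 x3 ≤ ENNReal.ofReal C := by
  obtain ⟨C1, hC1, h1⟩ := lint_Wk (θ := 1 - 2 * γ) (by linarith) (by linarith)
  obtain ⟨C2, hC2, h2⟩ := lint_Wk (θ := 1 / 2) (by norm_num) (by norm_num)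
  refine ⟨C1 + C1 + C2 + C2 + C2 + C2, by positivity, fun x1 x2 => ?_⟩
  unfold KB
  have m1 : ∀ θ c, Measurable fun x3 => Wk θ (x3 + (x1 + x2) / 2) c := fun θ c =>
    (measurable_Wk θ c).comp (by fun_prop)
  have m2 : ∀ θ c, Measurable fun x3 => Wk θ (-(x1 + x2) - x3) c := fun θ c =>
    (measurable_Wk θ c).comp (by fun_prop)
  have m3 := measurable_Wk
  rw [lintegral_add_right _ (m2 _ _), lintegral_add_right _ (m2 _ _), lintegral_add_right _ (m3 _ _),
    lintegral_add_right _ (m3 _ _), lintegral_add_right _ (m1 _ _)]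
  have e1 : ∀ θ c, ∫⁻ x3, Wk θ (x3 + (x1 + x2) / 2) c = ∫⁻ z, Wk θ z c := fun θ c =>
    lintegral_add_right_eq_self (fun z => Wk θ z c) _
  have e2 : ∀ θ c, ∫⁻ x3, Wk θ (-(x1 + x2) - x3) c = ∫⁻ z, Wk θ z c := fun θ c =>
    lintegral_sub_left_eq_self (fun z => Wk θ z c) _
  simp only [e1, e2]
  rw [ENNReal.ofReal_add (by positivity) hC2.le, ENNReal.ofReal_add (by positivity) hC2.le,
    ENNReal.ofReal_add (by positivity) hC2.le, ENNReal.ofReal_add (by positivity) hC2.le,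
    ENNReal.ofReal_add hC1.le hC1.le]
  gcongr <;> first | exact h1 _ | exact h2 _

lemma lint_KA {C κ Y x1 : ℝ} (hC : 0 < C) (hκ : 0 < κ) (hY : 0 ≤ Y) :
    ∫⁻ x2, KA C κ (x1 + x2) Y ≤ ENNReal.ofReal ((2 + 2 * C) * (Real.sqrt κ)⁻¹) := by
  rw [lintegral_add_left_eq_self (fun p => KA C κ p Y) x1]
  have ms : ∀ Z, {p : ℝ | |p| ≤ Z} = Icc (-Z) Z := fun Z => by ext; simp [abs_le]
  unfold KA
  have hsk : 0 < Real.sqrt κ := Real.sqrt_pos.2 hκ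
  rw [ms, ms, lintegral_add_left (measurable_const.indicator measurableSet_Icc),
    lintegral_indicator measurableSet_Icc, lintegral_indicator measurableSet_Icc,
    setLIntegral_const, setLIntegral_const, Real.volume_Icc, Real.volume_Icc,
    ← ENNReal.ofReal_mul (by positivity), ← ENNReal.ofReal_mul (by positivity),
    ← ENNReal.ofReal_add]
  · apply ENNReal.ofReal_le_ofReal
    rw [add_mul]
    apply add_le_add
    · have : κ⁻¹ = (Real.sqrt κ)⁻¹ * (Real.sqrt κ)⁻¹ := by rw [← mul_inv, Real.mul_self_sqrt hκ.le]
      rw [this]; apply le_of_eq; field_simp; ring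
    · rcases hY.eq_or_lt with h | h
      · rw [← h]; simp; positivity
      · apply le_of_eq; field_simp; ring
  · apply mul_nonneg (by positivity); linarith
  · apply mul_nonneg (by positivity); linarith

end PAn

namespace PAn
set_option linter.unusedVariables false

/-! quadrilinear integrals -/

noncomputable def I4 (Ψ : ℝ → ℝ → ℝ → ℝ → ℝ≥0∞) : ℝ≥0∞ :=
  ∫⁻ w : ℝ × ℝ × ℝ, Ψ w.1 w.2.1 w.2.2 (-w.1 - w.2.1 - w.2.2)

def M4able {β : Type*} [MeasurableSpace β] (Ψ : ℝ → ℝ → ℝ → ℝ → β) : Prop :=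
  Measurable fun p : ℝ × ℝ × ℝ × ℝ => Ψ p.1 p.2.1 p.2.2.1 p.2.2.2

lemma M4able.comp {β : Type*} [MeasurableSpace β] {Ψ : ℝ → ℝ → ℝ → ℝ → β} (h : M4able Ψ)
    {α : Type*} [MeasurableSpace α] {f1 f2 f3 f4 : α → ℝ} (h1 : Measurable f1) (h2 : Measurable f2)
    (h3 : Measurable f3) (h4 : Measurable f4) :
    Measurable fun a => Ψ (f1 a) (f2 a) (f3 a) (f4 a) :=
  Measurable.comp (g := fun p : ℝ × ℝ × ℝ × ℝ => Ψ p.1 p.2.1 p.2.2.1 p.2.2.2) h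
    (h1.prodMk (h2.prodMk (h3.prodMk h4)))

lemma mp_sub2 (c : ℝ) : MeasurePreserving (fun p : ℝ × ℝ => (p.1, c - p.1 - p.2)) := by
  apply MeasurePreserving.skew_product (f := id) (g := fun x2 x3 => c - x2 - x3)
    (MeasurePreserving.id _) (by fun_prop)
  exact Eventually.of_forall fun x => (Measure.measurePreserving_sub_left volume (c - x)).map_eq

lemma mp34 : MeasurePreserving (fun w : ℝ × ℝ × ℝ => (w.1, w.2.1, -w.1 - w.2.1 - w.2.2)) := by
  apply MeasurePreserving.skew_product (f := id) (g := fun (x1 : ℝ) (p : ℝ × ℝ) => (p.1, -x1 - p.1 - p.2))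
    (MeasurePreserving.id _) (by fun_prop)
  exact Eventually.of_forall fun x => (mp_sub2 (-x)).map_eq

lemma mp23 : MeasurePreserving (fun w : ℝ × ℝ × ℝ => (w.1, w.2.2, w.2.1)) := by
  exact MeasurePreserving.prod (MeasurePreserving.id _) Measure.measurePreserving_swap

lemma mp12 : MeasurePreserving (fun w : ℝ × ℝ × ℝ => (w.2.1, w.1, w.2.2)) := by
  have h1 : MeasurePreserving (MeasurableEquiv.prodAssoc : (ℝ × ℝ) × ℝ ≃ᵐ _) :=
    volume_preserving_prodAssoc
  have h2 := h1.symm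
  have h3 : MeasurePreserving (fun p : (ℝ × ℝ) × ℝ => (p.1.swap, p.2)) :=
    MeasurePreserving.prod Measure.measurePreserving_swap (MeasurePreserving.id _)
  exact h1.comp (h3.comp h2)

lemma I4_34 {Ψ : ℝ → ℝ → ℝ → ℝ → ℝ≥0∞} (h : M4able Ψ) :
    I4 (fun x1 x2 x3 x4 => Ψ x1 x2 x4 x3) = I4 Ψ := by
  unfold I4
  rw [← mp34.lintegral_comp (f := fun w : ℝ × ℝ × ℝ => Ψ w.1 w.2.1 w.2.2 (-w.1 - w.2.1 - w.2.2))]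
  · simp
  · apply h.comp <;> fun_prop

lemma I4_23 {Ψ : ℝ → ℝ → ℝ → ℝ → ℝ≥0∞} (h : M4able Ψ) :
    I4 (fun x1 x2 x3 x4 => Ψ x1 x3 x2 x4) = I4 Ψ := by
  unfold I4
  rw [← mp23.lintegral_comp (f := fun w : ℝ × ℝ × ℝ => Ψ w.1 w.2.1 w.2.2 (-w.1 - w.2.1 - w.2.2))]
  · congr 1; ext w; simp only; congr 1; ring
  · apply h.comp <;> fun_prop

lemma I4_12 {Ψ : ℝ → ℝ → ℝ → ℝ → ℝ≥0∞} (h : M4able Ψ) :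
    I4 (fun x1 x2 x3 x4 => Ψ x2 x1 x3 x4) = I4 Ψ := by
  unfold I4
  rw [← mp12.lintegral_comp (f := fun w : ℝ × ℝ × ℝ => Ψ w.1 w.2.1 w.2.2 (-w.1 - w.2.1 - w.2.2))]
  · congr 1; ext w; simp only; congr 1; ring
  · apply h.comp <;> fun_prop

lemma I4_3412 {Ψ : ℝ → ℝ → ℝ → ℝ → ℝ≥0∞} (h : M4able Ψ) :
    I4 (fun x1 x2 x3 x4 => Ψ x3 x4 x1 x2) = I4 Ψ := by
  have h1 : M4able (fun x1 x2 x3 x4 => Ψ x1 x3 x2 x4) := by unfold M4able; apply h.comp <;> fun_prop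
  have h2 : M4able (fun x1 x2 x3 x4 => Ψ x2 x3 x1 x4) := by unfold M4able; apply h.comp <;> fun_prop
  have h3 : M4able (fun x1 x2 x3 x4 => Ψ x2 x4 x1 x3) := by unfold M4able; apply h.comp <;> fun_prop
  rw [← I4_23 h, ← I4_12 h1, ← I4_34 h2, ← I4_23 h3]

/-- `L²` norm squared and norm in `ℝ≥0∞` -/
noncomputable def L2 (F : ℝ → ℝ≥0∞) : ℝ≥0∞ := (∫⁻ x, F x ^ 2) ^ (1 / 2 : ℝ)

lemma L2_sq (F : ℝ → ℝ≥0∞) : L2 F ^ 2 = ∫⁻ x, F x ^ 2 := by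
  unfold L2
  rw [← ENNReal.rpow_natCast, ← ENNReal.rpow_mul]; norm_num

lemma wCS {α : Type*} [MeasurableSpace α] {μ : Measure α} {k f g : α → ℝ≥0∞} (hk : Measurable k)
    (hf : Measurable f) (hg : Measurable g) :
    ∫⁻ a, k a * (f a * g a) ∂μ ≤
      (∫⁻ a, k a * f a ^ 2 ∂μ) ^ (1 / 2 : ℝ) * (∫⁻ a, k a * g a ^ 2 ∂μ) ^ (1 / 2 : ℝ) := by
  have := ENNReal.lintegral_mul_le_Lp_mul_Lq (μ.withDensity k) Real.HolderConjugate.two_two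
    hf.aemeasurable hg.aemeasurable
  rw [lintegral_withDensity_eq_lintegral_mul _ hk (hf.mul hg),
    lintegral_withDensity_eq_lintegral_mul _ hk (by fun_prop),
    lintegral_withDensity_eq_lintegral_mul _ hk (by fun_prop)] at this
  simpa using this

lemma I4_sq_le {k : ℝ → ℝ → ℝ → ℝ → ℝ≥0∞} (hk : M4able k) {F1 F2 : ℝ → ℝ≥0∞} (h1 : Measurable F1)
    (h2 : Measurable F2) {D : ℝ≥0∞} (hD : ∀ x1 x2, ∫⁻ x3, k x1 x2 x3 (-x1 - x2 - x3) ≤ D) :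
    I4 (fun x1 x2 x3 x4 => k x1 x2 x3 x4 * (F1 x1 * F2 x2) ^ 2) ≤ D * (L2 F1 ^ 2 * L2 F2 ^ 2) := by
  unfold I4
  have hk' : Measurable fun w : ℝ × ℝ × ℝ => k w.1 w.2.1 w.2.2 (-w.1 - w.2.1 - w.2.2) := by
    apply hk.comp <;> fun_prop
  have hm : Measurable fun w : ℝ × ℝ × ℝ => k w.1 w.2.1 w.2.2 (-w.1 - w.2.1 - w.2.2) *
      (F1 w.1 * F2 w.2.1) ^ 2 := hk'.mul (by fun_prop)
  rw [Measure.volume_eq_prod, lintegral_prod _ hm.aemeasurable]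
  have e : ∀ x1, ∫⁻ p : ℝ × ℝ, k x1 p.1 p.2 (-x1 - p.1 - p.2) * (F1 x1 * F2 p.1) ^ 2 ≤
      F1 x1 ^ 2 * (D * L2 F2 ^ 2) := by
    intro x1
    have hm' : Measurable fun p : ℝ × ℝ => k x1 p.1 p.2 (-x1 - p.1 - p.2) * (F1 x1 * F2 p.1) ^ 2 := by
      have : Measurable fun p : ℝ × ℝ => k x1 p.1 p.2 (-x1 - p.1 - p.2) := by
        apply hk.comp <;> fun_prop
      exact this.mul (by fun_prop)
    rw [Measure.volume_eq_prod, lintegral_prod _ hm'.aemeasurable]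
    calc _ ≤ ∫⁻ x2, (F1 x1 ^ 2 * D) * F2 x2 ^ 2 := by
          apply lintegral_mono
          intro x2
          simp only
          rw [lintegral_mul_const _ (by apply hk.comp <;> fun_prop)]
          calc _ ≤ D * (F1 x1 * F2 x2) ^ 2 := by gcongr; exact hD _ _
            _ = _ := by ring
      _ = _ := by rw [lintegral_const_mul _ (by fun_prop), L2_sq, mul_assoc]
  calc _ ≤ ∫⁻ x1, F1 x1 ^ 2 * (D * L2 F2 ^ 2) := lintegral_mono e
    _ = _ := by rw [lintegral_mul_const _ (by fun_prop), L2_sq, L2_sq]; ring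

lemma schur12 {k : ℝ → ℝ → ℝ → ℝ → ℝ≥0∞} (hk : M4able k) {F1 F2 F3 F4 : ℝ → ℝ≥0∞}
    (h1 : Measurable F1) (h2 : Measurable F2) (h3 : Measurable F3) (h4 : Measurable F4) {D : ℝ≥0∞}
    (hD : ∀ x1 x2, ∫⁻ x3, k x1 x2 x3 (-x1 - x2 - x3) ≤ D)
    (hD' : ∀ x3 x4, ∫⁻ x1, k x1 (-x3 - x4 - x1) x3 x4 ≤ D) :
    I4 (fun x1 x2 x3 x4 => k x1 x2 x3 x4 * (F1 x1 * F2 x2 * F3 x3 * F4 x4)) ≤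
      D * (L2 F1 * L2 F2 * L2 F3 * L2 F4) := by
  have hk' : Measurable fun w : ℝ × ℝ × ℝ => k w.1 w.2.1 w.2.2 (-w.1 - w.2.1 - w.2.2) := by
    apply hk.comp <;> fun_prop
  have c := wCS (μ := volume) hk' (f := fun w : ℝ × ℝ × ℝ => F1 w.1 * F2 w.2.1)
    (g := fun w : ℝ × ℝ × ℝ => F3 w.2.2 * F4 (-w.1 - w.2.1 - w.2.2)) (by fun_prop) (by fun_prop)
  have a1 := I4_sq_le hk h1 h2 hD
  have hkp : M4able (fun x1 x2 x3 x4 => k x3 x4 x1 x2) := by unfold M4able; apply hk.comp <;> fun_prop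
  have a2 := I4_sq_le hkp h3 h4 (D := D) (by
    intro x1 x2
    exact hD' x1 x2)
  have hm : M4able (fun x1 x2 x3 x4 => k x3 x4 x1 x2 * (F3 x1 * F4 x2) ^ 2) := by
    have : Measurable fun p : ℝ × ℝ × ℝ × ℝ => k p.2.2.1 p.2.2.2 p.1 p.2.1 := hkp
    exact this.mul (by fun_prop)
  rw [← I4_3412 hm] at a2
  unfold I4 at a1 a2 ⊢
  calc _ = _ := by
        congr 1; ext w
        show k w.1 w.2.1 w.2.2 (-w.1 - w.2.1 - w.2.2) * (F1 w.1 * F2 w.2.1 * F3 w.2.2 * F4 (-w.1 - w.2.1 - w.2.2))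
         = k w.1 w.2.1 w.2.2 (-w.1 - w.2.1 - w.2.2) * ((F1 w.1 * F2 w.2.1) * (F3 w.2.2 * F4 (-w.1 - w.2.1 - w.2.2)))
        ring
    _ ≤ _ := c
    _ ≤ (D * (L2 F1 ^ 2 * L2 F2 ^ 2)) ^ (1 / 2 : ℝ) * (D * (L2 F3 ^ 2 * L2 F4 ^ 2)) ^ (1 / 2 : ℝ) := by
        gcongr
    _ = ((D * (L2 F1 * L2 F2 * L2 F3 * L2 F4)) ^ 2) ^ (1 / 2 : ℝ) := by
        rw [← ENNReal.mul_rpow_of_nonneg _ _ (by norm_num)]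
        congr 1; ring
    _ = _ := by
        rw [← ENNReal.rpow_natCast, ← ENNReal.rpow_mul]; norm_num

end PAn

namespace PAn
set_option linter.unusedVariables false

/-- hypotheses on the kernel, relative to a phase -/
structure KHyp (κ : ℝ) (Φ k : ℝ → ℝ → ℝ → ℝ → ℝ) : Prop where
  meas : M4able k
  nonneg : ∀ x1 x2 x3 x4, 0 ≤ k x1 x2 x3 x4
  triv : ∀ x1 x2 x3 x4, x1 + x2 + x3 + x4 = 0 → κ * k x1 x2 x3 x4 ≤ 1
  main : ∀ x1 x2 x3 x4, x1 + x2 + x3 + x4 = 0 → ∀ r, 0 ≤ r → Tri r x1 x2 x3 x4 →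
    k x1 x2 x3 x4 * (1 + r) ^ 3 * (κ + |Φ x1 x2 x3 x4|) ≤ 2 * (|x1| + |x2| + |x3| + |x4|)

lemma phase_eq (a b x1 x2 x3 x4 : ℝ) (hs : x1 + x2 + x3 + x4 = 0) :
    |a * (x1 ^ 3 + x2 ^ 3) + b * (x3 ^ 3 + x4 ^ 3)| = |x1 + x2| * |Rf a b x1 x2 x3 x4| := by
  rw [← abs_mul]
  congr 1
  have : x4 = -(x1 + x2 + x3) := by linarith
  rw [this]; unfold Rf; ring

lemma Tri_zero (x1 x2 x3 x4 : ℝ) : Tri 0 x1 x2 x3 x4 := Or.inl ⟨abs_nonneg _, abs_nonneg _, abs_nonneg _⟩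

lemma Tri_swap {r x1 x2 x3 x4 : ℝ} (h : Tri r x3 x4 x1 x2) : Tri r x1 x2 x3 x4 := by
  unfold Tri at *; tauto

lemma RA_swap {ρ c1 κ a b x1 x2 x3 x4 : ℝ} (hs : x1 + x2 + x3 + x4 = 0)
    (h : RA ρ c1 κ b a x3 x4 x1 x2) : RA ρ c1 κ a b x1 x2 x3 x4 := by
  unfold RA at *
  have e1 : |x3 + x4| = |x1 + x2| := by rw [show x3 + x4 = -(x1 + x2) by linarith, abs_neg]
  have e2 : |Rf b a x3 x4 x1 x2| = |Rf a b x1 x2 x3 x4| := by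
    rw [← abs_neg]; congr 1; unfold Rf; ring
  have e3 : |x3| + |x4| + |x1| + |x2| = |x1| + |x2| + |x3| + |x4| := by ring
  rwa [e1, e2, e3] at h

lemma measurable_RA (ρ c1 κ a b : ℝ) :
    MeasurableSet {p : ℝ × ℝ × ℝ × ℝ | RA ρ c1 κ a b p.1 p.2.1 p.2.2.1 p.2.2.2} := by
  unfold RA Rf
  simp only [ofPred_or, ofPred_and]
  apply MeasurableSet.union
  · apply measurableSet_le <;> fun_prop
  · apply MeasurableSet.inter
    · apply measurableSet_le <;> fun_prop
    · apply measurableSet_le <;> fun_prop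

open Classical in
theorem T4core {a b γ : ℝ} (ha : a ≠ 0) (hb : b ≠ 0) (hγ : 0 < γ) (hγ4 : γ < 1 / 4) :
    ∃ C : ℝ, 0 < C ∧ ∀ κ : ℝ, 0 < κ → κ ≤ 1 → ∀ k : ℝ → ℝ → ℝ → ℝ → ℝ,
      KHyp κ (fun x1 x2 x3 x4 => a * (x1 ^ 3 + x2 ^ 3) + b * (x3 ^ 3 + x4 ^ 3)) k →
      ∀ F1 F2 F3 F4 : ℝ → ℝ≥0∞, Measurable F1 → Measurable F2 → Measurable F3 → Measurable F4 →
      I4 (fun x1 x2 x3 x4 => ENNReal.ofReal (k x1 x2 x3 x4) * (F1 x1 * F2 x2 * F3 x3 * F4 x4)) ≤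
        ENNReal.ofReal (C * κ ^ (-(1 / 2 + γ))) * (L2 F1 * L2 F2 * L2 F3 * L2 F4) := by
  have hpa : 0 < |a| := abs_pos.2 ha
  have hpb : 0 < |b| := abs_pos.2 hb
  obtain ⟨μ, hμd⟩ : ∃ μ, μ = min |a| |b| := ⟨_, rfl⟩
  obtain ⟨A, hAd⟩ : ∃ A, A = max |a| |b| := ⟨_, rfl⟩
  have hμ : 0 < μ := by rw [hμd]; exact lt_min hpa hpb
  have hAp : 0 < A := by rw [hAd]; exact lt_max_of_lt_left hpa
  have hμA : μ ≤ A := by rw [hμd, hAd]; exact min_le_max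
  have hma : μ ≤ |a| := by rw [hμd]; exact min_le_left _ _
  have hmb : μ ≤ |b| := by rw [hμd]; exact min_le_right _ _
  have hma' : |a| ≤ A := by rw [hAd]; exact le_max_left _ _
  have hmb' : |b| ≤ A := by rw [hAd]; exact le_max_right _ _
  obtain ⟨ρ, hρd⟩ : ∃ ρ, ρ = Real.sqrt (μ / A) := ⟨_, rfl⟩
  have hρ : 0 < ρ := by rw [hρd]; exact Real.sqrt_pos.2 (by positivity)
  have hρ1 : ρ ≤ 1 := by
    rw [hρd]; apply Real.sqrt_le_one.2; rw [div_le_one hAp]; exact hμA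
  have hA : A * ρ ^ 2 = μ := by rw [hρd, Real.sq_sqrt (by positivity)]; field_simp
  obtain ⟨B1, hB1, pB1⟩ := pointB ha hb hγ hγ4 hρ hρ1 hμ hma hma' hmb hmb' hA
  obtain ⟨B2, hB2, pB2⟩ := pointB hb ha hγ hγ4 hρ hρ1 hμ hmb hmb' hma hma' hA
  obtain ⟨A1, hA1, pA⟩ := pointA (a := a) (b := b) (c1 := μ / 16) (by positivity) hρ hρ1
  obtain ⟨D1, hD1, lB1⟩ := lint_KB (a := a) (b := b) hγ hγ4
  obtain ⟨D2, hD2, lB2⟩ := lint_KB (a := b) (b := a) hγ hγ4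
  refine ⟨(2 + 2 * A1) + (B1 * D1 + B2 * D2), by positivity, ?_⟩
  intro κ hκ hκ1 k hk F1 F2 F3 F4 h1 h2 h3 h4
  have hκp : 0 < κ ^ (-(1 / 2 + γ)) := Real.rpow_pos_of_pos hκ _
  set k1 : ℝ → ℝ → ℝ → ℝ → ℝ≥0∞ := fun x1 x2 x3 x4 =>
    if RA ρ (μ / 16) κ a b x1 x2 x3 x4 then ENNReal.ofReal (k x1 x2 x3 x4) else 0 with hk1
  set k2 : ℝ → ℝ → ℝ → ℝ → ℝ≥0∞ := fun x1 x2 x3 x4 =>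
    if RA ρ (μ / 16) κ a b x1 x2 x3 x4 then 0 else ENNReal.ofReal (k x1 x2 x3 x4) with hk2
  have hkm : Measurable fun p : ℝ × ℝ × ℝ × ℝ => ENNReal.ofReal (k p.1 p.2.1 p.2.2.1 p.2.2.2) :=
    hk.meas.ennreal_ofReal
  have m1 : M4able k1 := Measurable.ite (measurable_RA _ _ _ _ _) hkm measurable_const
  have m2 : M4able k2 := Measurable.ite (measurable_RA _ _ _ _ _) measurable_const hkm
  have hphase : ∀ x1 x2 x3 x4, x1 + x2 + x3 + x4 = 0 → ∀ r, 0 ≤ r → Tri r x1 x2 x3 x4 →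
      k x1 x2 x3 x4 * (1 + r) ^ 3 * (κ + |x1 + x2| * |Rf a b x1 x2 x3 x4|)
        ≤ 2 * (|x1| + |x2| + |x3| + |x4|) := by
    intro x1 x2 x3 x4 hs r hr ht
    have := hk.main x1 x2 x3 x4 hs r hr ht
    rwa [phase_eq _ _ _ _ _ _ hs] at this
  -- region A
  have rA : I4 (fun x1 x2 x3 x4 => k1 x1 x2 x3 x4 * (F1 x1 * F2 x2 * F3 x3 * F4 x4)) ≤
      ENNReal.ofReal ((2 + 2 * A1) * κ ^ (-(1 / 2 + γ))) * (L2 F1 * L2 F2 * L2 F3 * L2 F4) := by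
    have hle : (2 + 2 * A1) * (Real.sqrt κ)⁻¹ ≤ (2 + 2 * A1) * κ ^ (-(1 / 2 + γ)) := by
      have : (Real.sqrt κ)⁻¹ = κ ^ (-(1 / 2 : ℝ)) := by rw [Real.rpow_neg hκ.le, Real.sqrt_eq_rpow]
      rw [this]
      gcongr 1
      exact Real.rpow_le_rpow_of_exponent_ge hκ hκ1 (by linarith)
    have pk : ∀ x1 x2 x3 x4, x1 + x2 + x3 + x4 = 0 →
        k1 x1 x2 x3 x4 ≤ KA A1 κ (x1 + x2) (|x1| + |x3|) ∧
        k1 x1 x2 x3 x4 ≤ KA A1 κ (x1 + x2) (|x2| + |x4|) := by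
      intro x1 x2 x3 x4 hs
      simp only [hk1]
      split_ifs with hR
      · refine pA _ κ x1 x2 x3 x4 (hk.nonneg _ _ _ _) hκ hs (hk.triv _ _ _ _ hs) ?_ hR
        simpa using hphase x1 x2 x3 x4 hs 0 le_rfl (Tri_zero _ _ _ _)
      · simp
    have m1' : M4able (fun x1 x2 x3 x4 => k1 x1 x3 x2 x4) := by
      unfold M4able; apply m1.comp <;> fun_prop
    have := schur12 m1' h1 h3 h2 h4 (D := ENNReal.ofReal ((2 + 2 * A1) * κ ^ (-(1 / 2 + γ))))
      (by
        intro x1 x3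
        refine le_trans (lintegral_mono fun x2 => ?_) ((lint_KA hA1 hκ (by positivity : 0 ≤ |x1| + |x3|)
          (x1 := x1)).trans (ENNReal.ofReal_le_ofReal hle))
        exact (pk x1 x2 x3 _ (by ring)).1)
      (by
        intro x2 x4
        refine le_trans (lintegral_mono fun x1 => ?_) ((lint_KA hA1 hκ (by positivity : 0 ≤ |x2| + |x4|)
          (x1 := x2)).trans (ENNReal.ofReal_le_ofReal hle))
        rw [add_comm x2 x1]
        exact (pk x1 x2 _ x4 (by ring)).2)
    have hm : M4able (fun x1 x2 x3 x4 => k1 x1 x2 x3 x4 * (F1 x1 * F2 x2 * F3 x3 * F4 x4)) :=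
      Measurable.mul m1 (by fun_prop)
    rw [← I4_23 hm]
    calc _ = I4 (fun x1 x2 x3 x4 => k1 x1 x3 x2 x4 * (F1 x1 * F3 x2 * F2 x3 * F4 x4)) := by
          congr 1; ext x1 x2 x3 x4; ring
      _ ≤ _ := this
      _ = _ := by ring
  -- region B
  have rB : I4 (fun x1 x2 x3 x4 => k2 x1 x2 x3 x4 * (F1 x1 * F2 x2 * F3 x3 * F4 x4)) ≤
      ENNReal.ofReal ((B1 * D1 + B2 * D2) * κ ^ (-(1 / 2 + γ))) * (L2 F1 * L2 F2 * L2 F3 * L2 F4) := by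
    apply schur12 m2 h1 h2 h3 h4
    · intro x1 x2
      calc _ ≤ ∫⁻ x3, ENNReal.ofReal (B1 * κ ^ (-(1 / 2 + γ))) * KB a b γ x1 x2 x3 := by
            apply lintegral_mono
            intro x3
            simp only [hk2]
            split_ifs with hR
            · simp
            · exact pB1 _ κ x1 x2 x3 _ (hk.nonneg _ _ _ _) hκ hκ1 (by ring)
                (hphase _ _ _ _ (by ring)) hR
        _ ≤ ENNReal.ofReal (B1 * κ ^ (-(1 / 2 + γ))) * ENNReal.ofReal D1 := by
            rw [lintegral_const_mul' _ _ ENNReal.ofReal_ne_top]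
            gcongr; exact lB1 _ _
        _ ≤ _ := by
            rw [← ENNReal.ofReal_mul (by positivity)]
            apply ENNReal.ofReal_le_ofReal
            have : 0 < B2 * D2 * κ ^ (-(1 / 2 + γ)) := by positivity
            nlinarith
    · intro x3 x4
      calc _ ≤ ∫⁻ x1, ENNReal.ofReal (B2 * κ ^ (-(1 / 2 + γ))) * KB b a γ x3 x4 x1 := by
            apply lintegral_mono
            intro x1
            simp only [hk2]
            split_ifs with hR
            · simp
            · refine pB2 _ κ x3 x4 x1 (-x3 - x4 - x1) (hk.nonneg _ _ _ _) hκ hκ1 (by ring) ?_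
                (fun h => hR (RA_swap (by ring) h))
              intro r hr ht
              have := hphase x1 (-x3 - x4 - x1) x3 x4 (by ring) r hr (Tri_swap ht)
              have e1 : |x3 + x4| = |x1 + (-x3 - x4 - x1)| := by
                rw [← abs_neg]; congr 1; ring
              have e2 : |Rf b a x3 x4 x1 (-x3 - x4 - x1)| = |Rf a b x1 (-x3 - x4 - x1) x3 x4| := by
                rw [← abs_neg]; congr 1; unfold Rf; ring
              rw [e1, e2]
              linarith
        _ ≤ ENNReal.ofReal (B2 * κ ^ (-(1 / 2 + γ))) * ENNReal.ofReal D2 := by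
            rw [lintegral_const_mul' _ _ ENNReal.ofReal_ne_top]
            gcongr; exact lB2 _ _
        _ ≤ _ := by
            rw [← ENNReal.ofReal_mul (by positivity)]
            apply ENNReal.ofReal_le_ofReal
            have : 0 < B1 * D1 * κ ^ (-(1 / 2 + γ)) := by positivity
            nlinarith
  have hsum : I4 (fun x1 x2 x3 x4 => ENNReal.ofReal (k x1 x2 x3 x4) * (F1 x1 * F2 x2 * F3 x3 * F4 x4)) =
      I4 (fun x1 x2 x3 x4 => k1 x1 x2 x3 x4 * (F1 x1 * F2 x2 * F3 x3 * F4 x4)) +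
      I4 (fun x1 x2 x3 x4 => k2 x1 x2 x3 x4 * (F1 x1 * F2 x2 * F3 x3 * F4 x4)) := by
    unfold I4
    rw [← lintegral_add_left]
    · congr 1; ext w
      simp only [hk1, hk2]
      split_ifs <;> simp
    · apply Measurable.mul
      · apply m1.comp <;> fun_prop
      · fun_prop
  rw [hsum, add_mul ((2 : ℝ) + 2 * A1), ENNReal.ofReal_add (by positivity) (by positivity), add_mul]
  exact add_le_add rA rB

lemma Tri_23 {r x1 x2 x3 x4 : ℝ} (h : Tri r x1 x3 x2 x4) : Tri r x1 x2 x3 x4 := by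
  unfold Tri at *; tauto

lemma Tri_24 {r x1 x2 x3 x4 : ℝ} (h : Tri r x1 x4 x3 x2) : Tri r x1 x2 x3 x4 := by
  unfold Tri at *; tauto

lemma I4_1432 {Ψ : ℝ → ℝ → ℝ → ℝ → ℝ≥0∞} (h : M4able Ψ) :
    I4 (fun x1 x2 x3 x4 => Ψ x1 x4 x3 x2) = I4 Ψ := by
  have h1 : M4able (fun x1 x2 x3 x4 => Ψ x1 x2 x4 x3) := by unfold M4able; apply h.comp <;> fun_prop
  have h2 : M4able (fun x1 x2 x3 x4 => Ψ x1 x3 x4 x2) := by unfold M4able; apply h.comp <;> fun_prop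
  rw [← I4_34 h, ← I4_23 h1, ← I4_34 h2]

/-- The quadrilinear estimate for all paired phases. -/
theorem T4 {α : Fin 2 → ℝ} (hα : ∀ i, α i ≠ 0) {γ : ℝ} (hγ : 0 < γ) (hγ4 : γ < 1 / 4) :
    ∃ C : ℝ, 0 < C ∧ ∀ κ : ℝ, 0 < κ → κ ≤ 1 → ∀ i1 i2 i3 i4 : Fin 2, i1 + i2 + i3 + i4 = 0 →
      ∀ k : ℝ → ℝ → ℝ → ℝ → ℝ,
      KHyp κ (fun x1 x2 x3 x4 => α i1 * x1 ^ 3 + α i2 * x2 ^ 3 + α i3 * x3 ^ 3 + α i4 * x4 ^ 3) k →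
      ∀ F1 F2 F3 F4 : ℝ → ℝ≥0∞, Measurable F1 → Measurable F2 → Measurable F3 → Measurable F4 →
      I4 (fun x1 x2 x3 x4 => ENNReal.ofReal (k x1 x2 x3 x4) * (F1 x1 * F2 x2 * F3 x3 * F4 x4)) ≤
        ENNReal.ofReal (C * κ ^ (-(1 / 2 + γ))) * (L2 F1 * L2 F2 * L2 F3 * L2 F4) := by
  choose Cf hC hf using fun p : Fin 2 × Fin 2 => T4core (hα p.1) (hα p.2) hγ hγ4
  refine ⟨∑ p, Cf p, Finset.sum_pos (fun p _ => hC p) Finset.univ_nonempty, ?_⟩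
  intro κ hκ hκ1 i1 i2 i3 i4 hi k hk F1 F2 F3 F4 h1 h2 h3 h4
  have hκp : 0 < κ ^ (-(1 / 2 + γ)) := Real.rpow_pos_of_pos hκ _
  have hle : ∀ p, ENNReal.ofReal (Cf p * κ ^ (-(1 / 2 + γ))) ≤
      ENNReal.ofReal ((∑ p, Cf p) * κ ^ (-(1 / 2 + γ))) := by
    intro p
    apply ENNReal.ofReal_le_ofReal
    gcongr
    exact Finset.single_le_sum (fun p _ => (hC p).le) (Finset.mem_univ p)
  have hmk : M4able (fun x1 x2 x3 x4 => ENNReal.ofReal (k x1 x2 x3 x4) * (F1 x1 * F2 x2 * F3 x3 * F4 x4)) :=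
    Measurable.mul hk.meas.ennreal_ofReal (by fun_prop)
  have hcase0 : ∀ i1 i2 i3 i4 : Fin 2, i1 + i2 + i3 + i4 = 0 →
      (i1 = i2 ∧ i3 = i4) ∨ (i1 = i3 ∧ i2 = i4) ∨ (i1 = i4 ∧ i3 = i2) := by decide
  have hcase := hcase0 i1 i2 i3 i4 hi
  rcases hcase with ⟨e1, e2⟩ | ⟨e1, e2⟩ | ⟨e1, e2⟩
  · subst e1 e2
    refine (hf (i1, i3) κ hκ hκ1 k ?_ F1 F2 F3 F4 h1 h2 h3 h4).trans ?_
    · have e : (fun x1 x2 x3 x4 : ℝ => α i1 * (x1 ^ 3 + x2 ^ 3) + α i3 * (x3 ^ 3 + x4 ^ 3)) =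
          fun x1 x2 x3 x4 => α i1 * x1 ^ 3 + α i1 * x2 ^ 3 + α i3 * x3 ^ 3 + α i3 * x4 ^ 3 := by
        funext x1 x2 x3 x4; ring
      simpa only [e] using hk
    · exact mul_le_mul' (hle _) le_rfl
  · subst e1 e2
    rw [← I4_23 hmk]
    have := hf (i1, i2) κ hκ hκ1 (fun x1 x2 x3 x4 => k x1 x3 x2 x4) ?_ F1 F3 F2 F4 h1 h3 h2 h4
    · calc _ = I4 (fun x1 x2 x3 x4 => ENNReal.ofReal (k x1 x3 x2 x4) * (F1 x1 * F3 x2 * F2 x3 * F4 x4)) := by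
            congr 1; ext x1 x2 x3 x4; ring
        _ ≤ _ := this
        _ = ENNReal.ofReal (Cf (i1, i2) * κ ^ (-(1 / 2 + γ))) * (L2 F1 * L2 F2 * L2 F3 * L2 F4) := by ring
        _ ≤ _ := mul_le_mul' (hle _) le_rfl
    · refine ⟨?_, fun _ _ _ _ => hk.nonneg _ _ _ _, fun x1 x2 x3 x4 hs => hk.triv _ _ _ _ (by linarith), ?_⟩
      · unfold M4able; apply hk.meas.comp <;> fun_prop
      · intro x1 x2 x3 x4 hs r hr ht
        have := hk.main x1 x3 x2 x4 (by linarith) r hr (Tri_23 ht)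
        have e : α i1 * x1 ^ 3 + α i2 * x3 ^ 3 + α i1 * x2 ^ 3 + α i2 * x4 ^ 3 =
          α i1 * (x1 ^ 3 + x2 ^ 3) + α i2 * (x3 ^ 3 + x4 ^ 3) := by ring
        simp only [e] at this
        linarith
  · subst e1 e2
    rw [← I4_1432 hmk]
    have := hf (i1, i3) κ hκ hκ1 (fun x1 x2 x3 x4 => k x1 x4 x3 x2) ?_ F1 F4 F3 F2 h1 h4 h3 h2
    · calc _ = I4 (fun x1 x2 x3 x4 => ENNReal.ofReal (k x1 x4 x3 x2) * (F1 x1 * F4 x2 * F3 x3 * F2 x4)) := by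
            congr 1; ext x1 x2 x3 x4; ring
        _ ≤ _ := this
        _ = ENNReal.ofReal (Cf (i1, i3) * κ ^ (-(1 / 2 + γ))) * (L2 F1 * L2 F2 * L2 F3 * L2 F4) := by ring
        _ ≤ _ := mul_le_mul' (hle _) le_rfl
    · refine ⟨?_, fun _ _ _ _ => hk.nonneg _ _ _ _, fun x1 x2 x3 x4 hs => hk.triv _ _ _ _ (by linarith), ?_⟩
      · unfold M4able; apply hk.meas.comp <;> fun_prop
      · intro x1 x2 x3 x4 hs r hr ht
        have := hk.main x1 x4 x3 x2 (by linarith) r hr (Tri_24 ht)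
        have e : α i1 * x1 ^ 3 + α i3 * x4 ^ 3 + α i3 * x3 ^ 3 + α i1 * x2 ^ 3 =
          α i1 * (x1 ^ 3 + x2 ^ 3) + α i3 * (x3 ^ 3 + x4 ^ 3) := by ring
        simp only [e] at this
        linarith

end PAn

namespace PAn
set_option linter.unusedVariables false

lemma lint_conv_le {F G : ℝ → ℝ≥0∞} (hF : Measurable F) (hG : Measurable G) (c : ℝ) :
    ∫⁻ x, F x * G (c - x) ≤ L2 F * L2 G := by
  have h := wCS (μ := (volume : Measure ℝ)) (k := fun _ => 1) (f := F) (g := fun x => G (c - x))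
    measurable_const hF (by fun_prop)
  simp only [one_mul] at h
  refine h.trans (le_of_eq ?_)
  have : ∫⁻ x, G (c - x) ^ 2 = ∫⁻ x, G x ^ 2 :=
    lintegral_sub_left_eq_self (fun x => G x ^ 2) c
  rw [this]; rfl

noncomputable def I3 (Ψ : ℝ → ℝ → ℝ → ℝ≥0∞) : ℝ≥0∞ :=
  ∫⁻ w : ℝ × ℝ, Ψ w.1 w.2 (-w.1 - w.2)

def M3able {β : Type*} [MeasurableSpace β] (Ψ : ℝ → ℝ → ℝ → β) : Prop :=
  Measurable fun p : ℝ × ℝ × ℝ => Ψ p.1 p.2.1 p.2.2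

lemma M3able.comp {β : Type*} [MeasurableSpace β] {Ψ : ℝ → ℝ → ℝ → β} (h : M3able Ψ)
    {α : Type*} [MeasurableSpace α] {f1 f2 f3 : α → ℝ} (h1 : Measurable f1) (h2 : Measurable f2)
    (h3 : Measurable f3) : Measurable fun a => Ψ (f1 a) (f2 a) (f3 a) :=
  Measurable.comp (g := fun p : ℝ × ℝ × ℝ => Ψ p.1 p.2.1 p.2.2) h
    (h1.prodMk (h2.prodMk h3))

lemma mpc : MeasurePreserving (fun p : ℝ × ℝ => (p.2, -p.1 - p.2)) := by
  have h1 : MeasurePreserving (fun p : ℝ × ℝ => (p.2, p.1)) := Measure.measurePreserving_swap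
  have h2 := (mp_sub2 0).comp h1
  convert h2 using 1
  ext p <;> simp
  ring

lemma I3_cyc {Ψ : ℝ → ℝ → ℝ → ℝ≥0∞} (h : M3able Ψ) : I3 (fun x y z => Ψ y z x) = I3 Ψ := by
  unfold I3
  rw [← mpc.lintegral_comp (f := fun w : ℝ × ℝ => Ψ w.1 w.2 (-w.1 - w.2))]
  · congr 1; ext w; simp only; congr 1; ring
  · apply h.comp <;> fun_prop

lemma I3_young {F1 F2 F3 : ℝ → ℝ≥0∞} (h1 : Measurable F1) (h2 : Measurable F2) (h3 : Measurable F3) :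
    I3 (fun x y z => F1 x * F2 y * F3 z) ≤ (∫⁻ x, F1 x) * L2 F2 * L2 F3 := by
  unfold I3
  rw [Measure.volume_eq_prod, lintegral_prod _ (by fun_prop)]
  calc _ ≤ ∫⁻ x, F1 x * (L2 F2 * L2 F3) := by
        apply lintegral_mono; intro x
        simp only [mul_assoc]
        rw [lintegral_const_mul _ (by fun_prop)]
        gcongr
        exact lint_conv_le h2 h3 (-x)
    _ = _ := by rw [lintegral_mul_const _ h1, mul_assoc]

lemma I4_young {F1 F2 F3 F4 : ℝ → ℝ≥0∞} (h1 : Measurable F1) (h2 : Measurable F2) (h3 : Measurable F3)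
    (h4 : Measurable F4) :
    I4 (fun x y z w => F1 x * F2 y * F3 z * F4 w) ≤ (∫⁻ x, F1 x) * (∫⁻ x, F2 x) * L2 F3 * L2 F4 := by
  unfold I4
  rw [Measure.volume_eq_prod, lintegral_prod _ (by fun_prop)]
  calc _ ≤ ∫⁻ x, F1 x * ((∫⁻ x, F2 x) * L2 F3 * L2 F4) := by
        apply lintegral_mono; intro x
        simp only [mul_assoc]
        rw [lintegral_const_mul _ (by fun_prop), Measure.volume_eq_prod, lintegral_prod _ (by fun_prop)]
        gcongr
        rw [← lintegral_mul_const _ h2]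
        apply lintegral_mono; intro y
        simp only
        rw [lintegral_const_mul _ (by fun_prop)]
        gcongr
        exact lint_conv_le h3 h4 (-x - y)
    _ = _ := by rw [lintegral_mul_const _ h1, mul_assoc, mul_assoc, mul_assoc]

noncomputable def cv (F G : ℝ → ℝ≥0∞) (ξ : ℝ) : ℝ≥0∞ := ∫⁻ y, F y * G (ξ - y)

lemma measurable_cv {F G : ℝ → ℝ≥0∞} (hF : Measurable F) (hG : Measurable G) : Measurable (cv F G) := by
  unfold cv
  exact Measurable.lintegral_prod_right' (f := fun p : ℝ × ℝ => F p.2 * G (p.1 - p.2)) (by fun_prop)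

lemma cv_comm {F G : ℝ → ℝ≥0∞} (ξ : ℝ) : cv F G ξ = cv G F ξ := by
  unfold cv
  rw [← lintegral_sub_left_eq_self (fun y => F y * G (ξ - y)) ξ]
  congr 1; ext y; simp [mul_comm]

lemma lint_cv {F G : ℝ → ℝ≥0∞} (hF : Measurable F) (hG : Measurable G) :
    ∫⁻ x, cv F G x = (∫⁻ x, F x) * ∫⁻ x, G x := by
  unfold cv
  rw [lintegral_lintegral_swap (by fun_prop)]
  rw [← lintegral_mul_const _ hF]
  congr 1; ext y
  rw [lintegral_const_mul _ (by fun_prop)]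
  congr 1
  exact lintegral_sub_right_eq_self (fun x => G x) y

lemma L2_cv {F G : ℝ → ℝ≥0∞} (hF : Measurable F) (hG : Measurable G) :
    L2 (cv F G) ≤ (∫⁻ x, F x) * L2 G := by
  have key : ∫⁻ x, cv F G x ^ 2 ≤ (∫⁻ x, F x) ^ 2 * ∫⁻ x, G x ^ 2 := by
    calc ∫⁻ x, cv F G x ^ 2 ≤ ∫⁻ x, (∫⁻ y, F y) * cv F (fun z => G z ^ 2) x := by
          apply lintegral_mono; intro x
          have h := wCS (μ := (volume : Measure ℝ)) (k := F) (f := fun _ => 1) (g := fun y => G (x - y))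
            hF measurable_const (by fun_prop)
          simp only [one_mul, one_pow, mul_one] at h
          calc cv F G x ^ 2 ≤ ((∫⁻ y, F y) ^ (1 / 2 : ℝ) * (∫⁻ y, F y * G (x - y) ^ 2) ^ (1 / 2 : ℝ)) ^ 2 := by
                gcongr; exact h
            _ = _ := by
                rw [mul_pow, ← ENNReal.rpow_natCast, ← ENNReal.rpow_mul, ← ENNReal.rpow_natCast,
                  ← ENNReal.rpow_mul]
                norm_num [cv]
      _ = _ := by
          rw [lintegral_const_mul _ (measurable_cv hF (by fun_prop)), lint_cv hF (by fun_prop), sq, mul_assoc]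
  have h2 : L2 (cv F G) ^ 2 ≤ ((∫⁻ x, F x) * L2 G) ^ 2 := by
    rw [L2_sq, mul_pow, L2_sq]; exact key
  exact (ENNReal.pow_le_pow_left_iff two_ne_zero).1 h2

lemma L2_mono {F G : ℝ → ℝ≥0∞} (h : ∀ x, F x ≤ G x) : L2 F ≤ L2 G := by
  unfold L2
  gcongr with x; exact h x

lemma L2_const_mul (c : ℝ≥0∞) {F : ℝ → ℝ≥0∞} (hF : Measurable F) : L2 (fun x => c * F x) = c * L2 F := by
  unfold L2
  simp only [mul_pow]
  rw [lintegral_const_mul _ (by fun_prop), ENNReal.mul_rpow_of_nonneg _ _ (by norm_num), ← ENNReal.rpow_natCast,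
    ← ENNReal.rpow_mul]
  norm_num

lemma L2_add {F G : ℝ → ℝ≥0∞} (hF : Measurable F) (hG : Measurable G) :
    L2 (fun x => F x + G x) ≤ L2 F + L2 G := by
  have := ENNReal.lintegral_Lp_add_le hF.aemeasurable hG.aemeasurable (μ := volume) (p := 2) (by norm_num)
  unfold L2
  simpa using this

lemma L2_sum {ι : Type*} (s : Finset ι) {F : ι → ℝ → ℝ≥0∞} (hF : ∀ i, Measurable (F i)) :
    L2 (fun x => ∑ i ∈ s, F i x) ≤ ∑ i ∈ s, L2 (F i) := by
  classical
  induction s using Finset.induction_on with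
  | empty => simp [L2]
  | insert a s ha ih =>
    simp only [Finset.sum_insert ha]
    refine (L2_add (hF a) (Finset.measurable_sum _ fun i _ => hF i)).trans ?_
    gcongr

lemma L2_comp_neg (F : ℝ → ℝ≥0∞) : L2 (fun x => F (-x)) = L2 F := by
  unfold L2
  rw [← lintegral_neg_eq_self (fun x => F x ^ 2)]

/-- `L¹` from weighted `L²` -/
lemma lint_le_L2 {F : ℝ → ℝ≥0∞} (hF : Measurable F) :
    ∫⁻ x, ENNReal.ofReal ((1 + |x|)⁻¹) * F x ≤ 2 * L2 F := by
  have h := wCS (μ := (volume : Measure ℝ)) (k := fun _ => 1) (f := fun x => ENNReal.ofReal ((1 + |x|)⁻¹))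
    (g := F) measurable_const (by fun_prop) hF
  simp only [one_mul] at h
  refine h.trans ?_
  gcongr
  · have : ∫⁻ x : ℝ, ENNReal.ofReal ((1 + |x|)⁻¹) ^ 2 ≤ ENNReal.ofReal Real.pi := by
      have hi : ∫ x : ℝ, (1 + x ^ 2)⁻¹ = Real.pi := integral_univ_inv_one_add_sq
      rw [← hi, ofReal_integral_eq_lintegral_ofReal integrable_inv_one_add_sq
        (Eventually.of_forall fun x => by positivity)]
      apply lintegral_mono; intro x
      simp only
      rw [← ENNReal.ofReal_pow (by positivity)]
      apply ENNReal.ofReal_le_ofReal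
      rw [inv_pow]
      apply inv_anti₀ (by positivity)
      nlinarith [sq_abs x, abs_nonneg x]
    calc _ ≤ (ENNReal.ofReal Real.pi) ^ (1 / 2 : ℝ) := by gcongr
      _ ≤ (ENNReal.ofReal 4) ^ (1 / 2 : ℝ) := by gcongr; exact Real.pi_le_four
      _ = 2 := by
        rw [ENNReal.ofReal_rpow_of_nonneg (by norm_num) (by norm_num), ← Real.sqrt_eq_rpow,
          show (4:ℝ) = 2 ^ 2 by norm_num, Real.sqrt_sq (by norm_num)]
        simp
  · exact le_rfl

end PAn

namespace PAn
set_option linter.unusedVariables false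

lemma q_bd {S : Sys} {C : ℝ} (hS : S.Adm C) {m : ℝ → ℝ} (hm : GoodW m) (j k l : Fin 2) {x y z : ℝ}
    (hs : x + y + z = 0) : ∃ N μ, |x| ≤ N ∧ |y| ≤ N ∧ |z| ≤ N ∧ 0 ≤ μ ∧ μ ≤ |x| ∧ μ ≤ |y| ∧ μ ≤ |z| ∧
      (μ = |x| ∨ μ = |y| ∨ μ = |z|) ∧
      |S.q m j k l x y z| * (1 + N) * (1 + μ) ^ 4 ≤ 64 * C * (m x * m y * m z) := by
  have aux : ∀ j k l x y z, x + y + z = 0 → |x| ≤ |y| → |y| ≤ |z| →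
      |S.q m j k l x y z| * (1 + |z|) * (1 + |x|) ^ 4 ≤ 64 * C * (m x * m y * m z) ∧
      |S.q m j k l y x z| * (1 + |z|) * (1 + |x|) ^ 4 ≤ 64 * C * (m x * m y * m z) := by
    intro j k l x y z hs h1 h2
    have hz : m z * (1 + |x|) ^ 4 ≤ 64 * (m x * m y) := by
      have := hm.sub x y h1
      rwa [show x + y = -z by linarith, hm.even] at this
    have hC := hS.C_pos
    have e1 : m |z| = m z := le_antisymm (hm.mono _ _ (by simp)) (hm.mono _ _ (by simp))
    have hpz := hm.pos z
    constructor
    · have := hS.bd m hm j k l x y z hs |z| (h1.trans h2) h2 le_rfl (by tauto)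
      rw [e1] at this
      calc _ ≤ C * m z ^ 2 * (1 + |x|) ^ 4 := by gcongr
        _ = C * m z * (m z * (1 + |x|) ^ 4) := by ring
        _ ≤ C * m z * (64 * (m x * m y)) := by gcongr
        _ = _ := by ring
    · have := hS.bd m hm j k l y x z (by linarith) |z| h2 (h1.trans h2) le_rfl (by tauto)
      rw [e1] at this
      calc _ ≤ C * m z ^ 2 * (1 + |x|) ^ 4 := by gcongr
        _ = C * m z * (m z * (1 + |x|) ^ 4) := by ring
        _ ≤ C * m z * (64 * (m x * m y)) := by gcongr
        _ = _ := by ring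
  have c1 := S.q_cyc m j k l x y z
  have c2 := S.q_cyc m k l j y z x
  rcases le_total |x| |y| with a | a <;> rcases le_total |y| |z| with b | b <;>
    rcases le_total |x| |z| with c | c
  · exact ⟨|z|, |x|, c, b, le_rfl, abs_nonneg _, le_rfl, a, c, by tauto, (aux j k l x y z hs a b).1⟩
  · exact ⟨|z|, |x|, by linarith, b, le_rfl, abs_nonneg _, le_rfl, a, by linarith, by tauto, (aux j k l x y z hs a b).1⟩
  · -- x ≤ z ≤ y
    refine ⟨|y|, |x|, a, le_rfl, b, abs_nonneg _, le_rfl, a, c, by tauto, ?_⟩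
    have := (aux l j k x z y (by linarith) c b).2
    rw [c1, c2]; convert this using 1; ring
  · -- z ≤ x ≤ y
    refine ⟨|y|, |z|, a, le_rfl, b, abs_nonneg _, c, b, le_rfl, by tauto, ?_⟩
    have := (aux l j k z x y (by linarith) c a).1
    rw [c1, c2]; convert this using 1; ring
  · -- y ≤ x ≤ z
    refine ⟨|z|, |y|, c, b, le_rfl, abs_nonneg _, a, le_rfl, b, by tauto, ?_⟩
    have := (aux j k l y x z (by linarith) a c).2
    convert this using 1; ring
  · -- y ≤ z ≤ x
    refine ⟨|x|, |y|, le_rfl, a, c, abs_nonneg _, a, le_rfl, b, by tauto, ?_⟩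
    have := (aux k l j y z x (by linarith) b c).1
    rw [c1]; convert this using 1; ring
  · refine ⟨|x|, |z|, le_rfl, a, by linarith, abs_nonneg _, by linarith, b, le_rfl, by tauto, ?_⟩
    have := (aux k l j z y x (by linarith) b a).2
    rw [c1]; convert this using 1; ring
  · -- z ≤ y ≤ x
    refine ⟨|x|, |z|, le_rfl, a, c, abs_nonneg _, c, b, le_rfl, by tauto, ?_⟩
    have := (aux k l j z y x (by linarith) b a).2
    rw [c1]; convert this using 1; ring

noncomputable def Sys.M4 (S : Sys) (m : ℝ → ℝ) (j k l i n : Fin 2) (x1 x2 x3 x4 : ℝ) : ℝ :=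
  S.q m j k l x1 x2 (x3 + x4) * (S.b l i n * x3 + S.b l n i * x4)

noncomputable def Sys.bb (S : Sys) : ℝ := 1 + ∑ j, ∑ k, ∑ l, |S.b j k l|

lemma Sys.bb_pos (S : Sys) : 0 < S.bb := by
  unfold bb
  have : 0 ≤ ∑ j, ∑ k, ∑ l, |S.b j k l| := by positivity
  linarith

lemma Sys.b_le (S : Sys) (j k l : Fin 2) : |S.b j k l| ≤ S.bb := by
  unfold bb
  have h1 : |S.b j k l| ≤ ∑ l, |S.b j k l| := Finset.single_le_sum (f := fun l => |S.b j k l|) (fun _ _ => abs_nonneg _) (Finset.mem_univ l)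
  have h2 : ∑ l, |S.b j k l| ≤ ∑ k, ∑ l, |S.b j k l| := Finset.single_le_sum (f := fun k => ∑ l, |S.b j k l|) (fun _ _ => by positivity) (Finset.mem_univ k)
  have h3 : ∑ k, ∑ l, |S.b j k l| ≤ ∑ j, ∑ k, ∑ l, |S.b j k l| := Finset.single_le_sum (f := fun j => ∑ k, ∑ l, |S.b j k l|) (fun _ _ => by positivity) (Finset.mem_univ j)
  linarith

lemma Sys.B_le (S : Sys) (l i n : Fin 2) (x y : ℝ) : |S.b l i n * x + S.b l n i * y| ≤ S.bb * (|x| + |y|) := by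
  refine (abs_add_le _ _).trans ?_
  rw [abs_mul, abs_mul, mul_add]
  gcongr <;> exact S.b_le _ _ _

lemma GoodW.sub' {m : ℝ → ℝ} (hm : GoodW m) (x y : ℝ) :
    m (x + y) * (1 + min |x| |y|) ^ 4 ≤ 64 * (m x * m y) := by
  rcases le_total |x| |y| with h | h
  · rw [min_eq_left h]; exact hm.sub x y h
  · rw [min_eq_right h]; have := hm.sub y x h; rw [add_comm y x] at this; linarith

lemma abs_add_min (x y : ℝ) : |x| + |y| ≤ |x + y| + 2 * min |x| |y| := by
  rcases le_total |x| |y| with h | h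
  · rw [min_eq_left h]
    have := abs_sub (x + y) x
    rw [show x + y - x = y by ring] at this; linarith
  · rw [min_eq_right h]
    have := abs_sub (x + y) y
    rw [show x + y - y = x by ring] at this; linarith

noncomputable def Dc (S : Sys) (C : ℝ) : ℝ := 65536 * S.bb * C

lemma M4_bd {S : Sys} {C : ℝ} (hS : S.Adm C) {m : ℝ → ℝ} (hm : GoodW m) (j k l i n : Fin 2)
    {x1 x2 x3 x4 : ℝ} (hs : x1 + x2 + x3 + x4 = 0) {r : ℝ} (hr : 0 ≤ r) (ht : Tri r x1 x2 x3 x4) :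
    |S.M4 m j k l i n x1 x2 x3 x4| * (1 + r) ^ 3 ≤ Dc S C * (m x1 * m x2 * m x3 * m x4) ∧
    |S.M4 m j k l i n x1 x2 x3 x4| * (1 + r) ^ 3 ≤
      Dc S C * (|x1| + |x2| + |x3| + |x4|) * (m x1 * m x2 * m x3 * m x4) := by
  obtain ⟨N, μ, hx, hy, hz, hμ, hμx, hμy, hμz, hμe, hq⟩ := q_bd hS hm j k l (x := x1) (y := x2) (z := x3 + x4) (by linarith)
  have hC := hS.C_pos
  have hb := S.bb_pos
  have p1 := hm.pos x1; have p2 := hm.pos x2; have p3 := hm.pos x3; have p4 := hm.pos x4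
  have pw := hm.pos (x3 + x4)
  obtain ⟨ν, hν⟩ : ∃ ν, ν = min |x3| |x4| := ⟨_, rfl⟩
  have hν0 : 0 ≤ ν := by rw [hν]; positivity
  have hN0 : 0 ≤ N := (abs_nonneg _).trans hx
  have h34 := hm.sub' x3 x4
  rw [← hν] at h34
  have hadd := abs_add_min x3 x4
  rw [← hν] at hadd
  obtain ⟨Q, hQ⟩ : ∃ Q, Q = |S.q m j k l x1 x2 (x3 + x4)| := ⟨_, rfl⟩
  have hQ0 : 0 ≤ Q := by rw [hQ]; positivity
  rw [← hQ] at hq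
  obtain ⟨P, hP⟩ : ∃ P, P = m x1 * m x2 * m x3 * m x4 := ⟨_, rfl⟩
  have hP0 : 0 < P := by rw [hP]; positivity
  have hqq : Q * (1 + N) * (1 + μ) ^ 4 * (1 + ν) ^ 4 ≤ 4096 * C * P := by
    calc _ ≤ 64 * C * (m x1 * m x2 * m (x3 + x4)) * (1 + ν) ^ 4 := by gcongr
      _ = 64 * C * (m x1 * m x2) * (m (x3 + x4) * (1 + ν) ^ 4) := by ring
      _ ≤ 64 * C * (m x1 * m x2) * (64 * (m x3 * m x4)) := by gcongr
      _ = _ := by rw [hP]; ring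
  have hM : |S.M4 m j k l i n x1 x2 x3 x4| ≤ S.bb * (Q * (|x3| + |x4|)) := by
    unfold Sys.M4
    rw [abs_mul, ← hQ]
    calc _ ≤ Q * (S.bb * (|x3| + |x4|)) := by gcongr; exact S.B_le _ _ _ _ _
      _ = _ := by ring
  have hA : Q * (|x3| + |x4|) * ((1 + μ) * (1 + ν)) ^ 3 ≤ 8192 * C * P := by
    calc _ ≤ Q * (2 * (1 + N) * (1 + ν)) * ((1 + μ) * (1 + ν)) ^ 3 := by
          gcongr
          have := mul_nonneg hN0 hν0
          have e : 2 * (1 + N) * (1 + ν) = 2 + 2 * N + 2 * ν + 2 * (N * ν) := by ring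
          rw [e]; linarith
      _ = 2 * (Q * (1 + N) * (1 + μ) ^ 3 * (1 + ν) ^ 4) := by ring
      _ ≤ 2 * (Q * (1 + N) * (1 + μ) ^ 4 * (1 + ν) ^ 4) := by
          gcongr <;> linarith
      _ ≤ _ := by linarith
  have hrr : 1 + r ≤ (1 + μ) * (1 + ν) := by
    have hmn := mul_nonneg hμ hν0
    have hpr : (1 + μ) * (1 + ν) = 1 + μ + ν + μ * ν := by ring
    rw [hpr]
    have hb34 : r ≤ |x3| → r ≤ |x4| → 1 + r ≤ 1 + μ + ν + μ * ν := by
      intro h3 h4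
      have : r ≤ ν := by rw [hν]; exact le_min h3 h4
      linarith
    have h12 : r ≤ |x1| → r ≤ |x2| → (r ≤ |x3| ∨ r ≤ |x4|) → 1 + r ≤ 1 + μ + ν + μ * ν := by
      intro h1 h2 h34
      have hw : r ≤ |x3 + x4| + ν := by
        have : |x3| + |x4| = max |x3| |x4| + ν := by rw [hν, max_add_min]
        have h5 : r ≤ max |x3| |x4| := by rw [le_max_iff]; exact h34
        linarith
      rcases hμe with h | h | h
      · linarith
      · linarith
      · linarith
    unfold Tri at ht
    tauto
  have hfirst : Q * (|x3| + |x4|) * (1 + r) ^ 3 ≤ 8192 * C * P := by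
    refine le_trans ?_ hA
    gcongr
  have hsecond : Q * (|x3| + |x4|) ≤ (|x1| + |x2| + |x3| + |x4|) * (4096 * C * P) := by
    have : Q ≤ 4096 * C * P := by
      refine le_trans ?_ hqq
      have : 1 ≤ (1 + N) * (1 + μ) ^ 4 * (1 + ν) ^ 4 := by
        have a := one_le_pow₀ (n := 4) (by linarith : 1 ≤ 1 + μ)
        have b := one_le_pow₀ (n := 4) (by linarith : 1 ≤ 1 + ν)
        have c : 1 ≤ 1 + N := by linarith
        exact one_le_mul_of_one_le_of_one_le (one_le_mul_of_one_le_of_one_le c a) b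
      calc Q = Q * 1 := by ring
        _ ≤ Q * ((1 + N) * (1 + μ) ^ 4 * (1 + ν) ^ 4) := by gcongr
        _ = _ := by ring
    rw [mul_comm]
    gcongr
    linarith [abs_nonneg x1, abs_nonneg x2]
  rw [← hP]
  unfold Dc
  have f1 : |S.M4 m j k l i n x1 x2 x3 x4| * (1 + r) ^ 3 ≤ 8192 * S.bb * C * P := by
    calc _ ≤ S.bb * (Q * (|x3| + |x4|)) * (1 + r) ^ 3 := by gcongr
      _ = S.bb * (Q * (|x3| + |x4|) * (1 + r) ^ 3) := by ring
      _ ≤ S.bb * (8192 * C * P) := by gcongr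
      _ = _ := by ring
  have hbCP : 0 < S.bb * C * P := by positivity
  obtain ⟨X, hX⟩ : ∃ X, X = |x1| + |x2| + |x3| + |x4| := ⟨_, rfl⟩
  have hX0 : 0 ≤ X := by rw [hX]; positivity
  have e5 : 65536 * S.bb * C * P = 8 * (8192 * S.bb * C * P) := by ring
  refine ⟨by linarith, ?_⟩
  rw [← hX] at hsecond ⊢
  rcases le_total 1 X with h1 | h1
  · have := mul_le_mul_of_nonneg_left h1 hbCP.le
    have e6 : 65536 * S.bb * C * X * P = 65536 * (S.bb * C * P * X) := by ring
    have e7 : 8192 * S.bb * C * P = 8192 * (S.bb * C * P) := by ring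
    rw [e6]; linarith
  · have hr1 : r ≤ 1 := by
      unfold Tri at ht
      have := abs_nonneg x1; have := abs_nonneg x2; have := abs_nonneg x3; have := abs_nonneg x4
      rcases ht with ⟨_, _, _⟩ | ⟨_, _, _⟩ | ⟨_, _, _⟩ | ⟨_, _, _⟩ <;> linarith
    calc _ ≤ S.bb * (Q * (|x3| + |x4|)) * (1 + 1) ^ 3 := by gcongr
      _ ≤ S.bb * (X * (4096 * C * P)) * (1 + 1) ^ 3 := by gcongr
      _ = 32768 * (S.bb * C * P * X) := by ring
      _ ≤ 65536 * (S.bb * C * P * X) := by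
          have : 0 ≤ S.bb * C * P * X := by positivity
          linarith
      _ = _ := by ring

end PAn

namespace PAn
set_option linter.unusedVariables false

noncomputable def XX (x1 x2 x3 x4 : ℝ) : ℝ := |x1| + |x2| + |x3| + |x4|

lemma XX_nonneg (x1 x2 x3 x4 : ℝ) : 0 ≤ XX x1 x2 x3 x4 := by unfold XX; positivity

noncomputable def Sys.P4 (S : Sys) (j k i n : Fin 2) (x1 x2 x3 x4 : ℝ) : ℝ :=
  S.α j * x1 ^ 3 + S.α k * x2 ^ 3 + S.α i * x3 ^ 3 + S.α n * x4 ^ 3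

noncomputable def Sys.rr (S : Sys) (m : ℝ → ℝ) (κ : ℝ) (j k l i n : Fin 2) (x1 x2 x3 x4 : ℝ) : ℝ :=
  S.M4 m j k l i n x1 x2 x3 x4 * S.P4 j k i n x1 x2 x3 x4 /
    ((κ * (1 + XX x1 x2 x3 x4)) ^ 2 + S.P4 j k i n x1 x2 x3 x4 ^ 2)

noncomputable def Sys.nr (S : Sys) (m : ℝ → ℝ) (κ : ℝ) (j k l i n : Fin 2) (x1 x2 x3 x4 : ℝ) : ℝ :=
  S.M4 m j k l i n x1 x2 x3 x4 * (κ * (1 + XX x1 x2 x3 x4)) ^ 2 /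
    ((κ * (1 + XX x1 x2 x3 x4)) ^ 2 + S.P4 j k i n x1 x2 x3 x4 ^ 2)

noncomputable def Sys.kk (S : Sys) (m : ℝ → ℝ) (C κ : ℝ) (j k l i n : Fin 2) (x1 x2 x3 x4 : ℝ) : ℝ :=
  |S.M4 m j k l i n x1 x2 x3 x4| / (Dc S C * (m x1 * m x2 * m x3 * m x4)) * (1 + XX x1 x2 x3 x4) /
    (κ * (1 + XX x1 x2 x3 x4) + |S.P4 j k i n x1 x2 x3 x4|)

lemma M4_split (S : Sys) (m : ℝ → ℝ) {κ : ℝ} (hκ : 0 < κ) (j k l i n : Fin 2) (x1 x2 x3 x4 : ℝ) :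
    S.M4 m j k l i n x1 x2 x3 x4 = S.nr m κ j k l i n x1 x2 x3 x4 +
      S.P4 j k i n x1 x2 x3 x4 * S.rr m κ j k l i n x1 x2 x3 x4 := by
  unfold Sys.nr Sys.rr
  have := XX_nonneg x1 x2 x3 x4
  have : 0 < (κ * (1 + XX x1 x2 x3 x4)) ^ 2 + S.P4 j k i n x1 x2 x3 x4 ^ 2 := by positivity
  field_simp

lemma Dc_pos {S : Sys} {C : ℝ} (hS : S.Adm C) : 0 < Dc S C := by
  have := hS.C_pos; have := S.bb_pos; unfold Dc; positivity

lemma rr_le {S : Sys} {C : ℝ} (hS : S.Adm C) {m : ℝ → ℝ} (hm : GoodW m) {κ : ℝ} (hκ : 0 < κ)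
    (j k l i n : Fin 2) (x1 x2 x3 x4 : ℝ) :
    |S.rr m κ j k l i n x1 x2 x3 x4| * (1 + XX x1 x2 x3 x4) ≤
      2 * Dc S C * S.kk m C κ j k l i n x1 x2 x3 x4 * (m x1 * m x2 * m x3 * m x4) ∧
    |S.nr m κ j k l i n x1 x2 x3 x4| ≤
      2 * Dc S C * κ * S.kk m C κ j k l i n x1 x2 x3 x4 * (m x1 * m x2 * m x3 * m x4) := by
  have hD := Dc_pos hS
  have p1 := hm.pos x1; have p2 := hm.pos x2; have p3 := hm.pos x3; have p4 := hm.pos x4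
  have hX := XX_nonneg x1 x2 x3 x4
  unfold Sys.rr Sys.nr Sys.kk
  generalize S.M4 m j k l i n x1 x2 x3 x4 = M
  generalize S.P4 j k i n x1 x2 x3 x4 = Φ
  generalize XX x1 x2 x3 x4 = X at *
  have hκX : 0 < κ * (1 + X) := by positivity
  generalize hK : κ * (1 + X) = K at *
  have hP : 0 < m x1 * m x2 * m x3 * m x4 := by positivity
  generalize m x1 * m x2 * m x3 * m x4 = P at *
  have hden : 0 < K ^ 2 + Φ ^ 2 := by positivity
  have hden' : 0 < K + |Φ| := by positivity
  have e1 : 2 * Dc S C * (|M| / (Dc S C * P) * (1 + X) / (K + |Φ|)) * P = 2 * |M| * (1 + X) / (K + |Φ|) := by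
    field_simp
  have e2 : 2 * Dc S C * κ * (|M| / (Dc S C * P) * (1 + X) / (K + |Φ|)) * P = 2 * |M| * K / (K + |Φ|) := by
    rw [← hK]; field_simp
  rw [e1, e2]
  have hs : (K - |Φ|) ^ 2 ≥ 0 := sq_nonneg _
  constructor
  · rw [abs_div, abs_mul, abs_of_pos hden, div_mul_eq_mul_div, div_le_div_iff₀ hden hden']
    have : |Φ| * (K + |Φ|) ≤ 2 * (K ^ 2 + Φ ^ 2) := by rw [← sq_abs Φ]; nlinarith [sq_nonneg K, sq_nonneg |Φ|]
    calc |M| * |Φ| * (1 + X) * (K + |Φ|) = |M| * (1 + X) * (|Φ| * (K + |Φ|)) := by ring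
      _ ≤ |M| * (1 + X) * (2 * (K ^ 2 + Φ ^ 2)) := by gcongr
      _ = _ := by ring
  · rw [abs_div, abs_mul, abs_of_pos hden, div_le_div_iff₀ hden hden', abs_of_nonneg (sq_nonneg K)]
    have : K * (K + |Φ|) ≤ 2 * (K ^ 2 + Φ ^ 2) := by rw [← sq_abs Φ]; nlinarith [sq_nonneg K, sq_nonneg |Φ|]
    calc |M| * K ^ 2 * (K + |Φ|) = |M| * K * (K * (K + |Φ|)) := by ring
      _ ≤ |M| * K * (2 * (K ^ 2 + Φ ^ 2)) := by gcongr
      _ = _ := by ring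

lemma kk_nonneg {S : Sys} {C : ℝ} (hS : S.Adm C) {m : ℝ → ℝ} (hm : GoodW m) {κ : ℝ} (hκ : 0 < κ)
    (j k l i n : Fin 2) (x1 x2 x3 x4 : ℝ) : 0 ≤ S.kk m C κ j k l i n x1 x2 x3 x4 := by
  have hD := Dc_pos hS
  have p1 := hm.pos x1; have p2 := hm.pos x2; have p3 := hm.pos x3; have p4 := hm.pos x4
  have hX := XX_nonneg x1 x2 x3 x4
  unfold Sys.kk; positivity

lemma q_meas {S : Sys} {m : ℝ → ℝ} (hm : Measurable m) (j k l : Fin 2) {β : Type*} [MeasurableSpace β]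
    {f g h : β → ℝ} (hf : Measurable f) (hg : Measurable g) (hh : Measurable h) :
    Measurable fun p => S.q m j k l (f p) (g p) (h p) := by
  unfold Sys.q Sys.M3 Sys.Ph
  fun_prop

lemma M4_meas {S : Sys} {m : ℝ → ℝ} (hm : Measurable m) (j k l i n : Fin 2) : M4able (S.M4 m j k l i n) := by
  unfold M4able Sys.M4
  apply Measurable.mul
  · apply q_meas hm <;> fun_prop
  · fun_prop

lemma P4_meas {S : Sys} (j k i n : Fin 2) : M4able (S.P4 j k i n) := by
  unfold M4able Sys.P4; fun_prop

lemma XX_meas : M4able XX := by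
  unfold M4able XX; fun_prop

lemma kk_meas {S : Sys} {m : ℝ → ℝ} (hm : Measurable m) (C κ : ℝ) (j k l i n : Fin 2) : M4able (S.kk m C κ j k l i n) := by
  have h1 : M4able (S.M4 m j k l i n) := M4_meas hm j k l i n
  have h2 := P4_meas (S := S) j k i n
  have h3 := XX_meas
  unfold M4able at *
  unfold Sys.kk
  fun_prop

lemma rr_meas {S : Sys} {m : ℝ → ℝ} (hm : Measurable m) (κ : ℝ) (j k l i n : Fin 2) : M4able (S.rr m κ j k l i n) := by
  have h1 : M4able (S.M4 m j k l i n) := M4_meas hm j k l i n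
  have h2 := P4_meas (S := S) j k i n
  have h3 := XX_meas
  unfold M4able at *
  unfold Sys.rr
  fun_prop

lemma nr_meas {S : Sys} {m : ℝ → ℝ} (hm : Measurable m) (κ : ℝ) (j k l i n : Fin 2) : M4able (S.nr m κ j k l i n) := by
  have h1 : M4able (S.M4 m j k l i n) := M4_meas hm j k l i n
  have h2 := P4_meas (S := S) j k i n
  have h3 := XX_meas
  unfold M4able at *
  unfold Sys.nr
  fun_prop

lemma kk_hyp {S : Sys} {C : ℝ} (hS : S.Adm C) {m : ℝ → ℝ} (hm : GoodW m) {κ : ℝ} (hκ : 0 < κ)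
    (j k l i n : Fin 2) : KHyp κ (S.P4 j k i n) (S.kk m C κ j k l i n) where
  meas := kk_meas hm.cont.measurable _ _ _ _ _ _ _
  nonneg := kk_nonneg hS hm hκ j k l i n
  triv := by
    intro x1 x2 x3 x4 hs
    have hD := Dc_pos hS
    have p1 := hm.pos x1; have p2 := hm.pos x2; have p3 := hm.pos x3; have p4 := hm.pos x4
    have hX := XX_nonneg x1 x2 x3 x4
    have hb := (M4_bd hS hm j k l i n hs le_rfl (Tri_zero x1 x2 x3 x4)).1
    unfold Sys.kk
    generalize S.M4 m j k l i n x1 x2 x3 x4 = M at *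
    generalize S.P4 j k i n x1 x2 x3 x4 = Φ
    generalize XX x1 x2 x3 x4 = X at *
    have hP : 0 < Dc S C * (m x1 * m x2 * m x3 * m x4) := by positivity
    generalize Dc S C * (m x1 * m x2 * m x3 * m x4) = P at *
    have hb' : |M| / P ≤ 1 := by rw [div_le_one hP]; simpa using hb
    have hΦ := abs_nonneg Φ
    have hκX : 0 < κ * (1 + X) := by positivity
    calc _ = |M| / P * (κ * (1 + X) / (κ * (1 + X) + |Φ|)) := by ring
      _ ≤ 1 * 1 := by
        gcongr
        rw [div_le_one (by positivity)]; linarith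
      _ = 1 := by norm_num
  main := by
    intro x1 x2 x3 x4 hs r hr ht
    have hD := Dc_pos hS
    have p1 := hm.pos x1; have p2 := hm.pos x2; have p3 := hm.pos x3; have p4 := hm.pos x4
    have hX := XX_nonneg x1 x2 x3 x4
    obtain ⟨hb, hb2⟩ := M4_bd hS hm j k l i n hs hr ht
    change _ ≤ 2 * XX x1 x2 x3 x4
    change _ ≤ Dc S C * XX x1 x2 x3 x4 * _ at hb2
    unfold Sys.kk
    generalize S.M4 m j k l i n x1 x2 x3 x4 = M at *
    generalize S.P4 j k i n x1 x2 x3 x4 = Φ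
    generalize XX x1 x2 x3 x4 = X at *
    have hP : 0 < Dc S C * (m x1 * m x2 * m x3 * m x4) := by positivity
    rw [mul_assoc (Dc S C), mul_left_comm] at hb2
    generalize Dc S C * (m x1 * m x2 * m x3 * m x4) = P at *
    have hb' : |M| / P * (1 + r) ^ 3 ≤ 1 := by rw [div_mul_eq_mul_div, div_le_one hP]; exact hb
    have hb2' : |M| / P * (1 + r) ^ 3 ≤ X := by rw [div_mul_eq_mul_div, div_le_iff₀ hP]; exact hb2
    have hΦ := abs_nonneg Φ
    have hκX : 0 < κ * (1 + X) := by positivity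
    have hquot : (κ + |Φ|) / (κ * (1 + X) + |Φ|) ≤ 1 := by
      rw [div_le_one (by positivity)]; nlinarith
    calc _ = (|M| / P * (1 + r) ^ 3) * (1 + X) * ((κ + |Φ|) / (κ * (1 + X) + |Φ|)) := by ring
      _ ≤ (|M| / P * (1 + r) ^ 3) * (1 + X) * 1 := by gcongr
      _ = (|M| / P * (1 + r) ^ 3) + (|M| / P * (1 + r) ^ 3) * X := by ring
      _ ≤ X + 1 * X := by gcongr
      _ = _ := by ring

noncomputable def Wm (m : ℝ → ℝ) (f : ℝ → ℝ≥0∞) (x : ℝ) : ℝ≥0∞ := ENNReal.ofReal (m x) * f x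

lemma measurable_Wm {m : ℝ → ℝ} (hm : Measurable m) {f : ℝ → ℝ≥0∞} (hf : Measurable f) : Measurable (Wm m f) := by
  unfold Wm; fun_prop

lemma M4_par {S : Sys} {C : ℝ} (hS : S.Adm C) (m : ℝ → ℝ) (j k l i n : Fin 2) (h : j + k + i + n ≠ 0)
    (x1 x2 x3 x4 : ℝ) : S.M4 m j k l i n x1 x2 x3 x4 = 0 := by
  by_contra hne
  unfold Sys.M4 at hne
  have h1 := hS.qpar m j k l _ _ _ (left_ne_zero_of_mul hne)
  have h2 := right_ne_zero_of_mul hne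
  have h3 : l + i + n = 0 := by
    by_cases hb : S.b l i n = 0
    · by_cases hb' : S.b l n i = 0
      · simp [hb, hb'] at h2
      · have := hS.par _ _ _ hb'; rw [← this]; abel
    · exact hS.par _ _ _ hb
  have key : ∀ j k l i n : Fin 2, j + k + l = 0 → l + i + n = 0 → j + k + i + n = 0 := by decide
  exact h (key j k l i n h1 h3)

/-- the two quadrilinear bounds -/
theorem quad_bd {S : Sys} {C : ℝ} (hS : S.Adm C) {γ : ℝ} (hγ : 0 < γ) (hγ4 : γ < 1 / 4) :
    ∃ Q : ℝ, 0 < Q ∧ ∀ m, GoodW m → ∀ κ : ℝ, 0 < κ → κ ≤ 1 → ∀ j k l i n : Fin 2,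
      ∀ f1 f2 f3 f4 : ℝ → ℝ≥0∞, Measurable f1 → Measurable f2 → Measurable f3 → Measurable f4 →
      I4 (fun x1 x2 x3 x4 => ENNReal.ofReal (|S.rr m κ j k l i n x1 x2 x3 x4| * (1 + XX x1 x2 x3 x4))
        * (f1 x1 * f2 x2 * f3 x3 * f4 x4)) ≤
        ENNReal.ofReal (Q * κ ^ (-(1 / 2 + γ))) * (L2 (Wm m f1) * L2 (Wm m f2) * L2 (Wm m f3) * L2 (Wm m f4)) ∧
      I4 (fun x1 x2 x3 x4 => ENNReal.ofReal (|S.nr m κ j k l i n x1 x2 x3 x4|)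
        * (f1 x1 * f2 x2 * f3 x3 * f4 x4)) ≤
        ENNReal.ofReal (Q * κ ^ (1 / 2 - γ)) * (L2 (Wm m f1) * L2 (Wm m f2) * L2 (Wm m f3) * L2 (Wm m f4)) := by
  obtain ⟨CT, hCT, hT⟩ := T4 hS.α_ne hγ hγ4
  have hD := Dc_pos hS
  refine ⟨2 * Dc S C * CT, by positivity, ?_⟩
  intro m hm κ hκ hκ1 j k l i n f1 f2 f3 f4 h1 h2 h3 h4
  by_cases hpar : j + k + i + n = 0
  · have := hT κ hκ hκ1 j k i n hpar (S.kk m C κ j k l i n) (kk_hyp hS hm hκ j k l i n) _ _ _ _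
      (measurable_Wm hm.cont.measurable h1) (measurable_Wm hm.cont.measurable h2)
      (measurable_Wm hm.cont.measurable h3) (measurable_Wm hm.cont.measurable h4)
    have gen : ∀ (c : ℝ) (hc : 0 ≤ c) (g : ℝ → ℝ → ℝ → ℝ → ℝ),
        (∀ x1 x2 x3 x4, g x1 x2 x3 x4 ≤ c * S.kk m C κ j k l i n x1 x2 x3 x4 * (m x1 * m x2 * m x3 * m x4)) →
        I4 (fun x1 x2 x3 x4 => ENNReal.ofReal (g x1 x2 x3 x4) * (f1 x1 * f2 x2 * f3 x3 * f4 x4)) ≤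
        ENNReal.ofReal (c * (CT * κ ^ (-(1 / 2 + γ)))) *
          (L2 (Wm m f1) * L2 (Wm m f2) * L2 (Wm m f3) * L2 (Wm m f4)) := by
      intro c hc g hg
      rw [ENNReal.ofReal_mul hc, mul_assoc]
      refine le_trans ?_ (mul_le_mul' le_rfl this)
      unfold I4
      rw [← lintegral_const_mul' _ _ ENNReal.ofReal_ne_top]
      apply lintegral_mono
      intro w
      simp only [Wm]
      refine (mul_le_mul' (ENNReal.ofReal_le_ofReal (hg _ _ _ _)) le_rfl).trans (le_of_eq ?_)
      have p1 := (hm.pos w.1).le; have p2 := (hm.pos w.2.1).le; have p3 := (hm.pos w.2.2).le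
      have p4 := (hm.pos (-w.1 - w.2.1 - w.2.2)).le
      have pk := kk_nonneg hS hm hκ j k l i n w.1 w.2.1 w.2.2 (-w.1 - w.2.1 - w.2.2)
      rw [ENNReal.ofReal_mul (by positivity), ENNReal.ofReal_mul hc, ENNReal.ofReal_mul (by positivity),
        ENNReal.ofReal_mul (by positivity), ENNReal.ofReal_mul (by positivity)]
      ring
    constructor
    · refine (gen (2 * Dc S C) (by positivity) _ (fun x1 x2 x3 x4 => (rr_le hS hm hκ j k l i n x1 x2 x3 x4).1)).trans
        (le_of_eq ?_)
      rw [mul_assoc (2 * Dc S C)]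
    · refine (gen (2 * Dc S C * κ) (by positivity) _ (fun x1 x2 x3 x4 => (rr_le hS hm hκ j k l i n x1 x2 x3 x4).2)).trans
        (le_of_eq ?_)
      have : κ ^ (1 / 2 - γ) = κ * κ ^ (-(1 / 2 + γ)) := by
        rw [← Real.rpow_one_add' hκ.le (by linarith)]; congr 1; ring
      rw [this]
      congr 2; ring
  · have hz := M4_par hS m j k l i n hpar
    simp [Sys.rr, Sys.nr, hz, I4]

end PAn

namespace PAn
set_option linter.unusedVariables false

/-- bilinear symbol -/
noncomputable def Sys.B (S : Sys) (l i n : Fin 2) (y z : ℝ) : ℝ := S.b l i n * y + S.b l n i * z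

/-- nonlinearity in Fourier variables -/
noncomputable def Sys.nl (S : Sys) (f : Fin 2 → ℝ → ℂ) (l : Fin 2) (ξ : ℝ) : ℂ :=
  ∑ i, ∑ n, ∫ y, Complex.I * (S.B l i n y (ξ - y) : ℂ) * (f i y * f n (ξ - y))

noncomputable def wN (N : ℕ) (f : ℝ → ℂ) (ξ : ℝ) : ℝ≥0∞ := ENNReal.ofReal ((1 + |ξ|) ^ N) * ‖f ξ‖ₑ

lemma measurable_wN (N : ℕ) {f : ℝ → ℂ} (hf : Measurable f) : Measurable (wN N f) := by
  unfold wN; fun_prop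

structure NiceB (B : ℝ≥0∞) (f : ℝ → ℂ) : Prop where
  meas : Measurable f
  one : ∫⁻ x, wN 8 f x ≤ B
  two : L2 (wN 8 f) ≤ B

lemma nl_enorm_le (S : Sys) (f : Fin 2 → ℝ → ℂ) (l : Fin 2) (ξ : ℝ) :
    ‖S.nl f l ξ‖ₑ ≤ ∑ i, ∑ n, ∫⁻ y, ENNReal.ofReal (S.bb * (|y| + |ξ - y|)) * (‖f i y‖ₑ * ‖f n (ξ - y)‖ₑ) := by
  unfold Sys.nl
  refine (enorm_sum_le _ _).trans (Finset.sum_le_sum fun i _ => ?_)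
  refine (enorm_sum_le _ _).trans (Finset.sum_le_sum fun n _ => ?_)
  refine (enorm_integral_le_lintegral_enorm _).trans (lintegral_mono fun y => ?_)
  simp only [enorm_mul]
  have hI : ‖Complex.I‖ₑ = 1 := by rw [← ofReal_norm]; simp
  rw [hI, one_mul]
  gcongr
  rw [← ofReal_norm]
  apply ENNReal.ofReal_le_ofReal
  rw [Complex.norm_real, Real.norm_eq_abs]
  exact S.B_le _ _ _ _ _

lemma one_add_abs_mul {y z ξ : ℝ} (h : y + z = ξ) : 1 + |ξ| ≤ (1 + |y|) * (1 + |z|) := by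
  have := abs_add_le y z
  rw [h] at this
  nlinarith [mul_nonneg (abs_nonneg y) (abs_nonneg z)]

lemma nl_crude (S : Sys) {f : Fin 2 → ℝ → ℂ} (hf : ∀ i, Measurable (f i)) (l : Fin 2) (ξ : ℝ) :
    ENNReal.ofReal ((1 + |ξ|) ^ 8) * ‖S.nl f l ξ‖ₑ ≤
      ∑ i, ∑ n, ENNReal.ofReal S.bb * cv (wN 9 (f i)) (wN 9 (f n)) ξ := by
  refine (mul_le_mul' le_rfl (nl_enorm_le S f l ξ)).trans ?_
  rw [Finset.mul_sum]
  refine Finset.sum_le_sum fun i _ => ?_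
  rw [Finset.mul_sum]
  refine Finset.sum_le_sum fun n _ => ?_
  unfold cv wN
  rw [← lintegral_const_mul' _ _ ENNReal.ofReal_ne_top, ← lintegral_const_mul' _ _ ENNReal.ofReal_ne_top]
  apply lintegral_mono; intro y
  simp only
  have hb := S.bb_pos
  calc _ = ENNReal.ofReal ((1 + |ξ|) ^ 8 * (S.bb * (|y| + |ξ - y|))) * (‖f i y‖ₑ * ‖f n (ξ - y)‖ₑ) := by
        rw [ENNReal.ofReal_mul (p := (1 + |ξ|) ^ 8) (by positivity), mul_assoc]
    _ ≤ ENNReal.ofReal (S.bb * ((1 + |y|) ^ 9 * (1 + |ξ - y|) ^ 9)) * (‖f i y‖ₑ * ‖f n (ξ - y)‖ₑ) := by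
        refine mul_le_mul' (ENNReal.ofReal_le_ofReal ?_) le_rfl
        have h1 := one_add_abs_mul (y := y) (z := ξ - y) (ξ := ξ) (by ring)
        have h2 : |y| + |ξ - y| ≤ (1 + |y|) * (1 + |ξ - y|) := by
          nlinarith [mul_nonneg (abs_nonneg y) (abs_nonneg (ξ - y))]
        calc _ ≤ ((1 + |y|) * (1 + |ξ - y|)) ^ 8 * (S.bb * ((1 + |y|) * (1 + |ξ - y|))) := by gcongr
          _ = _ := by ring
    _ = _ := by
        rw [ENNReal.ofReal_mul (p := S.bb) hb.le, ENNReal.ofReal_mul (p := (1 + |y|) ^ 9) (by positivity)]; ring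

/-- measurability of the nonlinearity with parameters -/
lemma nl_meas_param (S : Sys) {β : Type*} [MeasurableSpace β] {f : β → Fin 2 → ℝ → ℂ}
    (hf : ∀ i, Measurable fun p : β × ℝ => f p.1 i p.2) (l : Fin 2) :
    Measurable fun p : β × ℝ => S.nl (f p.1) l p.2 := by
  unfold Sys.nl
  refine Finset.measurable_sum _ fun i _ => Finset.measurable_sum _ fun n _ => ?_
  have : StronglyMeasurable fun q : (β × ℝ) × ℝ =>
      Complex.I * (S.B l i n q.2 (q.1.2 - q.2) : ℂ) * (f q.1.1 i q.2 * f q.1.1 n (q.1.2 - q.2)) := by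
    apply Measurable.stronglyMeasurable
    have h1 : Measurable fun q : (β × ℝ) × ℝ => f q.1.1 i q.2 :=
      (hf i).comp (by fun_prop : Measurable fun q : (β × ℝ) × ℝ => (q.1.1, q.2))
    have h2 : Measurable fun q : (β × ℝ) × ℝ => f q.1.1 n (q.1.2 - q.2) :=
      (hf n).comp (by fun_prop : Measurable fun q : (β × ℝ) × ℝ => (q.1.1, q.1.2 - q.2))
    unfold Sys.B
    fun_prop
  exact this.integral_prod_right.measurable

lemma nl_meas (S : Sys) {f : Fin 2 → ℝ → ℂ} (hf : ∀ i, Measurable (f i)) (l : Fin 2) :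
    Measurable (S.nl f l) := by
  unfold Sys.nl
  refine Finset.measurable_sum _ fun i _ => Finset.measurable_sum _ fun n _ => ?_
  have : StronglyMeasurable fun q : ℝ × ℝ =>
      Complex.I * (S.B l i n q.2 (q.1 - q.2) : ℂ) * (f i q.2 * f n (q.1 - q.2)) := by
    apply Measurable.stronglyMeasurable
    have h1 : Measurable fun q : ℝ × ℝ => f i q.2 := (hf i).comp measurable_snd
    have h2 : Measurable fun q : ℝ × ℝ => f n (q.1 - q.2) := (hf n).comp (measurable_fst.sub measurable_snd)
    unfold Sys.B
    fun_prop
  exact this.integral_prod_right.measurable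

lemma wN_lint_le (N : ℕ) {f : ℝ → ℂ} (hf : Measurable f) : ∫⁻ x, wN N f x ≤ 2 * L2 (wN (N + 1) f) := by
  refine le_trans (le_of_eq ?_) (lint_le_L2 (measurable_wN (N + 1) hf))
  congr 1; ext x
  unfold wN
  rw [← mul_assoc, ← ENNReal.ofReal_mul (by positivity)]
  congr 2
  rw [pow_succ]
  field_simp

lemma wN_mono {N M : ℕ} (h : N ≤ M) (f : ℝ → ℂ) (x : ℝ) : wN N f x ≤ wN M f x := by
  unfold wN
  gcongr
  linarith [abs_nonneg x]

/-- crude niceness of `f` and of the nonlinearity -/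
lemma nice_of_L2 (S : Sys) {f : Fin 2 → ℝ → ℂ} (hf : ∀ i, Measurable (f i)) {R : ℝ≥0∞} (hR : ∀ i, L2 (wN 10 (f i)) ≤ R) :
    (∀ i, NiceB (2 * R + ENNReal.ofReal S.bb * (16 * R * R)) (f i)) ∧
      ∀ l, NiceB (2 * R + ENNReal.ofReal S.bb * (16 * R * R)) (S.nl f l) := by
  have h9 : ∀ i, ∫⁻ x, wN 9 (f i) x ≤ 2 * R := fun i => (wN_lint_le 9 (hf i)).trans (by gcongr; exact hR i)
  have h9' : ∀ i, L2 (wN 9 (f i)) ≤ R := fun i => (L2_mono fun x => wN_mono (by norm_num) (f i) x).trans (hR i)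
  constructor
  · intro i
    refine ⟨hf i, ?_, ?_⟩
    · refine le_trans (lintegral_mono fun x => wN_mono (by norm_num : 8 ≤ 9) (f i) x) ((h9 i).trans ?_)
      exact le_self_add
    · refine (L2_mono fun x => wN_mono (by norm_num : 8 ≤ 9) (f i) x).trans ((h9' i).trans ?_)
      calc R ≤ 2 * R := by rw [two_mul]; exact le_self_add
        _ ≤ _ := le_self_add
  · intro l
    have hmc : ∀ i n, Measurable (cv (wN 9 (f i)) (wN 9 (f n))) := fun i n =>
      measurable_cv (measurable_wN 9 (hf i)) (measurable_wN 9 (hf n))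
    refine ⟨nl_meas S hf l, ?_, ?_⟩
    · refine le_trans (lintegral_mono fun x => nl_crude S hf l x) ?_
      rw [lintegral_finsetSum _ (fun i _ => Finset.measurable_sum _ fun n _ => (hmc i n).const_mul _)]
      have : ∀ i, ∫⁻ x, ∑ n, ENNReal.ofReal S.bb * cv (wN 9 (f i)) (wN 9 (f n)) x ≤
          ENNReal.ofReal S.bb * (8 * R * R) := by
        intro i
        rw [lintegral_finsetSum _ (fun n _ => (hmc i n).const_mul _)]
        calc _ ≤ ∑ n : Fin 2, ENNReal.ofReal S.bb * (4 * R * R) := by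
              refine Finset.sum_le_sum fun n _ => ?_
              rw [lintegral_const_mul _ (hmc i n), lint_cv (measurable_wN 9 (hf i)) (measurable_wN 9 (hf n))]
              exact mul_le_mul' le_rfl (le_trans (mul_le_mul' (h9 i) (h9 n)) (le_of_eq (by ring)))
          _ = _ := by simp; ring
      calc _ ≤ ∑ i : Fin 2, ENNReal.ofReal S.bb * (8 * R * R) := Finset.sum_le_sum fun i _ => this i
        _ = ENNReal.ofReal S.bb * (16 * R * R) := by simp; ring
        _ ≤ _ := le_add_self
    · refine le_trans (L2_mono fun x => nl_crude S hf l x) ?_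
      refine (L2_sum _ (fun i => Finset.measurable_sum _ fun n _ => (hmc i n).const_mul _)).trans ?_
      have : ∀ i, L2 (fun x => ∑ n, ENNReal.ofReal S.bb * cv (wN 9 (f i)) (wN 9 (f n)) x) ≤
          ENNReal.ofReal S.bb * (4 * R * R) := by
        intro i
        refine (L2_sum _ (fun n => (hmc i n).const_mul _)).trans ?_
        calc _ ≤ ∑ n : Fin 2, ENNReal.ofReal S.bb * (2 * R * R) := by
              refine Finset.sum_le_sum fun n _ => ?_
              rw [L2_const_mul _ (hmc i n)]
              exact mul_le_mul' le_rfl ((L2_cv (measurable_wN 9 (hf i)) (measurable_wN 9 (hf n))).trans (mul_le_mul' (h9 i) (h9' n)))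
          _ = _ := by simp; ring
      calc _ ≤ ∑ i : Fin 2, ENNReal.ofReal S.bb * (4 * R * R) := Finset.sum_le_sum fun i _ => this i
        _ = ENNReal.ofReal S.bb * (8 * R * R) := by simp; ring
        _ ≤ ENNReal.ofReal S.bb * (16 * R * R) := by gcongr; norm_num
        _ ≤ _ := le_add_self

/-- refined bound of the nonlinearity -/
noncomputable def Sys.G (S : Sys) (m : ℝ → ℝ) (f : Fin 2 → ℝ → ℂ) (ξ : ℝ) : ℝ≥0∞ :=
  ∑ i : Fin 2, ∑ n : Fin 2, ENNReal.ofReal (128 * S.bb) *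
    (cv (fun y => ENNReal.ofReal ((1 + |y|)⁻¹) * Wm m (fun x => ‖f i x‖ₑ) y) (Wm m (fun x => ‖f n x‖ₑ)) ξ +
     cv (Wm m (fun x => ‖f i x‖ₑ)) (fun y => ENNReal.ofReal ((1 + |y|)⁻¹) * Wm m (fun x => ‖f n x‖ₑ) y) ξ)

lemma nl_fine (S : Sys) {m : ℝ → ℝ} (hm : GoodW m) {f : Fin 2 → ℝ → ℂ} (hf : ∀ i, Measurable (f i)) (l : Fin 2) (ξ : ℝ) :
    ENNReal.ofReal (m ξ) * ‖S.nl f l ξ‖ₑ ≤ ENNReal.ofReal (1 + |ξ|) * S.G m f ξ := by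
  refine (mul_le_mul' le_rfl (nl_enorm_le S f l ξ)).trans ?_
  unfold Sys.G
  rw [Finset.mul_sum, Finset.mul_sum]
  refine Finset.sum_le_sum fun i _ => ?_
  rw [Finset.mul_sum, Finset.mul_sum]
  refine Finset.sum_le_sum fun n _ => ?_
  have hmm := hm.cont.measurable
  have hfi := hf i
  have hfn := hf n
  unfold cv Wm
  rw [← lintegral_add_left (by fun_prop), ← lintegral_const_mul' _ _ ENNReal.ofReal_ne_top,
    ← lintegral_const_mul' _ _ ENNReal.ofReal_ne_top, ← lintegral_const_mul' _ _ ENNReal.ofReal_ne_top]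
  apply lintegral_mono; intro y
  simp only
  have hb := S.bb_pos
  have p1 := hm.pos y
  have p2 := hm.pos (ξ - y)
  have p3 := hm.pos ξ
  have key : m ξ * (S.bb * (|y| + |ξ - y|)) ≤
      (1 + |ξ|) * (128 * S.bb) * (((1 + |y|)⁻¹ + (1 + |ξ - y|)⁻¹) * (m y * m (ξ - y))) := by
    have h1 := hm.sub' y (ξ - y)
    have h2 := abs_add_min y (ξ - y)
    rw [add_sub_cancel] at h1 h2
    obtain ⟨ν, hν⟩ : ∃ ν, ν = min |y| |ξ - y| := ⟨_, rfl⟩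
    rw [← hν] at h1 h2
    have hν0 : 0 ≤ ν := by rw [hν]; positivity
    have h3 : (1 + ν)⁻¹ ≤ (1 + |y|)⁻¹ + (1 + |ξ - y|)⁻¹ := by
      have a1 : 0 ≤ (1 + |y|)⁻¹ := by positivity
      have a2 : 0 ≤ (1 + |ξ - y|)⁻¹ := by positivity
      rw [hν]
      rcases min_choice |y| |ξ - y| with h | h <;> rw [h] <;> linarith
    have h4 : |y| + |ξ - y| ≤ 2 * (1 + |ξ|) * (1 + ν) := by nlinarith [mul_nonneg (abs_nonneg ξ) hν0, abs_nonneg ξ]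
    have h5 : m ξ * (1 + ν) ≤ 64 * (m y * m (ξ - y)) * (1 + ν)⁻¹ := by
      rw [← div_eq_mul_inv, le_div_iff₀ (by positivity)]
      refine le_trans ?_ h1
      calc m ξ * (1 + ν) * (1 + ν) = m ξ * (1 + ν) ^ 2 := by ring
        _ ≤ _ := by
          gcongr
          · linarith
          · norm_num
    calc _ ≤ m ξ * (S.bb * (2 * (1 + |ξ|) * (1 + ν))) := by gcongr
      _ = 2 * S.bb * (1 + |ξ|) * (m ξ * (1 + ν)) := by ring
      _ ≤ 2 * S.bb * (1 + |ξ|) * (64 * (m y * m (ξ - y)) * (1 + ν)⁻¹) := by gcongr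
      _ ≤ 2 * S.bb * (1 + |ξ|) * (64 * (m y * m (ξ - y)) * ((1 + |y|)⁻¹ + (1 + |ξ - y|)⁻¹)) := by gcongr
      _ = _ := by ring
  calc _ = ENNReal.ofReal (m ξ * (S.bb * (|y| + |ξ - y|))) * (‖f i y‖ₑ * ‖f n (ξ - y)‖ₑ) := by
        rw [ENNReal.ofReal_mul p3.le, mul_assoc]
    _ ≤ ENNReal.ofReal ((1 + |ξ|) * (128 * S.bb) * (((1 + |y|)⁻¹ + (1 + |ξ - y|)⁻¹) * (m y * m (ξ - y)))) *
          (‖f i y‖ₑ * ‖f n (ξ - y)‖ₑ) := mul_le_mul' (ENNReal.ofReal_le_ofReal key) le_rfl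
    _ = _ := by
        rw [ENNReal.ofReal_mul (p := (1 + |ξ|) * (128 * S.bb)) (by positivity), ENNReal.ofReal_mul (p := 1 + |ξ|) (by positivity),
          ENNReal.ofReal_mul (p := (1 + |y|)⁻¹ + (1 + |ξ - y|)⁻¹) (by positivity),
          ENNReal.ofReal_add (p := (1 + |y|)⁻¹) (by positivity) (by positivity), ENNReal.ofReal_mul (p := m y) p1.le]
        ring

lemma measurable_G (S : Sys) {m : ℝ → ℝ} (hm : GoodW m) {f : Fin 2 → ℝ → ℂ} (hf : ∀ i, Measurable (f i)) :
    Measurable (S.G m f) := by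
  have hmm := hm.cont.measurable
  unfold Sys.G
  refine Finset.measurable_sum _ fun i _ => Finset.measurable_sum _ fun n _ => ?_
  have hi := measurable_Wm hmm (hf i).enorm
  have hn := measurable_Wm hmm (hf n).enorm
  refine ((measurable_cv ?_ ?_).add (measurable_cv ?_ ?_)).const_mul _ <;> fun_prop

lemma L2_G (S : Sys) {m : ℝ → ℝ} (hm : GoodW m) {f : Fin 2 → ℝ → ℂ} (hf : ∀ i, Measurable (f i))
    {b : ℝ≥0∞} (hb : ∀ i, L2 (Wm m (fun x => ‖f i x‖ₑ)) ≤ b) :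
    L2 (S.G m f) ≤ ENNReal.ofReal (2048 * S.bb) * b ^ 2 := by
  have hmm := hm.cont.measurable
  have hW : ∀ i, Measurable (Wm m (fun x => ‖f i x‖ₑ)) := fun i => measurable_Wm hmm (hf i).enorm
  have hWw : ∀ i, Measurable (fun y => ENNReal.ofReal ((1 + |y|)⁻¹) * Wm m (fun x => ‖f i x‖ₑ) y) := fun i => by
    have := hW i; fun_prop
  have h1 : ∀ i, ∫⁻ y, ENNReal.ofReal ((1 + |y|)⁻¹) * Wm m (fun x => ‖f i x‖ₑ) y ≤ 2 * b := fun i =>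
    (lint_le_L2 (hW i)).trans (by gcongr; exact hb i)
  have hbb := S.bb_pos
  unfold Sys.G
  have term : ∀ i n, L2 (fun ξ => ENNReal.ofReal (128 * S.bb) *
    (cv (fun y => ENNReal.ofReal ((1 + |y|)⁻¹) * Wm m (fun x => ‖f i x‖ₑ) y) (Wm m (fun x => ‖f n x‖ₑ)) ξ +
     cv (Wm m (fun x => ‖f i x‖ₑ)) (fun y => ENNReal.ofReal ((1 + |y|)⁻¹) * Wm m (fun x => ‖f n x‖ₑ) y) ξ)) ≤
     ENNReal.ofReal (512 * S.bb) * b ^ 2 := by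
    intro i n
    have m1 := measurable_cv (hWw i) (hW n)
    have m2 := measurable_cv (hW i) (hWw n)
    rw [L2_const_mul _ (by fun_prop)]
    calc _ ≤ ENNReal.ofReal (128 * S.bb) * (2 * b * b + 2 * b * b) := by
          refine mul_le_mul' le_rfl ((L2_add m1 m2).trans (add_le_add ?_ ?_))
          · exact (L2_cv (hWw i) (hW n)).trans (mul_le_mul' (h1 i) (hb n))
          · have : cv (Wm m (fun x => ‖f i x‖ₑ)) (fun y => ENNReal.ofReal ((1 + |y|)⁻¹) * Wm m (fun x => ‖f n x‖ₑ) y) =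
              cv (fun y => ENNReal.ofReal ((1 + |y|)⁻¹) * Wm m (fun x => ‖f n x‖ₑ) y) (Wm m (fun x => ‖f i x‖ₑ)) := by
              ext ξ; exact cv_comm ξ
            rw [this]
            exact (L2_cv (hWw n) (hW i)).trans (mul_le_mul' (h1 n) (hb i))
      _ = _ := by
          rw [show (512 : ℝ) * S.bb = 128 * S.bb * 4 by ring, ENNReal.ofReal_mul (p := 128 * S.bb) (by positivity)]
          rw [show ENNReal.ofReal 4 = 4 by simp]
          ring
  have mt : ∀ i n, Measurable (fun ξ => ENNReal.ofReal (128 * S.bb) *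
    (cv (fun y => ENNReal.ofReal ((1 + |y|)⁻¹) * Wm m (fun x => ‖f i x‖ₑ) y) (Wm m (fun x => ‖f n x‖ₑ)) ξ +
     cv (Wm m (fun x => ‖f i x‖ₑ)) (fun y => ENNReal.ofReal ((1 + |y|)⁻¹) * Wm m (fun x => ‖f n x‖ₑ) y) ξ)) := fun i n =>
    ((measurable_cv (hWw i) (hW n)).add (measurable_cv (hW i) (hWw n))).const_mul _
  refine (L2_sum _ fun i => Finset.measurable_sum _ fun n _ => mt i n).trans ?_
  calc _ ≤ ∑ i : Fin 2, ∑ n : Fin 2, ENNReal.ofReal (512 * S.bb) * b ^ 2 := by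
        refine Finset.sum_le_sum fun i _ => (L2_sum _ fun n => mt i n).trans ?_
        exact Finset.sum_le_sum fun n _ => term i n
    _ = _ := by
        rw [show (2048 : ℝ) * S.bb = 4 * (512 * S.bb) by ring, ENNReal.ofReal_mul (p := 4) (by positivity)]
        rw [show ENNReal.ofReal 4 = 4 by simp]
        simp
        ring

end PAn

namespace PAn
set_option linter.unusedVariables false

noncomputable def L3 (K : ℝ → ℝ → ℝ → ℝ) (f g h : ℝ → ℂ) : ℂ :=
  ∫ p : ℝ × ℝ, (K p.1 p.2 (-p.1 - p.2) : ℂ) * (f p.1 * g p.2 * h (-p.1 - p.2))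

noncomputable def L4 (K : ℝ → ℝ → ℝ → ℝ → ℝ) (f g h k : ℝ → ℂ) : ℂ :=
  ∫ w : ℝ × ℝ × ℝ, (K w.1 w.2.1 w.2.2 (-w.1 - w.2.1 - w.2.2) : ℂ) *
    (f w.1 * g w.2.1 * h w.2.2 * k (-w.1 - w.2.1 - w.2.2))

lemma enorm_L3_int (K : ℝ) (a b c : ℂ) : ‖(K : ℂ) * (a * b * c)‖ₑ = ENNReal.ofReal |K| * (‖a‖ₑ * ‖b‖ₑ * ‖c‖ₑ) := by
  simp only [enorm_mul]
  congr 1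
  rw [← ofReal_norm, Complex.norm_real, Real.norm_eq_abs]

lemma enorm_L4_int (K : ℝ) (a b c d : ℂ) :
    ‖(K : ℂ) * (a * b * c * d)‖ₑ = ENNReal.ofReal |K| * (‖a‖ₑ * ‖b‖ₑ * ‖c‖ₑ * ‖d‖ₑ) := by
  simp only [enorm_mul]
  congr 1
  rw [← ofReal_norm, Complex.norm_real, Real.norm_eq_abs]

lemma L3_le (K : ℝ → ℝ → ℝ → ℝ) (f g h : ℝ → ℂ) :
    ‖L3 K f g h‖ₑ ≤ I3 (fun x y z => ENNReal.ofReal |K x y z| * (‖f x‖ₑ * ‖g y‖ₑ * ‖h z‖ₑ)) := by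
  unfold L3 I3
  refine (enorm_integral_le_lintegral_enorm _).trans (le_of_eq ?_)
  congr 1; ext p; exact enorm_L3_int _ _ _ _

lemma L4_le (K : ℝ → ℝ → ℝ → ℝ → ℝ) (f g h k : ℝ → ℂ) :
    ‖L4 K f g h k‖ₑ ≤ I4 (fun x y z w => ENNReal.ofReal |K x y z w| * (‖f x‖ₑ * ‖g y‖ₑ * ‖h z‖ₑ * ‖k w‖ₑ)) := by
  unfold L4 I4
  refine (enorm_integral_le_lintegral_enorm _).trans (le_of_eq ?_)
  congr 1; ext p; exact enorm_L4_int _ _ _ _ _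

structure KB3 (c : ℝ) (K : ℝ → ℝ → ℝ → ℝ) : Prop where
  meas : M3able K
  bd : ∀ x y z, x + y + z = 0 → |K x y z| ≤ c * ((1 + |x|) ^ 8 * (1 + |y|) ^ 8 * (1 + |z|) ^ 8)

structure KB4 (c : ℝ) (K : ℝ → ℝ → ℝ → ℝ → ℝ) : Prop where
  meas : M4able K
  bd : ∀ x y z w, x + y + z + w = 0 → |K x y z w| ≤ c * ((1 + |x|) ^ 8 * (1 + |y|) ^ 8 * (1 + |z|) ^ 8 * (1 + |w|) ^ 8)

lemma KB3.c_nonneg {c : ℝ} {K} (h : KB3 c K) : 0 ≤ c := by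
  have := (abs_nonneg _).trans (h.bd 0 0 0 (by simp)); simpa using this

lemma KB4.c_nonneg {c : ℝ} {K} (h : KB4 c K) : 0 ≤ c := by
  have := (abs_nonneg _).trans (h.bd 0 0 0 0 (by simp)); simpa using this

lemma KB3.lint {c : ℝ} {K : ℝ → ℝ → ℝ → ℝ} (hK : KB3 c K) {B : ℝ≥0∞} {f g h : ℝ → ℂ} (hf : NiceB B f) (hg : NiceB B g)
    (hh : NiceB B h) :
    I3 (fun x y z => ENNReal.ofReal |K x y z| * (‖f x‖ₑ * ‖g y‖ₑ * ‖h z‖ₑ)) ≤ ENNReal.ofReal c * B ^ 3 := by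
  have hc := hK.c_nonneg
  calc _ ≤ ENNReal.ofReal c * I3 (fun x y z => wN 8 f x * wN 8 g y * wN 8 h z) := by
        unfold I3
        rw [← lintegral_const_mul' _ _ ENNReal.ofReal_ne_top]
        apply lintegral_mono; intro p
        simp only [wN]
        refine (mul_le_mul' (ENNReal.ofReal_le_ofReal (hK.bd p.1 p.2 (-p.1 - p.2) (by ring))) le_rfl).trans (le_of_eq ?_)
        generalize -p.1 - p.2 = z
        rw [ENNReal.ofReal_mul (p := c) hc, ENNReal.ofReal_mul (p := (1 + |p.1|) ^ 8 * (1 + |p.2|) ^ 8) (by positivity),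
          ENNReal.ofReal_mul (p := (1 + |p.1|) ^ 8) (by positivity)]
        ring
    _ ≤ ENNReal.ofReal c * (B * B * B) := by
        refine mul_le_mul' le_rfl ((I3_young (measurable_wN 8 hf.meas) (measurable_wN 8 hg.meas) (measurable_wN 8 hh.meas)).trans ?_)
        exact mul_le_mul' (mul_le_mul' hf.one hg.two) hh.two
    _ = _ := by ring

lemma KB4.lint {c : ℝ} {K : ℝ → ℝ → ℝ → ℝ → ℝ} (hK : KB4 c K) {B : ℝ≥0∞} {f g h k : ℝ → ℂ} (hf : NiceB B f) (hg : NiceB B g)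
    (hh : NiceB B h) (hk : NiceB B k) :
    I4 (fun x y z w => ENNReal.ofReal |K x y z w| * (‖f x‖ₑ * ‖g y‖ₑ * ‖h z‖ₑ * ‖k w‖ₑ)) ≤ ENNReal.ofReal c * B ^ 4 := by
  have hc := hK.c_nonneg
  calc _ ≤ ENNReal.ofReal c * I4 (fun x y z w => wN 8 f x * wN 8 g y * wN 8 h z * wN 8 k w) := by
        unfold I4
        rw [← lintegral_const_mul' _ _ ENNReal.ofReal_ne_top]
        apply lintegral_mono; intro p
        simp only [wN]
        refine (mul_le_mul' (ENNReal.ofReal_le_ofReal (hK.bd p.1 p.2.1 p.2.2 (-p.1 - p.2.1 - p.2.2) (by ring))) le_rfl).trans (le_of_eq ?_)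
        generalize -p.1 - p.2.1 - p.2.2 = z
        rw [ENNReal.ofReal_mul (p := c) hc,
          ENNReal.ofReal_mul (p := (1 + |p.1|) ^ 8 * (1 + |p.2.1|) ^ 8 * (1 + |p.2.2|) ^ 8) (by positivity),
          ENNReal.ofReal_mul (p := (1 + |p.1|) ^ 8 * (1 + |p.2.1|) ^ 8) (by positivity),
          ENNReal.ofReal_mul (p := (1 + |p.1|) ^ 8) (by positivity)]
        ring
    _ ≤ ENNReal.ofReal c * (B * B * B * B) := by
        refine mul_le_mul' le_rfl ((I4_young (measurable_wN 8 hf.meas) (measurable_wN 8 hg.meas) (measurable_wN 8 hh.meas)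
          (measurable_wN 8 hk.meas)).trans ?_)
        exact mul_le_mul' (mul_le_mul' (mul_le_mul' hf.one hg.one) hh.two) hk.two
    _ = _ := by ring

lemma KB3.meas_int {c : ℝ} {K : ℝ → ℝ → ℝ → ℝ} (hK : KB3 c K) {β : Type*} [MeasurableSpace β] {f g h : β → ℝ → ℂ}
    (hf : Measurable fun p : β × ℝ => f p.1 p.2) (hg : Measurable fun p : β × ℝ => g p.1 p.2)
    (hh : Measurable fun p : β × ℝ => h p.1 p.2) :
    Measurable fun q : β × ℝ × ℝ => (K q.2.1 q.2.2 (-q.2.1 - q.2.2) : ℂ) * (f q.1 q.2.1 * g q.1 q.2.2 * h q.1 (-q.2.1 - q.2.2)) := by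
  have h0 : Measurable fun q : β × ℝ × ℝ => K q.2.1 q.2.2 (-q.2.1 - q.2.2) :=
    hK.meas.comp (by fun_prop) (by fun_prop) (by fun_prop)
  have h1 : Measurable fun q : β × ℝ × ℝ => f q.1 q.2.1 :=
    hf.comp (by fun_prop : Measurable fun q : β × ℝ × ℝ => (q.1, q.2.1))
  have h2 : Measurable fun q : β × ℝ × ℝ => g q.1 q.2.2 :=
    hg.comp (by fun_prop : Measurable fun q : β × ℝ × ℝ => (q.1, q.2.2))
  have h3 : Measurable fun q : β × ℝ × ℝ => h q.1 (-q.2.1 - q.2.2) :=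
    hh.comp (by fun_prop : Measurable fun q : β × ℝ × ℝ => (q.1, -q.2.1 - q.2.2))
  exact (Complex.measurable_ofReal.comp h0).mul ((h1.mul h2).mul h3)

lemma KB4.meas_int {c : ℝ} {K : ℝ → ℝ → ℝ → ℝ → ℝ} (hK : KB4 c K) {β : Type*} [MeasurableSpace β] {f g h k : β → ℝ → ℂ}
    (hf : Measurable fun p : β × ℝ => f p.1 p.2) (hg : Measurable fun p : β × ℝ => g p.1 p.2)
    (hh : Measurable fun p : β × ℝ => h p.1 p.2) (hk : Measurable fun p : β × ℝ => k p.1 p.2) :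
    Measurable fun q : β × ℝ × ℝ × ℝ => (K q.2.1 q.2.2.1 q.2.2.2 (-q.2.1 - q.2.2.1 - q.2.2.2) : ℂ) *
      (f q.1 q.2.1 * g q.1 q.2.2.1 * h q.1 q.2.2.2 * k q.1 (-q.2.1 - q.2.2.1 - q.2.2.2)) := by
  have h0 : Measurable fun q : β × ℝ × ℝ × ℝ => K q.2.1 q.2.2.1 q.2.2.2 (-q.2.1 - q.2.2.1 - q.2.2.2) :=
    hK.meas.comp (by fun_prop) (by fun_prop) (by fun_prop) (by fun_prop)
  have h1 : Measurable fun q : β × ℝ × ℝ × ℝ => f q.1 q.2.1 :=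
    hf.comp (by fun_prop : Measurable fun q : β × ℝ × ℝ × ℝ => (q.1, q.2.1))
  have h2 : Measurable fun q : β × ℝ × ℝ × ℝ => g q.1 q.2.2.1 :=
    hg.comp (by fun_prop : Measurable fun q : β × ℝ × ℝ × ℝ => (q.1, q.2.2.1))
  have h3 : Measurable fun q : β × ℝ × ℝ × ℝ => h q.1 q.2.2.2 :=
    hh.comp (by fun_prop : Measurable fun q : β × ℝ × ℝ × ℝ => (q.1, q.2.2.2))
  have h4 : Measurable fun q : β × ℝ × ℝ × ℝ => k q.1 (-q.2.1 - q.2.2.1 - q.2.2.2) :=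
    hk.comp (by fun_prop : Measurable fun q : β × ℝ × ℝ × ℝ => (q.1, -q.2.1 - q.2.2.1 - q.2.2.2))
  exact (Complex.measurable_ofReal.comp h0).mul (((h1.mul h2).mul h3).mul h4)

lemma KB3.integrable {c : ℝ} {K : ℝ → ℝ → ℝ → ℝ} (hK : KB3 c K) {B : ℝ≥0∞} (hB : B ≠ ⊤) {f g h : ℝ → ℂ}
    (hf : NiceB B f) (hg : NiceB B g) (hh : NiceB B h) :
    Integrable fun p : ℝ × ℝ => (K p.1 p.2 (-p.1 - p.2) : ℂ) * (f p.1 * g p.2 * h (-p.1 - p.2)) := by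
  have hm : Measurable fun p : ℝ × ℝ => (K p.1 p.2 (-p.1 - p.2) : ℂ) * (f p.1 * g p.2 * h (-p.1 - p.2)) := by
    have := hf.meas; have := hg.meas; have := hh.meas
    have h0 : Measurable fun p : ℝ × ℝ => K p.1 p.2 (-p.1 - p.2) :=
      hK.meas.comp (by fun_prop) (by fun_prop) (by fun_prop)
    refine (Complex.measurable_ofReal.comp h0).mul ?_
    fun_prop
  refine ⟨hm.aestronglyMeasurable, ?_⟩
  unfold HasFiniteIntegral
  simp only [enorm_L3_int]
  refine lt_of_le_of_lt (hK.lint hf hg hh) ?_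
  exact ENNReal.mul_lt_top ENNReal.ofReal_lt_top (ENNReal.pow_lt_top hB.lt_top)

lemma KB4.integrable {c : ℝ} {K : ℝ → ℝ → ℝ → ℝ → ℝ} (hK : KB4 c K) {B : ℝ≥0∞} (hB : B ≠ ⊤) {f g h k : ℝ → ℂ}
    (hf : NiceB B f) (hg : NiceB B g) (hh : NiceB B h) (hk : NiceB B k) :
    Integrable fun w : ℝ × ℝ × ℝ => (K w.1 w.2.1 w.2.2 (-w.1 - w.2.1 - w.2.2) : ℂ) *
    (f w.1 * g w.2.1 * h w.2.2 * k (-w.1 - w.2.1 - w.2.2)) := by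
  have hm : Measurable fun w : ℝ × ℝ × ℝ => (K w.1 w.2.1 w.2.2 (-w.1 - w.2.1 - w.2.2) : ℂ) *
    (f w.1 * g w.2.1 * h w.2.2 * k (-w.1 - w.2.1 - w.2.2)) := by
    have := hf.meas; have := hg.meas; have := hh.meas; have := hk.meas
    have h0 : Measurable fun w : ℝ × ℝ × ℝ => K w.1 w.2.1 w.2.2 (-w.1 - w.2.1 - w.2.2) :=
      hK.meas.comp (by fun_prop) (by fun_prop) (by fun_prop) (by fun_prop)
    refine (Complex.measurable_ofReal.comp h0).mul ?_
    fun_prop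
  refine ⟨hm.aestronglyMeasurable, ?_⟩
  unfold HasFiniteIntegral
  simp only [enorm_L4_int]
  refine lt_of_le_of_lt (hK.lint hf hg hh hk) ?_
  exact ENNReal.mul_lt_top ENNReal.ofReal_lt_top (ENNReal.pow_lt_top hB.lt_top)

/-! kernels -/

lemma oneadd_pow_le {x : ℝ} {a b : ℕ} (h : a ≤ b) : (1 + |x|) ^ a ≤ (1 + |x|) ^ b :=
  pow_le_pow_right₀ (by linarith [abs_nonneg x]) h

noncomputable def Sys.K1 (S : Sys) (m : ℝ → ℝ) (j k l : Fin 2) (x y z : ℝ) : ℝ :=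
  2 * (S.e j * m x ^ 2 * (S.b j k l * y + S.b j l k * z))

lemma q_simple {S : Sys} {C : ℝ} (hS : S.Adm C) {m : ℝ → ℝ} (hm : GoodW m) (j k l : Fin 2) {x y z : ℝ}
    (hs : x + y + z = 0) : |S.q m j k l x y z| ≤ 64 * C * (m x * m y * m z) * ((1 + |x|)⁻¹ + (1 + |y|)⁻¹ + (1 + |z|)⁻¹) := by
  obtain ⟨N, μ, hx, hy, hz, hμ, hμx, hμy, hμz, hμe, hq⟩ := q_bd hS hm j k l hs
  have hC := hS.C_pos
  have p1 := hm.pos x; have p2 := hm.pos y; have p3 := hm.pos z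
  have hN : 0 ≤ N := (abs_nonneg x).trans hx
  have a0 : 0 ≤ |S.q m j k l x y z| := abs_nonneg _
  have h1 : |S.q m j k l x y z| * (1 + μ) ≤ 64 * C * (m x * m y * m z) := by
    refine le_trans ?_ hq
    have : (1 + μ) ≤ (1 + N) * (1 + μ) ^ 4 := by
      have b1 : (1 + μ) ^ 1 ≤ (1 + μ) ^ 4 := pow_le_pow_right₀ (by linarith) (by norm_num)
      nlinarith [pow_pos (by linarith : 0 < 1 + μ) 4]
    nlinarith
  have h2 : |S.q m j k l x y z| ≤ 64 * C * (m x * m y * m z) * (1 + μ)⁻¹ := by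
    rw [← div_eq_mul_inv, le_div_iff₀ (by positivity)]; exact h1
  refine h2.trans ?_
  have q1 : 0 ≤ (1 + |x|)⁻¹ := by positivity
  have q2 : 0 ≤ (1 + |y|)⁻¹ := by positivity
  have q3 : 0 ≤ (1 + |z|)⁻¹ := by positivity
  have : (1 + μ)⁻¹ ≤ (1 + |x|)⁻¹ + (1 + |y|)⁻¹ + (1 + |z|)⁻¹ := by
    rcases hμe with h | h | h <;> rw [h] <;> linarith
  gcongr

lemma q_le' {S : Sys} {C : ℝ} (hS : S.Adm C) {m : ℝ → ℝ} (hm : GoodW m) (j k l : Fin 2) {x y z : ℝ}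
    (hs : x + y + z = 0) : |S.q m j k l x y z| ≤ 192 * C * (m x * m y * m z) := by
  refine (q_simple hS hm j k l hs).trans ?_
  have hC := hS.C_pos
  have p1 := hm.pos x; have p2 := hm.pos y; have p3 := hm.pos z
  have q1 : ∀ x : ℝ, (1 + |x|)⁻¹ ≤ 1 := fun x => inv_le_one_of_one_le₀ (by linarith [abs_nonneg x])
  calc _ ≤ 64 * C * (m x * m y * m z) * (1 + 1 + 1) := by gcongr <;> exact q1 _
    _ = _ := by ring

lemma Ph_le (S : Sys) (j k l : Fin 2) (x y z : ℝ) :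
    |S.Ph j k l x y z| ≤ (|S.α j| + |S.α k| + |S.α l|) * ((1 + |x|) ^ 4 * (1 + |y|) ^ 4 * (1 + |z|) ^ 4) := by
  have hp : ∀ x : ℝ, |x| ^ 3 ≤ (1 + |x|) ^ 4 := fun x => by
    calc |x| ^ 3 ≤ (1 + |x|) ^ 3 := by gcongr; linarith
      _ ≤ _ := oneadd_pow_le (by norm_num)
  have h1 : ∀ x : ℝ, 1 ≤ (1 + |x|) ^ 4 := fun x => one_le_pow₀ (by linarith [abs_nonneg x])
  have n1 := h1 x; have n2 := h1 y; have n3 := h1 z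
  unfold Sys.Ph
  refine (abs_add_three _ _ _).trans ?_
  rw [abs_mul, abs_mul, abs_mul, abs_pow, abs_pow, abs_pow, add_mul, add_mul]
  have g1 : |x| ^ 3 ≤ (1 + |x|) ^ 4 * (1 + |y|) ^ 4 * (1 + |z|) ^ 4 := by
    calc _ = |x| ^ 3 * 1 * 1 := by ring
      _ ≤ _ := by gcongr; exact hp x
  have g2 : |y| ^ 3 ≤ (1 + |x|) ^ 4 * (1 + |y|) ^ 4 * (1 + |z|) ^ 4 := by
    calc _ = 1 * |y| ^ 3 * 1 := by ring
      _ ≤ _ := by gcongr; exact hp y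
  have g3 : |z| ^ 3 ≤ (1 + |x|) ^ 4 * (1 + |y|) ^ 4 * (1 + |z|) ^ 4 := by
    calc _ = 1 * 1 * |z| ^ 3 := by ring
      _ ≤ _ := by gcongr; exact hp z
  gcongr

end PAn

namespace PAn
set_option linter.unusedVariables false

lemma KB3.mono {c c' : ℝ} {K} (h : KB3 c K) (hc : c ≤ c') : KB3 c' K :=
  ⟨h.meas, fun x y z hs => (h.bd x y z hs).trans (mul_le_mul_of_nonneg_right hc (by positivity))⟩

lemma KB4.mono {c c' : ℝ} {K} (h : KB4 c K) (hc : c ≤ c') : KB4 c' K :=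
  ⟨h.meas, fun x y z w hs => (h.bd x y z w hs).trans (mul_le_mul_of_nonneg_right hc (by positivity))⟩

lemma w48 (x : ℝ) : (1 + |x|) ^ 4 ≤ (1 + |x|) ^ 8 := oneadd_pow_le (by norm_num)

lemma q_bd4 {S : Sys} {C : ℝ} (hS : S.Adm C) {m : ℝ → ℝ} (hm : GoodW m) {D : ℝ} (hD0 : 0 < D) (hD : ∀ x, m x ≤ D * (1 + |x|) ^ 4)
    (j k l : Fin 2) (x y z : ℝ) (hs : x + y + z = 0) :
    |S.q m j k l x y z| ≤ 192 * C * D ^ 3 * ((1 + |x|) ^ 4 * (1 + |y|) ^ 4 * (1 + |z|) ^ 4) := by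
  have hC := hS.C_pos
  have p1 := hm.pos x; have p2 := hm.pos y; have p3 := hm.pos z
  have d1 := hD x; have d2 := hD y; have d3 := hD z
  refine (q_le' hS hm j k l hs).trans ?_
  have nX : 0 ≤ (1 + |x|) ^ 4 := by positivity
  generalize (1 + |x|) ^ 4 = X at *
  have nY : 0 ≤ (1 + |y|) ^ 4 := by positivity
  generalize (1 + |y|) ^ 4 = Y at *
  have nZ : 0 ≤ (1 + |z|) ^ 4 := by positivity
  generalize (1 + |z|) ^ 4 = Z at *
  calc 192 * C * (m x * m y * m z) ≤ 192 * C * ((D * X) * (D * Y) * (D * Z)) := by gcongr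
    _ = _ := by ring

lemma kb_q {S : Sys} {C : ℝ} (hS : S.Adm C) {m : ℝ → ℝ} (hm : GoodW m) {D : ℝ} (hD0 : 0 < D) (hD : ∀ x, m x ≤ D * (1 + |x|) ^ 4)
    (j k l : Fin 2) : KB3 (192 * C * D ^ 3) (S.q m j k l) := by
  have hC := hS.C_pos
  refine ⟨q_meas hm.cont.measurable j k l (by fun_prop) (by fun_prop) (by fun_prop), fun x y z hs => ?_⟩
  refine (q_bd4 hS hm hD0 hD j k l x y z hs).trans ?_
  have := w48 x; have := w48 y; have := w48 z
  apply mul_le_mul_of_nonneg_left _ (by positivity)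
  apply mul_le_mul (mul_le_mul _ _ _ _) <;> first | positivity | assumption

noncomputable def Sys.Pq (S : Sys) (m : ℝ → ℝ) (j k l : Fin 2) (x y z : ℝ) : ℝ := S.Ph j k l x y z * S.q m j k l x y z

lemma kb_Pq {S : Sys} {C : ℝ} (hS : S.Adm C) {m : ℝ → ℝ} (hm : GoodW m) {D : ℝ} (hD0 : 0 < D) (hD : ∀ x, m x ≤ D * (1 + |x|) ^ 4)
    (j k l : Fin 2) : KB3 ((|S.α j| + |S.α k| + |S.α l|) * (192 * C * D ^ 3)) (S.Pq m j k l) := by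
  have hC := hS.C_pos
  refine ⟨?_, fun x y z hs => ?_⟩
  · have := q_meas (S := S) hm.cont.measurable j k l (β := ℝ × ℝ × ℝ) (f := fun p => p.1) (g := fun p => p.2.1) (h := fun p => p.2.2)
      (by fun_prop) (by fun_prop) (by fun_prop)
    unfold M3able Sys.Pq
    refine Measurable.mul ?_ this
    unfold Sys.Ph
    fun_prop
  · unfold Sys.Pq
    rw [abs_mul]
    have h1 := mul_le_mul (Ph_le S j k l x y z) (q_bd4 hS hm hD0 hD j k l x y z hs) (abs_nonneg _) (by positivity)
    refine h1.trans (le_of_eq ?_)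
    have e : ∀ x : ℝ, (1 + |x|) ^ 8 = (1 + |x|) ^ 4 * (1 + |x|) ^ 4 := fun x => by rw [← pow_add]
    rw [e x, e y, e z]
    have nX : 0 ≤ (1 + |x|) ^ 4 := by positivity
    generalize (1 + |x|) ^ 4 = X at *
    have nY : 0 ≤ (1 + |y|) ^ 4 := by positivity
    generalize (1 + |y|) ^ 4 = Y at *
    have nZ : 0 ≤ (1 + |z|) ^ 4 := by positivity
    generalize (1 + |z|) ^ 4 = Z at *
    ring

lemma kb_m2 {m : ℝ → ℝ} (hm : GoodW m) {D : ℝ} (hD : ∀ x, m x ≤ D * (1 + |x|) ^ 4) (x : ℝ) : m x ^ 2 ≤ D ^ 2 * (1 + |x|) ^ 8 := by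
  have e : (1 + |x|) ^ 8 = ((1 + |x|) ^ 4) ^ 2 := by rw [← pow_mul]
  rw [e, ← mul_pow]
  exact pow_le_pow_left₀ (hm.pos x).le (hD x) 2

lemma kb_K1 {S : Sys} {C : ℝ} (hS : S.Adm C) {m : ℝ → ℝ} (hm : GoodW m) {D : ℝ} (hD0 : 0 < D) (hD : ∀ x, m x ≤ D * (1 + |x|) ^ 4)
    (j k l : Fin 2) : KB3 (2 * S.e j * D ^ 2 * S.bb) (S.K1 m j k l) := by
  have hb := S.bb_pos
  refine ⟨?_, fun x y z hs => ?_⟩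
  · have := hm.cont.measurable
    unfold M3able Sys.K1
    fun_prop
  · unfold Sys.K1
    have hj := hS.e_pos j
    rw [abs_mul, abs_mul, abs_mul, abs_of_pos hj, abs_of_nonneg (sq_nonneg (m x)), abs_of_pos (by norm_num : (0:ℝ) < 2)]
    have hyz : |y| + |z| ≤ (1 + |y|) ^ 8 * (1 + |z|) ^ 8 := by
      have e1 : (1 + |y|) ^ 1 ≤ (1 + |y|) ^ 8 := oneadd_pow_le (by norm_num)
      have e2 : (1 + |z|) ^ 1 ≤ (1 + |z|) ^ 8 := oneadd_pow_le (by norm_num)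
      rw [pow_one] at e1 e2
      have := mul_le_mul e1 e2 (by positivity) (by positivity)
      nlinarith [mul_nonneg (abs_nonneg y) (abs_nonneg z)]
    have h1 := S.B_le j k l y z
    have h2 := kb_m2 hm hD x
    have nX : 0 ≤ (1 + |x|) ^ 8 := by positivity
    generalize (1 + |x|) ^ 8 = X at *
    have nY : 0 ≤ (1 + |y|) ^ 8 := by positivity
    generalize (1 + |y|) ^ 8 = Y at *
    have nZ : 0 ≤ (1 + |z|) ^ 8 := by positivity
    generalize (1 + |z|) ^ 8 = Z at *
    have h3 : |S.b j k l * y + S.b j l k * z| ≤ S.bb * (Y * Z) := h1.trans (by gcongr)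
    calc _ ≤ 2 * (S.e j * (D ^ 2 * X) * (S.bb * (Y * Z))) := by gcongr
      _ = _ := by ring

lemma kb_M4 {S : Sys} {C : ℝ} (hS : S.Adm C) {m : ℝ → ℝ} (hm : GoodW m) {D : ℝ} (hD0 : 0 < D) (hD : ∀ x, m x ≤ D * (1 + |x|) ^ 4)
    (j k l i n : Fin 2) : KB4 (Dc S C * D ^ 4) (S.M4 m j k l i n) := by
  have hDc := Dc_pos hS
  refine ⟨M4_meas hm.cont.measurable j k l i n, fun x y z w hs => ?_⟩
  have p1 := hm.pos x; have p2 := hm.pos y; have p3 := hm.pos z; have p4 := hm.pos w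
  have h0 := (M4_bd hS hm j k l i n hs (le_refl 0) (Tri_zero x y z w)).1
  rw [add_zero, one_pow, mul_one] at h0
  have d : ∀ x, m x ≤ D * (1 + |x|) ^ 8 := fun x => (hD x).trans (mul_le_mul_of_nonneg_left (w48 x) hD0.le)
  have d1 := d x; have d2 := d y; have d3 := d z; have d4 := d w
  refine h0.trans ?_
  have nX : 0 ≤ (1 + |x|) ^ 8 := by positivity
  generalize (1 + |x|) ^ 8 = X at *
  have nY : 0 ≤ (1 + |y|) ^ 8 := by positivity
  generalize (1 + |y|) ^ 8 = Y at *
  have nZ : 0 ≤ (1 + |z|) ^ 8 := by positivity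
  generalize (1 + |z|) ^ 8 = Z at *
  have nW : 0 ≤ (1 + |w|) ^ 8 := by positivity
  generalize (1 + |w|) ^ 8 = W at *
  calc _ ≤ Dc S C * ((D * X) * (D * Y) * (D * Z) * (D * W)) := by gcongr
    _ = _ := by ring

/-- all kernels are polynomially bounded -/
lemma kernels {S : Sys} {C : ℝ} (hS : S.Adm C) {m : ℝ → ℝ} (hm : GoodW m) :
    ∃ c, 0 ≤ c ∧ (∀ j k l, KB3 c (S.q m j k l)) ∧ (∀ j k l, KB3 c (S.Pq m j k l)) ∧
      (∀ j k l, KB3 c (S.K1 m j k l)) ∧ (∀ j k l i n, KB4 c (S.M4 m j k l i n)) ∧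
      (∀ x, m x ^ 2 ≤ c * (1 + |x|) ^ 8) := by
  obtain ⟨D, hD⟩ := hm.crude
  have hD0 : 0 < D := by have := hD 0; have := hm.pos 0; simp at *; linarith
  have hC := hS.C_pos
  have hDc := Dc_pos hS
  have hb := S.bb_pos
  have hc1 : 0 < 192 * C * D ^ 3 := by positivity
  have hc4 : 0 < Dc S C * D ^ 4 := by positivity
  have hc2 : 0 < D ^ 2 := by positivity
  have hA : ∀ j, |S.α j| ≤ |S.α 0| + |S.α 1| := fun j => by
    have := abs_nonneg (S.α 0); have := abs_nonneg (S.α 1)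
    fin_cases j <;> simp
  have he : ∀ j, S.e j ≤ S.e 0 + S.e 1 := fun j => by
    have := hS.e_pos 0; have := hS.e_pos 1
    fin_cases j <;> simp <;> linarith
  have h0 := hS.e_pos 0; have h1 := hS.e_pos 1
  have q1 := fun j k l => kb_q hS hm hD0 hD j k l
  have q2 := fun j k l => kb_Pq hS hm hD0 hD j k l
  have q3 := fun j k l => kb_K1 hS hm hD0 hD j k l
  have q4 := fun j k l i n => kb_M4 hS hm hD0 hD j k l i n
  have q5 := fun x => kb_m2 hm hD x
  generalize 192 * C * D ^ 3 = c1 at *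
  generalize Dc S C * D ^ 4 = c4 at *
  generalize D ^ 2 = c2 at *
  generalize |S.α 0| + |S.α 1| = A at *
  have hA0 : 0 ≤ A := (abs_nonneg _).trans (hA 0)
  generalize hee : S.e 0 + S.e 1 = e at *
  have he0 : 0 < e := by linarith
  have z1 : 0 ≤ (A + A + A) * c1 := by positivity
  have z2 : 0 ≤ 2 * e * c2 * S.bb := by positivity
  refine ⟨c1 + (A + A + A) * c1 + 2 * e * c2 * S.bb + c4 + c2, by positivity, fun j k l => (q1 j k l).mono (by linarith),
    fun j k l => (q2 j k l).mono ?_, fun j k l => (q3 j k l).mono ?_, fun j k l i n => (q4 j k l i n).mono (by linarith), fun x => ?_⟩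
  · have : (|S.α j| + |S.α k| + |S.α l|) * c1 ≤ (A + A + A) * c1 :=
      mul_le_mul_of_nonneg_right (add_le_add (add_le_add (hA j) (hA k)) (hA l)) hc1.le
    linarith
  · have : 2 * S.e j * c2 * S.bb ≤ 2 * e * c2 * S.bb := by
      have := he j
      gcongr
    linarith
  · refine (q5 x).trans (mul_le_mul_of_nonneg_right (by linarith) (by positivity))

end PAn

namespace PAn
set_option linter.unusedVariables false

lemma alg_rr {κ X M P b : ℝ} (hκ : 0 < κ) (hX : 0 ≤ X) (h : |M| ≤ b) :
    |M * P / ((κ * (1 + X)) ^ 2 + P ^ 2)| ≤ b / κ ∧ |M * (κ * (1 + X)) ^ 2 / ((κ * (1 + X)) ^ 2 + P ^ 2)| ≤ b ∧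
      |P * (M * P / ((κ * (1 + X)) ^ 2 + P ^ 2))| ≤ b := by
  have hA : κ ≤ κ * (1 + X) := by nlinarith
  generalize κ * (1 + X) = A at *
  have hA0 : 0 < A := hκ.trans_le hA
  have hb : 0 ≤ b := (abs_nonneg _).trans h
  have hp : 0 < A ^ 2 + P ^ 2 := by positivity
  have h1 : |P / (A ^ 2 + P ^ 2)| ≤ 1 / κ := by
    rw [abs_div, abs_of_pos hp, div_le_div_iff₀ hp hκ, ← sq_abs P]
    nlinarith [sq_nonneg (|P| - κ), abs_nonneg P]
  have h2 : |A ^ 2 / (A ^ 2 + P ^ 2)| ≤ 1 := by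
    rw [abs_div, abs_of_pos hp, div_le_one hp, abs_of_nonneg (sq_nonneg A)]; nlinarith [sq_nonneg P]
  have h3 : |P ^ 2 / (A ^ 2 + P ^ 2)| ≤ 1 := by
    rw [abs_div, abs_of_pos hp, div_le_one hp, abs_of_nonneg (sq_nonneg P)]; nlinarith [sq_nonneg A]
  refine ⟨?_, ?_, ?_⟩
  · rw [mul_div_assoc, abs_mul]
    calc _ ≤ b * (1 / κ) := mul_le_mul h h1 (abs_nonneg _) hb
      _ = _ := by ring
  · rw [mul_div_assoc, abs_mul]
    calc _ ≤ b * 1 := mul_le_mul h h2 (abs_nonneg _) hb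
      _ = _ := by ring
  · rw [show P * (M * P / (A ^ 2 + P ^ 2)) = M * (P ^ 2 / (A ^ 2 + P ^ 2)) by ring, abs_mul]
    calc _ ≤ b * 1 := mul_le_mul h h3 (abs_nonneg _) hb
      _ = _ := by ring

lemma kernels_rr {S : Sys} {m : ℝ → ℝ} (hm : GoodW m) {κ c : ℝ} (hκ : 0 < κ) {j k l i n : Fin 2}
    (h : KB4 c (S.M4 m j k l i n)) : KB4 (c / κ) (S.rr m κ j k l i n) := by
  refine ⟨rr_meas hm.cont.measurable κ j k l i n, fun x y z w hs => ?_⟩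
  refine (alg_rr hκ (XX_nonneg x y z w) (h.bd x y z w hs)).1.trans (le_of_eq ?_)
  rw [mul_div_right_comm]

lemma kernels_nr {S : Sys} {m : ℝ → ℝ} (hm : GoodW m) {κ c : ℝ} (hκ : 0 < κ) {j k l i n : Fin 2}
    (h : KB4 c (S.M4 m j k l i n)) : KB4 c (S.nr m κ j k l i n) :=
  ⟨nr_meas hm.cont.measurable κ j k l i n, fun x y z w hs =>
    (alg_rr hκ (XX_nonneg x y z w) (h.bd x y z w hs)).2.1⟩

noncomputable def Sys.pr (S : Sys) (m : ℝ → ℝ) (κ : ℝ) (j k l i n : Fin 2) (x1 x2 x3 x4 : ℝ) : ℝ :=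
  S.P4 j k i n x1 x2 x3 x4 * S.rr m κ j k l i n x1 x2 x3 x4

lemma kernels_pr {S : Sys} {m : ℝ → ℝ} (hm : GoodW m) {κ c : ℝ} (hκ : 0 < κ) {j k l i n : Fin 2}
    (h : KB4 c (S.M4 m j k l i n)) : KB4 c (S.pr m κ j k l i n) := by
  refine ⟨?_, fun x y z w hs => (alg_rr hκ (XX_nonneg x y z w) (h.bd x y z w hs)).2.2⟩
  have h1 : M4able (S.rr m κ j k l i n) := rr_meas hm.cont.measurable κ j k l i n
  have h2 : M4able (S.P4 j k i n) := P4_meas j k i n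
  unfold M4able at *
  unfold Sys.pr
  exact Measurable.mul h2 h1

end PAn

namespace PAn
set_option linter.unusedVariables false

lemma L3q_le {S : Sys} {C : ℝ} (hS : S.Adm C) {m : ℝ → ℝ} (hm : GoodW m) (j k l : Fin 2) {f g h : ℝ → ℂ}
    (hf : Measurable f) (hg : Measurable g) (hh : Measurable h) {b : ℝ≥0∞}
    (bf : L2 (Wm m (fun x => ‖f x‖ₑ)) ≤ b) (bg : L2 (Wm m (fun x => ‖g x‖ₑ)) ≤ b) (bh : L2 (Wm m (fun x => ‖h x‖ₑ)) ≤ b) :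
    ‖L3 (S.q m j k l) f g h‖ₑ ≤ ENNReal.ofReal (384 * C) * b ^ 3 := by
  have hC := hS.C_pos
  have mm := hm.cont.measurable
  refine (L3_le _ _ _ _).trans ?_
  obtain ⟨F, hF⟩ : ∃ F, F = Wm m (fun x => ‖f x‖ₑ) := ⟨_, rfl⟩
  obtain ⟨G, hG⟩ : ∃ F, F = Wm m (fun x => ‖g x‖ₑ) := ⟨_, rfl⟩
  obtain ⟨H, hH⟩ : ∃ F, F = Wm m (fun x => ‖h x‖ₑ) := ⟨_, rfl⟩
  have mF : Measurable F := by rw [hF]; exact measurable_Wm mm hf.enorm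
  have mG : Measurable G := by rw [hG]; exact measurable_Wm mm hg.enorm
  have mH : Measurable H := by rw [hH]; exact measurable_Wm mm hh.enorm
  rw [← hF] at bf; rw [← hG] at bg; rw [← hH] at bh
  obtain ⟨w, hw⟩ : ∃ w : ℝ → ℝ≥0∞, w = fun x => ENNReal.ofReal ((1 + |x|)⁻¹) := ⟨_, rfl⟩
  have mw : Measurable w := by rw [hw]; fun_prop
  have one : ∀ F G H : ℝ → ℝ≥0∞, Measurable F → Measurable G → Measurable H → L2 F ≤ b → L2 G ≤ b → L2 H ≤ b →
      I3 (fun x y z => (w x * F x) * G y * H z) ≤ 2 * b ^ 3 := by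
    intro F G H mF mG mH bF bG bH
    refine (I3_young (mw.mul mF) mG mH).trans ?_
    have : ∫⁻ x, (w * F) x ≤ 2 * b := by
      have h1 := lint_le_L2 mF
      rw [hw]
      exact h1.trans (mul_le_mul' le_rfl bF)
    exact (mul_le_mul' (mul_le_mul' this bG) bH).trans (le_of_eq (by ring))
  have t1 := one F G H mF mG mH bf bg bh
  have t2 := one G H F mG mH mF bg bh bf
  have t3 := one H F G mH mF mG bh bf bg
  have c2 : I3 (fun x y z => (w y * G y) * H z * F x) ≤ 2 * b ^ 3 := by
    have := I3_cyc (Ψ := fun a b c => (w a * G a) * H b * F c) (by unfold M3able; fun_prop)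
    exact (le_of_eq this).trans t2
  have c3 : I3 (fun x y z => (w z * H z) * F x * G y) ≤ 2 * b ^ 3 := by
    have e1 := I3_cyc (Ψ := fun a b c => (w b * H b) * F c * G a) (by unfold M3able; fun_prop)
    have e2 := I3_cyc (Ψ := fun a b c => (w a * H a) * F b * G c) (by unfold M3able; fun_prop)
    exact (le_of_eq e1).trans ((le_of_eq e2).trans t3)
  calc _ ≤ ENNReal.ofReal (64 * C) * (I3 (fun x y z => (w x * F x) * G y * H z) + I3 (fun x y z => (w y * G y) * H z * F x)
        + I3 (fun x y z => (w z * H z) * F x * G y)) := by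
        unfold I3
        rw [← lintegral_add_left (by fun_prop), ← lintegral_add_left (by fun_prop),
          ← lintegral_const_mul' _ _ ENNReal.ofReal_ne_top]
        apply lintegral_mono; intro p
        simp only
        have hq := q_simple hS hm j k l (x := p.1) (y := p.2) (z := -p.1 - p.2) (by ring)
        generalize -p.1 - p.2 = z at *
        have p1 := hm.pos p.1; have p2 := hm.pos p.2; have p3 := hm.pos z
        refine (mul_le_mul' (ENNReal.ofReal_le_ofReal hq) le_rfl).trans (le_of_eq ?_)
        rw [ENNReal.ofReal_mul (p := 64 * C * (m p.1 * m p.2 * m z)) (by positivity), ENNReal.ofReal_mul (p := 64 * C) (by positivity),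
          ENNReal.ofReal_mul (p := m p.1 * m p.2) (by positivity), ENNReal.ofReal_mul (p := m p.1) (by positivity),
          ENNReal.ofReal_add (p := (1 + |p.1|)⁻¹ + (1 + |p.2|)⁻¹) (by positivity) (by positivity),
          ENNReal.ofReal_add (p := (1 + |p.1|)⁻¹) (by positivity) (by positivity), hF, hG, hH, hw]
        simp only [Wm]
        ring
    _ ≤ ENNReal.ofReal (64 * C) * (2 * b ^ 3 + 2 * b ^ 3 + 2 * b ^ 3) :=
        mul_le_mul' le_rfl (add_le_add (add_le_add t1 c2) c3)
    _ = _ := by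
        rw [show 384 * C = 64 * C * 6 by ring, ENNReal.ofReal_mul (p := 64 * C) (by positivity)]
        rw [show ENNReal.ofReal 6 = 6 by simp]
        ring

lemma L3_cyc {c : ℝ} {K : ℝ → ℝ → ℝ → ℝ} (hK : KB3 c K) {f g h : ℝ → ℂ} (hf : Measurable f) (hg : Measurable g) (hh : Measurable h) :
    L3 (fun x y z => K y z x) f g h = L3 K g h f := by
  unfold L3
  have h0 : Measurable fun p : ℝ × ℝ => K p.1 p.2 (-p.1 - p.2) :=
    hK.meas.comp (by fun_prop) (by fun_prop) (by fun_prop)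
  have hm : Measurable fun p : ℝ × ℝ => (K p.1 p.2 (-p.1 - p.2) : ℂ) * (g p.1 * h p.2 * f (-p.1 - p.2)) := by
    refine (Complex.measurable_ofReal.comp h0).mul ?_
    fun_prop
  conv_rhs => rw [← mpc.map_eq]
  rw [integral_map mpc.measurable.aemeasurable hm.aestronglyMeasurable]
  congr 1; ext p
  simp only
  rw [show -p.2 - (-p.1 - p.2) = p.1 by ring]
  ring

/-- quadratic identity, before symmetrization -/
lemma E_id1 {S : Sys} {m : ℝ → ℝ} {c : ℝ} {B : ℝ≥0∞} (hB : B ≠ ⊤)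
    {f : Fin 2 → ℝ → ℂ} (hf : ∀ i, NiceB B (f i)) (j : Fin 2) (hK : ∀ k l, KB3 c (S.K1 m j k l)) :
    2 * (S.e j : ℂ) * ∫ x, (m x ^ 2 : ℂ) * (f j x * S.nl f j (-x)) = Complex.I * ∑ k, ∑ l, L3 (S.K1 m j k l) (f j) (f k) (f l) := by
  have hInt := fun k l => (hK k l).integrable hB (hf j) (hf k) (hf l)
  have e1 : ∀ k l, L3 (S.K1 m j k l) (f j) (f k) (f l) = ∫ x, ∫ y, (S.K1 m j k l x y (-x - y) : ℂ) * (f j x * f k y * f l (-x - y)) := by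
    intro k l
    unfold L3
    rw [Measure.volume_eq_prod, integral_prod _ (by rw [← Measure.volume_eq_prod]; exact hInt k l)]
  have i1 : ∀ k l, Integrable fun x => ∫ y, (S.K1 m j k l x y (-x - y) : ℂ) * (f j x * f k y * f l (-x - y)) := by
    intro k l
    have := hInt k l
    rw [Measure.volume_eq_prod] at this
    exact this.integral_prod_left
  simp only [e1]
  rw [← integral_const_mul]
  have : ∀ k, ∑ l, ∫ x, ∫ y, (S.K1 m j k l x y (-x - y) : ℂ) * (f j x * f k y * f l (-x - y)) =
      ∫ x, ∑ l, ∫ y, (S.K1 m j k l x y (-x - y) : ℂ) * (f j x * f k y * f l (-x - y)) := fun k =>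
    (integral_finsetSum _ fun l _ => i1 k l).symm
  simp only [this]
  rw [← integral_finsetSum _ fun k _ => integrable_finsetSum _ fun l _ => i1 k l, ← integral_const_mul]
  congr 1; ext x
  unfold Sys.nl
  simp only [Finset.mul_sum]
  refine Finset.sum_congr rfl fun k _ => Finset.sum_congr rfl fun l _ => ?_
  rw [← integral_const_mul, ← integral_const_mul, ← integral_const_mul, ← integral_const_mul]
  congr 1; ext y
  unfold Sys.K1 Sys.B
  push_cast
  ring

lemma E_sym {S : Sys} {C : ℝ} (hS : S.Adm C) {m : ℝ → ℝ} (hm : GoodW m) {c : ℝ} {B : ℝ≥0∞} (hB : B ≠ ⊤)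
    {f : Fin 2 → ℝ → ℂ} (hf : ∀ i, NiceB B (f i)) (hK : ∀ j k l, KB3 c (S.K1 m j k l)) (j k l : Fin 2) :
    3 * L3 (S.Pq m j k l) (f j) (f k) (f l) = L3 (S.K1 m j k l) (f j) (f k) (f l) +
      L3 (S.K1 m k l j) (f k) (f l) (f j) + L3 (S.K1 m l j k) (f l) (f j) (f k) := by
  have mf := fun i => (hf i).meas
  have kc : ∀ j k l, KB3 c (fun x y z => S.K1 m k l j y z x) := fun j k l => by
    refine ⟨?_, fun x y z hs => ?_⟩
    · exact (hK k l j).meas.comp (by fun_prop) (by fun_prop) (by fun_prop)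
    · refine ((hK k l j).bd y z x (by linarith)).trans (le_of_eq ?_)
      generalize (1 + |x|) ^ 8 = X
      generalize (1 + |y|) ^ 8 = Y
      generalize (1 + |z|) ^ 8 = Z
      ring
  have kc2 : ∀ j k l, KB3 c (fun x y z => S.K1 m l j k z x y) := fun j k l => by
    refine ⟨?_, fun x y z hs => ?_⟩
    · exact (hK l j k).meas.comp (by fun_prop) (by fun_prop) (by fun_prop)
    · refine ((hK l j k).bd z x y (by linarith)).trans (le_of_eq ?_)
      generalize (1 + |x|) ^ 8 = X
      generalize (1 + |y|) ^ 8 = Y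
      generalize (1 + |z|) ^ 8 = Z
      ring
  have c1 : L3 (fun x y z => S.K1 m k l j y z x) (f j) (f k) (f l) = L3 (S.K1 m k l j) (f k) (f l) (f j) :=
    L3_cyc (hK k l j) (mf j) (mf k) (mf l)
  have c2 : L3 (fun x y z => S.K1 m l j k z x y) (f j) (f k) (f l) = L3 (S.K1 m l j k) (f l) (f j) (f k) := by
    rw [← L3_cyc (hK l j k) (mf k) (mf l) (mf j)]
    exact L3_cyc (kc k l j) (mf j) (mf k) (mf l)
  rw [← c1, ← c2]
  unfold L3
  have i1 := (hK j k l).integrable hB (hf j) (hf k) (hf l)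
  have i2 := (kc j k l).integrable hB (hf j) (hf k) (hf l)
  have i3 := (kc2 j k l).integrable hB (hf j) (hf k) (hf l)
  have s := (integral_add' (i1.add i2) i3)
  rw [integral_add' i1 i2] at s
  refine Eq.trans ?_ s
  rw [← integral_const_mul]
  congr 1; ext p
  have h3 : S.M3 m j k l p.1 p.2 (-p.1 - p.2) = 3 * S.Pq m j k l p.1 p.2 (-p.1 - p.2) := by
    rw [hS.eq m hm j k l p.1 p.2 (-p.1 - p.2) (by ring)]; unfold Sys.Pq; ring
  have h4 : S.M3 m j k l p.1 p.2 (-p.1 - p.2) = S.K1 m j k l p.1 p.2 (-p.1 - p.2) + S.K1 m k l j p.2 (-p.1 - p.2) p.1 +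
      S.K1 m l j k (-p.1 - p.2) p.1 p.2 := by unfold Sys.M3 Sys.K1; ring
  have h5 : (3 : ℂ) * (S.Pq m j k l p.1 p.2 (-p.1 - p.2) : ℂ) = S.K1 m j k l p.1 p.2 (-p.1 - p.2) + S.K1 m k l j p.2 (-p.1 - p.2) p.1 +
      S.K1 m l j k (-p.1 - p.2) p.1 p.2 := by
    rw [h3] at h4; exact_mod_cast h4
  rw [← mul_assoc, h5]
  simp only [Pi.add_apply]
  ring

lemma E_id {S : Sys} {C : ℝ} (hS : S.Adm C) {m : ℝ → ℝ} (hm : GoodW m) {c : ℝ} {B : ℝ≥0∞} (hB : B ≠ ⊤)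
    {f : Fin 2 → ℝ → ℂ} (hf : ∀ i, NiceB B (f i)) (hK : ∀ j k l, KB3 c (S.K1 m j k l)) :
    ∑ j, (S.e j : ℂ) * ((∫ x, (m x ^ 2 : ℂ) * (S.nl f j x * f j (-x))) + ∫ x, (m x ^ 2 : ℂ) * (f j x * S.nl f j (-x))) =
      Complex.I * ∑ j, ∑ k, ∑ l, L3 (S.Pq m j k l) (f j) (f k) (f l) := by
  have e0 : ∀ j, ∫ x, (m x ^ 2 : ℂ) * (S.nl f j x * f j (-x)) = ∫ x, (m x ^ 2 : ℂ) * (f j x * S.nl f j (-x)) := by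
    intro j
    rw [← integral_neg_eq_self]
    congr 1; ext x
    rw [hm.even x, neg_neg]; ring
  have e1 : ∀ j, (S.e j : ℂ) * ((∫ x, (m x ^ 2 : ℂ) * (S.nl f j x * f j (-x))) + ∫ x, (m x ^ 2 : ℂ) * (f j x * S.nl f j (-x))) =
      Complex.I * ∑ k, ∑ l, L3 (S.K1 m j k l) (f j) (f k) (f l) := by
    intro j
    rw [← E_id1 hB hf j (hK j), e0]; ring
  simp only [e1]
  rw [← Finset.mul_sum]
  congr 1
  have h3 : ∀ j k l, L3 (S.Pq m j k l) (f j) (f k) (f l) = (L3 (S.K1 m j k l) (f j) (f k) (f l) +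
      L3 (S.K1 m k l j) (f k) (f l) (f j) + L3 (S.K1 m l j k) (f l) (f j) (f k)) / 3 := fun j k l => by
    rw [← E_sym hS hm hB hf hK j k l]; ring
  simp only [h3, Fin.sum_univ_two]
  ring

/-- quartic identity -/
lemma A_id {S : Sys} {m : ℝ → ℝ} {c : ℝ} {B : ℝ≥0∞} (hB : B ≠ ⊤)
    {f : Fin 2 → ℝ → ℂ} (hf : ∀ i, NiceB B (f i)) (j k l : Fin 2) (hK : ∀ i n, KB4 c (S.M4 m j k l i n)) :
    L3 (S.q m j k l) (f j) (f k) (S.nl f l) = Complex.I * ∑ i, ∑ n, L4 (S.M4 m j k l i n) (f j) (f k) (f i) (f n) := by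
  have hInt : ∀ i n, Integrable (fun q : (ℝ × ℝ) × ℝ => (S.M4 m j k l i n q.1.1 q.1.2 q.2 (-q.1.1 - q.1.2 - q.2) : ℂ) *
      (f j q.1.1 * f k q.1.2 * f i q.2 * f n (-q.1.1 - q.1.2 - q.2))) := by
    intro i n
    have := (hK i n).integrable hB (hf j) (hf k) (hf i) (hf n)
    have mp := measurePreserving_prodAssoc (volume : Measure ℝ) (volume : Measure ℝ) (volume : Measure ℝ)
    exact (mp.integrable_comp_emb (MeasurableEquiv.measurableEmbedding _)).2 this
  have e1 : ∀ i n, L4 (S.M4 m j k l i n) (f j) (f k) (f i) (f n) = ∫ p : ℝ × ℝ, ∫ y, (S.M4 m j k l i n p.1 p.2 y (-p.1 - p.2 - y) : ℂ) *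
      (f j p.1 * f k p.2 * f i y * f n (-p.1 - p.2 - y)) := by
    intro i n
    have mp := measurePreserving_prodAssoc (volume : Measure ℝ) (volume : Measure ℝ) (volume : Measure ℝ)
    have h1 := mp.integral_comp' (fun w : ℝ × ℝ × ℝ => (S.M4 m j k l i n w.1 w.2.1 w.2.2 (-w.1 - w.2.1 - w.2.2) : ℂ) *
      (f j w.1 * f k w.2.1 * f i w.2.2 * f n (-w.1 - w.2.1 - w.2.2)))
    have h2 := integral_prod _ (hInt i n)
    unfold L4
    exact h1.symm.trans h2
  have i1 : ∀ i n, Integrable fun p : ℝ × ℝ => ∫ y, (S.M4 m j k l i n p.1 p.2 y (-p.1 - p.2 - y) : ℂ) *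
      (f j p.1 * f k p.2 * f i y * f n (-p.1 - p.2 - y)) := fun i n => (hInt i n).integral_prod_left
  simp only [e1]
  have : ∀ i, ∑ n, ∫ p : ℝ × ℝ, ∫ y, (S.M4 m j k l i n p.1 p.2 y (-p.1 - p.2 - y) : ℂ) *
      (f j p.1 * f k p.2 * f i y * f n (-p.1 - p.2 - y)) = ∫ p : ℝ × ℝ, ∑ n, ∫ y, (S.M4 m j k l i n p.1 p.2 y (-p.1 - p.2 - y) : ℂ) *
      (f j p.1 * f k p.2 * f i y * f n (-p.1 - p.2 - y)) := fun i => (integral_finsetSum _ fun n _ => i1 i n).symm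
  simp only [this]
  rw [← integral_finsetSum _ fun i _ => integrable_finsetSum _ fun n _ => i1 i n, ← integral_const_mul]
  unfold L3
  congr 1; ext p
  unfold Sys.nl
  simp only [Finset.mul_sum]
  refine Finset.sum_congr rfl fun i _ => Finset.sum_congr rfl fun n _ => ?_
  rw [← integral_const_mul, ← integral_const_mul, ← integral_const_mul]
  congr 1; ext y
  unfold Sys.M4 Sys.B
  rw [show y + (-p.1 - p.2 - y) = -p.1 - p.2 by ring]
  push_cast
  ring

lemma q_cyc_nl {S : Sys} {m : ℝ → ℝ} {c : ℝ} (hK : ∀ j k l, KB3 c (S.q m j k l)) {f g h : ℝ → ℂ}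
    (hf : Measurable f) (hg : Measurable g) (hh : Measurable h) (j k l : Fin 2) :
    L3 (S.q m j k l) f g h = L3 (S.q m k l j) g h f := by
  rw [← L3_cyc (hK k l j) hf hg hh]
  congr 1; ext x y z; exact S.q_cyc m j k l x y z

lemma A_id' {S : Sys} {m : ℝ → ℝ} {c : ℝ} {B : ℝ≥0∞} (hB : B ≠ ⊤)
    {f : Fin 2 → ℝ → ℂ} (hf : ∀ i, NiceB B (f i)) (hK3 : ∀ j k l, KB3 c (S.q m j k l)) (hK : ∀ j k l i n, KB4 c (S.M4 m j k l i n)) :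
    ∑ j, ∑ k, ∑ l, (L3 (S.q m j k l) (S.nl f j) (f k) (f l) + L3 (S.q m j k l) (f j) (S.nl f k) (f l) +
      L3 (S.q m j k l) (f j) (f k) (S.nl f l)) =
      3 * Complex.I * ∑ j, ∑ k, ∑ l, ∑ i, ∑ n, L4 (S.M4 m j k l i n) (f j) (f k) (f i) (f n) := by
  have mf := fun i => (hf i).meas
  have mn := fun i => nl_meas S mf i
  have a1 : ∀ j k l, L3 (S.q m j k l) (S.nl f j) (f k) (f l) = L3 (S.q m k l j) (f k) (f l) (S.nl f j) := fun j k l =>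
    q_cyc_nl hK3 (mn j) (mf k) (mf l) j k l
  have a2 : ∀ j k l, L3 (S.q m j k l) (f j) (S.nl f k) (f l) = L3 (S.q m l j k) (f l) (f j) (S.nl f k) := fun j k l =>
    (q_cyc_nl hK3 (mf j) (mn k) (mf l) j k l).trans (q_cyc_nl hK3 (mn k) (mf l) (mf j) k l j)
  simp only [a1, a2, A_id hB hf _ _ _ (hK _ _ _)]
  simp only [Fin.sum_univ_two]
  ring

/-- `L4` splitting -/
lemma L4_split {S : Sys} {m : ℝ → ℝ} (hm : GoodW m) {κ c : ℝ} (hκ : 0 < κ) {B : ℝ≥0∞} (hB : B ≠ ⊤)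
    {f1 f2 f3 f4 : ℝ → ℂ} (h1 : NiceB B f1) (h2 : NiceB B f2) (h3 : NiceB B f3) (h4 : NiceB B f4) {j k l i n : Fin 2}
    (hK : KB4 c (S.M4 m j k l i n)) :
    L4 (S.M4 m j k l i n) f1 f2 f3 f4 = L4 (S.nr m κ j k l i n) f1 f2 f3 f4 + L4 (S.pr m κ j k l i n) f1 f2 f3 f4 := by
  unfold L4
  rw [← integral_add ((kernels_nr hm hκ hK).integrable hB h1 h2 h3 h4) ((kernels_pr hm hκ hK).integrable hB h1 h2 h3 h4)]
  congr 1; ext w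
  rw [M4_split S m hκ]
  unfold Sys.pr
  push_cast; ring

end PAn

namespace PAn
set_option linter.unusedVariables false

lemma L4_rr_gen {S : Sys} {m : ℝ → ℝ} {κ D : ℝ} {j k l i n : Fin 2} {a1 a2 a3 a4 : ℝ → ℂ} {g1 g2 g3 g4 : ℝ → ℝ≥0∞}
    (hQ : I4 (fun x1 x2 x3 x4 => ENNReal.ofReal (|S.rr m κ j k l i n x1 x2 x3 x4| * (1 + XX x1 x2 x3 x4))
        * (g1 x1 * g2 x2 * g3 x3 * g4 x4)) ≤ ENNReal.ofReal D * (L2 (Wm m g1) * L2 (Wm m g2) * L2 (Wm m g3) * L2 (Wm m g4)))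
    (h : ∀ x1 x2 x3 x4, ‖a1 x1‖ₑ * ‖a2 x2‖ₑ * ‖a3 x3‖ₑ * ‖a4 x4‖ₑ ≤ ENNReal.ofReal (1 + XX x1 x2 x3 x4) * (g1 x1 * g2 x2 * g3 x3 * g4 x4)) :
    ‖L4 (S.rr m κ j k l i n) a1 a2 a3 a4‖ₑ ≤ ENNReal.ofReal D * (L2 (Wm m g1) * L2 (Wm m g2) * L2 (Wm m g3) * L2 (Wm m g4)) := by
  refine (L4_le _ _ _ _ _).trans (le_trans ?_ hQ)
  unfold I4
  refine lintegral_mono fun w => ?_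
  simp only
  refine (mul_le_mul' le_rfl (h _ _ _ _)).trans (le_of_eq ?_)
  rw [ENNReal.ofReal_mul (abs_nonneg _)]; ring

noncomputable def Sys.Gt (S : Sys) (m : ℝ → ℝ) (f : Fin 2 → ℝ → ℂ) (x : ℝ) : ℝ≥0∞ :=
  ENNReal.ofReal ((m x)⁻¹) * S.G m f x

lemma Gt_W (S : Sys) {m : ℝ → ℝ} (hm : GoodW m) (f : Fin 2 → ℝ → ℂ) : Wm m (S.Gt m f) = S.G m f := by
  ext x
  unfold Wm Sys.Gt
  rw [← mul_assoc, ← ENNReal.ofReal_mul (hm.pos x).le, mul_inv_cancel₀ (hm.pos x).ne']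
  simp

lemma nl_le_Gt (S : Sys) {m : ℝ → ℝ} (hm : GoodW m) {f : Fin 2 → ℝ → ℂ} (hf : ∀ i, Measurable (f i)) (l : Fin 2) (x : ℝ) :
    ‖S.nl f l x‖ₑ ≤ ENNReal.ofReal (1 + |x|) * S.Gt m f x := by
  have h := nl_fine S hm hf l x
  have h2 := mul_le_mul' (le_refl (ENNReal.ofReal ((m x)⁻¹))) h
  rw [← mul_assoc, ← ENNReal.ofReal_mul (inv_pos.2 (hm.pos x)).le, inv_mul_cancel₀ (hm.pos x).ne', ENNReal.ofReal_one, one_mul] at h2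
  refine h2.trans (le_of_eq ?_)
  unfold Sys.Gt; ring

noncomputable def Sys.Q5 (S : Sys) (m : ℝ → ℝ) (κ : ℝ) (f : Fin 2 → ℝ → ℂ) (j k l i n : Fin 2) : ℂ :=
  L4 (S.rr m κ j k l i n) (S.nl f j) (f k) (f i) (f n) + L4 (S.rr m κ j k l i n) (f j) (S.nl f k) (f i) (f n) +
  L4 (S.rr m κ j k l i n) (f j) (f k) (S.nl f i) (f n) + L4 (S.rr m κ j k l i n) (f j) (f k) (f i) (S.nl f n)

theorem static_bd {S : Sys} {C : ℝ} (hS : S.Adm C) {γ : ℝ} (hγ : 0 < γ) (hγ4 : γ < 1 / 4) :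
    ∃ Q : ℝ, 0 < Q ∧ ∀ m, GoodW m → ∀ κ : ℝ, 0 < κ → κ ≤ 1 → ∀ f : Fin 2 → ℝ → ℂ, (∀ i, Measurable (f i)) → ∀ b : ℝ≥0∞,
      (∀ i, L2 (Wm m (fun x => ‖f i x‖ₑ)) ≤ b) → ∀ j k l i n : Fin 2,
      ‖L4 (S.rr m κ j k l i n) (f j) (f k) (f i) (f n)‖ₑ ≤ ENNReal.ofReal (Q * κ ^ (-(1 / 2 + γ))) * b ^ 4 ∧
      ‖L4 (S.nr m κ j k l i n) (f j) (f k) (f i) (f n)‖ₑ ≤ ENNReal.ofReal (Q * κ ^ (1 / 2 - γ)) * b ^ 4 ∧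
      ‖S.Q5 m κ f j k l i n‖ₑ ≤ ENNReal.ofReal (Q * κ ^ (-(1 / 2 + γ))) * b ^ 5 := by
  obtain ⟨Q, hQ, H⟩ := quad_bd hS hγ hγ4
  have hbb := S.bb_pos
  refine ⟨Q * (1 + 8192 * S.bb), by positivity, ?_⟩
  intro m hm κ hκ hκ1 f hf b hb j k l i n
  have H := H m hm κ hκ hκ1 j k l i n
  have mf : ∀ i, Measurable fun x => ‖f i x‖ₑ := fun i => (hf i).enorm
  have X0 := XX_nonneg
  have hκp : 0 < κ ^ (-(1 / 2 + γ)) := Real.rpow_pos_of_pos hκ _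
  have hκq : 0 < κ ^ (1 / 2 - γ) := Real.rpow_pos_of_pos hκ _
  have mono1 : ENNReal.ofReal (Q * κ ^ (-(1 / 2 + γ))) ≤ ENNReal.ofReal (Q * (1 + 8192 * S.bb) * κ ^ (-(1 / 2 + γ))) := by
    apply ENNReal.ofReal_le_ofReal
    gcongr
    nlinarith
  have mono2 : ENNReal.ofReal (Q * κ ^ (1 / 2 - γ)) ≤ ENNReal.ofReal (Q * (1 + 8192 * S.bb) * κ ^ (1 / 2 - γ)) := by
    apply ENNReal.ofReal_le_ofReal
    gcongr
    nlinarith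
  refine ⟨?_, ?_, ?_⟩
  · refine (L4_rr_gen (H _ _ _ _ (mf j) (mf k) (mf i) (mf n)).1 ?_).trans ?_
    · intro x1 x2 x3 x4
      refine le_mul_of_one_le_left' ?_
      rw [ENNReal.one_le_ofReal]; linarith [X0 x1 x2 x3 x4]
    · refine (mul_le_mul' mono1 (mul_le_mul' (mul_le_mul' (mul_le_mul' (hb j) (hb k)) (hb i)) (hb n))).trans (le_of_eq ?_)
      ring
  · refine (L4_le _ _ _ _ _).trans ((H _ _ _ _ (mf j) (mf k) (mf i) (mf n)).2.trans ?_)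
    refine (mul_le_mul' mono2 (mul_le_mul' (mul_le_mul' (mul_le_mul' (hb j) (hb k)) (hb i)) (hb n))).trans (le_of_eq ?_)
    ring
  · have mG : Measurable (S.Gt m f) := by
      have := measurable_G S hm hf
      have := hm.cont.measurable
      unfold Sys.Gt; fun_prop
    have hG : L2 (Wm m (S.Gt m f)) ≤ ENNReal.ofReal (2048 * S.bb) * b ^ 2 := by
      rw [Gt_W S hm]; exact L2_G S hm hf hb
    have key : ∀ x X l, |x| ≤ X → ‖S.nl f l x‖ₑ ≤ ENNReal.ofReal (1 + X) * S.Gt m f x := fun x X l h =>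
      (nl_le_Gt S hm hf l x).trans (mul_le_mul' (ENNReal.ofReal_le_ofReal (by linarith)) le_rfl)
    have xx : ∀ x1 x2 x3 x4, |x1| ≤ XX x1 x2 x3 x4 ∧ |x2| ≤ XX x1 x2 x3 x4 ∧ |x3| ≤ XX x1 x2 x3 x4 ∧ |x4| ≤ XX x1 x2 x3 x4 := by
      intro x1 x2 x3 x4
      unfold XX
      have := abs_nonneg x1; have := abs_nonneg x2; have := abs_nonneg x3; have := abs_nonneg x4
      refine ⟨?_, ?_, ?_, ?_⟩ <;> linarith
    have s1 := L4_rr_gen (H _ _ _ _ mG (mf k) (mf i) (mf n)).1 (a1 := S.nl f j) (a2 := f k) (a3 := f i) (a4 := f n) (by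
      intro x1 x2 x3 x4
      refine (mul_le_mul' (mul_le_mul' (mul_le_mul' (key x1 _ j (xx x1 x2 x3 x4).1) le_rfl) le_rfl) le_rfl).trans (le_of_eq ?_)
      ring)
    have s2 := L4_rr_gen (H _ _ _ _ (mf j) mG (mf i) (mf n)).1 (a1 := f j) (a2 := S.nl f k) (a3 := f i) (a4 := f n) (by
      intro x1 x2 x3 x4
      refine (mul_le_mul' (mul_le_mul' (mul_le_mul' le_rfl (key x2 _ k (xx x1 x2 x3 x4).2.1)) le_rfl) le_rfl).trans (le_of_eq ?_)
      ring)
    have s3 := L4_rr_gen (H _ _ _ _ (mf j) (mf k) mG (mf n)).1 (a1 := f j) (a2 := f k) (a3 := S.nl f i) (a4 := f n) (by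
      intro x1 x2 x3 x4
      refine (mul_le_mul' (mul_le_mul' (mul_le_mul' le_rfl le_rfl) (key x3 _ i (xx x1 x2 x3 x4).2.2.1)) le_rfl).trans (le_of_eq ?_)
      ring)
    have s4 := L4_rr_gen (H _ _ _ _ (mf j) (mf k) (mf i) mG).1 (a1 := f j) (a2 := f k) (a3 := f i) (a4 := S.nl f n) (by
      intro x1 x2 x3 x4
      refine (mul_le_mul' (mul_le_mul' (mul_le_mul' le_rfl le_rfl) le_rfl) (key x4 _ n (xx x1 x2 x3 x4).2.2.2)).trans (le_of_eq ?_)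
      ring)
    have t1 := s1.trans (mul_le_mul' le_rfl (mul_le_mul' (mul_le_mul' (mul_le_mul' hG (hb k)) (hb i)) (hb n)))
    have t2 := s2.trans (mul_le_mul' le_rfl (mul_le_mul' (mul_le_mul' (mul_le_mul' (hb j) hG) (hb i)) (hb n)))
    have t3 := s3.trans (mul_le_mul' le_rfl (mul_le_mul' (mul_le_mul' (mul_le_mul' (hb j) (hb k)) hG) (hb n)))
    have t4 := s4.trans (mul_le_mul' le_rfl (mul_le_mul' (mul_le_mul' (mul_le_mul' (hb j) (hb k)) (hb i)) hG))
    unfold Sys.Q5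
    refine (enorm_add_le _ _).trans ((add_le_add ((enorm_add_le _ _).trans (add_le_add ((enorm_add_le _ _).trans (add_le_add t1 t2)) t3)) t4).trans ?_)
    have e : ENNReal.ofReal (Q * 8192 * S.bb * κ ^ (-(1 / 2 + γ))) = 4 * (ENNReal.ofReal (Q * κ ^ (-(1 / 2 + γ))) * ENNReal.ofReal (2048 * S.bb)) := by
      rw [← ENNReal.ofReal_mul (by positivity), show (4 : ℝ≥0∞) = ENNReal.ofReal 4 by simp, ← ENNReal.ofReal_mul (by norm_num)]
      congr 1; ring
    calc _ = ENNReal.ofReal (Q * 8192 * S.bb * κ ^ (-(1 / 2 + γ))) * b ^ 5 := by rw [e]; ring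
      _ ≤ _ := by
        refine mul_le_mul' (ENNReal.ofReal_le_ofReal ?_) le_rfl
        have : 0 < Q * κ ^ (-(1 / 2 + γ)) := by positivity
        nlinarith

/-- differentiation under the integral, integrated form -/
lemma ftc_int {Ω : Type*} [MeasurableSpace Ω] {μ : Measure Ω} [SFinite μ] {P P' : ℝ → Ω → ℂ} {t0 t1 : ℝ} (h01 : t0 ≤ t1)
    (hd : ∀ ω, ∀ t ∈ Icc t0 t1, HasDerivWithinAt (fun τ => P τ ω) (P' t ω) (Icc t0 t1) t)
    (hm : Measurable fun p : ℝ × Ω => P' p.1 p.2) {C : ℝ≥0∞} (hC : C ≠ ⊤)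
    (hb : ∀ t ∈ Icc t0 t1, ∫⁻ ω, ‖P' t ω‖ₑ ∂μ ≤ C) (i0 : Integrable (P t0) μ) (i1 : Integrable (P t1) μ) :
    IntervalIntegrable (fun t => ∫ ω, P' t ω ∂μ) volume t0 t1 ∧
      (∫ ω, P t1 ω ∂μ) - (∫ ω, P t0 ω ∂μ) = ∫ t in t0..t1, ∫ ω, P' t ω ∂μ := by
  have hI : Integrable (fun p : ℝ × Ω => P' p.1 p.2) ((volume.restrict (Ioc t0 t1)).prod μ) := by
    refine ⟨hm.aestronglyMeasurable, ?_⟩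
    unfold HasFiniteIntegral
    rw [lintegral_prod _ hm.enorm.aemeasurable]
    calc _ ≤ ∫⁻ t in Ioc t0 t1, C := by
          refine setLIntegral_mono measurable_const fun t ht => hb t ⟨ht.1.le, ht.2⟩
      _ = C * volume (Ioc t0 t1) := by simp
      _ < ⊤ := by
        rw [Real.volume_Ioc]
        exact ENNReal.mul_lt_top hC.lt_top ENNReal.ofReal_lt_top
  refine ⟨(intervalIntegrable_iff_integrableOn_Ioc_of_le h01).2 hI.integral_prod_left, ?_⟩
  rw [← integral_sub i1 i0, intervalIntegral.integral_of_le h01]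
  rw [integral_integral_swap (f := fun t ω => P' t ω) hI]
  refine integral_congr_ae ?_
  filter_upwards [hI.prod_left_ae] with ω hω
  rw [← intervalIntegral.integral_of_le h01]
  refine (intervalIntegral.integral_eq_sub_of_hasDerivAt_of_le h01 (fun t ht => (hd ω t ht).continuousWithinAt) (fun t ht => (hd ω t ⟨ht.1.le, ht.2.le⟩).hasDerivAt (Icc_mem_nhds ht.1 ht.2)) ?_).symm
  exact (intervalIntegrable_iff_integrableOn_Ioc_of_le h01).2 hω

end PAn

namespace PAn
set_option linter.unusedVariables false

def FTC (F D : ℝ → ℂ) (t0 t1 : ℝ) : Prop := IntervalIntegrable D volume t0 t1 ∧ F t1 - F t0 = ∫ t in t0..t1, D t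

lemma FTC.add {F D F' D' : ℝ → ℂ} {t0 t1 : ℝ} (h : FTC F D t0 t1) (h' : FTC F' D' t0 t1) :
    FTC (fun t => F t + F' t) (fun t => D t + D' t) t0 t1 := by
  refine ⟨h.1.add h'.1, ?_⟩
  rw [intervalIntegral.integral_add h.1 h'.1, ← h.2, ← h'.2]; ring

lemma FTC.const_mul (c : ℂ) {F D : ℝ → ℂ} {t0 t1 : ℝ} (h : FTC F D t0 t1) :
    FTC (fun t => c * F t) (fun t => c * D t) t0 t1 := by
  refine ⟨h.1.const_mul c, ?_⟩
  rw [intervalIntegral.integral_const_mul, ← h.2]; ring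

lemma FTC.sum {ι : Type*} (s : Finset ι) {F D : ι → ℝ → ℂ} {t0 t1 : ℝ} (h : ∀ i, FTC (F i) (D i) t0 t1) :
    FTC (fun t => ∑ i ∈ s, F i t) (fun t => ∑ i ∈ s, D i t) t0 t1 := by
  classical
  induction s using Finset.induction_on with
  | empty => simp [FTC]
  | insert a s ha ih => simp only [Finset.sum_insert ha]; exact (h a).add ih

structure FSol (S : Sys) (h : ℝ → Fin 2 → ℝ → ℂ) (t0 t1 : ℝ) : Prop where
  le : t0 ≤ t1
  meas : ∀ j, Measurable fun p : ℝ × ℝ => h p.1 j p.2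
  der : ∀ j ξ, ∀ t ∈ Icc t0 t1, HasDerivWithinAt (fun τ => h τ j ξ)
    (Complex.I * (S.α j * ξ ^ 3 : ℝ) * h t j ξ + S.nl (h t) j ξ) (Icc t0 t1) t
  real : ∀ j ξ, ∀ t ∈ Icc t0 t1, h t j (-ξ) = (starRingEnd ℂ) (h t j ξ)
  bdd : ∃ R : ℝ≥0∞, R ≠ ⊤ ∧ ∀ t ∈ Icc t0 t1, ∀ j, L2 (wN 10 (h t j)) ≤ R

lemma FSol.meas1 {S : Sys} {h : ℝ → Fin 2 → ℝ → ℂ} {t0 t1 : ℝ} (H : FSol S h t0 t1) (t : ℝ) (j : Fin 2) : Measurable (h t j) :=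
  (H.meas j).comp (measurable_const.prodMk measurable_id)

lemma FSol.mono {S : Sys} {h : ℝ → Fin 2 → ℝ → ℂ} {t0 t1 s0 s1 : ℝ} (H : FSol S h t0 t1) (h0 : t0 ≤ s0) (h1 : s1 ≤ t1) (hs : s0 ≤ s1) :
    FSol S h s0 s1 := by
  have sub : Icc s0 s1 ⊆ Icc t0 t1 := Icc_subset_Icc h0 h1
  obtain ⟨R, hR, hb⟩ := H.bdd
  exact ⟨hs, H.meas, fun j ξ t ht => (H.der j ξ t (sub ht)).mono sub, fun j ξ t ht => H.real j ξ t (sub ht), R, hR,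
    fun t ht => hb t (sub ht)⟩

lemma FSol.nice {S : Sys} {h : ℝ → Fin 2 → ℝ → ℂ} {t0 t1 : ℝ} (H : FSol S h t0 t1) :
    ∃ B : ℝ≥0∞, B ≠ ⊤ ∧ ∀ t ∈ Icc t0 t1, (∀ i, NiceB B (h t i)) ∧ ∀ l, NiceB B (S.nl (h t) l) := by
  obtain ⟨R, hR, hb⟩ := H.bdd
  refine ⟨_, ?_, fun t ht => nice_of_L2 S (fun i => H.meas1 t i) (hb t ht)⟩
  finiteness

lemma meas_neg2 {F : ℝ → ℝ → ℂ} (h : Measurable fun p : ℝ × ℝ => F p.1 p.2) : Measurable fun p : ℝ × ℝ => F p.1 (-p.2) := by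
  have ng : Measurable fun p : ℝ × ℝ => (p.1, -p.2) := by fun_prop
  exact h.comp ng

lemma ftc_E {S : Sys} {h : ℝ → Fin 2 → ℝ → ℂ} {t0 t1 : ℝ} (H : FSol S h t0 t1) {M : ℝ → ℂ} (mm2 : Measurable M) {c : ℝ}
    (hc : ∀ x, ‖M x‖ ≤ c * (1 + |x|) ^ 8) (j : Fin 2) :
    FTC (fun t => ∫ x, M x * (h t j x * h t j (-x)))
      (fun t => (∫ x, M x * (S.nl (h t) j x * h t j (-x))) + ∫ x, M x * (h t j x * S.nl (h t) j (-x))) t0 t1 := by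
  obtain ⟨B, hB, hn⟩ := H.nice
  have mh := H.meas j
  have mn := nl_meas_param S H.meas j
  have bd : ∀ f g : ℝ → ℂ, NiceB B f → NiceB B g → ∫⁻ x, ‖M x * (f x * g (-x))‖ₑ ≤ ENNReal.ofReal c * B ^ 2 := by
    intro f g hf hg
    have h1 := lint_conv_le (measurable_wN 8 hf.meas) (measurable_wN 8 hg.meas) 0
    calc _ ≤ ∫⁻ x, ENNReal.ofReal c * (wN 8 f x * wN 8 g (0 - x)) := by
          refine lintegral_mono fun x => ?_
          simp only [enorm_mul]
          have e1 : ‖M x‖ₑ ≤ ENNReal.ofReal c * ENNReal.ofReal ((1 + |x|) ^ 8) := by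
            rw [← ofReal_norm, ← ENNReal.ofReal_mul' (by positivity)]
            apply ENNReal.ofReal_le_ofReal
            exact hc x
          have e2 : ‖g (-x)‖ₑ ≤ wN 8 g (0 - x) := by
            unfold wN
            rw [zero_sub]
            refine le_mul_of_one_le_left' ?_
            rw [ENNReal.one_le_ofReal]
            exact one_le_pow₀ (by linarith [abs_nonneg (-x)])
          refine (mul_le_mul' e1 (mul_le_mul' le_rfl e2)).trans (le_of_eq ?_)
          conv_rhs => rw [wN]
          ring
      _ = ENNReal.ofReal c * ∫⁻ x, (wN 8 f x * wN 8 g (0 - x)) := lintegral_const_mul' _ _ ENNReal.ofReal_ne_top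
      _ ≤ ENNReal.ofReal c * (B * B) := mul_le_mul' le_rfl (h1.trans (mul_le_mul' hf.two hg.two))
      _ = _ := by ring
  have itg : ∀ f g : ℝ → ℂ, NiceB B f → NiceB B g → Integrable fun x => M x * (f x * g (-x)) := by
    intro f g hf hg
    have mf := hf.meas
    have mg := hg.meas
    refine ⟨(mm2.mul (mf.mul (mg.comp measurable_neg))).aestronglyMeasurable, ?_⟩
    exact (bd f g hf hg).trans_lt (by finiteness)
  have key := ftc_int (μ := (volume : Measure ℝ)) (P := fun t x => M x * (h t j x * h t j (-x)))
    (P' := fun t x => M x * (S.nl (h t) j x * h t j (-x)) + M x * (h t j x * S.nl (h t) j (-x))) H.le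
    (C := ENNReal.ofReal c * B ^ 2 + ENNReal.ofReal c * B ^ 2) ?_ ?_ (by finiteness) ?_ ?_ ?_
  · have e : ∀ t ∈ uIcc t0 t1, ∫ x, (M x * (S.nl (h t) j x * h t j (-x)) + M x * (h t j x * S.nl (h t) j (-x))) =
        (∫ x, M x * (S.nl (h t) j x * h t j (-x))) + ∫ x, M x * (h t j x * S.nl (h t) j (-x)) := by
      intro t ht
      rw [uIcc_of_le H.le] at ht
      exact integral_add (itg _ _ ((hn t ht).2 j) ((hn t ht).1 j)) (itg _ _ ((hn t ht).1 j) ((hn t ht).2 j))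
    refine ⟨key.1.congr ?_, ?_⟩
    · intro t ht
      exact e t (uIoc_subset_uIcc ht)
    · rw [key.2]
      exact intervalIntegral.integral_congr e
  · intro x t ht
    have d1 := H.der j x t ht
    have d2 := H.der j (-x) t ht
    have := (d1.mul d2).const_mul (M x)
    refine this.congr_deriv ?_
    push_cast
    ring
  · have a1 : Measurable fun p : ℝ × ℝ => h p.1 j (-p.2) := meas_neg2 (F := fun t x => h t j x) mh
    have a2 : Measurable fun p : ℝ × ℝ => S.nl (h p.1) j (-p.2) := meas_neg2 (F := fun t x => S.nl (h t) j x) mn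
    have a3 : Measurable fun p : ℝ × ℝ => M p.2 := mm2.comp measurable_snd
    exact (a3.mul (mn.mul a1)).add (a3.mul (mh.mul a2))
  · intro t ht
    refine (lintegral_mono fun x => enorm_add_le _ _).trans ?_
    rw [lintegral_add_left]
    · exact add_le_add (bd _ _ ((hn t ht).2 j) ((hn t ht).1 j)) (bd _ _ ((hn t ht).1 j) ((hn t ht).2 j))
    · exact (mm2.mul (((hn t ht).2 j).meas.mul (((hn t ht).1 j).meas.comp measurable_neg))).enorm
  · exact itg _ _ ((hn t0 ⟨le_rfl, H.le⟩).1 j) ((hn t0 ⟨le_rfl, H.le⟩).1 j)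
  · exact itg _ _ ((hn t1 ⟨H.le, le_rfl⟩).1 j) ((hn t1 ⟨H.le, le_rfl⟩).1 j)

lemma ftc_L3 {S : Sys} {h : ℝ → Fin 2 → ℝ → ℂ} {t0 t1 : ℝ} (H : FSol S h t0 t1) {K K' : ℝ → ℝ → ℝ → ℝ} {c : ℝ}
    (hK : KB3 c K) (hK' : KB3 c K') {j k l : Fin 2} (e : ∀ x y z, K' x y z = S.Ph j k l x y z * K x y z) :
    FTC (fun t => L3 K (h t j) (h t k) (h t l))
      (fun t => Complex.I * L3 K' (h t j) (h t k) (h t l) + (L3 K (S.nl (h t) j) (h t k) (h t l) +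
        L3 K (h t j) (S.nl (h t) k) (h t l) + L3 K (h t j) (h t k) (S.nl (h t) l))) t0 t1 := by
  obtain ⟨B, hB, hn⟩ := H.nice
  have mh := H.meas
  have mn := nl_meas_param S H.meas
  have m0 := hK'.meas_int (β := ℝ) (f := fun t => h t j) (g := fun t => h t k) (h := fun t => h t l) (mh j) (mh k) (mh l)
  have m1 := hK.meas_int (β := ℝ) (f := fun t => S.nl (h t) j) (g := fun t => h t k) (h := fun t => h t l) (mn j) (mh k) (mh l)
  have m2 := hK.meas_int (β := ℝ) (f := fun t => h t j) (g := fun t => S.nl (h t) k) (h := fun t => h t l) (mh j) (mn k) (mh l)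
  have m3 := hK.meas_int (β := ℝ) (f := fun t => h t j) (g := fun t => h t k) (h := fun t => S.nl (h t) l) (mh j) (mh k) (mn l)
  have hI0 := fun t ht => hK'.integrable hB ((hn t ht).1 j) ((hn t ht).1 k) ((hn t ht).1 l)
  have hI1 := fun t ht => hK.integrable hB ((hn t ht).2 j) ((hn t ht).1 k) ((hn t ht).1 l)
  have hI2 := fun t ht => hK.integrable hB ((hn t ht).1 j) ((hn t ht).2 k) ((hn t ht).1 l)
  have hI3 := fun t ht => hK.integrable hB ((hn t ht).1 j) ((hn t ht).1 k) ((hn t ht).2 l)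
  have hI := fun t ht => hK.integrable hB ((hn t ht).1 j) ((hn t ht).1 k) ((hn t ht).1 l)
  have key := ftc_int (μ := (volume : Measure (ℝ × ℝ))) (P := fun t p => (K p.1 p.2 (-p.1 - p.2) : ℂ) * (h t j p.1 * h t k p.2 * h t l (-p.1 - p.2)))
    (P' := fun t p => Complex.I * ((K' p.1 p.2 (-p.1 - p.2) : ℂ) * (h t j p.1 * h t k p.2 * h t l (-p.1 - p.2))) +
      ((K p.1 p.2 (-p.1 - p.2) : ℂ) * (S.nl (h t) j p.1 * h t k p.2 * h t l (-p.1 - p.2)) +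
       (K p.1 p.2 (-p.1 - p.2) : ℂ) * (h t j p.1 * S.nl (h t) k p.2 * h t l (-p.1 - p.2)) +
       (K p.1 p.2 (-p.1 - p.2) : ℂ) * (h t j p.1 * h t k p.2 * S.nl (h t) l (-p.1 - p.2)))) H.le
    (C := ENNReal.ofReal c * B ^ 3 + (ENNReal.ofReal c * B ^ 3 + ENNReal.ofReal c * B ^ 3 + ENNReal.ofReal c * B ^ 3))
      ?_ ?_ (by finiteness) ?_ (hI t0 ⟨le_rfl, H.le⟩) (hI t1 ⟨H.le, le_rfl⟩)
  · have e : ∀ t ∈ uIcc t0 t1, ∫ p : ℝ × ℝ, (Complex.I * ((K' p.1 p.2 (-p.1 - p.2) : ℂ) * (h t j p.1 * h t k p.2 * h t l (-p.1 - p.2))) +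
      ((K p.1 p.2 (-p.1 - p.2) : ℂ) * (S.nl (h t) j p.1 * h t k p.2 * h t l (-p.1 - p.2)) +
       (K p.1 p.2 (-p.1 - p.2) : ℂ) * (h t j p.1 * S.nl (h t) k p.2 * h t l (-p.1 - p.2)) +
       (K p.1 p.2 (-p.1 - p.2) : ℂ) * (h t j p.1 * h t k p.2 * S.nl (h t) l (-p.1 - p.2)))) =
        (Complex.I * L3 K' (h t j) (h t k) (h t l) + (L3 K (S.nl (h t) j) (h t k) (h t l) +
        L3 K (h t j) (S.nl (h t) k) (h t l) + L3 K (h t j) (h t k) (S.nl (h t) l))) := by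
      intro t ht
      rw [uIcc_of_le H.le] at ht
      unfold L3
      rw [← integral_const_mul]
      have s12 := (hI1 t ht).add (hI2 t ht)
      have s123 := s12.add (hI3 t ht)
      have a1 := integral_add' (hI1 t ht) (hI2 t ht)
      have a2 := integral_add' s12 (hI3 t ht)
      have a3 := integral_add' ((hI0 t ht).const_mul Complex.I) s123
      rw [a2, a1] at a3
      exact a3
    refine ⟨key.1.congr ?_, ?_⟩
    · intro t ht
      exact e t (uIoc_subset_uIcc ht)
    · refine Eq.trans key.2 ?_
      exact intervalIntegral.integral_congr e
  · intro p t ht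
    have d1 := H.der j p.1 t ht
    have d2 := H.der k p.2 t ht
    have d3 := H.der l (-p.1 - p.2) t ht
    have := ((d1.mul d2).mul d3).const_mul (K p.1 p.2 (-p.1 - p.2) : ℂ)
    refine this.congr_deriv ?_
    rw [e]
    unfold Sys.Ph
    simp only [Pi.mul_apply]
    push_cast
    ring
  · exact (m0.const_mul _).add ((m1.add m2).add m3)
  · intro t ht
    have b0 := hK'.lint ((hn t ht).1 j) ((hn t ht).1 k) ((hn t ht).1 l)
    have b1 := hK.lint ((hn t ht).2 j) ((hn t ht).1 k) ((hn t ht).1 l)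
    have b2 := hK.lint ((hn t ht).1 j) ((hn t ht).2 k) ((hn t ht).1 l)
    have b3 := hK.lint ((hn t ht).1 j) ((hn t ht).1 k) ((hn t ht).2 l)
    unfold I3 at b0 b1 b2 b3
    simp only [← enorm_L3_int] at b0 b1 b2 b3
    refine (lintegral_mono fun x => (enorm_add_le _ _).trans (add_le_add (le_of_eq (enorm_mul _ _)) ((enorm_add_le _ _).trans
      (add_le_add (enorm_add_le _ _) le_rfl)))).trans ?_
    have eI : ‖Complex.I‖ₑ = 1 := by rw [← ofReal_norm]; simp
    simp only [eI, one_mul]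
    have mt : Measurable fun q : ℝ × ℝ => (t, q) := by fun_prop
    have n0 := (m0.comp mt).enorm
    have n1 := (m1.comp mt).enorm
    have n2 := (m2.comp mt).enorm
    have n3 := (m3.comp mt).enorm
    simp only [Function.comp_def] at n0 n1 n2 n3
    rw [lintegral_add_left n0, lintegral_add_right _ n3, lintegral_add_left n1]
    exact add_le_add b0 (add_le_add (add_le_add b1 b2) b3)

lemma ftc_L4 {S : Sys} {h : ℝ → Fin 2 → ℝ → ℂ} {t0 t1 : ℝ} (H : FSol S h t0 t1) {K K' : ℝ → ℝ → ℝ → ℝ → ℝ} {c c' : ℝ}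
    (hK : KB4 c K) (hK' : KB4 c' K') {j k i n : Fin 2} (e : ∀ x y z w, K' x y z w = S.P4 j k i n x y z w * K x y z w) :
    FTC (fun t => L4 K (h t j) (h t k) (h t i) (h t n))
      (fun t => Complex.I * L4 K' (h t j) (h t k) (h t i) (h t n) + (L4 K (S.nl (h t) j) (h t k) (h t i) (h t n) +
        L4 K (h t j) (S.nl (h t) k) (h t i) (h t n) + L4 K (h t j) (h t k) (S.nl (h t) i) (h t n) +
        L4 K (h t j) (h t k) (h t i) (S.nl (h t) n))) t0 t1 := by
  obtain ⟨B, hB, hn⟩ := H.nice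
  have mh := H.meas
  have mn := nl_meas_param S H.meas
  have m0 := hK'.meas_int (β := ℝ) (f := fun t => h t j) (g := fun t => h t k) (h := fun t => h t i) (k := fun t => h t n) (mh j) (mh k) (mh i) (mh n)
  have m1 := hK.meas_int (β := ℝ) (f := fun t => S.nl (h t) j) (g := fun t => h t k) (h := fun t => h t i) (k := fun t => h t n) (mn j) (mh k) (mh i) (mh n)
  have m2 := hK.meas_int (β := ℝ) (f := fun t => h t j) (g := fun t => S.nl (h t) k) (h := fun t => h t i) (k := fun t => h t n) (mh j) (mn k) (mh i) (mh n)
  have m3 := hK.meas_int (β := ℝ) (f := fun t => h t j) (g := fun t => h t k) (h := fun t => S.nl (h t) i) (k := fun t => h t n) (mh j) (mh k) (mn i) (mh n)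
  have m4 := hK.meas_int (β := ℝ) (f := fun t => h t j) (g := fun t => h t k) (h := fun t => h t i) (k := fun t => S.nl (h t) n) (mh j) (mh k) (mh i) (mn n)
  have hI0 := fun t ht => hK'.integrable hB ((hn t ht).1 j) ((hn t ht).1 k) ((hn t ht).1 i) ((hn t ht).1 n)
  have hI1 := fun t ht => hK.integrable hB ((hn t ht).2 j) ((hn t ht).1 k) ((hn t ht).1 i) ((hn t ht).1 n)
  have hI2 := fun t ht => hK.integrable hB ((hn t ht).1 j) ((hn t ht).2 k) ((hn t ht).1 i) ((hn t ht).1 n)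
  have hI3 := fun t ht => hK.integrable hB ((hn t ht).1 j) ((hn t ht).1 k) ((hn t ht).2 i) ((hn t ht).1 n)
  have hI4 := fun t ht => hK.integrable hB ((hn t ht).1 j) ((hn t ht).1 k) ((hn t ht).1 i) ((hn t ht).2 n)
  have hI := fun t ht => hK.integrable hB ((hn t ht).1 j) ((hn t ht).1 k) ((hn t ht).1 i) ((hn t ht).1 n)
  have key := ftc_int (μ := (volume : Measure (ℝ × ℝ × ℝ)))
    (P := fun t p => (K p.1 p.2.1 p.2.2 (-p.1 - p.2.1 - p.2.2) : ℂ) * (h t j p.1 * h t k p.2.1 * h t i p.2.2 * h t n (-p.1 - p.2.1 - p.2.2)))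
    (P' := fun t p => Complex.I * ((K' p.1 p.2.1 p.2.2 (-p.1 - p.2.1 - p.2.2) : ℂ) * (h t j p.1 * h t k p.2.1 * h t i p.2.2 * h t n (-p.1 - p.2.1 - p.2.2))) +
      ((K p.1 p.2.1 p.2.2 (-p.1 - p.2.1 - p.2.2) : ℂ) * (S.nl (h t) j p.1 * h t k p.2.1 * h t i p.2.2 * h t n (-p.1 - p.2.1 - p.2.2)) +
       (K p.1 p.2.1 p.2.2 (-p.1 - p.2.1 - p.2.2) : ℂ) * (h t j p.1 * S.nl (h t) k p.2.1 * h t i p.2.2 * h t n (-p.1 - p.2.1 - p.2.2)) +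
       (K p.1 p.2.1 p.2.2 (-p.1 - p.2.1 - p.2.2) : ℂ) * (h t j p.1 * h t k p.2.1 * S.nl (h t) i p.2.2 * h t n (-p.1 - p.2.1 - p.2.2)) +
       (K p.1 p.2.1 p.2.2 (-p.1 - p.2.1 - p.2.2) : ℂ) * (h t j p.1 * h t k p.2.1 * h t i p.2.2 * S.nl (h t) n (-p.1 - p.2.1 - p.2.2)))) H.le
    (C := ENNReal.ofReal c' * B ^ 4 + (ENNReal.ofReal c * B ^ 4 + ENNReal.ofReal c * B ^ 4 + ENNReal.ofReal c * B ^ 4 + ENNReal.ofReal c * B ^ 4))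
      ?_ ?_ (by finiteness) ?_ (hI t0 ⟨le_rfl, H.le⟩) (hI t1 ⟨H.le, le_rfl⟩)
  · have e : ∀ t ∈ uIcc t0 t1, ∫ p : ℝ × ℝ × ℝ, (Complex.I * ((K' p.1 p.2.1 p.2.2 (-p.1 - p.2.1 - p.2.2) : ℂ) * (h t j p.1 * h t k p.2.1 * h t i p.2.2 * h t n (-p.1 - p.2.1 - p.2.2))) +
      ((K p.1 p.2.1 p.2.2 (-p.1 - p.2.1 - p.2.2) : ℂ) * (S.nl (h t) j p.1 * h t k p.2.1 * h t i p.2.2 * h t n (-p.1 - p.2.1 - p.2.2)) +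
       (K p.1 p.2.1 p.2.2 (-p.1 - p.2.1 - p.2.2) : ℂ) * (h t j p.1 * S.nl (h t) k p.2.1 * h t i p.2.2 * h t n (-p.1 - p.2.1 - p.2.2)) +
       (K p.1 p.2.1 p.2.2 (-p.1 - p.2.1 - p.2.2) : ℂ) * (h t j p.1 * h t k p.2.1 * S.nl (h t) i p.2.2 * h t n (-p.1 - p.2.1 - p.2.2)) +
       (K p.1 p.2.1 p.2.2 (-p.1 - p.2.1 - p.2.2) : ℂ) * (h t j p.1 * h t k p.2.1 * h t i p.2.2 * S.nl (h t) n (-p.1 - p.2.1 - p.2.2)))) =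
       Complex.I * L4 K' (h t j) (h t k) (h t i) (h t n) + (L4 K (S.nl (h t) j) (h t k) (h t i) (h t n) +
        L4 K (h t j) (S.nl (h t) k) (h t i) (h t n) + L4 K (h t j) (h t k) (S.nl (h t) i) (h t n) +
        L4 K (h t j) (h t k) (h t i) (S.nl (h t) n)) := by
      intro t ht
      rw [uIcc_of_le H.le] at ht
      unfold L4
      rw [← integral_const_mul]
      have s12 := (hI1 t ht).add (hI2 t ht)
      have s123 := s12.add (hI3 t ht)
      have s1234 := s123.add (hI4 t ht)
      have a1 := integral_add' (hI1 t ht) (hI2 t ht)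
      have a2 := integral_add' s12 (hI3 t ht)
      have a22 := integral_add' s123 (hI4 t ht)
      have a3 := integral_add' ((hI0 t ht).const_mul Complex.I) s1234
      rw [a22, a2, a1] at a3
      exact a3
    refine ⟨key.1.congr ?_, ?_⟩
    · intro t ht
      exact e t (uIoc_subset_uIcc ht)
    · refine Eq.trans key.2 ?_
      exact intervalIntegral.integral_congr e
  · intro p t ht
    have d1 := H.der j p.1 t ht
    have d2 := H.der k p.2.1 t ht
    have d3 := H.der i p.2.2 t ht
    have d4 := H.der n (-p.1 - p.2.1 - p.2.2) t ht
    have := (((d1.mul d2).mul d3).mul d4).const_mul (K p.1 p.2.1 p.2.2 (-p.1 - p.2.1 - p.2.2) : ℂ)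
    refine this.congr_deriv ?_
    rw [e]
    unfold Sys.P4
    generalize -p.1 - p.2.1 - p.2.2 = x4
    simp only [Pi.mul_apply]
    push_cast
    ring
  · exact (m0.const_mul _).add (((m1.add m2).add m3).add m4)
  · intro t ht
    have b0 := hK'.lint ((hn t ht).1 j) ((hn t ht).1 k) ((hn t ht).1 i) ((hn t ht).1 n)
    have b1 := hK.lint ((hn t ht).2 j) ((hn t ht).1 k) ((hn t ht).1 i) ((hn t ht).1 n)
    have b2 := hK.lint ((hn t ht).1 j) ((hn t ht).2 k) ((hn t ht).1 i) ((hn t ht).1 n)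
    have b3 := hK.lint ((hn t ht).1 j) ((hn t ht).1 k) ((hn t ht).2 i) ((hn t ht).1 n)
    have b4 := hK.lint ((hn t ht).1 j) ((hn t ht).1 k) ((hn t ht).1 i) ((hn t ht).2 n)
    unfold I4 at b0 b1 b2 b3 b4
    simp only [← enorm_L4_int] at b0 b1 b2 b3 b4
    refine (lintegral_mono fun x => (enorm_add_le _ _).trans (add_le_add (le_of_eq (enorm_mul _ _)) ((enorm_add_le _ _).trans
      (add_le_add ((enorm_add_le _ _).trans (add_le_add (enorm_add_le _ _) le_rfl)) le_rfl)))).trans ?_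
    have eI : ‖Complex.I‖ₑ = 1 := by rw [← ofReal_norm]; simp
    simp only [eI, one_mul]
    have mt : Measurable fun q : ℝ × ℝ × ℝ => (t, q) := by fun_prop
    have n0 := (m0.comp mt).enorm
    have n1 := (m1.comp mt).enorm
    have n2 := (m2.comp mt).enorm
    have n3 := (m3.comp mt).enorm
    have n4 := (m4.comp mt).enorm
    simp only [Function.comp_def] at n0 n1 n2 n3 n4
    rw [lintegral_add_left n0, lintegral_add_right _ n4, lintegral_add_right _ n3, lintegral_add_left n1]
    exact add_le_add b0 (add_le_add (add_le_add (add_le_add b1 b2) b3) b4)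

end PAn

namespace PAn
set_option linter.unusedVariables false

noncomputable def Sys.Ec (S : Sys) (m : ℝ → ℝ) (f : Fin 2 → ℝ → ℂ) : ℂ :=
  ∑ j, (S.e j : ℂ) * ∫ x, (m x ^ 2 : ℂ) * (f j x * f j (-x))

noncomputable def Sys.Ac (S : Sys) (m : ℝ → ℝ) (f : Fin 2 → ℝ → ℂ) : ℂ :=
  ∑ j, ∑ k, ∑ l, L3 (S.q m j k l) (f j) (f k) (f l)

noncomputable def Sys.Wc (S : Sys) (m : ℝ → ℝ) (κ : ℝ) (f : Fin 2 → ℝ → ℂ) : ℂ :=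
  ∑ j, ∑ k, ∑ l, ∑ i, ∑ n, L4 (S.rr m κ j k l i n) (f j) (f k) (f i) (f n)

noncomputable def Sys.Dc' (S : Sys) (m : ℝ → ℝ) (κ : ℝ) (f : Fin 2 → ℝ → ℂ) : ℂ :=
  ∑ j, ∑ k, ∑ l, ∑ i, ∑ n, (-3 * Complex.I * L4 (S.nr m κ j k l i n) (f j) (f k) (f i) (f n) + 3 * S.Q5 m κ f j k l i n)

lemma sum2_norm {F : Fin 2 → ℂ} {b : ℝ} (h : ∀ i, ‖F i‖ ≤ b) : ‖∑ i, F i‖ ≤ 2 * b := by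
  rw [Fin.sum_univ_two]
  exact (norm_add_le _ _).trans (by linarith [h 0, h 1])

lemma norm_le_of_enorm {z : ℂ} {a : ℝ} (ha : 0 ≤ a) (h : ‖z‖ₑ ≤ ENNReal.ofReal a) : ‖z‖ ≤ a := by
  rw [← ofReal_norm] at h
  exact (ENNReal.ofReal_le_ofReal_iff ha).1 h

lemma FTC.congr {F D D' : ℝ → ℂ} {t0 t1 : ℝ} (h : FTC F D t0 t1) (e : ∀ t ∈ uIcc t0 t1, D t = D' t) : FTC F D' t0 t1 :=
  ⟨h.1.congr fun t ht => e t (uIoc_subset_uIcc ht), h.2.trans (intervalIntegral.integral_congr e)⟩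

lemma ftc_Y {S : Sys} {C : ℝ} (hS : S.Adm C) {h : ℝ → Fin 2 → ℝ → ℂ} {t0 t1 : ℝ} (H : FSol S h t0 t1) {m : ℝ → ℝ} (hm : GoodW m)
    {κ : ℝ} (hκ : 0 < κ) :
    FTC (fun t => S.Ec m (h t) + ((-1) * S.Ac m (h t) + 3 * S.Wc m κ (h t))) (fun t => S.Dc' m κ (h t)) t0 t1 := by
  obtain ⟨c, hc0, hq, hPq, hK1, hM4, hm2⟩ := kernels hS hm
  obtain ⟨B, hB, hn⟩ := H.nice
  have mM : Measurable fun x => (m x ^ 2 : ℂ) := by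
    have := (Complex.measurable_ofReal.comp hm.cont.measurable).pow_const 2
    exact this
  have nM : ∀ x, ‖(m x ^ 2 : ℂ)‖ ≤ c * (1 + |x|) ^ 8 := by
    intro x
    rw [norm_pow, Complex.norm_real, Real.norm_eq_abs, sq_abs]
    exact hm2 x
  have f1 : FTC (fun t => S.Ec m (h t)) _ t0 t1 := FTC.sum Finset.univ fun j => (ftc_E H mM nM j).const_mul (S.e j : ℂ)
  have f2 : FTC (fun t => S.Ac m (h t)) _ t0 t1 := FTC.sum Finset.univ fun j => FTC.sum Finset.univ fun k => FTC.sum Finset.univ fun l =>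
    ftc_L3 H (hq j k l) (hPq j k l) (fun x y z => rfl)
  have f3 : FTC (fun t => S.Wc m κ (h t)) _ t0 t1 := FTC.sum Finset.univ fun j => FTC.sum Finset.univ fun k => FTC.sum Finset.univ fun l =>
    FTC.sum Finset.univ fun i => FTC.sum Finset.univ fun n =>
    ftc_L4 H (kernels_rr hm hκ (hM4 j k l i n)) (kernels_pr hm hκ (hM4 j k l i n)) (fun x y z w => rfl)
  have f := f1.add ((f2.const_mul (-1)).add (f3.const_mul 3))
  refine FTC.congr f ?_
  · intro t ht
    rw [uIcc_of_le H.le] at ht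
    have a1 := E_id hS hm hB (hn t ht).1 hK1
    have a2 := A_id' hB (hn t ht).1 hq hM4
    have a3 : ∀ j k l i n, L4 (S.M4 m j k l i n) (h t j) (h t k) (h t i) (h t n) =
        L4 (S.nr m κ j k l i n) (h t j) (h t k) (h t i) (h t n) + L4 (S.pr m κ j k l i n) (h t j) (h t k) (h t i) (h t n) :=
      fun j k l i n => L4_split hm hκ hB ((hn t ht).1 j) ((hn t ht).1 k) ((hn t ht).1 i) ((hn t ht).1 n) (hM4 j k l i n)
    simp only [a3] at a2
    have e1 := congrArg₂ (fun x y : ℂ => x + -1 * (Complex.I * (∑ j, ∑ k, ∑ l, L3 (S.Pq m j k l) (h t j) (h t k) (h t l)) + y)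
      + 3 * ∑ j, ∑ k, ∑ l, ∑ i, ∑ n, (Complex.I * L4 (S.pr m κ j k l i n) (h t j) (h t k) (h t i) (h t n) + S.Q5 m κ (h t) j k l i n)) a1 a2

    have e2 : S.Dc' m κ (h t) = Complex.I * (∑ j, ∑ k, ∑ l, L3 (S.Pq m j k l) (h t j) (h t k) (h t l)) + -1 *
      (Complex.I * (∑ j, ∑ k, ∑ l, L3 (S.Pq m j k l) (h t j) (h t k) (h t l)) +
      3 * Complex.I * ∑ j, ∑ k, ∑ l, ∑ i, ∑ n, (L4 (S.nr m κ j k l i n) (h t j) (h t k) (h t i) (h t n) + L4 (S.pr m κ j k l i n) (h t j) (h t k) (h t i) (h t n)))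
      + 3 * ∑ j, ∑ k, ∑ l, ∑ i, ∑ n, (Complex.I * L4 (S.pr m κ j k l i n) (h t j) (h t k) (h t i) (h t n) + S.Q5 m κ (h t) j k l i n) := by
      unfold Sys.Dc'
      simp only [Finset.sum_add_distrib, ← Finset.mul_sum]
      ring
    refine Eq.trans ?_ (e1.trans e2.symm)
    simp only [Finset.sum_add_distrib, ← Finset.mul_sum, Sys.Q5]
    ring

theorem increment {S : Sys} {C : ℝ} (hS : S.Adm C) {γ : ℝ} (hγ : 0 < γ) (hγ4 : γ < 1 / 4) :
    ∃ Q : ℝ, 0 < Q ∧ ∀ m, GoodW m → ∀ κ : ℝ, 0 < κ → κ ≤ 1 → ∀ (h : ℝ → Fin 2 → ℝ → ℂ) (t0 t1 : ℝ), FSol S h t0 t1 →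
      ∀ b : ℝ, 0 ≤ b → (∀ t ∈ Icc t0 t1, ∀ i, L2 (Wm m (fun x => ‖h t i x‖ₑ)) ≤ ENNReal.ofReal b) →
      ‖S.Ec m (h t1) - S.Ec m (h t0)‖ ≤ Q * (b ^ 3 + κ ^ (-(1 / 2 + γ)) * b ^ 4 +
        (t1 - t0) * (κ ^ (1 / 2 - γ) * b ^ 4 + κ ^ (-(1 / 2 + γ)) * b ^ 5)) := by
  obtain ⟨Q, hQ, st⟩ := static_bd hS hγ hγ4
  have hC := hS.C_pos
  refine ⟨16 * (384 * C) + 192 * Q, by positivity, ?_⟩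
  intro m hm κ hκ hκ1 h t0 t1 H b hb hbd
  have st := st m hm κ hκ hκ1
  have k1 : 0 < κ ^ (-(1 / 2 + γ)) := Real.rpow_pos_of_pos hκ _
  have k2 : 0 < κ ^ (1 / 2 - γ) := Real.rpow_pos_of_pos hκ _
  generalize κ ^ (-(1 / 2 + γ)) = κ1 at *
  generalize κ ^ (1 / 2 - γ) = κ2 at *
  have bA : ∀ t ∈ Icc t0 t1, ‖S.Ac m (h t)‖ ≤ 8 * (384 * C * b ^ 3) := by
    intro t ht
    unfold Sys.Ac
    have : ∀ j k l, ‖L3 (S.q m j k l) (h t j) (h t k) (h t l)‖ ≤ 384 * C * b ^ 3 := by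
      intro j k l
      apply norm_le_of_enorm (by positivity)
      rw [ENNReal.ofReal_mul (by positivity), ENNReal.ofReal_pow hb]
      exact L3q_le hS hm j k l (H.meas1 t j) (H.meas1 t k) (H.meas1 t l) (hbd t ht j) (hbd t ht k) (hbd t ht l)
    refine (sum2_norm fun j => sum2_norm fun k => sum2_norm fun l => this j k l).trans (by linarith)
  have bW : ∀ t ∈ Icc t0 t1, ‖S.Wc m κ (h t)‖ ≤ 32 * (Q * κ1 * b ^ 4) := by
    intro t ht
    unfold Sys.Wc
    have : ∀ j k l i n, ‖L4 (S.rr m κ j k l i n) (h t j) (h t k) (h t i) (h t n)‖ ≤ Q * κ1 * b ^ 4 := by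
      intro j k l i n
      apply norm_le_of_enorm (by positivity)
      rw [ENNReal.ofReal_mul (by positivity), ENNReal.ofReal_pow hb]
      exact (st (h t) (H.meas1 t) _ (hbd t ht) j k l i n).1
    refine (sum2_norm fun j => sum2_norm fun k => sum2_norm fun l => sum2_norm fun i => sum2_norm fun n => this j k l i n).trans (by linarith)
  have bD : ∀ t ∈ Icc t0 t1, ‖S.Dc' m κ (h t)‖ ≤ 32 * (3 * (Q * κ2 * b ^ 4) + 3 * (Q * κ1 * b ^ 5)) := by
    intro t ht
    unfold Sys.Dc'
    have : ∀ j k l i n, ‖-3 * Complex.I * L4 (S.nr m κ j k l i n) (h t j) (h t k) (h t i) (h t n) + 3 * S.Q5 m κ (h t) j k l i n‖ ≤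
        3 * (Q * κ2 * b ^ 4) + 3 * (Q * κ1 * b ^ 5) := by
      intro j k l i n
      have s := st (h t) (H.meas1 t) _ (hbd t ht) j k l i n
      have s1 : ‖L4 (S.nr m κ j k l i n) (h t j) (h t k) (h t i) (h t n)‖ ≤ Q * κ2 * b ^ 4 := by
        apply norm_le_of_enorm (by positivity)
        rw [ENNReal.ofReal_mul (by positivity), ENNReal.ofReal_pow hb]
        exact s.2.1
      have s2 : ‖S.Q5 m κ (h t) j k l i n‖ ≤ Q * κ1 * b ^ 5 := by
        apply norm_le_of_enorm (by positivity)
        rw [ENNReal.ofReal_mul (by positivity), ENNReal.ofReal_pow hb]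
        exact s.2.2
      refine (norm_add_le _ _).trans ?_
      simp only [norm_mul, norm_neg, Complex.norm_I, Complex.norm_ofNat, mul_one]
      linarith
    refine (sum2_norm fun j => sum2_norm fun k => sum2_norm fun l => sum2_norm fun i => sum2_norm fun n => this j k l i n).trans (by linarith)
  have f := (ftc_Y hS H hm hκ).2
  have i0 : t0 ∈ Icc t0 t1 := ⟨le_rfl, H.le⟩
  have i1 : t1 ∈ Icc t0 t1 := ⟨H.le, le_rfl⟩
  have fi : ‖∫ t in t0..t1, S.Dc' m κ (h t)‖ ≤ 32 * (3 * (Q * κ2 * b ^ 4) + 3 * (Q * κ1 * b ^ 5)) * |t1 - t0| := by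
    apply intervalIntegral.norm_integral_le_of_norm_le_const
    intro t ht
    rw [uIoc_of_le H.le] at ht
    exact bD t ⟨ht.1.le, ht.2⟩
  rw [abs_of_nonneg (sub_nonneg.2 H.le)] at fi
  have e : S.Ec m (h t1) - S.Ec m (h t0) = (∫ t in t0..t1, S.Dc' m κ (h t)) + (S.Ac m (h t1) - S.Ac m (h t0)) - 3 * (S.Wc m κ (h t1) - S.Wc m κ (h t0)) := by
    rw [← f]; ring
  rw [e]
  refine (norm_sub_le _ _).trans ?_
  rw [norm_mul, Complex.norm_ofNat]
  have n1 := (norm_add_le (∫ t in t0..t1, S.Dc' m κ (h t)) (S.Ac m (h t1) - S.Ac m (h t0)))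
  have n2 := norm_sub_le (S.Ac m (h t1)) (S.Ac m (h t0))
  have n3 := norm_sub_le (S.Wc m κ (h t1)) (S.Wc m κ (h t0))
  have a0 := bA t0 i0; have a1 := bA t1 i1; have w0 := bW t0 i0; have w1 := bW t1 i1
  have ht : 0 ≤ t1 - t0 := sub_nonneg.2 H.le
  generalize t1 - t0 = T at *
  have p1 : 0 ≤ C * (κ1 * b ^ 4) := by positivity
  have p2 : 0 ≤ C * (T * (κ2 * b ^ 4 + κ1 * b ^ 5)) := by positivity
  have p3 : 0 ≤ Q * b ^ 3 := by positivity
  have p4 : 0 ≤ Q * (T * (κ2 * b ^ 4 + κ1 * b ^ 5)) := by positivity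
  linarith

end PAn

namespace PAn
set_option linter.unusedVariables false

lemma cont_boot {F : ℝ → ℝ} {t0 t1 a : ℝ} (h01 : t0 ≤ t1) (ha : 0 < a) (hF : ContinuousOn F (Icc t0 t1)) (h0 : F t0 ≤ a)
    (step : ∀ s ∈ Icc t0 t1, (∀ t ∈ Icc t0 s, F t ≤ 4 * a) → F s ≤ 3 * a) : ∀ t ∈ Icc t0 t1, F t ≤ 4 * a := by
  by_contra hcon
  push Not at hcon
  obtain ⟨t, ht, hFt⟩ := hcon
  have hcl : IsCompact (Icc t0 t1 ∩ F ⁻¹' Ici (4 * a)) :=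
    isCompact_Icc.of_isClosed_subset (hF.preimage_isClosed_of_isClosed isClosed_Icc isClosed_Ici) inter_subset_left
  obtain ⟨τ, hτ⟩ := hcl.exists_isLeast ⟨t, ht, hFt.le⟩
  have hτI : τ ∈ Icc t0 t1 := hτ.1.1
  have hτ4 : 4 * a ≤ F τ := hτ.1.2
  have lt : ∀ s ∈ Icc t0 τ, s ≠ τ → F s < 4 * a := by
    intro s hs hne
    by_contra hc
    push Not at hc
    exact hne (le_antisymm hs.2 (hτ.2 ⟨⟨hs.1, hs.2.trans hτI.2⟩, hc⟩))
  have hiv := intermediate_value_Icc hτI.1 (hF.mono (Icc_subset_Icc le_rfl hτI.2))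
  obtain ⟨r, hr, hr4⟩ := hiv (show 4 * a ∈ Icc (F t0) (F τ) from ⟨by linarith, hτ4⟩)
  have : r = τ := by
    by_contra hne
    exact absurd (lt r hr hne) (by linarith)
  subst this
  have := step r hτI (fun s hs => by
    by_cases e : s = r
    · rw [e]; exact hr4.le
    · exact (lt s hs e).le)
  linarith

noncomputable def Sys.Er (S : Sys) (m : ℝ → ℝ) (f : Fin 2 → ℝ → ℂ) : ℝ :=
  ∑ j, S.e j * (L2 (Wm m (fun x => ‖f j x‖ₑ))).toReal ^ 2

lemma Ec_eq (S : Sys) {m : ℝ → ℝ} (hm : GoodW m) {f : Fin 2 → ℝ → ℂ} (hf : ∀ i, Measurable (f i))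
    (hr : ∀ j ξ, f j (-ξ) = (starRingEnd ℂ) (f j ξ)) : S.Ec m f = (S.Er m f : ℂ) := by
  unfold Sys.Ec Sys.Er
  push_cast
  refine Finset.sum_congr rfl fun j _ => ?_
  congr 1
  have e1 : ∀ x, (m x ^ 2 : ℂ) * (f j x * f j (-x)) = (((m x * ‖f j x‖) ^ 2 : ℝ) : ℂ) := by
    intro x
    rw [hr, Complex.mul_conj, Complex.normSq_eq_norm_sq]
    push_cast; ring
  simp_rw [e1]
  rw [integral_complex_ofReal, ← Complex.ofReal_pow]
  congr 1
  rw [integral_eq_lintegral_of_nonneg_ae (Eventually.of_forall fun x => by positivity)]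
  · rw [← ENNReal.toReal_pow, L2_sq]
    congr 1
    refine lintegral_congr fun x => ?_
    unfold Wm
    rw [ENNReal.ofReal_pow (mul_nonneg (hm.pos x).le (norm_nonneg _)), ENNReal.ofReal_mul (hm.pos x).le, ofReal_norm]
  · have h1 := hm.cont.measurable
    have h2 := (hf j).norm
    exact ((h1.mul h2).pow_const 2).aestronglyMeasurable

lemma L2_Wm_fin {S : Sys} {h : ℝ → Fin 2 → ℝ → ℂ} {t0 t1 : ℝ} (H : FSol S h t0 t1) {m : ℝ → ℝ} (hm : GoodW m) {t : ℝ} (ht : t ∈ Icc t0 t1)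
    (j : Fin 2) : L2 (Wm m (fun x => ‖h t j x‖ₑ)) ≠ ⊤ := by
  obtain ⟨R, hR, hb⟩ := H.bdd
  obtain ⟨C, hC⟩ := hm.crude
  have : L2 (Wm m (fun x => ‖h t j x‖ₑ)) ≤ ENNReal.ofReal C * R := by
    calc _ ≤ L2 (fun x => ENNReal.ofReal C * wN 10 (h t j) x) := by
          apply L2_mono; intro x
          refine le_trans ?_ (mul_le_mul' le_rfl (wN_mono (by norm_num : 4 ≤ 10) (h t j) x))
          unfold Wm wN
          rw [← mul_assoc, ← ENNReal.ofReal_mul' (by positivity)]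
          exact mul_le_mul' (ENNReal.ofReal_le_ofReal (hC x)) le_rfl
      _ = ENNReal.ofReal C * L2 (wN 10 (h t j)) := L2_const_mul _ (measurable_wN 10 (H.meas1 t j))
      _ ≤ _ := mul_le_mul' le_rfl (hb t ht j)
  exact ne_top_of_le_ne_top (by finiteness) this

lemma Er_cont {S : Sys} {C : ℝ} (hS : S.Adm C) {h : ℝ → Fin 2 → ℝ → ℂ} {t0 t1 : ℝ} (H : FSol S h t0 t1) {m : ℝ → ℝ} (hm : GoodW m) :
    ContinuousOn (fun t => S.Er m (h t)) (Icc t0 t1) := by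
  obtain ⟨c, hc0, hq, hPq, hK1, hM4, hm2⟩ := kernels hS hm
  have mM : Measurable fun x => (m x ^ 2 : ℂ) := by
    have := (Complex.measurable_ofReal.comp hm.cont.measurable).pow_const 2
    exact this
  have nM : ∀ x, ‖(m x ^ 2 : ℂ)‖ ≤ c * (1 + |x|) ^ 8 := by
    intro x
    rw [norm_pow, Complex.norm_real, Real.norm_eq_abs, sq_abs]
    exact hm2 x
  have fc : ContinuousOn (fun t => S.Ec m (h t)) (Icc t0 t1) := by
    unfold Sys.Ec
    refine continuousOn_finsetSum _ fun j _ => continuousOn_const.mul ?_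
    have key : ∀ t ∈ Icc t0 t1, ∫ x, (m x ^ 2 : ℂ) * (h t j x * h t j (-x)) = (∫ x, (m x ^ 2 : ℂ) * (h t0 j x * h t0 j (-x))) + ∫ s in t0..t,
      ((∫ x, (m x ^ 2 : ℂ) * (S.nl (h s) j x * h s j (-x))) + ∫ x, (m x ^ 2 : ℂ) * (h s j x * S.nl (h s) j (-x))) := by
      intro t ht
      have := (ftc_E (H.mono le_rfl ht.2 ht.1) mM nM j).2
      rw [← this]; ring
    refine ContinuousOn.congr ?_ key
    refine continuousOn_const.add ?_
    have i := (ftc_E H mM nM j).1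
    have := intervalIntegral.continuousOn_primitive_interval ((intervalIntegrable_iff' (by finiteness)).1 i)
    rw [uIcc_of_le H.le] at this
    exact this
  have : ContinuousOn (fun t => (S.Ec m (h t)).re) (Icc t0 t1) := Complex.continuous_re.comp_continuousOn fc
  refine this.congr fun t ht => ?_
  simp only
  rw [Ec_eq S hm (H.meas1 t) (fun j ξ => H.real j ξ t ht), Complex.ofReal_re]

theorem boot {S : Sys} {C : ℝ} (hS : S.Adm C) {γ : ℝ} (hγ : 0 < γ) (hγ4 : γ < 1 / 4) :
    ∃ c : ℝ, 0 < c ∧ ∀ m, GoodW m → ∀ (h : ℝ → Fin 2 → ℝ → ℂ) (t0 t1 : ℝ), FSol S h t0 t1 →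
      ∀ ε : ℝ, 0 < ε → ε ≤ c → (t1 - t0) * ε ^ (5 / 2 - γ) ≤ c →
      (S.Er m (h t0) ≤ ε ^ 2 → ∀ t ∈ Icc t0 t1, S.Er m (h t) ≤ 4 * ε ^ 2) ∧
      (S.Er m (h t1) ≤ ε ^ 2 → ∀ t ∈ Icc t0 t1, S.Er m (h t) ≤ 4 * ε ^ 2) := by
  obtain ⟨Q, hQ, inc⟩ := increment hS hγ hγ4
  have he := hS.e_pos
  obtain ⟨β, hβ1, hβ⟩ : ∃ β : ℝ, 1 ≤ β ∧ ∀ j, 4 ≤ S.e j * β ^ 2 := by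
    refine ⟨1 + 4 / S.e 0 + 4 / S.e 1, ?_, ?_⟩
    · have := he 0; have := he 1
      have : 0 < 4 / S.e 0 := by positivity
      have : 0 < 4 / S.e 1 := by positivity
      linarith
    · have h0 : 0 < 4 / S.e 0 := div_pos (by norm_num) (he 0)
      have h1 : 0 < 4 / S.e 1 := div_pos (by norm_num) (he 1)
      intro j
      have key : ∀ r : ℝ, 0 < r → ∀ x, 0 ≤ x → 4 ≤ r * (1 + 4 / r + x) ^ 2 := by
        intro r hr x hx
        have : 0 < 4 / r := by positivity
        calc (4:ℝ) = r * (4 / r) := by field_simp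
          _ ≤ _ := by
            apply mul_le_mul_of_nonneg_left _ hr.le
            nlinarith
      fin_cases j
      · exact key _ (he 0) _ h1.le
      · have := key _ (he 1) _ h0.le
        simp only [Fin.mk_one, Fin.isValue]
        convert this using 3
        ring
  have hβ0 : 0 < β := by linarith
  have c0 : 0 < 1 / (2 * Q * β ^ 5 + 1) := by positivity
  refine ⟨1 / (2 * Q * β ^ 5 + 1), c0, ?_⟩
  intro m hm h t0 t1 H ε hε hεc hT
  have cQ : 2 * Q * β ^ 5 * (1 / (2 * Q * β ^ 5 + 1)) ≤ 1 := by
    rw [mul_one_div, div_le_one (by positivity)]; linarith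
  have hε1 : ε ≤ 1 := hεc.trans (by rw [div_le_one (by positivity)]; nlinarith [show 0 < Q * β ^ 5 by positivity])
  generalize 1 / (2 * Q * β ^ 5 + 1) = c at *
  have hbd : ∀ t ∈ Icc t0 t1, S.Er m (h t) ≤ 4 * ε ^ 2 → ∀ i, L2 (Wm m (fun x => ‖h t i x‖ₑ)) ≤ ENNReal.ofReal (β * ε) := by
    intro t ht hE i
    have fin := L2_Wm_fin H hm ht i
    rw [← ENNReal.ofReal_toReal fin]
    apply ENNReal.ofReal_le_ofReal
    have : S.e i * (L2 (Wm m (fun x => ‖h t i x‖ₑ))).toReal ^ 2 ≤ S.Er m (h t) := by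
      unfold Sys.Er
      exact Finset.single_le_sum (f := fun j => S.e j * (L2 (Wm m (fun x => ‖h t j x‖ₑ))).toReal ^ 2)
        (fun j _ => mul_nonneg (he j).le (sq_nonneg _)) (Finset.mem_univ i)
    refine le_of_sq_le_sq ?_ (by positivity)
    refine le_of_mul_le_mul_left ?_ (he i)
    have := hβ i
    nlinarith [sq_nonneg ε]
  have inc' : ∀ s0 s1, t0 ≤ s0 → s1 ≤ t1 → s0 ≤ s1 → (∀ t ∈ Icc s0 s1, S.Er m (h t) ≤ 4 * ε ^ 2) →
      |S.Er m (h s1) - S.Er m (h s0)| ≤ 2 * ε ^ 2 := by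
    intro s0 s1 a0 a1 a01 hE
    have H' := H.mono a0 a1 a01
    have := inc m hm ε hε hε1 h s0 s1 H' (β * ε) (by positivity) (fun t ht => hbd t (Icc_subset_Icc a0 a1 ht) (hE t ht))
    rw [Ec_eq S hm (H'.meas1 s1) (fun j ξ => H'.real j ξ s1 ⟨a01, le_rfl⟩), Ec_eq S hm (H'.meas1 s0) (fun j ξ => H'.real j ξ s0 ⟨le_rfl, a01⟩),
      ← Complex.ofReal_sub, Complex.norm_real, Real.norm_eq_abs] at this
    refine this.trans ?_
    have r1 : ε ^ (-(1 / 2 + γ)) * ε ^ 4 ≤ ε ^ 3 := by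
      rw [← Real.rpow_natCast, ← Real.rpow_natCast, ← Real.rpow_add hε]
      exact Real.rpow_le_rpow_of_exponent_ge hε hε1 (by push_cast; linarith)
    have r2 : ε ^ (1 / 2 - γ) * ε ^ 4 = ε ^ (5 / 2 - γ) * ε ^ 2 := by
      rw [← Real.rpow_natCast, ← Real.rpow_natCast, ← Real.rpow_add hε, ← Real.rpow_add hε]
      congr 1; push_cast; ring
    have r3 : ε ^ (-(1 / 2 + γ)) * ε ^ 5 = ε ^ (5 / 2 - γ) * ε ^ 2 := by
      rw [← Real.rpow_natCast, ← Real.rpow_natCast, ← Real.rpow_add hε, ← Real.rpow_add hε]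
      congr 1; push_cast; ring
    have hz : 0 < ε ^ (5 / 2 - γ) := Real.rpow_pos_of_pos hε _
    have hT' : (s1 - s0) * ε ^ (5 / 2 - γ) ≤ c := le_trans (mul_le_mul_of_nonneg_right (by linarith) hz.le) hT
    have p3 : β ^ 3 ≤ β ^ 5 := pow_le_pow_right₀ hβ1 (by norm_num)
    have p4 : β ^ 4 ≤ β ^ 5 := pow_le_pow_right₀ hβ1 (by norm_num)
    have e3 : ε ^ 3 ≤ c * ε ^ 2 := by
      have := mul_le_mul_of_nonneg_right hεc (sq_nonneg ε)
      calc ε ^ 3 = ε * ε ^ 2 := by ring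
        _ ≤ _ := this
    have hs : 0 ≤ s1 - s0 := sub_nonneg.2 a01
    have hk : 0 < ε ^ (-(1 / 2 + γ)) := Real.rpow_pos_of_pos hε _
    have hk2 : 0 < ε ^ (1 / 2 - γ) := Real.rpow_pos_of_pos hε _
    calc Q * ((β * ε) ^ 3 + ε ^ (-(1 / 2 + γ)) * (β * ε) ^ 4 + (s1 - s0) * (ε ^ (1 / 2 - γ) * (β * ε) ^ 4 + ε ^ (-(1 / 2 + γ)) * (β * ε) ^ 5))
        = Q * (β ^ 3 * ε ^ 3 + β ^ 4 * (ε ^ (-(1 / 2 + γ)) * ε ^ 4) + (s1 - s0) * (β ^ 4 * (ε ^ (1 / 2 - γ) * ε ^ 4) + β ^ 5 * (ε ^ (-(1 / 2 + γ)) * ε ^ 5))) := by ring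
      _ ≤ Q * (β ^ 5 * ε ^ 3 + β ^ 5 * ε ^ 3 + (s1 - s0) * (β ^ 5 * (ε ^ (5 / 2 - γ) * ε ^ 2) + β ^ 5 * (ε ^ (5 / 2 - γ) * ε ^ 2))) := by
          rw [r2, r3]
          gcongr
      _ = 2 * Q * β ^ 5 * (ε ^ 3 + ((s1 - s0) * ε ^ (5 / 2 - γ)) * ε ^ 2) := by ring
      _ ≤ 2 * Q * β ^ 5 * (c * ε ^ 2 + c * ε ^ 2) := by gcongr
      _ = 2 * (2 * Q * β ^ 5 * c) * ε ^ 2 := by ring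
      _ ≤ 2 * 1 * ε ^ 2 := by gcongr
      _ = _ := by ring
  have hcont := Er_cont hS H hm
  have ε2 : 0 < ε ^ 2 := by positivity
  constructor
  · intro h0
    refine cont_boot H.le ε2 hcont h0 fun s hs hE => ?_
    have := inc' t0 s le_rfl hs.2 hs.1 hE
    linarith [(abs_le.1 this).2]
  · intro h1 t ht
    have key := cont_boot (F := fun t => S.Er m (h (-t))) (t0 := -t1) (t1 := -t0) (neg_le_neg H.le) ε2 ?_ (by simpa using h1) ?_ (-t)
      ⟨neg_le_neg ht.2, neg_le_neg ht.1⟩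
    · simpa using key
    · refine hcont.comp continuous_neg.continuousOn ?_
      intro x hx
      exact ⟨by linarith [hx.2], by linarith [hx.1]⟩
    · intro s hs hE
      have := inc' (-s) t1 (by linarith [hs.2]) le_rfl (by linarith [hs.1]) (fun t ht => by
        have := hE (-t) ⟨by linarith [ht.2], by linarith [ht.1]⟩
        simpa using this)
      linarith [(abs_le.1 this).1]

end PAn

namespace PAn
set_option linter.unusedVariables false

noncomputable def scl (σ : ℝ) (h : ℝ → Fin 2 → ℝ → ℂ) (τ : ℝ) (j : Fin 2) (ζ : ℝ) : ℂ := (σ : ℂ) * h (σ ^ 3 * τ) j (ζ / σ)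

lemma lint_scale {σ : ℝ} (hσ : 0 < σ) (F : ℝ → ℝ≥0∞) : ∫⁻ x, F (x / σ) = ENNReal.ofReal σ * ∫⁻ x, F x := by
  have h := lintegral_map_equiv (μ := (volume : Measure ℝ)) F (Homeomorph.mulLeft₀ (σ⁻¹) (by positivity)).toMeasurableEquiv
  have e : Measure.map (Homeomorph.mulLeft₀ (σ⁻¹) (by positivity : σ⁻¹ ≠ 0)).toMeasurableEquiv volume = ENNReal.ofReal σ • (volume : Measure ℝ) := by
    have := Real.map_volume_mul_left (a := σ⁻¹) (by positivity)
    rw [inv_inv, abs_of_pos hσ] at this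
    exact this
  rw [e, lintegral_smul_measure] at h
  rw [← smul_eq_mul, h]
  refine lintegral_congr fun x => ?_
  rw [div_eq_inv_mul]; rfl

lemma int_scale {σ : ℝ} (hσ : 0 < σ) (F : ℝ → ℂ) : ∫ x, F (x / σ) = (σ : ℂ) * ∫ x, F x := by
  rw [Measure.integral_comp_div, abs_of_pos hσ]; simp

lemma nl_scl (S : Sys) {σ : ℝ} (hσ : 0 < σ) (f : Fin 2 → ℝ → ℂ) (l : Fin 2) (ζ : ℝ) :
    S.nl (fun j ζ => (σ : ℂ) * f j (ζ / σ)) l ζ = (σ : ℂ) ^ 4 * S.nl f l (ζ / σ) := by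
  unfold Sys.nl
  rw [Finset.mul_sum]
  refine Finset.sum_congr rfl fun i _ => ?_
  rw [Finset.mul_sum]
  refine Finset.sum_congr rfl fun n _ => ?_
  have h := int_scale hσ (fun y => (σ : ℂ) ^ 3 * (Complex.I * (S.B l i n y (ζ / σ - y) : ℂ) * (f i y * f n (ζ / σ - y))))
  rw [pow_succ, mul_comm (_ ^ 3) (σ : ℂ), mul_assoc, ← integral_const_mul, ← h]
  congr 1; ext y
  have e : S.B l i n y (ζ - y) = σ * S.B l i n (y / σ) (ζ / σ - y / σ) := by
    unfold Sys.B; field_simp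
  beta_reduce
  rw [e, sub_div]
  push_cast
  ring

lemma FSol.scl {S : Sys} {h : ℝ → Fin 2 → ℝ → ℂ} {t0 t1 : ℝ} (H : FSol S h t0 t1) {σ : ℝ} (hσ : 0 < σ) (hσ1 : σ ≤ 1) :
    FSol S (PAn.scl σ h) (t0 / σ ^ 3) (t1 / σ ^ 3) := by
  have s3 : 0 < σ ^ 3 := by positivity
  have mt : MapsTo (fun τ => σ ^ 3 * τ) (Icc (t0 / σ ^ 3) (t1 / σ ^ 3)) (Icc t0 t1) := by
    intro τ hτ
    exact ⟨by have := (div_le_iff₀ s3).1 hτ.1; linarith, by have := (le_div_iff₀ s3).1 hτ.2; linarith⟩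
  refine ⟨by gcongr; exact H.le, ?_, ?_, ?_, ?_⟩
  · intro j
    have : Measurable fun p : ℝ × ℝ => (σ ^ 3 * p.1, p.2 / σ) := by fun_prop
    exact ((H.meas j).comp this).const_mul _
  · intro j ξ t ht
    have d := H.der j (ξ / σ) _ (mt ht)
    have d2 : HasDerivWithinAt (fun τ : ℝ => σ ^ 3 * τ) (σ ^ 3) (Icc (t0 / σ ^ 3) (t1 / σ ^ 3)) t := by
      have := (hasDerivAt_id t).const_mul (σ ^ 3)
      simpa using this.hasDerivWithinAt
    have d3 := (HasDerivWithinAt.scomp t d d2 mt).const_mul (σ : ℂ)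
    refine d3.congr_deriv ?_
    have := nl_scl S hσ (h (σ ^ 3 * t)) j ξ
    have e : S.nl (PAn.scl σ h t) j ξ = (σ : ℂ) ^ 4 * S.nl (h (σ ^ 3 * t)) j (ξ / σ) := this
    rw [e]
    unfold PAn.scl
    rw [Complex.real_smul]
    have hσc : (σ : ℂ) ≠ 0 := by exact_mod_cast hσ.ne'
    push_cast
    field_simp
  · intro j ξ t ht
    unfold PAn.scl
    rw [map_mul, Complex.conj_ofReal, neg_div, H.real j _ _ (mt ht)]
  · obtain ⟨R, hR, hb⟩ := H.bdd
    refine ⟨ENNReal.ofReal σ * ((ENNReal.ofReal σ * R ^ 2) ^ (1 / 2 : ℝ)), by finiteness, ?_⟩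
    intro t ht j
    have m1 := H.meas1 (σ ^ 3 * t) j
    calc L2 (wN 10 (PAn.scl σ h t j)) ≤ L2 (fun x => ENNReal.ofReal σ * wN 10 (h (σ ^ 3 * t) j) (x / σ)) := by
          apply L2_mono; intro x
          unfold wN PAn.scl
          rw [enorm_mul, ← mul_assoc, ← mul_assoc, mul_comm _ ‖(σ : ℂ)‖ₑ]
          have : ‖(σ : ℂ)‖ₑ = ENNReal.ofReal σ := by rw [← ofReal_norm, Complex.norm_real, Real.norm_eq_abs, abs_of_pos hσ]
          rw [this]
          refine mul_le_mul' (mul_le_mul' le_rfl (ENNReal.ofReal_le_ofReal (pow_le_pow_left₀ (by positivity) ?_ 10))) le_rfl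
          rw [abs_div, abs_of_pos hσ]
          linarith [le_div_self (abs_nonneg x) hσ hσ1]
      _ = ENNReal.ofReal σ * L2 (fun x => wN 10 (h (σ ^ 3 * t) j) (x / σ)) := by
          apply L2_const_mul
          exact (measurable_wN 10 m1).comp (measurable_id.div_const σ)
      _ ≤ _ := by
          gcongr
          unfold L2
          have := lint_scale hσ (fun x => wN 10 (h (σ ^ 3 * t) j) x ^ 2)
          gcongr
          rw [this]
          gcongr
          rw [← L2_sq]
          gcongr
          exact hb _ (mt ht) j

lemma Er_scl (S : Sys) {m : ℝ → ℝ} (hm : ∀ x, 0 ≤ m x) {σ : ℝ} (hσ : 0 < σ) (f : Fin 2 → ℝ → ℂ)  :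
    S.Er m (fun j ζ => (σ : ℂ) * f j (ζ / σ)) = σ ^ 3 * S.Er (fun x => m (σ * x)) f := by
  unfold Sys.Er
  rw [Finset.mul_sum]
  refine Finset.sum_congr rfl fun j _ => ?_
  simp only [← ENNReal.toReal_pow, L2_sq]
  have := lint_scale hσ (fun x => (ENNReal.ofReal σ * Wm (fun x => m (σ * x)) (fun x => ‖f j x‖ₑ) x) ^ 2)
  have e : ∀ x, (ENNReal.ofReal σ * Wm (fun x => m (σ * x)) (fun x => ‖f j x‖ₑ) (x / σ)) ^ 2 =
      Wm m (fun x => ‖(σ : ℂ) * f j (x / σ)‖ₑ) x ^ 2 := by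
    intro x
    unfold Wm
    have : ‖(σ : ℂ)‖ₑ = ENNReal.ofReal σ := by rw [← ofReal_norm, Complex.norm_real, Real.norm_eq_abs, abs_of_pos hσ]
    simp only
    rw [enorm_mul, this, mul_div_cancel₀ _ hσ.ne']
    ring
  simp only [e] at this
  rw [this]
  simp only [mul_pow]
  rw [lintegral_const_mul' _ _ (by finiteness), ENNReal.toReal_mul, ENNReal.toReal_mul, ENNReal.toReal_pow, ENNReal.toReal_ofReal hσ.le]
  ring

theorem boot_sc {S : Sys} {C : ℝ} (hS : S.Adm C) {γ : ℝ} (hγ : 0 < γ) (hγ4 : γ < 1 / 4) :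
    ∃ c : ℝ, 0 < c ∧ ∀ m, GoodW m → ∀ (h : ℝ → Fin 2 → ℝ → ℂ) (t0 t1 : ℝ), FSol S h t0 t1 →
      ∀ σ A : ℝ, 0 < σ → σ ≤ 1 → 0 < A → σ ^ 3 * A ≤ c → (t1 - t0) * σ ^ (3 / 4 - 3 / 2 * γ) * A ^ (5 / 4 - γ / 2) ≤ c →
      (S.Er (fun x => m (σ * x)) (h t0) ≤ A → ∀ t ∈ Icc t0 t1, S.Er (fun x => m (σ * x)) (h t) ≤ 4 * A) ∧
      (S.Er (fun x => m (σ * x)) (h t1) ≤ A → ∀ t ∈ Icc t0 t1, S.Er (fun x => m (σ * x)) (h t) ≤ 4 * A) := by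
  obtain ⟨c, hc, bt⟩ := boot hS hγ hγ4
  refine ⟨min c (c ^ 2), by positivity, ?_⟩
  intro m hm h t0 t1 H σ A hσ hσ1 hA h3 hT
  have s3 : 0 < σ ^ 3 := by positivity
  have hm0 : ∀ x, 0 ≤ m x := fun x => (hm.pos x).le
  have hsq : Real.sqrt (σ ^ 3 * A) ^ 2 = σ ^ 3 * A := Real.sq_sqrt (by positivity)
  have b := bt m hm _ _ _ (H.scl hσ hσ1) (Real.sqrt (σ ^ 3 * A)) (by positivity) ?_ ?_
  · have es : ∀ t, S.Er m (scl σ h (t / σ ^ 3)) = σ ^ 3 * S.Er (fun x => m (σ * x)) (h t) := by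
      intro t
      have := Er_scl S hm0 hσ (h t)
      rw [← this]
      unfold scl
      rw [mul_div_cancel₀ _ s3.ne']
    rw [es, es, hsq] at b
    have mem : ∀ t ∈ Icc t0 t1, t / σ ^ 3 ∈ Icc (t0 / σ ^ 3) (t1 / σ ^ 3) := fun t ht => ⟨by gcongr; exact ht.1, by gcongr; exact ht.2⟩
    constructor
    · intro h0 t ht
      have := b.1 (by gcongr) _ (mem t ht)
      rw [es] at this
      exact le_of_mul_le_mul_left (by linarith) s3
    · intro h0 t ht
      have := b.2 (by gcongr) _ (mem t ht)
      rw [es] at this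
      exact le_of_mul_le_mul_left (by linarith) s3
  · rw [Real.sqrt_le_left hc.le]
    exact h3.trans (min_le_right _ _)
  · refine le_trans (le_of_eq ?_) (hT.trans (min_le_left _ _))
    have e1 : Real.sqrt (σ ^ 3 * A) ^ (5 / 2 - γ) = (σ ^ 3 * σ ^ (3 / 4 - 3 / 2 * γ)) * A ^ (5 / 4 - γ / 2) := by
      rw [Real.sqrt_eq_rpow, ← Real.rpow_mul (by positivity), Real.mul_rpow s3.le hA.le, ← Real.rpow_natCast σ 3, ← Real.rpow_mul hσ.le,
        ← Real.rpow_add hσ]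
      congr 2
      · push_cast; ring
      · ring
    rw [e1, ← sub_div]
    field_simp

end PAn

namespace PAn
set_option linter.unusedVariables false

open scoped FourierTransform SchwartzMap

lemma four_eq (f : 𝓢(ℝ, ℂ)) (x : ℝ) :
    𝓕 f x = ∫ v : ℝ, Complex.exp (↑(-2 * Real.pi * v * x) * Complex.I) * f v := by
  rw [SchwartzMap.fourier_coe, Real.fourier_real_eq_integral_exp_smul]
  simp only [smul_eq_mul]

lemma L2_sch (f : 𝓢(ℝ, ℂ)) : (∫⁻ x, ‖f x‖ₑ ^ 2) = ENNReal.ofReal (∫ x, ‖f x‖ ^ 2) := by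
  have hm : MemLp (fun x => f x) 2 := f.memLp 2
  have hi : Integrable fun x => ‖f x‖ ^ 2 := hm.integrable_norm_pow (by norm_num)
  rw [ofReal_integral_eq_lintegral_ofReal hi (Eventually.of_forall fun x => by positivity)]
  refine lintegral_congr fun x => ?_
  rw [← ofReal_norm, ENNReal.ofReal_pow (norm_nonneg _)]

lemma L2_four (f : 𝓢(ℝ, ℂ)) : L2 (fun x => ‖𝓕 f x‖ₑ) = L2 (fun x => ‖f x‖ₑ) := by
  unfold L2
  rw [L2_sch, L2_sch, SchwartzMap.integral_norm_sq_fourier]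

lemma L2_sch_fin (f : 𝓢(ℝ, ℂ)) : L2 (fun x => ‖f x‖ₑ) ≠ ⊤ := by
  unfold L2
  rw [L2_sch]
  finiteness

lemma four_meas {β : Type*} [MeasurableSpace β] {W : β → 𝓢(ℝ, ℂ)} (h : Measurable fun p : β × ℝ => W p.1 p.2) :
    Measurable fun p : β × ℝ => 𝓕 (W p.1) p.2 := by
  simp only [four_eq]
  have : StronglyMeasurable (Function.uncurry fun (p : β × ℝ) (v : ℝ) =>
      Complex.exp (↑(-2 * Real.pi * v * p.2) * Complex.I) * W p.1 v) := by
    refine Measurable.stronglyMeasurable ?_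
    have h1 : Measurable fun q : (β × ℝ) × ℝ => W q.1.1 q.2 :=
      h.comp ((measurable_fst.comp measurable_fst).prodMk measurable_snd)
    have h2 : Measurable fun q : (β × ℝ) × ℝ => Complex.exp (↑(-2 * Real.pi * q.2 * q.1.2) * Complex.I) := by fun_prop
    exact h2.mul h1
  exact this.integral_prod_right.measurable

noncomputable def ph (α τ ξ : ℝ) : ℂ := Complex.exp (-(Complex.I * (α * ξ ^ 3 * τ : ℝ)))

lemma norm_ph (α τ ξ : ℝ) : ‖ph α τ ξ‖ = 1 := by
  unfold ph
  have : -(Complex.I * ((α * ξ ^ 3 * τ : ℝ) : ℂ)) = ((-(α * ξ ^ 3 * τ) : ℝ) : ℂ) * Complex.I := by push_cast; ring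
  rw [this]
  exact Complex.norm_exp_ofReal_mul_I _

lemma ph_ne (α τ ξ : ℝ) : ph α τ ξ ≠ 0 := Complex.exp_ne_zero _

lemma ph_der (α τ ξ : ℝ) : HasDerivAt (fun τ => ph α τ ξ) (-(Complex.I * (α * ξ ^ 3 : ℝ)) * ph α τ ξ) τ := by
  have h1 : HasDerivAt (fun τ : ℝ => -(Complex.I * (α * ξ ^ 3 * τ : ℝ))) (-(Complex.I * (α * ξ ^ 3 : ℝ))) τ := by
    have h0 : HasDerivAt (fun τ : ℝ => α * ξ ^ 3 * τ) (α * ξ ^ 3) τ := by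
      simpa using (hasDerivAt_id τ).const_mul (α * ξ ^ 3)
    exact (h0.ofReal_comp.const_mul Complex.I).neg
  have := h1.cexp
  unfold ph
  convert this using 1; ring

lemma ph_smooth (α τ : ℝ) : ContDiff ℝ (⊤ : ℕ∞) (fun ξ => ph α τ ξ) := by
  unfold ph
  have h0 : ContDiff ℝ (⊤ : ℕ∞) (fun ξ : ℝ => α * ξ ^ 3 * τ) := by fun_prop
  have h1 : ContDiff ℝ (⊤ : ℕ∞) (fun ξ : ℝ => ((α * ξ ^ 3 * τ : ℝ) : ℂ)) := Complex.ofRealCLM.contDiff.comp h0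
  exact (contDiff_const.mul h1).neg.cexp

lemma ph_cont2 (α : ℝ) : Continuous (fun p : ℝ × ℝ => ph α p.1 p.2) := by
  unfold ph; fun_prop

lemma tst_one (α : ℝ) {ψ : ℝ → ℂ} (hc : HasCompactSupport ψ) (hψ : ContDiff ℝ (⊤ : ℕ∞) ψ) :
    ∃ Q : ℝ → 𝓢(ℝ, ℂ), (∀ τ ξ, Q τ ξ = ψ ξ * ph α τ ξ) ∧ (Measurable fun p : ℝ × ℝ => 𝓕 (Q p.1) p.2) ∧
      ∃ K : ℝ≥0∞, K ≠ ⊤ ∧ ∀ τ, L2 (fun x => ‖𝓕 (Q τ) x‖ₑ) ≤ K := by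
  have hc' : ∀ τ, HasCompactSupport fun ξ => ψ ξ * ph α τ ξ := fun τ => hc.mul_right
  have hs : ∀ τ, ContDiff ℝ (⊤ : ℕ∞) fun ξ => ψ ξ * ph α τ ξ := fun τ => hψ.mul (ph_smooth α τ)
  refine ⟨fun τ => (hc' τ).toSchwartzMap (hs τ), fun τ ξ => rfl, ?_, ?_⟩
  · refine four_meas (W := fun τ => (hc' τ).toSchwartzMap (hs τ)) ?_
    have : Measurable fun p : ℝ × ℝ => ψ p.2 * ph α p.1 p.2 :=
      (hψ.continuous.measurable.comp measurable_snd).mul (ph_cont2 α).measurable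
    exact this
  · refine ⟨L2 (fun x => ‖ψ x‖ₑ), ?_, fun τ => ?_⟩
    · have := L2_sch_fin (hc.toSchwartzMap hψ)
      exact this
    · rw [L2_four]
      refine le_of_eq ?_
      congr 1; ext x
      have : ((hc' τ).toSchwartzMap (hs τ)) x = ψ x * ph α τ x := rfl
      rw [this, ← ofReal_norm, norm_mul, norm_ph, mul_one, ofReal_norm]

lemma tst_ex (α : ℝ) {ψ : ℝ → ℂ} (hc : HasCompactSupport ψ) (hψ : ContDiff ℝ (⊤ : ℕ∞) ψ) :
    ∃ Q Q' : ℝ → 𝓢(ℝ, ℂ), (∀ τ ξ, Q τ ξ = ψ ξ * ph α τ ξ) ∧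
      (∀ τ ξ, Q' τ ξ = -(Complex.I * (α * ξ ^ 3 : ℝ)) * (ψ ξ * ph α τ ξ)) ∧
      (∀ τ x, HasDerivAt (fun τ => 𝓕 (Q τ) x) (𝓕 (Q' τ) x) τ) ∧
      (Measurable fun p : ℝ × ℝ => 𝓕 (Q p.1) p.2) ∧ (Measurable fun p : ℝ × ℝ => 𝓕 (Q' p.1) p.2) ∧
      ∃ K : ℝ≥0∞, K ≠ ⊤ ∧ ∀ τ, L2 (fun x => ‖𝓕 (Q τ) x‖ₑ) ≤ K ∧ L2 (fun x => ‖𝓕 (Q' τ) x‖ₑ) ≤ K := by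
  have hc2 : HasCompactSupport fun ξ : ℝ => -(Complex.I * (α * ξ ^ 3 : ℝ)) * ψ ξ := hc.mul_left
  have hs2 : ContDiff ℝ (⊤ : ℕ∞) fun ξ : ℝ => -(Complex.I * (α * ξ ^ 3 : ℝ)) * ψ ξ := by
    refine ContDiff.mul ?_ hψ
    have h0 : ContDiff ℝ (⊤ : ℕ∞) (fun ξ : ℝ => α * ξ ^ 3) := by fun_prop
    have h1 : ContDiff ℝ (⊤ : ℕ∞) (fun ξ : ℝ => ((α * ξ ^ 3 : ℝ) : ℂ)) := Complex.ofRealCLM.contDiff.comp h0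
    exact (contDiff_const.mul h1).neg
  obtain ⟨Q, hQ, mQ, K, hK, bK⟩ := tst_one α hc hψ
  obtain ⟨Q', hQ', mQ', K', hK', bK'⟩ := tst_one α hc2 hs2
  refine ⟨Q, Q', hQ, fun τ ξ => by rw [hQ', mul_assoc], ?_, mQ, mQ', K + K', by finiteness,
    fun τ => ⟨(bK τ).trans le_self_add, (bK' τ).trans le_add_self⟩⟩
  intro τ x
  simp only [four_eq]
  have nexp : ∀ v : ℝ, ‖Complex.exp (↑(-2 * Real.pi * v * x) * Complex.I)‖ = 1 := fun v => Complex.norm_exp_ofReal_mul_I _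
  refine (hasDerivAt_integral_of_dominated_loc_of_deriv_le (𝕜 := ℝ) (x₀ := τ) (μ := volume)
    (F := fun τ v => Complex.exp (↑(-2 * Real.pi * v * x) * Complex.I) * Q τ v)
    (F' := fun τ v => Complex.exp (↑(-2 * Real.pi * v * x) * Complex.I) * Q' τ v) (bound := fun v => ‖Q' 0 v‖) (s := univ) univ_mem ?_ ?_ ?_ ?_ ?_ ?_).2
  · refine Eventually.of_forall fun τ => ?_
    refine Continuous.aestronglyMeasurable ?_
    have := (Q τ).continuous
    fun_prop
  · refine (Q τ).integrable.norm.mono' ?_ (Eventually.of_forall fun v => ?_)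
    · refine Continuous.aestronglyMeasurable ?_
      have := (Q τ).continuous
      fun_prop
    · rw [norm_mul, nexp, one_mul]
  · refine Continuous.aestronglyMeasurable ?_
    have := (Q' τ).continuous
    fun_prop
  · refine Eventually.of_forall fun v τ _ => ?_
    rw [norm_mul, nexp, one_mul, hQ', hQ', norm_mul, norm_mul _ (ph α 0 v), norm_ph, norm_ph]
  · exact (Q' 0).integrable.norm
  · refine Eventually.of_forall fun v τ _ => ?_
    refine HasDerivAt.const_mul _ ?_
    simp only [hQ, hQ']
    have := (ph_der α τ v).const_mul (ψ v)
    convert this using 1; ring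

end PAn

namespace PAn
set_option linter.unusedVariables false

open scoped FourierTransform SchwartzMap

lemma lint_mul_le {F G : ℝ → ℝ≥0∞} (hF : Measurable F) (hG : Measurable G) : ∫⁻ x, F x * G x ≤ L2 F * L2 G := by
  have h := lint_conv_le (G := fun x => G (-x)) hF (hG.comp measurable_neg) 0
  rw [L2_comp_neg] at h
  simpa using h

lemma sch_mul_int (f g : 𝓢(ℝ, ℂ)) : Integrable fun x => f x * g x := by
  obtain ⟨C, hC⟩ := g.decay 0 0
  refine f.integrable.mul_bdd (c := C) g.continuous.aestronglyMeasurable (Eventually.of_forall fun x => ?_)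
  simpa using hC.2 x

/-- abstract solution in physical space -/
structure PSol (S : Sys) (W Ψ : ℝ → Fin 2 → 𝓢(ℝ, ℂ)) : Prop where
  cont : ∀ j, Continuous fun p : ℝ × ℝ => W p.1 j p.2
  contΨ : ∀ j, Continuous fun p : ℝ × ℝ => Ψ p.1 j p.2
  der : ∀ j x t, HasDerivAt (fun τ => W τ j x) (Ψ t j x) t
  four : ∀ t j ξ, 𝓕 (Ψ t j) ξ = Complex.I * (S.α j * ξ ^ 3 : ℝ) * 𝓕 (W t j) ξ + S.nl (fun i y => 𝓕 (W t i) y) j ξ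
  real : ∀ t j x, (starRingEnd ℂ) (W t j x) = W t j x

noncomputable def hat (W : ℝ → Fin 2 → 𝓢(ℝ, ℂ)) (t : ℝ) (j : Fin 2) (ξ : ℝ) : ℂ := 𝓕 (W t j) ξ

lemma PSol.four' {S : Sys} {W Ψ : ℝ → Fin 2 → 𝓢(ℝ, ℂ)} (H : PSol S W Ψ) (t : ℝ) (j : Fin 2) (ξ : ℝ) :
    𝓕 (Ψ t j) ξ = Complex.I * (S.α j * ξ ^ 3 : ℝ) * hat W t j ξ + S.nl (hat W t) j ξ := H.four t j ξ

lemma hat_cont (W : ℝ → Fin 2 → 𝓢(ℝ, ℂ)) (t : ℝ) (j : Fin 2) : Continuous (hat W t j) := (𝓕 (W t j)).continuous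

lemma PSol.hmeas {S : Sys} {W Ψ : ℝ → Fin 2 → 𝓢(ℝ, ℂ)} (H : PSol S W Ψ) (j : Fin 2) :
    Measurable fun p : ℝ × ℝ => hat W p.1 j p.2 := four_meas (W := fun t => W t j) (H.cont j).measurable

lemma PSol.nl_cont {S : Sys} {W Ψ : ℝ → Fin 2 → 𝓢(ℝ, ℂ)} (H : PSol S W Ψ) (t : ℝ) (j : Fin 2) :
    Continuous (S.nl (hat W t) j) := by
  have e : S.nl (hat W t) j = fun ξ => 𝓕 (Ψ t j) ξ - Complex.I * (S.α j * ξ ^ 3 : ℝ) * hat W t j ξ := by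
    ext ξ; rw [H.four']; ring
  rw [e]
  have h1 := (𝓕 (Ψ t j)).continuous
  have h2 := hat_cont W t j
  fun_prop

lemma nl_pt (S : Sys) {f : Fin 2 → ℝ → ℂ} (hf : ∀ i, Measurable (f i)) {R : ℝ≥0∞} (hR : ∀ i, L2 (wN 10 (f i)) ≤ R) (hR' : R ≠ ⊤)
    (l : Fin 2) (ξ : ℝ) : (1 + |ξ|) ^ 8 * ‖S.nl f l ξ‖ ≤ (4 * (ENNReal.ofReal S.bb * (R * R))).toReal := by
  have h := nl_crude S hf l ξ
  have h2 : (∑ i, ∑ n, ENNReal.ofReal S.bb * cv (wN 9 (f i)) (wN 9 (f n)) ξ) ≤ 4 * (ENNReal.ofReal S.bb * (R * R)) := by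
    have : ∀ i n, ENNReal.ofReal S.bb * cv (wN 9 (f i)) (wN 9 (f n)) ξ ≤ ENNReal.ofReal S.bb * (R * R) := by
      intro i n
      refine mul_le_mul' le_rfl ?_
      refine (lint_conv_le (measurable_wN 9 (hf i)) (measurable_wN 9 (hf n)) ξ).trans (mul_le_mul' ?_ ?_)
      · exact (L2_mono fun x => wN_mono (by norm_num) (f i) x).trans (hR i)
      · exact (L2_mono fun x => wN_mono (by norm_num) (f n) x).trans (hR n)
    refine (Finset.sum_le_sum fun i _ => Finset.sum_le_sum fun n _ => this i n).trans (le_of_eq ?_)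
    simp only [Fin.sum_univ_two]; ring
  rw [← ofReal_norm, ← ENNReal.ofReal_mul (by positivity)] at h
  exact (ENNReal.ofReal_le_iff_le_toReal (by finiteness)).1 (h.trans h2)

lemma duh_weak {S : Sys} {W Ψ : ℝ → Fin 2 → 𝓢(ℝ, ℂ)} (H : PSol S W Ψ) {t0 t1 : ℝ} (h01 : t0 ≤ t1) {R : ℝ≥0∞} (hR : R ≠ ⊤)
    (hb : ∀ t ∈ Icc t0 t1, ∀ j, L2 (wN 10 (hat W t j)) ≤ R) (j : Fin 2) {ψ : ℝ → ℂ} (hc : HasCompactSupport ψ)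
    (hψ : ContDiff ℝ (⊤ : ℕ∞) ψ) :
    (∫ ξ, hat W t1 j ξ * (ψ ξ * ph (S.α j) t1 ξ)) - (∫ ξ, hat W t0 j ξ * (ψ ξ * ph (S.α j) t0 ξ)) =
      ∫ t in t0..t1, ∫ ξ, S.nl (hat W t) j ξ * (ψ ξ * ph (S.α j) t ξ) := by
  obtain ⟨Q, Q', hQ, hQ', dQ, mQ, mQ', K, hK, bK⟩ := tst_ex (S.α j) hc hψ
  have ms : ∀ f : 𝓢(ℝ, ℂ), Measurable fun x => ‖f x‖ₑ := fun f => f.continuous.measurable.enorm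
  set B := 2 * R + ENNReal.ofReal S.bb * (16 * R * R) with hBd
  have hBt : B ≠ ⊤ := by finiteness
  have bW : ∀ t ∈ Icc t0 t1, L2 (fun x => ‖W t j x‖ₑ) ≤ B := by
    intro t ht
    have hn := (nice_of_L2 S (fun i => (hat_cont W t i).measurable) (hb t ht)).1 j
    rw [← L2_four]
    refine (L2_mono fun x => ?_).trans hn.two
    unfold wN
    exact le_mul_of_one_le_left' (by rw [ENNReal.one_le_ofReal]; exact one_le_pow₀ (by linarith [abs_nonneg x]))
  have bΨ : ∀ t ∈ Icc t0 t1, L2 (fun x => ‖Ψ t j x‖ₑ) ≤ ENNReal.ofReal |S.α j| * B + B := by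
    intro t ht
    have hn := nice_of_L2 S (fun i => (hat_cont W t i).measurable) (hb t ht)
    have m1 := measurable_wN 8 (hn.1 j).meas
    have m2 := measurable_wN 8 (hn.2 j).meas
    rw [← L2_four]
    have : ∀ x, ‖𝓕 (Ψ t j) x‖ₑ ≤ ENNReal.ofReal |S.α j| * wN 8 (hat W t j) x + wN 8 (S.nl (hat W t) j) x := by
      intro x
      rw [H.four']
      refine (enorm_add_le _ _).trans (add_le_add ?_ ?_)
      · unfold wN
        rw [← ofReal_norm, ← ofReal_norm, norm_mul, norm_mul, Complex.norm_I, one_mul, Complex.norm_real, Real.norm_eq_abs, abs_mul, abs_pow,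
          ENNReal.ofReal_mul (by positivity), ENNReal.ofReal_mul (by positivity), mul_assoc]
        refine mul_le_mul' le_rfl (mul_le_mul' (ENNReal.ofReal_le_ofReal ?_) le_rfl)
        exact (pow_le_pow_left₀ (abs_nonneg x) (by linarith) 3).trans (pow_le_pow_right₀ (by linarith [abs_nonneg x]) (by norm_num))
      · unfold wN
        exact le_mul_of_one_le_left' (by rw [ENNReal.one_le_ofReal]; exact one_le_pow₀ (by linarith [abs_nonneg x]))
    refine (L2_mono this).trans ?_
    refine (L2_add (m1.const_mul _) m2).trans ?_
    rw [L2_const_mul _ m1]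
    exact add_le_add (mul_le_mul' le_rfl (hn.1 j).two) (hn.2 j).two
  have key := ftc_int (μ := volume) (P := fun τ x => W τ j x * 𝓕 (Q τ) x)
    (P' := fun τ x => Ψ τ j x * 𝓕 (Q τ) x + W τ j x * 𝓕 (Q' τ) x) h01
    (fun x t _ => ((H.der j x t).mul (dQ t x)).hasDerivWithinAt)
    (((H.contΨ j).measurable.mul mQ).add ((H.cont j).measurable.mul mQ'))
    (C := (ENNReal.ofReal |S.α j| * B + B) * K + B * K) (by finiteness) ?_
    (sch_mul_int _ _) (sch_mul_int _ _)
  · have k2 := key.2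
    rw [← SchwartzMap.integral_fourier_mul_eq, ← SchwartzMap.integral_fourier_mul_eq] at k2
    simp only [hQ] at k2
    refine k2.trans (intervalIntegral.integral_congr fun t _ => ?_)
    beta_reduce
    rw [integral_add (sch_mul_int _ _) (sch_mul_int _ _), ← SchwartzMap.integral_fourier_mul_eq, ← SchwartzMap.integral_fourier_mul_eq,
      ← integral_add (sch_mul_int _ _) (sch_mul_int _ _)]
    refine integral_congr_ae (Eventually.of_forall fun ξ => ?_)
    simp only [hQ, hQ', H.four']
    have : 𝓕 (W t j) ξ = hat W t j ξ := rfl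
    rw [this]; ring
  · intro t ht
    calc _ ≤ ∫⁻ x, (‖Ψ t j x‖ₑ * ‖𝓕 (Q t) x‖ₑ + ‖W t j x‖ₑ * ‖𝓕 (Q' t) x‖ₑ) := by
          refine lintegral_mono fun x => ?_
          rw [← enorm_mul, ← enorm_mul]
          exact enorm_add_le _ _
      _ = (∫⁻ x, ‖Ψ t j x‖ₑ * ‖𝓕 (Q t) x‖ₑ) + ∫⁻ x, ‖W t j x‖ₑ * ‖𝓕 (Q' t) x‖ₑ :=
          lintegral_add_left ((ms _).mul (ms _)) _
      _ ≤ _ := by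
          refine add_le_add ((lint_mul_le (ms _) (ms _)).trans ?_) ((lint_mul_le (ms _) (ms _)).trans ?_)
          · exact mul_le_mul' (bΨ t ht) (bK t).1
          · exact mul_le_mul' (bW t ht) (bK t).2

end PAn

namespace PAn
set_option linter.unusedVariables false

open scoped FourierTransform SchwartzMap

lemma swap_aux {t0 t1 : ℝ} (h01 : t0 ≤ t1) {N : ℝ → ℝ → ℂ} (mN : Measurable fun p : ℝ × ℝ => N p.1 p.2) {K : ℝ}
    (hN : ∀ t ∈ Icc t0 t1, ∀ ξ, ‖N t ξ‖ ≤ K) {ψ : ℝ → ℂ} (hψ : Integrable ψ) :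
    ∫ t in t0..t1, ∫ ξ, ψ ξ * N t ξ = ∫ ξ, ψ ξ * ∫ t in t0..t1, N t ξ := by
  have hK : 0 ≤ K := (norm_nonneg _).trans (hN t0 ⟨le_rfl, h01⟩ 0)
  obtain ⟨ψ', hm', hae⟩ := hψ.aestronglyMeasurable
  have i' : Integrable ψ' := hψ.congr hae
  have e1 : ∀ t, ∫ ξ, ψ ξ * N t ξ = ∫ ξ, ψ' ξ * N t ξ := fun t => integral_congr_ae (by filter_upwards [hae] with ξ h; rw [h])
  have e2 : ∫ ξ, ψ ξ * ∫ t in t0..t1, N t ξ = ∫ ξ, ψ' ξ * ∫ t in t0..t1, N t ξ :=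
    integral_congr_ae (by filter_upwards [hae] with ξ h; rw [h])
  rw [e2]
  simp only [e1, ← intervalIntegral.integral_const_mul]
  refine intervalIntegral_integral_swap ?_
  rw [uIoc_of_le h01]
  have mm : Measurable (Function.uncurry fun t ξ => ψ' ξ * N t ξ) := (hm'.measurable.comp measurable_snd).mul mN
  refine ⟨mm.aestronglyMeasurable, ?_⟩
  unfold HasFiniteIntegral
  rw [lintegral_prod _ mm.enorm.aemeasurable]
  have fin : ∫⁻ ξ, ‖ψ' ξ‖ₑ < ⊤ := i'.2
  calc _ ≤ ∫⁻ t in Ioc t0 t1, (∫⁻ ξ, ‖ψ' ξ‖ₑ) * ENNReal.ofReal K := by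
        refine setLIntegral_mono measurable_const fun t ht => ?_
        rw [← lintegral_mul_const _ hm'.measurable.enorm]
        refine lintegral_mono fun ξ => ?_
        simp only [Function.uncurry, enorm_mul]
        refine mul_le_mul' le_rfl ?_
        rw [← ofReal_norm]
        exact ENNReal.ofReal_le_ofReal (hN t ⟨ht.1.le, ht.2⟩ ξ)
    _ = (∫⁻ ξ, ‖ψ' ξ‖ₑ) * ENNReal.ofReal K * volume (Ioc t0 t1) := by simp
    _ < ⊤ := by
      rw [Real.volume_Ioc]
      exact ENNReal.mul_lt_top (ENNReal.mul_lt_top fin ENNReal.ofReal_lt_top) ENNReal.ofReal_lt_top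

lemma bdd_ii {t0 t1 : ℝ} (h01 : t0 ≤ t1) {N : ℝ → ℂ} (mN : Measurable N) {K : ℝ} (hN : ∀ t ∈ Icc t0 t1, ‖N t‖ ≤ K) :
    IntervalIntegrable N volume t0 t1 := by
  rw [intervalIntegrable_iff_integrableOn_Ioc_of_le h01]
  refine Measure.integrableOn_of_bounded (M := K) (by rw [Real.volume_Ioc]; exact ENNReal.ofReal_ne_top) mN.aestronglyMeasurable ?_
  exact (ae_restrict_iff' measurableSet_Ioc).2 (Eventually.of_forall fun t ht => hN t ⟨ht.1.le, ht.2⟩)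

lemma duh {S : Sys} {W Ψ : ℝ → Fin 2 → 𝓢(ℝ, ℂ)} (H : PSol S W Ψ) {t0 t1 : ℝ} (h01 : t0 ≤ t1) {R : ℝ≥0∞} (hR : R ≠ ⊤)
    (hb : ∀ t ∈ Icc t0 t1, ∀ j, L2 (wN 10 (hat W t j)) ≤ R) (j : Fin 2) (ξ : ℝ) :
    hat W t1 j ξ * ph (S.α j) t1 ξ - hat W t0 j ξ * ph (S.α j) t0 ξ = ∫ t in t0..t1, S.nl (hat W t) j ξ * ph (S.α j) t ξ := by
  have mn : Measurable fun p : ℝ × ℝ => S.nl (hat W p.1) j p.2 := nl_meas_param S H.hmeas j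
  obtain ⟨N, hNd⟩ : ∃ N : ℝ → ℝ → ℂ, N = fun t ξ => S.nl (hat W t) j ξ * ph (S.α j) t ξ := ⟨_, rfl⟩
  have mN : Measurable fun p : ℝ × ℝ => N p.1 p.2 := by rw [hNd]; exact mn.mul (ph_cont2 _).measurable
  have cN : ∀ t, Continuous (N t) := by
    intro t
    rw [hNd]
    exact (H.nl_cont t j).mul (ph_smooth _ _).continuous
  set K := (4 * (ENNReal.ofReal S.bb * (R * R))).toReal
  have hN : ∀ t ∈ Icc t0 t1, ∀ ξ, ‖N t ξ‖ ≤ K := by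
    intro t ht ξ
    rw [hNd]
    beta_reduce
    rw [norm_mul, norm_ph, mul_one]
    refine le_trans ?_ (nl_pt S (fun i => (hat_cont W t i).measurable) (hb t ht) hR j ξ)
    exact le_mul_of_one_le_left (norm_nonneg _) (one_le_pow₀ (by linarith [abs_nonneg ξ]))
  have cA : ∀ t, Continuous fun ξ => hat W t j ξ * ph (S.α j) t ξ := fun t => (hat_cont W t j).mul (ph_smooth _ _).continuous
  have cI : Continuous fun ξ => ∫ t in t0..t1, N t ξ := by
    refine intervalIntegral.continuous_of_dominated_interval (bound := fun _ => K) ?_ ?_ ?_ ?_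
    · intro ξ
      exact (mN.comp (measurable_id.prodMk measurable_const)).aestronglyMeasurable
    · intro ξ
      rw [uIoc_of_le h01]
      exact Eventually.of_forall fun t ht => hN t ⟨ht.1.le, ht.2⟩ ξ
    · exact intervalIntegrable_const
    · exact Eventually.of_forall fun t _ => cN t
  have cF : Continuous fun ξ => hat W t1 j ξ * ph (S.α j) t1 ξ - hat W t0 j ξ * ph (S.α j) t0 ξ - ∫ t in t0..t1, N t ξ :=
    ((cA t1).sub (cA t0)).sub cI
  have ae := ae_eq_zero_of_integral_contDiff_smul_eq_zero (μ := volume) cF.locallyIntegrable ?_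
  · have := (Continuous.ae_eq_iff_eq volume cF continuous_const).1 ae
    have h2 := congrFun this ξ
    beta_reduce at h2
    rw [sub_eq_zero] at h2
    rw [h2, hNd]
  · intro g hg hgc
    have hψ : ContDiff ℝ (⊤ : ℕ∞) fun ξ => (g ξ : ℂ) := Complex.ofRealCLM.contDiff.comp hg
    have hψc : HasCompactSupport fun ξ => (g ξ : ℂ) := hgc.comp_left (g := fun x : ℝ => (x : ℂ)) (by simp)
    have w := duh_weak H h01 hR hb j hψc hψ
    have int : ∀ F : ℝ → ℂ, Continuous F → Integrable fun ξ => (g ξ : ℂ) * F ξ := fun F hF =>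
      (hψ.continuous.mul hF).integrable_of_hasCompactSupport hψc.mul_right
    have iψ : Integrable fun ξ => (g ξ : ℂ) := hψ.continuous.integrable_of_hasCompactSupport hψc
    have sw := swap_aux h01 mN hN iψ
    simp only [Complex.real_smul, mul_sub]
    rw [integral_sub, integral_sub, ← sw]
    · have e : ∀ t, ∫ ξ, hat W t j ξ * ((g ξ : ℂ) * ph (S.α j) t ξ) = ∫ ξ, (g ξ : ℂ) * (hat W t j ξ * ph (S.α j) t ξ) :=
        fun t => integral_congr_ae (Eventually.of_forall fun ξ => by ring)
      have e' : ∀ t, ∫ ξ, S.nl (hat W t) j ξ * ((g ξ : ℂ) * ph (S.α j) t ξ) = ∫ ξ, (g ξ : ℂ) * N t ξ :=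
        fun t => integral_congr_ae (Eventually.of_forall fun ξ => by rw [hNd]; ring)
      rw [e, e] at w
      simp only [e'] at w
      rw [w, sub_self]
    · exact int _ (cA t1)
    · exact int _ (cA t0)
    · exact (int _ (cA t1)).sub (int _ (cA t0))
    · exact int _ cI

end PAn

namespace PAn
set_option linter.unusedVariables false

open scoped FourierTransform SchwartzMap

lemma meas_slice {F : ℝ → ℝ → ℂ} (h : Measurable fun p : ℝ × ℝ => F p.1 p.2) (ξ : ℝ) : Measurable fun t => F t ξ :=
  h.comp (measurable_id.prodMk measurable_const)

lemma ph_cont1 (α ξ : ℝ) : Continuous fun t => ph α t ξ := by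
  unfold ph; fun_prop

lemma ph_neg (α t ξ : ℝ) : ph α t ξ * ph (-α) t ξ = 1 := by
  unfold ph
  rw [← Complex.exp_add]
  have : -(Complex.I * ((α * ξ ^ 3 * t : ℝ) : ℂ)) + -(Complex.I * ((-α * ξ ^ 3 * t : ℝ) : ℂ)) = 0 := by push_cast; ring
  rw [this, Complex.exp_zero]

lemma sch_decay (f : 𝓢(ℝ, ℂ)) (k : ℕ) : ∃ K : ℝ, 0 < K ∧ ∀ x, (1 + |x|) ^ k * ‖f x‖ ≤ K := by
  refine ⟨2 ^ k * ((Finset.Iic (k, 0)).sup fun m => SchwartzMap.seminorm ℝ m.1 m.2) f + 1, ?_, fun x => ?_⟩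
  · have : 0 ≤ ((Finset.Iic (k, 0)).sup fun m => SchwartzMap.seminorm ℝ m.1 m.2) f := apply_nonneg _ _
    positivity
  · have := SchwartzMap.one_add_le_sup_seminorm_apply (𝕜 := ℝ) (m := (k, 0)) (k := k) (n := 0) le_rfl le_rfl f x
    simp only [norm_iteratedFDeriv_zero, Real.norm_eq_abs] at this
    linarith

lemma hat_real {W : ℝ → Fin 2 → 𝓢(ℝ, ℂ)} {t : ℝ} {j : Fin 2} (h : ∀ x, (starRingEnd ℂ) (W t j x) = W t j x) (ξ : ℝ) :
    hat W t j (-ξ) = (starRingEnd ℂ) (hat W t j ξ) := by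
  unfold hat
  rw [four_eq, four_eq, ← integral_conj]
  refine integral_congr_ae (Eventually.of_forall fun v => ?_)
  simp only [map_mul, h, ← Complex.exp_conj, Complex.conj_ofReal, Complex.conj_I]
  congr 2
  push_cast; ring

lemma nl_contOn (S : Sys) {h : ℝ → Fin 2 → ℝ → ℂ} {s : Set ℝ} (hm : ∀ t i, Measurable (h t i)) {K : ℝ} (hK : 0 ≤ K)
    (hb : ∀ t ∈ s, ∀ i y, (1 + |y|) ^ 8 * ‖h t i y‖ ≤ K) (hc : ∀ i y, ContinuousOn (fun t => h t i y) s) (l : Fin 2) (ξ : ℝ) :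
    ContinuousOn (fun t => S.nl (h t) l ξ) s := by
  unfold Sys.nl
  refine continuousOn_finsetSum _ fun i _ => continuousOn_finsetSum _ fun n _ => ?_
  have hbb := S.bb_pos
  refine continuousOn_of_dominated (bound := fun y => S.bb * K * K * (1 + y ^ 2)⁻¹) ?_ ?_ ?_ ?_
  · intro t ht
    have h1 := hm t i
    have h2 : Measurable fun y => h t n (ξ - y) := (hm t n).comp (measurable_const.sub measurable_id)
    have h3 : Measurable fun y => (Complex.I * (S.B l i n y (ξ - y) : ℂ)) := by
      unfold Sys.B
      fun_prop
    exact (h3.mul (h1.mul h2)).aestronglyMeasurable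
  · intro t ht
    refine Eventually.of_forall fun y => ?_
    rw [norm_mul, norm_mul, norm_mul, Complex.norm_I, one_mul, Complex.norm_real, Real.norm_eq_abs]
    have b1 := S.B_le l i n y (ξ - y)
    have b2 := hb t ht i y
    have b3 := hb t ht n (ξ - y)
    generalize ξ - y = z at *
    have hy : 1 ≤ 1 + |y| := by linarith [abs_nonneg y]
    have hz : 1 ≤ 1 + |z| := by linarith [abs_nonneg z]
    have e1 : |y| + |z| ≤ (1 + |y|) * (1 + |z|) := by nlinarith [mul_nonneg (abs_nonneg y) (abs_nonneg z)]
    have e2 : 1 + y ^ 2 ≤ (1 + |y|) ^ 7 := by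
      have : 1 + y ^ 2 ≤ (1 + |y|) ^ 2 := by nlinarith [abs_nonneg y, sq_abs y]
      exact this.trans (pow_le_pow_right₀ hy (by norm_num))
    rw [← div_eq_mul_inv, le_div_iff₀ (by positivity)]
    calc |S.B l i n y z| * (‖h t i y‖ * ‖h t n z‖) * (1 + y ^ 2)
        ≤ S.bb * ((1 + |y|) * (1 + |z|)) * (‖h t i y‖ * ‖h t n z‖) * (1 + |y|) ^ 7 := by
          gcongr
          exact b1.trans (by gcongr)
      _ = S.bb * ((1 + |y|) ^ 8 * ‖h t i y‖) * ((1 + |z|) ^ 1 * ‖h t n z‖) := by ring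
      _ ≤ S.bb * K * K := by
          gcongr
          refine le_trans ?_ b3
          gcongr
          norm_num
  · exact integrable_inv_one_add_sq.const_mul _
  · refine Eventually.of_forall fun y => ?_
    exact continuousOn_const.mul ((hc i y).mul (hc n (ξ - y)))

theorem PSol.fsol {S : Sys} {W Ψ : ℝ → Fin 2 → 𝓢(ℝ, ℂ)} (H : PSol S W Ψ) {t0 t1 : ℝ} (h01 : t0 ≤ t1) {R : ℝ≥0∞} (hR : R ≠ ⊤)
    (hb : ∀ t ∈ Icc t0 t1, ∀ j, L2 (wN 10 (hat W t j)) ≤ R) : FSol S (hat W) t0 t1 := by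
  have mn : ∀ j, Measurable fun p : ℝ × ℝ => S.nl (hat W p.1) j p.2 := nl_meas_param S H.hmeas
  obtain ⟨N, hNd⟩ : ∃ N : Fin 2 → ℝ → ℝ → ℂ, ∀ j t ξ, N j t ξ = S.nl (hat W t) j ξ * ph (S.α j) t ξ := ⟨_, fun _ _ _ => rfl⟩
  have mN : ∀ j ξ, Measurable fun t => N j t ξ := by
    intro j ξ; simp only [hNd]
    exact (meas_slice (F := fun t ξ => S.nl (hat W t) j ξ) (mn j) ξ).mul
      (meas_slice (F := fun t ξ => ph (S.α j) t ξ) (ph_cont2 (S.α j)).measurable ξ)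
  obtain ⟨K, hKd⟩ : ∃ K, K = (4 * (ENNReal.ofReal S.bb * (R * R))).toReal := ⟨_, rfl⟩
  have hK : 0 ≤ K := by rw [hKd]; exact ENNReal.toReal_nonneg
  have hN : ∀ j, ∀ t ∈ Icc t0 t1, ∀ ξ, (1 + |ξ|) ^ 8 * ‖N j t ξ‖ ≤ K := by
    intro j t ht ξ
    rw [hNd, norm_mul, norm_ph, mul_one, hKd]
    exact nl_pt S (fun i => (hat_cont W t i).measurable) (hb t ht) hR j ξ
  have hN1 : ∀ j, ∀ t ∈ Icc t0 t1, ∀ ξ, ‖N j t ξ‖ ≤ K := fun j t ht ξ =>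
    le_trans (le_mul_of_one_le_left (norm_nonneg _) (one_le_pow₀ (by linarith [abs_nonneg ξ]))) (hN j t ht ξ)
  have D : ∀ j ξ, ∀ t ∈ Icc t0 t1, hat W t j ξ = (hat W t0 j ξ * ph (S.α j) t0 ξ + ∫ τ in t0..t, N j τ ξ) * ph (-S.α j) t ξ := by
    intro j ξ t ht
    have := duh H ht.1 hR (fun τ hτ => hb τ ⟨hτ.1, hτ.2.trans ht.2⟩) j ξ
    simp only [hNd]
    rw [← this, add_sub_cancel, mul_assoc, ph_neg, mul_one]
  obtain ⟨K0, hK0, hK0b⟩ : ∃ K0 : ℝ, 0 < K0 ∧ ∀ i y, (1 + |y|) ^ 8 * ‖hat W t0 i y‖ ≤ K0 := by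
    have := fun i => sch_decay (𝓕 (W t0 i)) 8
    choose k hk hk' using this
    refine ⟨k 0 + k 1, add_pos (hk 0) (hk 1), fun i y => ?_⟩
    fin_cases i
    · exact (hk' 0 y).trans (by linarith [hk 1])
    · exact (hk' 1 y).trans (by linarith [hk 0])
  have bdW : ∀ t ∈ Icc t0 t1, ∀ i y, (1 + |y|) ^ 8 * ‖hat W t i y‖ ≤ K0 + K * (t1 - t0) := by
    intro t ht i y
    rw [D i y t ht, norm_mul, norm_ph, mul_one]
    have hP : 0 < (1 + |y|) ^ 8 := by positivity
    have b1 : ‖∫ τ in t0..t, N i τ y‖ ≤ K / (1 + |y|) ^ 8 * |t - t0| := by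
      refine intervalIntegral.norm_integral_le_of_norm_le_const fun τ hτ => ?_
      rw [uIoc_of_le ht.1] at hτ
      rw [le_div_iff₀ hP, mul_comm]
      exact hN i τ ⟨hτ.1.le, hτ.2.trans ht.2⟩ y
    have b2 : ‖hat W t0 i y * ph (S.α i) t0 y + ∫ τ in t0..t, N i τ y‖ ≤ ‖hat W t0 i y‖ + K / (1 + |y|) ^ 8 * |t - t0| := by
      refine (norm_add_le _ _).trans (add_le_add ?_ b1)
      rw [norm_mul, norm_ph, mul_one]
    have b3 := hK0b i y
    generalize (1 + |y|) ^ 8 = P at *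
    calc _ ≤ P * (‖hat W t0 i y‖ + K / P * |t - t0|) := by gcongr
      _ = P * ‖hat W t0 i y‖ + K * |t - t0| := by field_simp
      _ ≤ K0 + K * (t1 - t0) := by
        rw [abs_of_nonneg (by linarith [ht.1])]
        have := ht.2
        gcongr
  have ii : ∀ j ξ, IntervalIntegrable (fun t => N j t ξ) volume t0 t1 := fun j ξ =>
    bdd_ii h01 (mN j ξ) (fun t ht => hN1 j t ht ξ)
  have cph : ∀ α ξ, Continuous fun t => ph α t ξ := ph_cont1
  have cW : ∀ i y, ContinuousOn (fun t => hat W t i y) (Icc t0 t1) := by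
    intro i y
    have h1 : ContinuousOn (fun t => ∫ τ in t0..t, N i τ y) (Icc t0 t1) := by
      have := intervalIntegral.continuousOn_primitive_interval' (ii i y) left_mem_uIcc
      rwa [uIcc_of_le h01] at this
    have h2 : ContinuousOn (fun t => (hat W t0 i y * ph (S.α i) t0 y + ∫ τ in t0..t, N i τ y) * ph (-S.α i) t y) (Icc t0 t1) :=
      (continuousOn_const.add h1).mul (cph _ _).continuousOn
    exact h2.congr (D i y)
  have cN : ∀ j ξ, ContinuousOn (fun t => N j t ξ) (Icc t0 t1) := by
    intro j ξ
    simp only [hNd]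
    have hK2 : 0 ≤ K0 + K * (t1 - t0) := by have := sub_nonneg.2 h01; positivity
    exact (nl_contOn S (fun t i => (hat_cont W t i).measurable) hK2 bdW cW j ξ).mul (cph _ _).continuousOn
  refine ⟨h01, H.hmeas, ?_, fun j ξ t _ => hat_real (H.real t j) ξ, R, hR, hb⟩
  intro j ξ t ht
  set N' : ℝ → ℂ := fun τ => N j (projIcc t0 t1 h01 τ) ξ with hN'
  have cN' : Continuous N' := (continuousOn_iff_continuous_restrict.1 (cN j ξ)).comp continuous_projIcc
  have d1 : HasDerivAt (fun s => ∫ τ in t0..s, N' τ) (N' t) t := (cN'.integral_hasStrictDerivAt t0 t).hasDerivAt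
  have e1 : ∀ s ∈ Icc t0 t1, ∫ τ in t0..s, N j τ ξ = ∫ τ in t0..s, N' τ := by
    intro s hs
    refine intervalIntegral.integral_congr fun τ hτ => ?_
    rw [uIcc_of_le hs.1] at hτ
    simp only [hN']
    rw [projIcc_of_mem h01 ⟨hτ.1, hτ.2.trans hs.2⟩]
  have d2 := ((d1.const_add (hat W t0 j ξ * ph (S.α j) t0 ξ)).mul (ph_der (-S.α j) t ξ)).hasDerivWithinAt (s := Icc t0 t1)
  have d3 : HasDerivWithinAt (fun τ => hat W τ j ξ) _ (Icc t0 t1) t :=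
    d2.congr (fun s hs => by rw [D j ξ s hs, e1 s hs]; rfl) (by rw [D j ξ t ht, e1 t ht]; rfl)
  convert d3 using 1
  have e2 : N' t = N j t ξ := by simp only [hN']; rw [projIcc_of_mem h01 ht]
  rw [e2, hNd, D j ξ t ht, e1 t ht, mul_assoc (S.nl _ _ _), ph_neg]
  push_cast
  ring

end PAn

namespace PAn
set_option linter.unusedVariables false

open scoped FourierTransform SchwartzMap

noncomputable def mulS (f g : 𝓢(ℝ, ℂ)) : 𝓢(ℝ, ℂ) := SchwartzMap.pairing (ContinuousLinearMap.mul ℂ ℂ) f g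

lemma mulS_apply (f g : 𝓢(ℝ, ℂ)) (x : ℝ) : mulS f g x = f x * g x := by
  simp [mulS]

noncomputable def DS (f : 𝓢(ℝ, ℂ)) : 𝓢(ℝ, ℂ) := SchwartzMap.derivCLM ℂ ℂ f

lemma DS_apply (f : 𝓢(ℝ, ℂ)) (x : ℝ) : DS f x = deriv f x := SchwartzMap.derivCLM_apply ℂ f x

lemma DS_coe (f : 𝓢(ℝ, ℂ)) : (DS f : ℝ → ℂ) = deriv f := funext (DS_apply f)

lemma four_D (f : 𝓢(ℝ, ℂ)) (ξ : ℝ) : 𝓕 (DS f) ξ = 2 * Real.pi * Complex.I * ξ * 𝓕 f ξ := by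
  rw [SchwartzMap.fourier_coe, SchwartzMap.fourier_coe, DS_coe, Real.fourier_deriv f.integrable f.differentiable]
  · simp
  · rw [← DS_coe]; exact (DS f).integrable

lemma four_mul (f g : 𝓢(ℝ, ℂ)) (ξ : ℝ) : 𝓕 (mulS f g) ξ = ∫ y, 𝓕 f y * 𝓕 g (ξ - y) := by
  have inv : ∀ (h : 𝓢(ℝ, ℂ)) (x : ℝ), (𝓕⁻ h) x = (𝓕 h) (-x) := by
    intro h x
    rw [SchwartzMap.fourierInv_coe, SchwartzMap.fourier_coe, Real.fourierInv_eq_fourier_neg]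
  set B := ContinuousLinearMap.mul ℂ ℂ
  have e : mulS f g = 𝓕⁻ (SchwartzMap.convolution B (𝓕 f) (𝓕 g)) := by
    ext x
    rw [inv, SchwartzMap.fourier_convolution, SchwartzMap.pairing_apply_apply, ← inv, ← inv, mulS_apply]
    simp [B]
  rw [e, FourierTransform.fourier_fourierInv_eq, SchwartzMap.convolution_apply]
  rfl

lemma sch_conv_int (f g : 𝓢(ℝ, ℂ)) (ξ : ℝ) : Integrable fun y => f y * g (ξ - y) := by
  obtain ⟨C, hC⟩ := g.decay 0 0
  refine f.integrable.mul_bdd (c := C) (g.continuous.comp (by fun_prop)).aestronglyMeasurable (Eventually.of_forall fun x => ?_)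
  simpa using hC.2 (ξ - x)

lemma nl_sch (S : Sys) (W : Fin 2 → 𝓢(ℝ, ℂ)) (l : Fin 2) (ξ : ℝ) :
    S.nl (fun i y => 𝓕 (W i) y) l ξ = ∑ i, ∑ n, ((S.b l i n / Real.pi : ℝ) : ℂ) * 𝓕 (mulS (DS (W i)) (W n)) ξ := by
  have hpi : (Real.pi : ℂ) ≠ 0 := by exact_mod_cast Real.pi_ne_zero
  have ii : ∀ i n, Integrable fun y => 𝓕 (DS (W i)) y * 𝓕 (W n) (ξ - y) := fun i n => sch_conv_int _ _ _
  have ii' : ∀ i n, Integrable fun y => 𝓕 (DS (W n)) (ξ - y) * 𝓕 (W i) y := by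
    intro i n
    have := sch_conv_int (𝓕 (W i)) (𝓕 (DS (W n))) ξ
    refine this.congr (Eventually.of_forall fun y => mul_comm _ _)
  have key : ∀ i n, ∫ y, Complex.I * (S.B l i n y (ξ - y) : ℂ) * (𝓕 (W i) y * 𝓕 (W n) (ξ - y)) =
      ((S.b l i n / (2 * Real.pi) : ℝ) : ℂ) * 𝓕 (mulS (DS (W i)) (W n)) ξ
       + ((S.b l n i / (2 * Real.pi) : ℝ) : ℂ) * 𝓕 (mulS (DS (W n)) (W i)) ξ := by
    intro i n
    have sw : ∫ y, 𝓕 (DS (W n)) y * 𝓕 (W i) (ξ - y) = ∫ y, 𝓕 (DS (W n)) (ξ - y) * 𝓕 (W i) y := by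
      rw [← integral_sub_left_eq_self _ volume ξ]
      simp
    rw [four_mul, four_mul, sw, ← integral_const_mul, ← integral_const_mul, ← integral_add ((ii i n).const_mul _) ((ii' i n).const_mul _)]
    refine integral_congr_ae (Eventually.of_forall fun y => ?_)
    simp only [four_D, Sys.B]
    push_cast
    field_simp
  unfold Sys.nl
  simp only [key, Fin.sum_univ_two]
  push_cast
  field_simp
  ring

end PAn

namespace PAn
set_option linter.unusedVariables false

open scoped FourierTransform SchwartzMap

lemma joint_dt {F : ℝ → ℝ → ℝ} (hF : ContDiff ℝ (⊤ : ℕ∞) fun p : ℝ × ℝ => F p.1 p.2) (t x : ℝ) :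
    HasDerivAt (fun τ => F τ x) (fderiv ℝ (fun p : ℝ × ℝ => F p.1 p.2) (t, x) (1, 0)) t := by
  have h1 : HasFDerivAt (fun p : ℝ × ℝ => F p.1 p.2) (fderiv ℝ (fun p : ℝ × ℝ => F p.1 p.2) (t, x)) (t, x) :=
    (hF.differentiable (by simp)).differentiableAt.hasFDerivAt
  have h2 : HasDerivAt (fun τ : ℝ => (τ, x)) (1, 0) t := (hasDerivAt_id t).prodMk (hasDerivAt_const t x)
  exact h1.comp_hasDerivAt t h2

lemma joint_dx {F : ℝ → ℝ → ℝ} (hF : ContDiff ℝ (⊤ : ℕ∞) fun p : ℝ × ℝ => F p.1 p.2) (t x : ℝ) :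
    HasDerivAt (F t) (fderiv ℝ (fun p : ℝ × ℝ => F p.1 p.2) (t, x) (0, 1)) x := by
  have h1 : HasFDerivAt (fun p : ℝ × ℝ => F p.1 p.2) (fderiv ℝ (fun p : ℝ × ℝ => F p.1 p.2) (t, x)) (t, x) :=
    (hF.differentiable (by simp)).differentiableAt.hasFDerivAt
  have h2 : HasDerivAt (fun τ : ℝ => (t, τ)) (0, 1) x := (hasDerivAt_const x t).prodMk (hasDerivAt_id x)
  exact h1.comp_hasDerivAt x h2

lemma joint_fd {F : ℝ → ℝ → ℝ} (hF : ContDiff ℝ (⊤ : ℕ∞) fun p : ℝ × ℝ => F p.1 p.2) (e : ℝ × ℝ) :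
    ContDiff ℝ (⊤ : ℕ∞) fun p : ℝ × ℝ => fderiv ℝ (fun p : ℝ × ℝ => F p.1 p.2) p e :=
  (hF.fderiv_right (m := (⊤ : ℕ∞)) (by simp)).clm_apply contDiff_const

lemma joint_dxc {F : ℝ → ℝ → ℝ} (hF : ContDiff ℝ (⊤ : ℕ∞) fun p : ℝ × ℝ => F p.1 p.2) :
    ContDiff ℝ (⊤ : ℕ∞) fun p : ℝ × ℝ => deriv (F p.1) p.2 := by
  have : (fun p : ℝ × ℝ => deriv (F p.1) p.2) = fun p : ℝ × ℝ => fderiv ℝ (fun p : ℝ × ℝ => F p.1 p.2) p (0, 1) := by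
    ext p; exact (joint_dx hF p.1 p.2).deriv
  rw [this]; exact joint_fd hF _

lemma joint_iter {F : ℝ → ℝ → ℝ} (hF : ContDiff ℝ (⊤ : ℕ∞) fun p : ℝ × ℝ => F p.1 p.2) (k : ℕ) :
    ContDiff ℝ (⊤ : ℕ∞) fun p : ℝ × ℝ => iteratedDeriv k (F p.1) p.2 := by
  induction k with
  | zero => simpa using hF
  | succ k ih =>
    simp only [iteratedDeriv_succ]
    exact joint_dxc (F := fun t x => iteratedDeriv k (F t) x) ih

lemma DS_re {f : 𝓢(ℝ, ℂ)} {g : ℝ → ℝ} (hg : Differentiable ℝ g) (h : ∀ x, f x = (g x : ℂ)) (x : ℝ) : DS f x = ((deriv g x : ℝ) : ℂ) := by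
  rw [DS_apply]
  have : (f : ℝ → ℂ) = fun x => (g x : ℂ) := funext h
  rw [this]
  exact ((hg x).hasDerivAt.ofReal_comp).deriv

lemma four_add' (f g : 𝓢(ℝ, ℂ)) (ξ : ℝ) : 𝓕 (f + g) ξ = 𝓕 f ξ + 𝓕 g ξ := by
  rw [FourierTransform.fourier_add]; rfl

lemma four_smul' (c : ℂ) (f : 𝓢(ℝ, ℂ)) (ξ : ℝ) : 𝓕 (c • f) ξ = c * 𝓕 f ξ := by
  rw [FourierTransform.fourier_smul]; rfl

theorem psol_of (S : Sys) (a : Fin 2 → ℝ) (d : Fin 2 → Fin 2 → Fin 2 → ℝ) (hα : ∀ j, S.α j = (2 * Real.pi) ^ 3 * a j)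
    (hbd : ∀ l i n, S.b l i n = Real.pi * d l i n) (w : Fin 2 → ℝ → ℝ → ℝ)
    (hw : ∀ j, ContDiff ℝ (⊤ : ℕ∞) fun p : ℝ × ℝ => w j p.1 p.2)
    (hS : ∀ j t, ∃ φ : SchwartzMap ℝ ℝ, ∀ x : ℝ, φ x = w j t x)
    (hP : ∀ j t x, deriv (fun τ => w j τ x) t + a j * iteratedDeriv 3 (w j t) x =
      ∑ i, ∑ n, d j i n * (deriv (w i t) x * w n t x)) :
    ∃ W Ψ : ℝ → Fin 2 → 𝓢(ℝ, ℂ), PSol S W Ψ ∧ ∀ t j x, W t j x = (w j t x : ℂ) := by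
  have hpi : Real.pi ≠ 0 := Real.pi_ne_zero
  choose φ hφ using hS
  obtain ⟨W, hW⟩ : ∃ W : ℝ → Fin 2 → 𝓢(ℝ, ℂ), ∀ t j x, W t j x = (w j t x : ℂ) := by
    refine ⟨fun t j => SchwartzMap.postcompCLM (𝕜 := ℝ) Complex.ofRealCLM (φ j t), fun t j x => ?_⟩
    rw [SchwartzMap.postcompCLM_apply, hφ]; rfl
  obtain ⟨Ψ, hΨ⟩ : ∃ Ψ : ℝ → Fin 2 → 𝓢(ℝ, ℂ), ∀ t j, Ψ t j = (-(a j : ℂ)) • DS (DS (DS (W t j))) +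
      (((d j 0 0 : ℂ) • mulS (DS (W t 0)) (W t 0) + (d j 0 1 : ℂ) • mulS (DS (W t 0)) (W t 1)) +
      ((d j 1 0 : ℂ) • mulS (DS (W t 1)) (W t 0) + (d j 1 1 : ℂ) • mulS (DS (W t 1)) (W t 1))) := ⟨_, fun _ _ => rfl⟩
  have itd : ∀ j k t, Differentiable ℝ (iteratedDeriv k (w j t)) := by
    intro j k t x
    exact (joint_dx (F := fun t x => iteratedDeriv k (w j t) x) (joint_iter (hw j) k) t x).differentiableAt
  have d1 : ∀ t j x, DS (W t j) x = ((iteratedDeriv 1 (w j t) x : ℝ) : ℂ) := by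
    intro t j x
    rw [iteratedDeriv_one]
    have := itd j 0 t
    rw [iteratedDeriv_zero] at this
    exact DS_re this (hW t j) x
  have d2 : ∀ t j x, DS (DS (W t j)) x = ((iteratedDeriv 2 (w j t) x : ℝ) : ℂ) := by
    intro t j x
    rw [iteratedDeriv_succ]
    exact DS_re (itd j 1 t) (d1 t j) x
  have d3 : ∀ t j x, DS (DS (DS (W t j))) x = ((iteratedDeriv 3 (w j t) x : ℝ) : ℂ) := by
    intro t j x
    rw [iteratedDeriv_succ]
    exact DS_re (itd j 2 t) (d2 t j) x
  have hΨx : ∀ t j x, Ψ t j x = ((deriv (fun τ => w j τ x) t : ℝ) : ℂ) := by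
    intro t j x
    have e : deriv (fun τ => w j τ x) t = -a j * iteratedDeriv 3 (w j t) x + ∑ i, ∑ n, d j i n * (deriv (w i t) x * w n t x) := by
      rw [← hP]; ring
    rw [e, hΨ]
    simp only [SchwartzMap.add_apply, SchwartzMap.smul_apply, mulS_apply, d1, d3, hW, Fin.sum_univ_two, iteratedDeriv_one, smul_eq_mul]
    push_cast; ring
  refine ⟨W, Ψ, ⟨?_, ?_, ?_, ?_, ?_⟩, hW⟩
  · intro j
    simp only [hW]
    exact Complex.continuous_ofReal.comp (hw j).continuous
  · intro j
    simp only [hΨx]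
    have : (fun p : ℝ × ℝ => deriv (fun τ => w j τ p.2) p.1) = fun p : ℝ × ℝ => fderiv ℝ (fun p : ℝ × ℝ => w j p.1 p.2) p (1, 0) := by
      ext p; exact (joint_dt (hw j) p.1 p.2).deriv
    have c : Continuous (fun p : ℝ × ℝ => deriv (fun τ => w j τ p.2) p.1) := by rw [this]; exact (joint_fd (hw j) _).continuous
    exact Complex.continuous_ofReal.comp c
  · intro j x t
    simp only [hΨx, hW]
    exact (joint_dt (hw j) t x).differentiableAt.hasDerivAt.ofReal_comp
  · intro t j ξ
    rw [nl_sch, hΨ]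
    simp only [four_add', four_smul', four_D, Fin.sum_univ_two, hα, hbd, mul_div_cancel_left₀ _ hpi]
    have hI3 : Complex.I ^ 3 = -Complex.I := by rw [pow_succ, Complex.I_sq]; ring
    push_cast
    linear_combination (-(a j : ℂ)) * (2 * Real.pi) ^ 3 * ξ ^ 3 * 𝓕 (W t j) ξ * hI3
  · intro t j x
    rw [hW, Complex.conj_ofReal]

end PAn

namespace PAn
set_option linter.unusedVariables false

open scoped FourierTransform SchwartzMap

lemma L2_fatou {F : ℕ → ℝ → ℝ≥0∞} {G : ℝ → ℝ≥0∞} {C : ℝ≥0∞} (hF : ∀ n, Measurable (F n)) (hb : ∀ n, L2 (F n) ≤ C)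
    (hl : ∀ x, Tendsto (fun n => F n x) atTop (nhds (G x))) : L2 G ≤ C := by
  have h1 : ∫⁻ x, G x ^ 2 ≤ C ^ 2 := by
    have h2 : ∀ x, G x ^ 2 = liminf (fun n => F n x ^ 2) atTop := fun x =>
      (((ENNReal.continuous_pow 2).tendsto (G x)).comp (hl x)).liminf_eq.symm
    simp only [h2]
    refine (lintegral_liminf_le fun n => (hF n).pow_const 2).trans ?_
    refine liminf_le_of_le (by isBoundedDefault) ?_
    intro b hb'
    obtain ⟨n, hn⟩ := hb'.exists
    refine hn.trans ?_
    rw [← L2_sq]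
    gcongr
    exact hb n
  rw [← L2_sq] at h1
  exact (ENNReal.pow_le_pow_left_iff (by norm_num)).1 h1

lemma Er_le {S : Sys} {C0 : ℝ} (hS : S.Adm C0) {m : ℝ → ℝ} {f : Fin 2 → ℝ → ℂ} {B : ℝ} (hB : 0 ≤ B)
    (h : ∀ j, L2 (Wm m (fun x => ‖f j x‖ₑ)) ≤ ENNReal.ofReal B) : S.Er m f ≤ (S.e 0 + S.e 1) * B ^ 2 := by
  unfold Sys.Er
  have h1 : ∀ j, (L2 (Wm m (fun x => ‖f j x‖ₑ))).toReal ≤ B := fun j => ENNReal.toReal_le_of_le_ofReal hB (h j)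
  have h2 : ∀ j, S.e j * (L2 (Wm m (fun x => ‖f j x‖ₑ))).toReal ^ 2 ≤ S.e j * B ^ 2 := fun j => by
    have := (hS.e_pos j).le
    have := h1 j
    gcongr
  rw [Fin.sum_univ_two]
  linarith [h2 0, h2 1]

lemma L2_le_Er {S : Sys} {C0 : ℝ} (hS : S.Adm C0) {m : ℝ → ℝ} {f : Fin 2 → ℝ → ℂ} {A : ℝ}
    (hf : ∀ j, L2 (Wm m (fun x => ‖f j x‖ₑ)) ≠ ⊤) (h : S.Er m f ≤ A) (j : Fin 2) :
    L2 (Wm m (fun x => ‖f j x‖ₑ)) ≤ ENNReal.ofReal (Real.sqrt (A / S.e j)) := by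
  rw [← ENNReal.ofReal_toReal (hf j)]
  apply ENNReal.ofReal_le_ofReal
  apply Real.le_sqrt_of_sq_le
  rw [le_div_iff₀ (hS.e_pos j), mul_comm]
  refine le_trans ?_ h
  unfold Sys.Er
  exact Finset.single_le_sum (f := fun j => S.e j * (L2 (Wm m (fun x => ‖f j x‖ₑ))).toReal ^ 2)
    (fun i _ => by have := (hS.e_pos i).le; positivity) (Finset.mem_univ j)

lemma Wm_sc_fin {S : Sys} {h : ℝ → Fin 2 → ℝ → ℂ} {t0 t1 : ℝ} (H : FSol S h t0 t1) {m : ℝ → ℝ} (hm : GoodW m) {t : ℝ} (ht : t ∈ Icc t0 t1)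
    {σ : ℝ} (hσ : 0 < σ) (hσ1 : σ ≤ 1) (j : Fin 2) : L2 (Wm (fun x => m (σ * x)) (fun x => ‖h t j x‖ₑ)) ≠ ⊤ := by
  refine ne_top_of_le_ne_top (L2_Wm_fin H hm ht j) (L2_mono fun x => ?_)
  unfold Wm
  gcongr
  apply hm.mono
  rw [abs_mul, abs_of_pos hσ]
  exact mul_le_of_le_one_left (abs_nonneg x) hσ1

/-- limit of weights along a sequence -/
lemma L2_lim {f : ℝ → ℂ} (hf : Measurable f) {m : ℕ → ℝ → ℝ} (hm : ∀ n, Measurable (m n)) {g : ℝ → ℝ} {B : ℝ≥0∞}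
    (hl : ∀ x, Tendsto (fun n => m n x) atTop (nhds (g x)))
    (hb : ∀ n, L2 (Wm (m n) (fun x => ‖f x‖ₑ)) ≤ B) : L2 (Wm g (fun x => ‖f x‖ₑ)) ≤ B := by
  refine L2_fatou (fun n => measurable_Wm (hm n) hf.enorm) hb fun x => ?_
  unfold Wm
  exact ENNReal.Tendsto.mul_const (ENNReal.tendsto_ofReal (hl x)) (Or.inr (by simp))

lemma mw_lim6 (x : ℝ) : Tendsto (fun n : ℕ => mw 6 (1 / ((n : ℝ) + 1)) x) atTop (nhds (jap x ^ 4 * (1 + jap x / 6) ^ 6)) := by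
  unfold mw th
  have h0 : Tendsto (fun n : ℕ => 1 / ((n : ℝ) + 1)) atTop (nhds 0) := tendsto_one_div_add_atTop_nhds_zero_nat
  have h1 : Tendsto (fun n : ℕ => 1 + 1 / ((n : ℝ) + 1) * jap x) atTop (nhds (1 + 0 * jap x)) :=
    (h0.mul_const _).const_add 1
  have h2 := (((tendsto_const_nhds (x := jap x) (f := atTop (α := ℕ))).div h1 (by simp)).div_const 6).const_add 1
  have h3 := (h2.pow 6).const_mul (jap x ^ 4)
  simpa using h3

lemma mw6_ge {σ : ℝ} (hσ : 0 < σ) (hσ1 : σ ≤ 1) (x : ℝ) :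
    (1 + |x|) ^ 10 ≤ (2 / σ) ^ 10 * 6 ^ 6 * (jap (σ * x) ^ 4 * (1 + jap (σ * x) / 6) ^ 6) := by
  have h1 : σ * (1 + |x|) / 2 ≤ jap (σ * x) := by
    have a1 := one_le_jap (σ * x)
    have a2 := abs_le_jap (σ * x)
    rw [abs_mul, abs_of_pos hσ] at a2
    linarith
  have hx := abs_nonneg x
  have h2 : (σ * (1 + |x|) / 2) ^ 4 ≤ jap (σ * x) ^ 4 := by gcongr
  have h3 : (σ * (1 + |x|) / 2 / 6) ^ 6 ≤ (1 + jap (σ * x) / 6) ^ 6 := by gcongr; linarith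
  have h4 := mul_le_mul h2 h3 (by positivity) (by have := jap_pos (σ * x); positivity)
  generalize jap (σ * x) ^ 4 * (1 + jap (σ * x) / 6) ^ 6 = J at *
  generalize 1 + |x| = y at *
  calc y ^ 10 = (2 / σ) ^ 10 * 6 ^ 6 * ((σ * y / 2) ^ 4 * (σ * y / 2 / 6) ^ 6) := by field_simp
    _ ≤ _ := by gcongr

lemma mw6_le {δ σ : ℝ} (hδ : 0 < δ) (hσ : 0 < σ) (hσ1 : σ ≤ 1) (x : ℝ) : mw 6 δ (σ * x) ≤ 64 * (1 + |x|) ^ 10 := by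
  have hj : jap (σ * x) ≤ 1 + |x| := by
    refine (jap_le _).trans ?_
    rw [abs_mul, abs_of_pos hσ]
    have := mul_le_of_le_one_left (abs_nonneg x) hσ1
    linarith
  have hj0 := one_le_jap (σ * x)
  unfold mw th
  generalize jap (σ * x) = J at *
  have h1 : J / (1 + δ * J) ≤ J := div_le_self (by linarith) (by nlinarith)
  have h0 : 0 ≤ J / (1 + δ * J) := by positivity
  have h2 : 1 + J / (1 + δ * J) / ((6 : ℕ) : ℝ) ≤ 2 * (1 + |x|) := by push_cast; linarith
  calc J ^ 4 * (1 + J / (1 + δ * J) / ((6 : ℕ) : ℝ)) ^ 6 ≤ (1 + |x|) ^ 4 * (2 * (1 + |x|)) ^ 6 := by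
        gcongr
    _ = _ := by generalize 1 + |x| = y; ring

lemma apriori {S : Sys} {C0 : ℝ} (hS : S.Adm C0) (A T : ℝ) (hA : 0 ≤ A) (hT : 0 ≤ T) :
    ∃ R : ℝ≥0∞, R ≠ ⊤ ∧ ∀ h t0 t1, FSol S h t0 t1 → t1 - t0 ≤ T →
      ((∀ j, L2 (wN 10 (h t0 j)) ≤ ENNReal.ofReal A) → ∀ t ∈ Icc t0 t1, ∀ j, L2 (wN 10 (h t j)) ≤ R) ∧
      ((∀ j, L2 (wN 10 (h t1 j)) ≤ ENNReal.ofReal A) → ∀ t ∈ Icc t0 t1, ∀ j, L2 (wN 10 (h t j)) ≤ R) := by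
  obtain ⟨c, hc, hboot⟩ := boot_sc hS (γ := 1 / 8) (by norm_num) (by norm_num)
  have he0 := hS.e_pos 0
  have he1 := hS.e_pos 1
  obtain ⟨A', hA'⟩ : ∃ A', A' = (S.e 0 + S.e 1) * (64 * A) ^ 2 + 1 := ⟨_, rfl⟩
  have hA'0 : 0 < A' := by rw [hA']; positivity
  obtain ⟨σ, hσ, hσ1, hs1, hs2⟩ : ∃ σ : ℝ, 0 < σ ∧ σ ≤ 1 ∧ σ ^ 3 * A' ≤ c ∧
      T * σ ^ (3 / 4 - 3 / 2 * (1 / 8) : ℝ) * A' ^ (5 / 4 - (1 / 8) / 2 : ℝ) ≤ c := by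
    have t1 : Tendsto (fun σ : ℝ => σ ^ 3 * A') (nhdsWithin 0 (Ioi 0)) (nhds 0) := by
      have : Tendsto (fun σ : ℝ => σ ^ 3 * A') (nhds 0) (nhds (0 ^ 3 * A')) := by
        apply Continuous.tendsto; fun_prop
      simpa using this.mono_left nhdsWithin_le_nhds
    have t2 : Tendsto (fun σ : ℝ => T * σ ^ (3 / 4 - 3 / 2 * (1 / 8) : ℝ) * A' ^ (5 / 4 - (1 / 8) / 2 : ℝ)) (nhdsWithin 0 (Ioi 0)) (nhds 0) := by
      have : Tendsto (fun σ : ℝ => σ ^ (3 / 4 - 3 / 2 * (1 / 8) : ℝ)) (nhds 0) (nhds (0 ^ (3 / 4 - 3 / 2 * (1 / 8) : ℝ))) :=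
        (Real.continuousAt_rpow_const 0 _ (Or.inr (by norm_num))).tendsto
      rw [Real.zero_rpow (by norm_num)] at this
      have := ((this.const_mul T).mul_const (A' ^ (5 / 4 - (1 / 8) / 2 : ℝ))).mono_left (nhdsWithin_le_nhds (s := Ioi 0))
      simpa using this
    have e3 : ∀ᶠ σ : ℝ in nhdsWithin 0 (Ioi 0), σ ∈ Ioc (0 : ℝ) 1 := by
      exact Ioc_mem_nhdsGT one_pos
    obtain ⟨σ, h1, h2, h3⟩ := ((t1.eventually (eventually_le_nhds hc)).and ((t2.eventually (eventually_le_nhds hc)).and e3)).exists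
    exact ⟨σ, h3.1, h3.2, h1, h2⟩
  obtain ⟨K, hK⟩ : ∃ K : ℝ, K = (2 / σ) ^ 10 * 6 ^ 6 := ⟨_, rfl⟩
  have hK0 : 0 < K := by rw [hK]; positivity
  refine ⟨ENNReal.ofReal K * ENNReal.ofReal (Real.sqrt (4 * A' / S.e 0)) + ENNReal.ofReal K * ENNReal.ofReal (Real.sqrt (4 * A' / S.e 1)),
    by finiteness, ?_⟩
  intro h t0 t1 H hTT
  have hcond : (t1 - t0) * σ ^ (3 / 4 - 3 / 2 * (1 / 8) : ℝ) * A' ^ (5 / 4 - (1 / 8) / 2 : ℝ) ≤ c :=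
    le_trans (by gcongr) hs2
  have hδ : ∀ n : ℕ, 0 < 1 / ((n : ℝ) + 1) := fun n => by positivity
  have hE : ∀ n : ℕ, ∀ τ, (∀ j, L2 (wN 10 (h τ j)) ≤ ENNReal.ofReal A) →
      S.Er (fun x => mw 6 (1 / ((n : ℝ) + 1)) (σ * x)) (h τ) ≤ A' := by
    intro n τ hτ
    refine (Er_le hS (B := 64 * A) (by positivity) fun j => ?_).trans (by rw [hA']; linarith)
    rw [ENNReal.ofReal_mul (p := 64) (by norm_num)]
    calc _ ≤ L2 (fun x => ENNReal.ofReal 64 * wN 10 (h τ j) x) := by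
          apply L2_mono; intro x
          unfold Wm wN
          rw [← mul_assoc, ← ENNReal.ofReal_mul (p := 64) (by norm_num)]
          gcongr
          exact mw6_le (hδ n) hσ hσ1 x
      _ = ENNReal.ofReal 64 * L2 (wN 10 (h τ j)) := L2_const_mul _ (measurable_wN 10 (H.meas1 τ j))
      _ ≤ _ := by gcongr; exact hτ j
  have hfin : ∀ t ∈ Icc t0 t1, (∀ n : ℕ, S.Er (fun x => mw 6 (1 / ((n : ℝ) + 1)) (σ * x)) (h t) ≤ 4 * A') → ∀ j,
      L2 (wN 10 (h t j)) ≤ ENNReal.ofReal K * ENNReal.ofReal (Real.sqrt (4 * A' / S.e j)) := by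
    intro t ht hEr j
    have hb : ∀ n : ℕ, L2 (Wm (fun x => mw 6 (1 / ((n : ℝ) + 1)) (σ * x)) (fun x => ‖h t j x‖ₑ)) ≤ ENNReal.ofReal (Real.sqrt (4 * A' / S.e j)) :=
      fun n => L2_le_Er hS (fun i => Wm_sc_fin H (goodW_mw (by norm_num) (hδ n)) ht hσ hσ1 i) (hEr n) j
    have hl := L2_lim (H.meas1 t j) (fun n => ((goodW_mw (p := 6) (by norm_num) (hδ n)).cont.comp (continuous_const_mul σ)).measurable)
      (fun x => mw_lim6 (σ * x)) hb
    refine le_trans ?_ (mul_le_mul' le_rfl hl)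
    rw [← L2_const_mul]
    · apply L2_mono; intro x
      unfold Wm wN
      rw [← mul_assoc, ← ENNReal.ofReal_mul (p := K) hK0.le]
      gcongr
      rw [hK]
      exact mw6_ge hσ hσ1 x
    · apply measurable_Wm _ (H.meas1 t j).enorm
      have := continuous_jap
      exact Continuous.measurable (by fun_prop)
  have hfin' : ∀ t ∈ Icc t0 t1, (∀ n : ℕ, S.Er (fun x => mw 6 (1 / ((n : ℝ) + 1)) (σ * x)) (h t) ≤ 4 * A') → ∀ j,
      L2 (wN 10 (h t j)) ≤ ENNReal.ofReal K * ENNReal.ofReal (Real.sqrt (4 * A' / S.e 0)) + ENNReal.ofReal K * ENNReal.ofReal (Real.sqrt (4 * A' / S.e 1)) := by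
    intro t ht hEr j
    refine (hfin t ht hEr j).trans ?_
    fin_cases j
    · exact le_self_add
    · exact le_add_self
  constructor
  · intro h0 t ht
    exact hfin' t ht fun n => (hboot _ (goodW_mw (p := 6) (by norm_num) (hδ n)) h t0 t1 H σ A' hσ hσ1 hA'0 hs1 hcond).1 (hE n t0 h0) t ht
  · intro h0 t ht
    exact hfin' t ht fun n => (hboot _ (goodW_mw (p := 6) (by norm_num) (hδ n)) h t0 t1 H σ A' hσ hσ1 hA'0 hs1 hcond).2 (hE n t1 h0) t ht

end PAn

namespace PAn
set_option linter.unusedVariables false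

def LocB (M : ℝ → ℝ≥0∞) (t : ℝ) : Prop := ∃ R : ℝ≥0∞, R ≠ ⊤ ∧ ∀ᶠ τ in nhds t, M τ ≤ R

def BddOn (M : ℝ → ℝ≥0∞) (K : Set ℝ) : Prop := ∃ R : ℝ≥0∞, R ≠ ⊤ ∧ ∀ t ∈ K, M t ≤ R

lemma bddOn_of_loc {M : ℝ → ℝ≥0∞} {K : Set ℝ} (hK : IsCompact K) (h : ∀ t ∈ K, LocB M t) : BddOn M K := by
  refine hK.induction_on (p := fun s => BddOn M s) ⟨0, by simp, by simp⟩ ?_ ?_ ?_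
  · rintro s t hst ⟨R, hR, hb⟩
    exact ⟨R, hR, fun x hx => hb x (hst hx)⟩
  · rintro s t ⟨R, hR, hb⟩ ⟨R', hR', hb'⟩
    refine ⟨R + R', by finiteness, ?_⟩
    rintro x (hx | hx)
    · exact (hb x hx).trans le_self_add
    · exact (hb' x hx).trans le_add_self
  · intro x hx
    obtain ⟨R, hR, hb⟩ := h x hx
    exact ⟨{τ | M τ ≤ R}, mem_nhdsWithin_of_mem_nhds hb, R, hR, fun t ht => ht⟩

def AP (M : ℝ → ℝ≥0∞) : Prop := ∀ (A : ℝ≥0∞) (T : ℝ), A ≠ ⊤ → ∃ R : ℝ≥0∞, R ≠ ⊤ ∧ ∀ t0 t1, t0 ≤ t1 → t1 - t0 ≤ T → BddOn M (Icc t0 t1) →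
  (M t0 ≤ A → ∀ t ∈ Icc t0 t1, M t ≤ R) ∧ (M t1 ≤ A → ∀ t ∈ Icc t0 t1, M t ≤ R)

lemma right_aux {M : ℝ → ℝ≥0∞} {B : Set ℝ} (hBc : IsClosed B) (hloc : ∀ t, t ∉ B → LocB M t) (hfin : ∀ t, M t ≠ ⊤)
    (hap : AP M) {A R : ℝ≥0∞} {T : ℝ} (hA : A ≠ ⊤)
    (hAR : ∀ t0 t1, t0 ≤ t1 → t1 - t0 ≤ T → BddOn M (Icc t0 t1) → M t0 ≤ A → M t1 ≤ R)
    {b t : ℝ} (hb : b ∈ B) (ht : t ∉ B) (hbt : b ≤ t) (hT : t - b ≤ T) (hBA : ∀ τ ∈ B ∩ Icc b t, M τ ≤ A) : M t ≤ R := by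
  have hcomp : IsCompact (B ∩ Icc b t) := isCompact_Icc.inter_left hBc
  have hne : (B ∩ Icc b t).Nonempty := ⟨b, hb, ⟨le_rfl, hbt⟩⟩
  obtain ⟨α, hα⟩ : ∃ α, α = sSup (B ∩ Icc b t) := ⟨_, rfl⟩
  have hαm : α ∈ B ∩ Icc b t := hα ▸ hcomp.sSup_mem hne
  have hout : ∀ s, α < s → s ≤ t → s ∉ B := by
    intro s h1 h2 hs
    have : s ≤ α := hα ▸ le_csSup hcomp.bddAbove ⟨hs, ⟨hαm.2.1.trans h1.le, h2⟩⟩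
    linarith
  obtain ⟨R2, hR2, h2⟩ := hap (M t) T (hfin t)
  refine hAR α t hαm.2.2 (by linarith [hαm.2.1]) ⟨R2 + A, by finiteness, ?_⟩ (hBA α hαm)
  intro s hs
  rcases eq_or_lt_of_le hs.1 with h | h
  · rw [← h]; exact (hBA α hαm).trans le_add_self
  · refine le_trans ?_ le_self_add
    refine (h2 s t hs.2 (by linarith [hαm.2.1]) ?_).2 le_rfl s ⟨le_rfl, hs.2⟩
    exact bddOn_of_loc isCompact_Icc fun τ hτ => hloc τ (hout τ (h.trans_le hτ.1) hτ.2)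

lemma bddOn_neg {M : ℝ → ℝ≥0∞} {a b : ℝ} (h : BddOn (fun t => M (-t)) (Icc a b)) : BddOn M (Icc (-b) (-a)) := by
  obtain ⟨R, hR, hb⟩ := h
  refine ⟨R, hR, fun t ht => ?_⟩
  have := hb (-t) ⟨by linarith [ht.2], by linarith [ht.1]⟩
  simpa using this

lemma AP.neg {M : ℝ → ℝ≥0∞} (h : AP M) : AP fun t => M (-t) := by
  intro A T hA
  obtain ⟨R, hR, hb⟩ := h A T hA
  refine ⟨R, hR, fun t0 t1 h01 hT hB => ?_⟩
  have := hb (-t1) (-t0) (by linarith) (by linarith) (bddOn_neg hB)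
  exact ⟨fun h t ht => this.2 h (-t) ⟨by linarith [ht.2], by linarith [ht.1]⟩,
    fun h t ht => this.1 h (-t) ⟨by linarith [ht.2], by linarith [ht.1]⟩⟩

lemma baire_loc {M : ℝ → ℝ≥0∞} (hap : AP M) {F : ℕ → Set ℝ} (hF : ∀ n, IsClosed (F n)) (hcov : ∀ t, ∃ n, t ∈ F n)
    (hFb : ∀ n, BddOn M (F n)) (t : ℝ) : LocB M t := by
  have hfin : ∀ t, M t ≠ ⊤ := fun t => by
    obtain ⟨n, hn⟩ := hcov t
    obtain ⟨R, hR, hb⟩ := hFb n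
    exact ne_top_of_le_ne_top hR (hb t hn)
  obtain ⟨B, hB⟩ : ∃ B : Set ℝ, B = {t | ¬ LocB M t} := ⟨_, rfl⟩
  have hBc : IsClosed B := by
    rw [← isOpen_compl_iff, isOpen_iff_mem_nhds]
    intro x hx
    have hx' : LocB M x := by simpa [hB] using hx
    obtain ⟨R, hR, hb⟩ := hx'
    filter_upwards [eventually_eventually_nhds.2 hb] with y hy
    have : LocB M y := ⟨R, hR, hy⟩
    simpa [hB] using this
  have hloc : ∀ t, t ∉ B → LocB M t := fun t ht => by simpa [hB] using ht
  by_contra hcon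
  have htB : t ∈ B := by rw [hB]; exact hcon
  have : Nonempty B := ⟨⟨t, htB⟩⟩
  have : CompleteSpace B := hBc.completeSpace_coe
  obtain ⟨n, ⟨b0, hb0⟩, hInt⟩ := nonempty_interior_of_iUnion_of_closed (X := B) (f := fun n => (Subtype.val ⁻¹' (F n) : Set B))
    (fun n => (hF n).preimage continuous_subtype_val) (by ext x; simpa using hcov x)
  rw [mem_interior_iff_mem_nhds, Metric.mem_nhds_iff] at hInt
  obtain ⟨r, hr, hball⟩ := hInt
  obtain ⟨A, hA, hAb⟩ := hFb n
  have hBA : ∀ τ ∈ B, |τ - b0| < r → M τ ≤ A := by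
    intro τ hτ hτr
    apply hAb
    have : (⟨τ, hτ⟩ : B) ∈ Metric.ball (⟨b0, hb0⟩ : B) r := by
      rw [Metric.mem_ball, Subtype.dist_eq, Real.dist_eq]; exact hτr
    exact hball this
  obtain ⟨R, hR, hap'⟩ := hap A r hA
  obtain ⟨R', hR', hap''⟩ := hap.neg A r hA
  have hnot : b0 ∉ {t | LocB M t} := by rw [hB] at hb0; exact hb0
  apply hnot
  refine ⟨A + R + R', by finiteness, ?_⟩
  filter_upwards [Metric.ball_mem_nhds b0 hr] with τ hτ
  rw [Metric.mem_ball, Real.dist_eq] at hτ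
  by_cases hτB : τ ∈ B
  · exact (hBA τ hτB hτ).trans (by rw [add_assoc]; exact le_self_add)
  rw [abs_lt] at hτ
  rcases le_total b0 τ with h | h
  · refine (right_aux (T := r) (R := R) hBc hloc hfin hap hA ?_ hb0 hτB h (by linarith) ?_).trans (le_self_add.trans' le_add_self)
    · exact fun t0 t1 h01 hT hb h0 => (hap' t0 t1 h01 hT hb).1 h0 t1 ⟨h01, le_rfl⟩
    · intro s hs
      exact hBA s hs.1 (abs_lt.2 ⟨by linarith [hs.2.1], by linarith [hs.2.2]⟩)
  · have := right_aux (M := fun t => M (-t)) (B := (fun x => -x) ⁻¹' B) (A := A) (T := r) (R := R') (b := -b0) (t := -τ)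
      (hBc.preimage continuous_neg) ?_ (fun t => hfin (-t)) hap.neg hA
      (fun t0 t1 h01 hT hb h0 => (hap'' t0 t1 h01 hT hb).1 h0 t1 ⟨h01, le_rfl⟩) (by simpa using hb0) (by simpa using hτB)
      (by linarith) (by linarith) ?_
    · simp only [neg_neg] at this
      exact this.trans le_add_self
    · intro t ht
      obtain ⟨Q, hQ, hq⟩ := hloc (-t) ht
      exact ⟨Q, hQ, (continuous_neg.tendsto t).eventually hq⟩
    · intro s hs
      exact hBA (-s) hs.1 (abs_lt.2 ⟨by linarith [hs.2.1, hs.2.2], by linarith [hs.2.1]⟩)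

end PAn

namespace PAn
set_option linter.unusedVariables false

open scoped FourierTransform SchwartzMap

lemma L2_cauchy : L2 (fun x => ENNReal.ofReal ((1 + x ^ 2)⁻¹)) ≠ ⊤ := by
  unfold L2
  apply ENNReal.rpow_ne_top_of_nonneg (by norm_num)
  refine ne_top_of_le_ne_top (b := ∫⁻ x : ℝ, ENNReal.ofReal ((1 + x ^ 2)⁻¹)) ?_ (lintegral_mono fun x => ?_)
  · exact integrable_inv_one_add_sq.lintegral_lt_top.ne
  · have h0 : (0 : ℝ) < 1 + x ^ 2 := by positivity
    have h1 : (1 + x ^ 2)⁻¹ ≤ 1 := inv_le_one_of_one_le₀ (by nlinarith [sq_nonneg x])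
    rw [← ENNReal.ofReal_pow (by positivity)]
    apply ENNReal.ofReal_le_ofReal
    rw [sq]
    exact mul_le_of_le_one_left (by positivity) h1

lemma L2_of_decay {g : ℝ → ℂ} {R : ℝ} (h : ∀ x, (1 + x ^ 2) * ‖g x‖ ≤ R) :
    L2 (fun x => ‖g x‖ₑ) ≤ ENNReal.ofReal R * L2 (fun x => ENNReal.ofReal ((1 + x ^ 2)⁻¹)) := by
  rw [← L2_const_mul _ (by fun_prop)]
  apply L2_mono; intro x
  have hR : 0 ≤ R := le_trans (by positivity) (h x)
  rw [← ENNReal.ofReal_mul hR, ← ofReal_norm]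
  apply ENNReal.ofReal_le_ofReal
  rw [← div_eq_mul_inv, le_div_iff₀ (by positivity), mul_comm]
  exact h x

lemma four_Dk (f : 𝓢(ℝ, ℂ)) (k : ℕ) (ξ : ℝ) : 𝓕 (DS^[k] f) ξ = (2 * Real.pi * Complex.I * ξ) ^ k * 𝓕 f ξ := by
  induction k with
  | zero => simp
  | succ k ih => rw [Function.iterate_succ_apply', four_D, ih]; ring

lemma wN10_le (f : 𝓢(ℝ, ℂ)) : L2 (wN 10 (fun ξ => 𝓕 f ξ)) ≤ 512 * (L2 (fun x => ‖f x‖ₑ) + L2 (fun x => ‖DS^[10] f x‖ₑ)) := by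
  have hm1 : Measurable fun x => ‖𝓕 f x‖ₑ := (𝓕 f).continuous.measurable.enorm
  have hm2 : Measurable fun x => ‖𝓕 (DS^[10] f) x‖ₑ := (𝓕 (DS^[10] f)).continuous.measurable.enorm
  rw [← L2_four f, ← L2_four (DS^[10] f)]
  refine le_trans ?_ (mul_le_mul' le_rfl (L2_add hm1 hm2))
  rw [← L2_const_mul (F := fun x => ‖𝓕 f x‖ₑ + ‖𝓕 (DS^[10] f) x‖ₑ) _ (hm1.add hm2)]
  apply L2_mono; intro ξ
  unfold wN
  rw [← ofReal_norm, ← ofReal_norm (𝓕 (DS^[10] f) ξ), ← ENNReal.ofReal_mul (by positivity), ← ENNReal.ofReal_add (by positivity) (by positivity),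
    show (512 : ℝ≥0∞) = ENNReal.ofReal 512 by norm_num, ← ENNReal.ofReal_mul (by norm_num)]
  apply ENNReal.ofReal_le_ofReal
  rw [four_Dk, norm_mul, norm_pow]
  have h1 : |ξ| ^ 10 ≤ ‖2 * (Real.pi : ℂ) * Complex.I * ξ‖ ^ 10 := by
    gcongr
    simp only [norm_mul, Complex.norm_I, Complex.norm_real, Real.norm_eq_abs, Complex.norm_ofNat, mul_one]
    rw [abs_of_pos Real.pi_pos]
    have := Real.pi_gt_three
    nlinarith [abs_nonneg ξ]
  have h2 : (1 + |ξ|) ^ 10 ≤ 512 * (1 + |ξ| ^ 10) := by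
    have := add_pow_le (zero_le_one' ℝ) (abs_nonneg ξ) 10
    norm_num at this ⊢
    exact this
  calc (1 + |ξ|) ^ 10 * ‖𝓕 f ξ‖ ≤ (512 * (1 + ‖2 * (Real.pi : ℂ) * Complex.I * ξ‖ ^ 10)) * ‖𝓕 f ξ‖ := by
        gcongr
        linarith
    _ = _ := by generalize ‖2 * (Real.pi : ℂ) * Complex.I * ξ‖ ^ 10 = z; ring

lemma DSk_re {f : 𝓢(ℝ, ℂ)} {g : ℝ → ℝ} (hg : ContDiff ℝ (⊤ : ℕ∞) g) (h : ∀ x, f x = (g x : ℂ)) (k : ℕ) (x : ℝ) :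
    (DS^[k] f) x = ((iteratedDeriv k g x : ℝ) : ℂ) := by
  induction k generalizing x with
  | zero => simpa using h x
  | succ k ih =>
    rw [Function.iterate_succ_apply', DS_re (g := iteratedDeriv k g) _ ih, iteratedDeriv_succ]
    exact hg.differentiable_iteratedDeriv k (by exact_mod_cast WithTop.coe_lt_top k)

lemma AP_of {S : Sys} {C0 : ℝ} (hS : S.Adm C0) {W Ψ : ℝ → Fin 2 → 𝓢(ℝ, ℂ)} (H : PSol S W Ψ) :
    AP fun t => L2 (wN 10 (hat W t 0)) + L2 (wN 10 (hat W t 1)) := by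
  intro A T hA
  obtain ⟨R, hR, hb⟩ := apriori hS A.toReal (max T 0) (by positivity) (le_max_right _ _)
  refine ⟨R + R, by finiteness, fun t0 t1 h01 hT hB => ?_⟩
  obtain ⟨Q, hQ, hq⟩ := hB
  have hj : ∀ (t : ℝ) (j : Fin 2), L2 (wN 10 (hat W t j)) ≤ L2 (wN 10 (hat W t 0)) + L2 (wN 10 (hat W t 1)) := by
    intro t j
    fin_cases j
    · exact le_self_add
    · exact le_add_self
  have HF : FSol S (hat W) t0 t1 := H.fsol h01 hQ fun t ht j => (hj t j).trans (hq t ht)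
  have := hb (hat W) t0 t1 HF (hT.trans (le_max_left _ _))
  rw [ENNReal.ofReal_toReal hA] at this
  exact ⟨fun h t ht => add_le_add (this.1 (fun j => (hj t0 j).trans h) t ht 0) (this.1 (fun j => (hj t0 j).trans h) t ht 1),
    fun h t ht => add_le_add (this.2 (fun j => (hj t1 j).trans h) t ht 0) (this.2 (fun j => (hj t1 j).trans h) t ht 1)⟩

lemma cont_slice {G : ℝ → ℝ → ℝ} (h : Continuous fun p : ℝ × ℝ => G p.1 p.2) (x : ℝ) : Continuous fun t => G t x :=
  h.comp (Continuous.prodMk_left x)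

lemma cl_aux {G : ℝ → ℝ} (h : Continuous G) (a b : ℝ) : IsClosed {t | a * ‖G t‖ ≤ b} :=
  isClosed_le (by fun_prop) (by fun_prop)

theorem fsol_all {S : Sys} {C0 : ℝ} (hS : S.Adm C0) {W Ψ : ℝ → Fin 2 → 𝓢(ℝ, ℂ)} (H : PSol S W Ψ) {w : Fin 2 → ℝ → ℝ → ℝ}
    (hw : ∀ j, ContDiff ℝ (⊤ : ℕ∞) fun p : ℝ × ℝ => w j p.1 p.2) (hWw : ∀ t j x, W t j x = (w j t x : ℂ)) {t0 t1 : ℝ} (h01 : t0 ≤ t1) :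
    FSol S (hat W) t0 t1 := by
  obtain ⟨F, hF⟩ : ∃ F : ℕ → Set ℝ, F = fun n : ℕ => {t | ∀ j x, (1 + x ^ 2) * ‖w j t x‖ ≤ (n : ℝ) ∧ (1 + x ^ 2) * ‖iteratedDeriv 10 (w j t) x‖ ≤ (n : ℝ)} := ⟨_, rfl⟩
  have hslice : ∀ j t, ContDiff ℝ (⊤ : ℕ∞) (w j t) := fun j t => (hw j).comp (contDiff_const.prodMk contDiff_id)
  have hD := fun t j k x => DSk_re (hslice j t) (hWw t j) k x
  have hcl : ∀ n, IsClosed (F n) := by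
    intro n
    rw [hF]
    simp only [Set.ofPred_forall]
    refine isClosed_iInter fun j => isClosed_iInter fun x => ?_
    have c1 : Continuous fun t => w j t x := cont_slice (G := w j) (hw j).continuous x
    have c2 : Continuous fun t => iteratedDeriv 10 (w j t) x := cont_slice (G := fun t x => iteratedDeriv 10 (w j t) x) (joint_iter (hw j) 10).continuous x
    exact (cl_aux c1 _ _).inter (cl_aux c2 _ _)
  have hcov : ∀ t, ∃ n, t ∈ F n := by
    intro t
    have hx : ∀ x : ℝ, 1 + x ^ 2 ≤ (1 + |x|) ^ 2 := fun x => by nlinarith [abs_nonneg x, sq_abs x]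
    have h1 : ∀ j, ∃ K : ℝ, ∀ x, (1 + x ^ 2) * ‖w j t x‖ ≤ K ∧ (1 + x ^ 2) * ‖iteratedDeriv 10 (w j t) x‖ ≤ K := by
      intro j
      obtain ⟨K, hK, hk⟩ := sch_decay (W t j) 2
      obtain ⟨K', hK', hk'⟩ := sch_decay (DS^[10] (W t j)) 2
      refine ⟨K + K', fun x => ⟨?_, ?_⟩⟩
      · have := hk x
        rw [hWw, Complex.norm_real] at this
        have h3 := mul_le_mul_of_nonneg_right (hx x) (norm_nonneg (w j t x))
        linarith
      · have := hk' x
        rw [hD, Complex.norm_real] at this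
        have h3 := mul_le_mul_of_nonneg_right (hx x) (norm_nonneg (iteratedDeriv 10 (w j t) x))
        linarith
    choose K hK using h1
    obtain ⟨n, hn⟩ := exists_nat_ge (max (K 0) (K 1))
    refine ⟨n, ?_⟩
    rw [hF]
    intro j x
    have : K j ≤ n := by
      refine le_trans ?_ hn
      fin_cases j
      · exact le_max_left _ _
      · exact le_max_right _ _
    exact ⟨((hK j x).1).trans this, ((hK j x).2).trans this⟩
  have hbd : ∀ n, BddOn (fun t => L2 (wN 10 (hat W t 0)) + L2 (wN 10 (hat W t 1))) (F n) := by
    intro n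
    obtain ⟨Q, hQ⟩ : ∃ Q, Q = ENNReal.ofReal n * L2 (fun x => ENNReal.ofReal ((1 + x ^ 2)⁻¹)) := ⟨_, rfl⟩
    have hQt : Q ≠ ⊤ := by rw [hQ]; exact ENNReal.mul_ne_top (by finiteness) L2_cauchy
    have key : ∀ t ∈ F n, ∀ j, L2 (wN 10 (hat W t j)) ≤ 512 * (Q + Q) := by
      intro t ht j
      rw [hF] at ht
      refine (wN10_le (W t j)).trans ?_
      gcongr
      · rw [hQ]
        apply L2_of_decay; intro x
        rw [hWw, Complex.norm_real]; exact (ht j x).1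
      · rw [hQ]
        apply L2_of_decay; intro x
        rw [hD, Complex.norm_real]; exact (ht j x).2
    exact ⟨512 * (Q + Q) + 512 * (Q + Q), by finiteness, fun t ht => add_le_add (key t ht 0) (key t ht 1)⟩
  obtain ⟨R, hR, hb⟩ := bddOn_of_loc (isCompact_Icc (a := t0) (b := t1)) fun t _ => baire_loc (AP_of hS H) hcl hcov hbd t
  refine H.fsol h01 hR fun t ht j => le_trans ?_ (hb t ht)
  fin_cases j
  · exact le_self_add
  · exact le_add_self

end PAn

namespace PAn
set_option linter.unusedVariables false

open scoped FourierTransform SchwartzMap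

lemma rpow_le_exp {κ : ℝ} (hκ : 0 < κ) (s : ℝ) : ∃ K : ℝ, 0 < K ∧ ∀ z : ℝ, 0 ≤ z → (1 + z) ^ s ≤ K * Real.exp (κ * z) := by
  obtain ⟨q, hq⟩ : ∃ q, q = |s| + 1 := ⟨_, rfl⟩
  have hq0 : 0 < q := by rw [hq]; positivity
  have hsq : s ≤ q := by rw [hq]; linarith [le_abs_self s]
  refine ⟨((q / κ) ^ q) * Real.exp κ, by positivity, fun z hz => ?_⟩
  have h1 : 1 + z ≤ (q / κ) * Real.exp (κ / q * (1 + z)) := by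
    have h2 : κ / q * (1 + z) ≤ Real.exp (κ / q * (1 + z)) := by linarith [Real.add_one_le_exp (κ / q * (1 + z))]
    calc 1 + z = (q / κ) * (κ / q * (1 + z)) := by field_simp
      _ ≤ _ := by gcongr
  calc (1 + z) ^ s ≤ (1 + z) ^ q := Real.rpow_le_rpow_of_exponent_le (by linarith) hsq
    _ ≤ ((q / κ) * Real.exp (κ / q * (1 + z))) ^ q := Real.rpow_le_rpow (by linarith) h1 hq0.le
    _ = (q / κ) ^ q * Real.exp (κ / q * (1 + z) * q) := by
        rw [Real.mul_rpow (by positivity) (by positivity), ← Real.exp_mul]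
    _ = _ := by
        rw [mul_assoc (_ ^ q), ← Real.exp_add]
        congr 2
        field_simp

lemma FT1_eq (f : 𝓢(ℝ, ℂ)) {g : ℝ → ℂ} (hg : ∀ x, f x = g x) (ξ : ℝ) : FT1 g ξ = 𝓕 f (ξ / (2 * Real.pi)) := by
  rw [four_eq]
  unfold FT1
  refine integral_congr_ae (Eventually.of_forall fun x => ?_)
  beta_reduce
  rw [hg x]
  congr 2
  have := Real.pi_pos.ne'
  rw [show -2 * Real.pi * x * (ξ / (2 * Real.pi)) = - (x * ξ) by field_simp]
  push_cast; ring

lemma gev_top (f : 𝓢(ℝ, ℂ)) {g : ℝ → ℂ} (hg : ∀ x, f x = g x) (σ s : ℝ) :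
    gevreyNorm σ s g ≠ ⊤ ↔
      ∫⁻ y, ENNReal.ofReal (Real.exp (2 * σ * (2 * Real.pi * |y|)) * (1 + 2 * Real.pi * |y|) ^ (2 * s) * ‖𝓕 f y‖ ^ 2) ≠ ⊤ := by
  have hpi := Real.pi_pos
  unfold gevreyNorm
  have h1 := lint_scale (σ := 2 * Real.pi) (by positivity) (fun y => ENNReal.ofReal (Real.exp (2 * σ * (2 * Real.pi * |y|)) * (1 + 2 * Real.pi * |y|) ^ (2 * s) * ‖𝓕 f y‖ ^ 2))
  have h2 : ∀ ξ : ℝ, 2 * Real.pi * |ξ / (2 * Real.pi)| = |ξ| := fun ξ => by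
    rw [abs_div, abs_of_pos (by positivity : 0 < 2 * Real.pi)]; field_simp
  simp only [h2] at h1
  have h3 : ∀ ξ, FT1 g ξ = 𝓕 f (ξ / (2 * Real.pi)) := FT1_eq f hg
  simp only [h3]
  rw [h1]
  constructor
  · intro h h'
    apply h
    rw [h', ENNReal.mul_top (by simpa using hpi)]
    simp
  · intro h
    exact ENNReal.rpow_ne_top_of_nonneg (by norm_num) (ENNReal.mul_ne_top (by finiteness) h)

lemma mw_exp_le {p : ℕ} {δ : ℝ} (hδ : 0 < δ) (y : ℝ) : mw p δ y ≤ 24 * Real.exp 2 * Real.exp (2 * |y|) := by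
  unfold mw
  have hj := jap_le y
  have h0 := jap_pos y
  have hy := abs_nonneg y
  have h1 : th p δ (jap y) ≤ Real.exp (1 + |y|) := (th_le_exp hδ h0.le).trans (Real.exp_le_exp.2 hj)
  have h2 : jap y ^ 4 ≤ 24 * Real.exp (1 + |y|) := by
    have h3 : jap y ^ 4 ≤ (1 + |y|) ^ 4 := by gcongr
    have h4 := Real.pow_div_factorial_le_exp (1 + |y|) (by positivity) 4
    rw [div_le_iff₀ (by positivity)] at h4
    have h5 : ((Nat.factorial 4 : ℕ) : ℝ) = 24 := by norm_num [Nat.factorial]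
    rw [h5] at h4
    linarith
  have h6 : 0 ≤ th p δ (jap y) := zero_le_one.trans (th_one_le hδ h0.le)
  calc _ ≤ 24 * Real.exp (1 + |y|) * Real.exp (1 + |y|) := by gcongr
    _ = 24 * Real.exp 2 * Real.exp (2 * |y|) := by
      rw [mul_assoc, mul_assoc, ← Real.exp_add, ← Real.exp_add]; ring_nf

lemma mw_lim (x : ℝ) : Tendsto (fun n : ℕ => mw n (1 / ((n : ℝ) + 1)) x) atTop (nhds (jap x ^ 4 * Real.exp (jap x))) := by
  unfold mw th
  have h0 : Tendsto (fun n : ℕ => 1 / ((n : ℝ) + 1)) atTop (nhds 0) := tendsto_one_div_add_atTop_nhds_zero_nat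
  have h1 : Tendsto (fun n : ℕ => 1 + 1 / ((n : ℝ) + 1) * jap x) atTop (nhds (1 + 0 * jap x)) :=
    (h0.mul_const _).const_add 1
  have h2 := ((tendsto_const_nhds (x := jap x) (f := atTop (α := ℕ))).div h1 (by simp))
  have h3 : Tendsto (fun n : ℕ => (1 + jap x / (1 + 1 / ((n : ℝ) + 1) * jap x) / (n : ℝ)) ^ n) atTop (nhds (Real.exp (jap x))) := by
    apply Real.tendsto_one_add_pow_exp_of_tendsto
    have h4 : Tendsto (fun n : ℕ => jap x / (1 + 1 / ((n : ℝ) + 1) * jap x)) atTop (nhds (jap x)) := by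
      have h5 := h2
      rw [zero_mul, add_zero, div_one] at h5
      exact h5
    refine h4.congr' ?_
    filter_upwards [eventually_gt_atTop 0] with n hn
    have : (n : ℝ) ≠ 0 := by positivity
    field_simp
  exact h3.const_mul _

end PAn

namespace PAn
set_option linter.unusedVariables false

open scoped FourierTransform SchwartzMap

/-- initial weighted bound -/
lemma init_bd (f : 𝓢(ℝ, ℂ)) {σ₀ s : ℝ} (hσ₀ : 0 < σ₀)
    (h : ∫⁻ y, ENNReal.ofReal (Real.exp (2 * σ₀ * (2 * Real.pi * |y|)) * (1 + 2 * Real.pi * |y|) ^ (2 * s) * ‖𝓕 f y‖ ^ 2) ≠ ⊤) :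
    ∃ B : ℝ, 0 ≤ B ∧ ∀ (p : ℕ) (δ σ : ℝ), 0 < δ → 0 < σ → σ ≤ σ₀ →
      L2 (Wm (fun x => mw p δ (σ * x)) (fun x => ‖𝓕 f x‖ₑ)) ≤ ENNReal.ofReal B := by
  have hpi := Real.pi_pos
  have hpi3 := Real.pi_gt_three
  obtain ⟨K, hK, hKb⟩ := rpow_le_exp (κ := σ₀ / 2) (by positivity) (-s)
  obtain ⟨I, hI⟩ : ∃ I, I = ∫⁻ y, ENNReal.ofReal (Real.exp (2 * σ₀ * (2 * Real.pi * |y|)) * (1 + 2 * Real.pi * |y|) ^ (2 * s) * ‖𝓕 f y‖ ^ 2) := ⟨_, rfl⟩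
  rw [← hI] at h
  obtain ⟨Q, hQ⟩ : ∃ Q, Q = 24 * Real.exp 2 * K := ⟨_, rfl⟩
  have hQ0 : 0 < Q := by rw [hQ]; positivity
  refine ⟨Q * (I ^ (1 / 2 : ℝ)).toReal, by positivity, fun p δ σ hδ hσ hσσ => ?_⟩
  rw [ENNReal.ofReal_mul hQ0.le, ENNReal.ofReal_toReal (ENNReal.rpow_ne_top_of_nonneg (by norm_num) h)]
  have hpt : ∀ y, ENNReal.ofReal (mw p δ (σ * y)) ≤ ENNReal.ofReal Q * ENNReal.ofReal (Real.exp (σ₀ * (2 * Real.pi * |y|)) * (1 + 2 * Real.pi * |y|) ^ s) := by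
    intro y
    rw [← ENNReal.ofReal_mul hQ0.le]
    apply ENNReal.ofReal_le_ofReal
    refine (mw_exp_le hδ _).trans ?_
    have hy := abs_nonneg y
    have hz : 0 ≤ 2 * Real.pi * |y| := by positivity
    have h1 := hKb _ hz
    have hpos : 0 < (1 + 2 * Real.pi * |y|) ^ s := Real.rpow_pos_of_pos (by positivity) s
    rw [Real.rpow_neg (by positivity), inv_le_iff_one_le_mul₀ hpos] at h1
    have h2 : Real.exp (2 * |σ * y|) ≤ Real.exp (σ₀ / 2 * (2 * Real.pi * |y|)) := by
      apply Real.exp_le_exp.2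
      rw [abs_mul, abs_of_pos hσ]
      have h3 : σ * |y| ≤ σ₀ * |y| := by gcongr
      have h4 : 0 ≤ σ₀ * |y| := by positivity
      nlinarith
    have h5 : Real.exp (σ₀ * (2 * Real.pi * |y|)) = Real.exp (σ₀ / 2 * (2 * Real.pi * |y|)) * Real.exp (σ₀ / 2 * (2 * Real.pi * |y|)) := by
      rw [← Real.exp_add]; ring_nf
    rw [h5, hQ]
    generalize Real.exp (σ₀ / 2 * (2 * Real.pi * |y|)) = X at *
    generalize (1 + 2 * Real.pi * |y|) ^ s = Y at *
    have hX : 0 ≤ X := (Real.exp_pos _).le.trans h2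
    calc 24 * Real.exp 2 * Real.exp (2 * |σ * y|) ≤ 24 * Real.exp 2 * X := by gcongr
      _ = 24 * Real.exp 2 * X * 1 := by ring
      _ ≤ 24 * Real.exp 2 * X * (K * X * Y) := by gcongr
      _ = _ := by ring
  have hm : Measurable fun x => ‖𝓕 f x‖ₑ := (𝓕 f).continuous.measurable.enorm
  calc _ ≤ L2 (fun y => ENNReal.ofReal Q * (ENNReal.ofReal (Real.exp (σ₀ * (2 * Real.pi * |y|)) * (1 + 2 * Real.pi * |y|) ^ s) * ‖𝓕 f y‖ₑ)) := by
        apply L2_mono; intro y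
        unfold Wm
        rw [← mul_assoc]
        gcongr
        exact hpt y
    _ = ENNReal.ofReal Q * L2 (fun y => ENNReal.ofReal (Real.exp (σ₀ * (2 * Real.pi * |y|)) * (1 + 2 * Real.pi * |y|) ^ s) * ‖𝓕 f y‖ₑ) := by
        apply L2_const_mul
        fun_prop
    _ = _ := by
        congr 1
        unfold L2
        rw [hI]
        congr 1
        refine lintegral_congr fun y => ?_
        have hb : 0 ≤ 1 + 2 * Real.pi * |y| := by positivity
        beta_reduce
        rw [← ofReal_norm, ← ENNReal.ofReal_mul (by positivity), ← ENNReal.ofReal_pow (by positivity)]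
        congr 1
        rw [mul_pow, mul_pow, ← Real.exp_nat_mul, ← Real.rpow_natCast, ← Real.rpow_mul hb]
        congr 2
        · congr 1; push_cast; ring
        · rw [mul_comm s]; norm_num

/-- final step: weighted bound gives the Gevrey integral -/
lemma fin_bd (f : 𝓢(ℝ, ℂ)) {σ s : ℝ} (hσ : 0 < σ) {B : ℝ≥0∞} (hB : B ≠ ⊤)
    (h : L2 (Wm (fun x => jap (σ * x) ^ 4 * Real.exp (jap (σ * x))) (fun x => ‖𝓕 f x‖ₑ)) ≤ B) :
    ∫⁻ y, ENNReal.ofReal (Real.exp (2 * (σ / (4 * Real.pi)) * (2 * Real.pi * |y|)) * (1 + 2 * Real.pi * |y|) ^ (2 * s) * ‖𝓕 f y‖ ^ 2) ≠ ⊤ := by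
  have hpi := Real.pi_pos
  obtain ⟨K, hK, hKb⟩ := rpow_le_exp (κ := σ / (2 * Real.pi)) (by positivity) (2 * s)
  refine ne_top_of_le_ne_top (b := ENNReal.ofReal K * B ^ 2) (by finiteness) ?_
  calc _ ≤ ∫⁻ y, ENNReal.ofReal K * (Wm (fun x => jap (σ * x) ^ 4 * Real.exp (jap (σ * x))) (fun x => ‖𝓕 f x‖ₑ) y) ^ 2 := by
        apply lintegral_mono; intro y
        unfold Wm
        beta_reduce
        rw [← ofReal_norm, ← ENNReal.ofReal_mul (by have := jap_pos (σ * y); positivity), ← ENNReal.ofReal_pow (by have := jap_pos (σ * y); positivity), ← ENNReal.ofReal_mul hK.le]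
        apply ENNReal.ofReal_le_ofReal
        have h1 := hKb (2 * Real.pi * |y|) (by positivity)
        rw [show σ / (2 * Real.pi) * (2 * Real.pi * |y|) = σ * |y| by field_simp] at h1
        rw [show 2 * (σ / (4 * Real.pi)) * (2 * Real.pi * |y|) = σ * |y| by field_simp; ring]
        have h2 : Real.exp (σ * |y|) ≤ jap (σ * y) ^ 4 * Real.exp (jap (σ * y)) := by
          have h3 : 1 ≤ jap (σ * y) ^ 4 := one_le_pow₀ (one_le_jap _)
          have h4 : σ * |y| ≤ jap (σ * y) := by
            have := abs_le_jap (σ * y)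
            rwa [abs_mul, abs_of_pos hσ] at this
          calc Real.exp (σ * |y|) = 1 * Real.exp (σ * |y|) := by ring
            _ ≤ _ := by gcongr
        have hX := Real.exp_pos (σ * |y|)
        generalize Real.exp (σ * |y|) = X at *
        generalize jap (σ * y) ^ 4 * Real.exp (jap (σ * y)) = Z at *
        calc X * (1 + 2 * Real.pi * |y|) ^ (2 * s) * ‖𝓕 f y‖ ^ 2 ≤ Z * (K * Z) * ‖𝓕 f y‖ ^ 2 := by
              gcongr
              · exact hX.le.trans h2
              · exact h1.trans (by gcongr)
          _ = _ := by ring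
    _ = ENNReal.ofReal K * ∫⁻ y, (Wm (fun x => jap (σ * x) ^ 4 * Real.exp (jap (σ * x))) (fun x => ‖𝓕 f x‖ₑ) y) ^ 2 := by
        rw [lintegral_const_mul' _ _ (by finiteness)]
    _ ≤ _ := by
        rw [← L2_sq]
        gcongr

lemma small_ex {q A Q c σ₁ : ℝ} (hq : 0 < q) (hc : 0 < c) (hσ₁ : 0 < σ₁) :
    ∃ κ : ℝ, 0 < κ ∧ κ ≤ σ₁ ∧ κ ^ 3 * A ≤ c ∧ κ ^ q * Q ≤ c := by
  have t1 : Tendsto (fun σ : ℝ => σ ^ 3 * A) (nhdsWithin 0 (Ioi 0)) (nhds 0) := by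
    have : Tendsto (fun σ : ℝ => σ ^ 3 * A) (nhds 0) (nhds (0 ^ 3 * A)) := by
      apply Continuous.tendsto; fun_prop
    simpa using this.mono_left nhdsWithin_le_nhds
  have t2 : Tendsto (fun σ : ℝ => σ ^ q * Q) (nhdsWithin 0 (Ioi 0)) (nhds 0) := by
    have : Tendsto (fun σ : ℝ => σ ^ q) (nhds 0) (nhds (0 ^ q)) :=
      (Real.continuousAt_rpow_const 0 _ (Or.inr hq.le)).tendsto
    rw [Real.zero_rpow hq.ne'] at this
    have := (this.mul_const Q).mono_left (nhdsWithin_le_nhds (s := Ioi 0))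
    simpa using this
  have e3 : ∀ᶠ σ : ℝ in nhdsWithin 0 (Ioi 0), σ ∈ Ioc (0 : ℝ) σ₁ := Ioc_mem_nhdsGT hσ₁
  obtain ⟨σ, h1, h2, h3⟩ := ((t1.eventually (eventually_le_nhds hc)).and ((t2.eventually (eventually_le_nhds hc)).and e3)).exists
  exact ⟨σ, h3.1, h3.2, h1, h2⟩

theorem main_aux {S : Sys} {C0 : ℝ} (hS : S.Adm C0) {W : ℝ → Fin 2 → 𝓢(ℝ, ℂ)}
    (HF : ∀ t0 t1, t0 ≤ t1 → FSol S (hat W) t0 t1) {σ₀ s : ℝ} (hσ₀ : 0 < σ₀)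
    (h0 : ∀ j, ∫⁻ y, ENNReal.ofReal (Real.exp (2 * σ₀ * (2 * Real.pi * |y|)) * (1 + 2 * Real.pi * |y|) ^ (2 * s) * ‖𝓕 (W 0 j) y‖ ^ 2) ≠ ⊤)
    {ε : ℝ} (hε : 0 < ε) : ∃ κ : ℝ, 0 < κ ∧ ∀ t j,
      ∫⁻ y, ENNReal.ofReal (Real.exp (2 * (κ * (1 + |t|) ^ (-(4 / 3 : ℝ) - ε) / (4 * Real.pi)) * (2 * Real.pi * |y|)) * (1 + 2 * Real.pi * |y|) ^ (2 * s) * ‖𝓕 (W t j) y‖ ^ 2) ≠ ⊤ := by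
  obtain ⟨B0, hB0, hb0⟩ := init_bd (W 0 0) hσ₀ (h0 0)
  obtain ⟨B1, hB1, hb1⟩ := init_bd (W 0 1) hσ₀ (h0 1)
  obtain ⟨γ, hγ⟩ : ∃ γ, γ = 3 * ε / (32 + 24 * ε) := ⟨_, rfl⟩
  have hγ0 : 0 < γ := by rw [hγ]; positivity
  have hγ4 : γ < 1 / 4 := by rw [hγ, div_lt_iff₀ (by positivity)]; linarith
  have hγe : γ * (32 + 24 * ε) = 3 * ε := by rw [hγ]; field_simp
  obtain ⟨c, hc, hboot⟩ := boot_sc hS hγ0 hγ4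
  have he0 := hS.e_pos 0
  have he1 := hS.e_pos 1
  obtain ⟨A, hA⟩ : ∃ A, A = (S.e 0 + S.e 1) * (B0 + B1) ^ 2 + 1 := ⟨_, rfl⟩
  have hA0 : 0 < A := by rw [hA]; positivity
  have hq : 0 < 3 / 4 - 3 / 2 * γ := by linarith
  have hqe : 1 ≤ (4 / 3 + ε) * (3 / 4 - 3 / 2 * γ) := by nlinarith
  obtain ⟨q, hqd⟩ : ∃ q, q = 3 / 4 - 3 / 2 * γ := ⟨_, rfl⟩
  rw [← hqd] at hq hqe
  obtain ⟨κ, hκ, hκσ, hκ3, hκq⟩ := small_ex (A := A) (Q := A ^ (5 / 4 - γ / 2)) hq hc (lt_min hσ₀ one_pos)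
  refine ⟨κ, hκ, fun t j => ?_⟩
  have htp : 1 ≤ 1 + |t| := by linarith [abs_nonneg t]
  obtain ⟨σ, hσd⟩ : ∃ σ, σ = κ * (1 + |t|) ^ (-(4 / 3 : ℝ) - ε) := ⟨_, rfl⟩
  rw [← hσd]
  have hσ : 0 < σ := by rw [hσd]; positivity
  have hσκ : σ ≤ κ := by
    rw [hσd]
    exact mul_le_of_le_one_right hκ.le (Real.rpow_le_one_of_one_le_of_nonpos htp (by linarith))
  have hσ1 : σ ≤ 1 := hσκ.trans (hκσ.trans (min_le_right _ _))
  have hσ0' : σ ≤ σ₀ := hσκ.trans (hκσ.trans (min_le_left _ _))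
  have c1 : σ ^ 3 * A ≤ c := le_trans (by gcongr) hκ3
  have c2 : |t| * σ ^ q * A ^ (5 / 4 - γ / 2) ≤ c := by
    have hσq : |t| * σ ^ q ≤ κ ^ q := by
      rw [hσd, Real.mul_rpow hκ.le (by positivity), ← Real.rpow_mul (by positivity)]
      have h1 : (1 + |t|) ^ ((-(4 / 3 : ℝ) - ε) * q) ≤ (1 + |t|) ^ (-1 : ℝ) :=
        Real.rpow_le_rpow_of_exponent_le htp (by linarith)
      rw [Real.rpow_neg_one] at h1
      have h2 : |t| * (1 + |t|) ^ ((-(4 / 3 : ℝ) - ε) * q) ≤ 1 := by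
        calc _ ≤ (1 + |t|) * (1 + |t|)⁻¹ := by gcongr; linarith
          _ = 1 := mul_inv_cancel₀ (by positivity)
      calc _ = κ ^ q * (|t| * (1 + |t|) ^ ((-(4 / 3 : ℝ) - ε) * q)) := by ring
        _ ≤ κ ^ q * 1 := by gcongr
        _ = _ := mul_one _
    exact le_trans (by gcongr) hκq
  have hδ : ∀ n : ℕ, 0 < 1 / (((n + 1 : ℕ) : ℝ) + 1) := fun n => by positivity
  have hE0 : ∀ n : ℕ, S.Er (fun x => mw (n + 1) (1 / (((n + 1 : ℕ) : ℝ) + 1)) (σ * x)) (hat W 0) ≤ A := by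
    intro n
    refine (Er_le hS (B := B0 + B1) (by positivity) fun j => ?_).trans (by rw [hA]; linarith)
    fin_cases j
    · exact (hb0 _ _ _ (hδ n) hσ hσ0').trans (ENNReal.ofReal_le_ofReal (by linarith))
    · exact (hb1 _ _ _ (hδ n) hσ hσ0').trans (ENNReal.ofReal_le_ofReal (by linarith))
  have hgood : ∀ n : ℕ, GoodW (mw (n + 1) (1 / (((n + 1 : ℕ) : ℝ) + 1))) := fun n => goodW_mw (by omega) (hδ n)
  have hb : ∀ n : ℕ, L2 (Wm (fun x => mw (n + 1) (1 / (((n + 1 : ℕ) : ℝ) + 1)) (σ * x)) (fun x => ‖hat W t j x‖ₑ)) ≤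
      ENNReal.ofReal (Real.sqrt (4 * A / S.e j)) := by
    intro n
    rcases le_total 0 t with ht | ht
    · have hF := HF 0 t ht
      have := (hboot _ (hgood n) (hat W) 0 t hF σ A hσ hσ1 hA0 c1 (by rw [← hqd, sub_zero]; rwa [abs_of_nonneg ht] at c2)).1 (hE0 n) t ⟨ht, le_rfl⟩
      exact L2_le_Er hS (fun i => Wm_sc_fin hF (hgood n) ⟨ht, le_rfl⟩ hσ hσ1 i) this j
    · have hF := HF t 0 ht
      have := (hboot _ (hgood n) (hat W) t 0 hF σ A hσ hσ1 hA0 c1 (by rw [← hqd, zero_sub]; rwa [abs_of_nonpos ht] at c2)).2 (hE0 n) t ⟨le_rfl, ht⟩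
      exact L2_le_Er hS (fun i => Wm_sc_fin hF (hgood n) ⟨le_rfl, ht⟩ hσ hσ1 i) this j
  have hl := L2_lim (f := hat W t j) (hat_cont W t j).measurable (m := fun (n : ℕ) x => mw (n + 1) (1 / (((n + 1 : ℕ) : ℝ) + 1)) (σ * x))
    (g := fun x => jap (σ * x) ^ 4 * Real.exp (jap (σ * x)))
    (fun n => ((hgood n).cont.comp (continuous_const_mul σ)).measurable)
    (fun x => (mw_lim (σ * x)).comp (tendsto_add_atTop_nat 1)) hb
  exact fin_bd (W t j) hσ ENNReal.ofReal_ne_top hl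

end PAn

/-- Persistence of spatial analyticity (Theorem 1.1): under the coefficient
conditions of Table 1 and the cancellation condition `c₁₂ + η(c₂₂ − 2c₂₁) = 0`
for some `η > 0`, if `(u,v)` is a real-valued smooth solution of the coupled
KdV–KdV system, Schwartz in space, with `‖u(0)‖_{G^{σ₀,s}}, ‖v(0)‖_{G^{σ₀,s}}`
finite for some `σ₀ > 0`, then for every `ε > 0` there is `c > 0` such that
`‖u(t)‖_{G^{σ(t),s}}` and `‖v(t)‖_{G^{σ(t),s}}` are finite for all `t ∈ ℝ`,
where `σ(t) = c(1+|t|)^{−4/3−ε}`. -/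
theorem persistence_of_analyticity
    (a₁ a₂ c₁₁ c₁₂ c₂₁ c₂₂ : ℝ) (ha₁ : a₁ ≠ 0) (ha₂ : a₂ ≠ 0)
    (hcoef : (a₂ / a₁ < 0 ∨ 4 < a₂ / a₁) ∨
      (a₂ / a₁ = 1 ∧ c₂₁ = c₂₂) ∨
      (0 < a₂ / a₁ ∧ a₂ / a₁ ≤ 4 ∧ a₂ ≠ a₁ ∧ c₁₂ = 0 ∧ c₂₁ = 0 ∧ c₂₂ = 0))
    (η : ℝ) (hη : 0 < η) (hcancel : c₁₂ + η * (c₂₂ - 2 * c₂₁) = 0)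
    (σ₀ s : ℝ) (hσ₀ : 0 < σ₀)
    (u v : ℝ → ℝ → ℝ)
    (hu : ContDiff ℝ (⊤ : ℕ∞) (fun p : ℝ × ℝ => u p.1 p.2))
    (hv : ContDiff ℝ (⊤ : ℕ∞) (fun p : ℝ × ℝ => v p.1 p.2))
    (huS : ∀ t : ℝ, ∃ φ : SchwartzMap ℝ ℝ, ∀ x : ℝ, φ x = u t x)
    (hvS : ∀ t : ℝ, ∃ ψ : SchwartzMap ℝ ℝ, ∀ x : ℝ, ψ x = v t x)
    (hPDEu : ∀ t x : ℝ,
      deriv (fun τ => u τ x) t + a₁ * iteratedDeriv 3 (u t) x =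
        c₁₁ * u t x * deriv (u t) x + c₁₂ * v t x * deriv (v t) x)
    (hPDEv : ∀ t x : ℝ,
      deriv (fun τ => v τ x) t + a₂ * iteratedDeriv 3 (v t) x =
        c₂₁ * deriv (u t) x * v t x + c₂₂ * u t x * deriv (v t) x)
    (hu0 : gevreyNorm σ₀ s (fun x => (u 0 x : ℂ)) ≠ ⊤)
    (hv0 : gevreyNorm σ₀ s (fun x => (v 0 x : ℂ)) ≠ ⊤) :
    ∀ ε : ℝ, 0 < ε → ∃ c : ℝ, 0 < c ∧
      ∀ t : ℝ,
        gevreyNorm (c * (1 + |t|) ^ (-(4/3 : ℝ) - ε)) s (fun x => (u t x : ℂ)) ≠ ⊤ ∧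
        gevreyNorm (c * (1 + |t|) ^ (-(4/3 : ℝ) - ε)) s (fun x => (v t x : ℂ)) ≠ ⊤ := by
  intro ε hε
  have hpi := Real.pi_pos
  have hP0 : (2 * Real.pi) ^ 3 ≠ 0 := by positivity
  have hratio : ((2 * Real.pi) ^ 3 * a₂) / ((2 * Real.pi) ^ 3 * a₁) = a₂ / a₁ := mul_div_mul_left _ _ hP0
  have h2pi : 2 * Real.pi ≠ 0 := by positivity
  obtain ⟨C0, hS⟩ := PAn.kdv_adm ((2 * Real.pi) ^ 3 * a₁) ((2 * Real.pi) ^ 3 * a₂) (2 * Real.pi * c₁₁)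
    (2 * Real.pi * c₁₂) (2 * Real.pi * c₂₁) (2 * Real.pi * c₂₂)
    (mul_ne_zero hP0 ha₁) (mul_ne_zero hP0 ha₂)
    (by
      rw [hratio]
      rcases hcoef with h | ⟨h, h'⟩ | ⟨h1, h2, h3, h4, h5, h6⟩
      · exact Or.inl h
      · exact Or.inr (Or.inl ⟨h, by rw [h']⟩)
      · exact Or.inr (Or.inr ⟨h1, h2, fun h => h3 (mul_left_cancel₀ hP0 h), by simp [h4], by simp [h5], by simp [h6]⟩))
    η hη (by linear_combination (2 * Real.pi) * hcancel)
  have hw : ∀ j : Fin 2, ContDiff ℝ (⊤ : ℕ∞) fun p : ℝ × ℝ => (![u, v] : Fin 2 → ℝ → ℝ → ℝ) j p.1 p.2 := by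
    intro j
    fin_cases j
    · exact hu
    · exact hv
  obtain ⟨W, Ψ, HP, hWw⟩ := PAn.psol_of (PAn.kdv ((2 * Real.pi) ^ 3 * a₁) ((2 * Real.pi) ^ 3 * a₂) (2 * Real.pi * c₁₁) (2 * Real.pi * c₁₂)
      (2 * Real.pi * c₂₁) (2 * Real.pi * c₂₂) η) ![a₁, a₂] ![![![c₁₁, 0], ![0, c₁₂]], ![![0, c₂₁], ![c₂₂, 0]]]
    (by intro j; fin_cases j <;> simp [PAn.kdv])
    (by intro l i n; fin_cases l <;> fin_cases i <;> fin_cases n <;> simp [PAn.kdv] <;> ring)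
    ![u, v] hw
    (by
      intro j t
      fin_cases j
      · exact huS t
      · exact hvS t)
    (by
      intro j t x
      fin_cases j
      · have := hPDEu t x
        simp [Fin.sum_univ_two]
        linarith
      · have := hPDEv t x
        simp [Fin.sum_univ_two]
        linarith)
  have hW0 : ∀ t x, W t 0 x = (u t x : ℂ) := fun t x => hWw t 0 x
  have hW1 : ∀ t x, W t 1 x = (v t x : ℂ) := fun t x => hWw t 1 x
  obtain ⟨κ, hκ, hk⟩ := PAn.main_aux hS (W := W) (fun t0 t1 h01 => PAn.fsol_all hS HP hw hWw h01) (s := s) hσ₀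
    (by
      intro j
      fin_cases j
      · exact (PAn.gev_top (W 0 0) (hW0 0) σ₀ s).1 hu0
      · exact (PAn.gev_top (W 0 1) (hW1 0) σ₀ s).1 hv0) hε
  refine ⟨κ / (4 * Real.pi), by positivity, fun t => ?_⟩
  have he : κ / (4 * Real.pi) * (1 + |t|) ^ (-(4/3 : ℝ) - ε) = κ * (1 + |t|) ^ (-(4/3 : ℝ) - ε) / (4 * Real.pi) := by ring
  rw [he]
  exact ⟨(PAn.gev_top (W t 0) (hW0 t) _ s).2 (hk t 0), (PAn.gev_top (W t 1) (hW1 t) _ s).2 (hk t 1)⟩
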